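/- For all integers d, k ≥ 1 there exist integers N_0, N ≥ 1 and real constants ε_0, C > 0 such that: for every prime p, every field K of characteristic p, and every k-element subset F of GL_d(K) generating a subgroup which contains no solvable subgroup of index at most N, the set of products of at most N_0 elements of F ∪ F⁻¹ contains two elements a, b such that w(a,b) ≠ 1 in GL_d(K) for every nontrivial element w of the free group on two generators of reduced word length at most C·(log p)^{ε_0}. -/

import Mathlib

namespace LG
open Polynomial MvPolynomial Ideal Nat List

section nagata
variable {k : Type*} [Field k] {n : ℕ} (f : MvPolynomial (Fin (n + 1)) k)
variable (v w : Fin (n + 1) →₀ ℕ)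

/-- base used in the Nagata substitution -/
noncomputable abbrev nup (f : MvPolynomial (Fin (n + 1)) k) : ℕ := 2 + f.totalDegree

/-- exponents used in the Nagata substitution -/
noncomputable abbrev nr (f : MvPolynomial (Fin (n + 1)) k) : Fin (n + 1) → ℕ :=
  fun i ↦ nup f ^ i.1

variable {f v} in
lemma lt_nup (vlt : ∀ i, v i < nup f) : ∀ l ∈ ofFn v, l < nup f := by
  grind

/-- The substitution `X_i ↦ X_i + c X_0^{r_i}`. -/
noncomputable abbrev nT1 (c : k) :
    MvPolynomial (Fin (n + 1)) k →ₐ[k] MvPolynomial (Fin (n + 1)) k :=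
  aeval fun i ↦ if i = 0 then X 0 else X i + c • X 0 ^ nr f i

lemma nt1_comp_t1_neg (c : k) : (nT1 f c).comp (nT1 f (-c)) = AlgHom.id _ _ := by
  rw [comp_aeval, ← MvPolynomial.aeval_X_left]
  ext i v
  cases i using Fin.cases <;> simp

/-- `nT1 f 1` leads to an algebra equiv. -/
noncomputable abbrev nT := AlgEquiv.ofAlgHom (nT1 f 1) (nT1 f (-1))
  (nt1_comp_t1_neg f 1) (by simpa using nt1_comp_t1_neg f (-1))

lemma sum_nr_mul_ne (vlt : ∀ i, v i < nup f) (wlt : ∀ i, w i < nup f) (ne : v ≠ w) :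
    ∑ x : Fin (n + 1), nr f x * v x ≠ ∑ x : Fin (n + 1), nr f x * w x := by
  intro h
  refine ne <| Finsupp.ext <| congrFun <| ofFn_inj.mp ?_
  apply ofDigits_inj_of_len_eq (Nat.lt_add_right f.totalDegree one_lt_two)
    (by simp) (lt_nup vlt) (lt_nup wlt)
  simpa only [ofDigits_eq_sum_mapIdx, mapIdx_eq_ofFn, get_ofFn, length_ofFn,
    Fin.val_cast, mul_comm, sum_ofFn] using! h

lemma degreeOf_zero_nt {a : k} (ha : a ≠ 0) : ((nT f) (monomial v a)).degreeOf 0 =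
    ∑ i : Fin (n + 1), (nr f i) * v i := by
  rw [← natDegree_finSuccEquiv, monomial_eq, Finsupp.prod_pow v fun a ↦ X a]
  simp only [Fin.prod_univ_succ, Fin.sum_univ_succ, map_mul, map_prod, map_pow,
    AlgEquiv.ofAlgHom_apply, MvPolynomial.aeval_C, MvPolynomial.aeval_X, if_pos, Fin.succ_ne_zero,
    ite_false, one_smul, map_add, finSuccEquiv_X_zero, finSuccEquiv_X_succ, algebraMap_eq]
  have h (i : Fin n) :
      (Polynomial.C (X (R := k) i) + Polynomial.X ^ nr f i.succ) ^ v i.succ ≠ 0 :=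
    pow_ne_zero (v i.succ) (leadingCoeff_ne_zero.mp <| by simp [add_comm, leadingCoeff_X_pow_add_C])
  rw [natDegree_mul (by simp [ha]) (mul_ne_zero (by simp) (Finset.prod_ne_zero_iff.mpr
    (fun i _ ↦ h i))), natDegree_mul (by simp) (Finset.prod_ne_zero_iff.mpr (fun i _ ↦ h i)),
    natDegree_prod _ _ (fun i _ ↦ h i), natDegree_finSuccEquiv, degreeOf_C]
  simp only [natDegree_pow, zero_add, natDegree_X, mul_one]
  congr 1
  · simp [nr]
  · exact Finset.sum_congr rfl (fun i _ ↦ by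
      rw [add_comm (Polynomial.C _), natDegree_X_pow_add_C, mul_comm])

lemma degreeOf_nt_ne_of_ne (hv : v ∈ f.support) (hw : w ∈ f.support) (ne : v ≠ w) :
    (nT f <| monomial v <| coeff v f).degreeOf 0 ≠
    (nT f <| monomial w <| coeff w f).degreeOf 0 := by
  rw [degreeOf_zero_nt _ _ <| mem_support_iff.mp hv, degreeOf_zero_nt _ _ <| mem_support_iff.mp hw]
  refine sum_nr_mul_ne f v w (fun i ↦ ?_) (fun i ↦ ?_) ne <;>
  exact lt_of_le_of_lt ((monomial_le_degreeOf i ‹_›).trans (degreeOf_le_totalDegree f i))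
    (by lia)

lemma leadingCoeff_finSuccEquiv_nt :
    (finSuccEquiv k n ((nT f) ((monomial v) (coeff v f)))).leadingCoeff =
    algebraMap k _ (coeff v f) := by
  rw [monomial_eq, Finsupp.prod_fintype]
  · simp only [map_mul, map_prod, leadingCoeff_mul, leadingCoeff_prod]
    rw [AlgEquiv.ofAlgHom_apply, algHom_C, algebraMap_eq, finSuccEquiv_apply,
      eval₂Hom_C, RingHom.coe_comp]
    simp only [AlgEquiv.ofAlgHom_apply, Function.comp_apply, leadingCoeff_C, map_pow,
      leadingCoeff_pow, algebraMap_eq]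
    have : ∀ j, ((finSuccEquiv k n) ((nT1 f) 1 (X j))).leadingCoeff = 1 := fun j ↦ by
      by_cases h : j = 0
      · simp [h, finSuccEquiv_apply]
      · simp only [aeval_eq_bind₁, bind₁_X_right, if_neg h, one_smul, map_add, map_pow]
        obtain ⟨i, rfl⟩ := Fin.exists_succ_eq.mpr h
        simp [finSuccEquiv_X_succ, finSuccEquiv_X_zero, add_comm]
    simp only [this, one_pow, Finset.prod_const_one, mul_one]
  exact fun i ↦ pow_zero _

/-- the Nagata substitution makes the leading coefficient in `X_0` a unit. -/
lemma nT_leadingcoeff_isUnit (fne : f ≠ 0) :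
    IsUnit (finSuccEquiv k n (nT f f)).leadingCoeff := by
  obtain ⟨v, vin, vs⟩ := Finset.exists_max_image f.support
    (fun v ↦ (nT f ((monomial v) (coeff v f))).degreeOf 0) (support_nonempty.mpr fne)
  set h := fun w ↦ (MvPolynomial.monomial w) (coeff w f)
  simp only [← natDegree_finSuccEquiv] at vs
  replace vs : ∀ x ∈ f.support \ {v}, (finSuccEquiv k n ((nT f) (h x))).degree <
      (finSuccEquiv k n ((nT f) (h v))).degree := by
    intro x hx
    obtain ⟨h1, h2⟩ := Finset.mem_sdiff.mp hx
    apply degree_lt_degree <| lt_of_le_of_ne (vs x h1) ?_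
    simpa only [natDegree_finSuccEquiv]
      using degreeOf_nt_ne_of_ne f _ _ h1 vin <| ne_of_not_mem_cons h2
  have coeff : (finSuccEquiv k n ((nT f) (h v + ∑ x ∈ f.support \ {v}, h x))).leadingCoeff =
      (finSuccEquiv k n ((nT f) (h v))).leadingCoeff := by
    simp only [map_add, map_sum]
    rw [add_comm]
    apply leadingCoeff_add_of_degree_lt <| (lt_of_le_of_lt <| degree_sum_le _ _) ?_
    have h2 : h v ≠ 0 := by simpa [h] using mem_support_iff.mp vin
    replace h2 : (finSuccEquiv k n ((nT f) (h v))) ≠ 0 := fun eq ↦ h2 <|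
      by simpa only [map_eq_zero_iff _ (AlgEquiv.injective _)] using eq
    exact (Finset.sup_lt_iff <| Ne.bot_lt (fun x ↦ h2 <| degree_eq_bot.mp x)).mpr vs
  nth_rw 2 [← f.support_sum_monomial_coeff]
  rw [Finset.sum_eq_add_sum_sdiff_singleton_of_mem vin h]
  rw [leadingCoeff_finSuccEquiv_nt] at coeff
  simpa only [coeff, algebraMap_eq] using (mem_support_iff.mp vin).isUnit.map MvPolynomial.C

end nagata

/-- total degree under substitution -/
lemma totalDegree_aeval_le {σ τ k : Type*} [Field k] (g : σ → MvPolynomial τ k) (U : ℕ)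
    (hg : ∀ i, (g i).totalDegree ≤ U) (p : MvPolynomial σ k) :
    (aeval g p).totalDegree ≤ p.totalDegree * U := by
  classical
  rw [MvPolynomial.aeval_def, MvPolynomial.eval₂_eq]
  apply totalDegree_finsetSum_le
  intro s hs
  refine (totalDegree_mul _ _).trans ?_
  have h1 : ((algebraMap k (MvPolynomial τ k)) (coeff s p)).totalDegree = 0 := totalDegree_C _
  rw [h1, zero_add]
  refine (totalDegree_finsetProd _ _).trans ?_
  calc ∑ i ∈ s.support, ((g i) ^ s i).totalDegree ≤ ∑ i ∈ s.support, s i * U := by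
        apply Finset.sum_le_sum; intro i _
        exact (totalDegree_pow _ _).trans (Nat.mul_le_mul_left _ (hg i))
    _ = (∑ i ∈ s.support, s i) * U := by rw [Finset.sum_mul]
    _ ≤ _ := Nat.mul_le_mul_right _ (le_totalDegree hs)

lemma totalDegree_nT1_le {k : Type*} [Field k] {n : ℕ} (f : MvPolynomial (Fin (n + 1)) k) (c : k)
    (D : ℕ) (hf : f.totalDegree ≤ D) (p : MvPolynomial (Fin (n + 1)) k) :
    (nT1 f c p).totalDegree ≤ p.totalDegree * (2 + D) ^ n := by
  apply totalDegree_aeval_le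
  intro i
  have h1 : 1 ≤ (2 + D) ^ n := Nat.one_le_pow _ _ (by lia)
  split_ifs
  · simpa using h1
  · refine (totalDegree_add _ _).trans (max_le (by simpa using h1) ?_)
    refine (totalDegree_smul_le _ _).trans ?_
    rw [totalDegree_X_pow]
    calc (2 + f.totalDegree) ^ i.1 ≤ (2 + D) ^ i.1 := Nat.pow_le_pow_left (by lia) _
      _ ≤ _ := Nat.pow_le_pow_right (by lia) (by lia)

/-- degree of a determinant -/
lemma totalDegree_det_le {m : Type*} [Fintype m] [DecidableEq m] {τ k : Type*} [CommRing k]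
    (M : Matrix m m (MvPolynomial τ k)) (D : ℕ) (hM : ∀ i j, (M i j).totalDegree ≤ D) :
    M.det.totalDegree ≤ Fintype.card m * D := by
  rw [Matrix.det_apply]
  apply totalDegree_finsetSum_le
  intro s _
  refine (totalDegree_smul_le _ _).trans ?_
  refine (totalDegree_finsetProd _ _).trans ?_
  refine (Finset.sum_le_card_nsmul _ _ D (fun i _ => hM _ _)).trans ?_
  simp

lemma totalDegree_adjugate_le {m : Type*} [Fintype m] [DecidableEq m] {τ k : Type*} [CommRing k]
    (M : Matrix m m (MvPolynomial τ k)) (D : ℕ) (hM : ∀ i j, (M i j).totalDegree ≤ D) (i j : m) :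
    (M.adjugate i j).totalDegree ≤ Fintype.card m * D := by
  rw [Matrix.adjugate_apply]
  apply totalDegree_det_le
  intro a b
  rw [Matrix.updateRow_apply]
  split_ifs
  · rw [Pi.single_apply]; split_ifs <;> simp
  · exact hM a b

end LG

namespace LG
open MvPolynomial

/-- degree bound in the effective Nullstellensatz -/
def nullB : ℕ → ℕ → ℕ
  | 0, _ => 0
  | (s+1), D => (nullB s (2 * (D * (2 + D) ^ s + 1) ^ 2) + 4 * (D * (2 + D) ^ s + 1) ^ 2)
      * (2 + D) ^ s

/-- degree bounded combinations -/
noncomputable def degSpan {k σ : Type*} [Field k] (S : Set (MvPolynomial σ k)) (b : ℕ) :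
    Submodule k (MvPolynomial σ k) :=
  Submodule.span k {q | ∃ f ∈ S, ∃ g : MvPolynomial σ k, g.totalDegree ≤ b ∧ q = g * f}

lemma degSpan_mul {k σ : Type*} [Field k] {S : Set (MvPolynomial σ k)} {b c : ℕ}
    {q h : MvPolynomial σ k} (hq : q ∈ degSpan S b) (hh : h.totalDegree ≤ c) :
    h * q ∈ degSpan S (c + b) := by
  unfold degSpan at hq
  induction hq using Submodule.span_induction with
  | mem x hx =>
    obtain ⟨f, hf, g, hg, rfl⟩ := hx
    exact Submodule.subset_span ⟨f, hf, h * g, (totalDegree_mul _ _).trans (by lia), by ring⟩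
  | zero => simp
  | add x y _ _ hx hy => rw [mul_add]; exact add_mem hx hy
  | smul a x _ hx => rw [mul_smul_comm]; exact Submodule.smul_mem _ _ hx

lemma degSpan_trans {k σ : Type*} [Field k] {S S' : Set (MvPolynomial σ k)} {b c : ℕ}
    (h : ∀ f ∈ S', f ∈ degSpan S c) {q : MvPolynomial σ k} (hq : q ∈ degSpan S' b) :
    q ∈ degSpan S (b + c) := by
  unfold degSpan at hq
  induction hq using Submodule.span_induction with
  | mem x hx =>
    obtain ⟨f, hf, g, hg, rfl⟩ := hx
    exact degSpan_mul (h f hf) hg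
  | zero => simp
  | add x y _ _ hx hy => exact add_mem hx hy
  | smul a x _ hx => exact Submodule.smul_mem _ _ hx

lemma degSpan_map {k σ τ : Type*} [Field k] {S : Set (MvPolynomial σ k)} {b c : ℕ}
    (φ : MvPolynomial σ k →ₐ[k] MvPolynomial τ k)
    (h : ∀ g, (φ g).totalDegree ≤ g.totalDegree * c) {q : MvPolynomial σ k}
    (hq : q ∈ degSpan S b) : φ q ∈ degSpan (φ '' S) (b * c) := by
  unfold degSpan at hq
  induction hq using Submodule.span_induction with
  | mem x hx =>
    obtain ⟨f, hf, g, hg, rfl⟩ := hx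
    exact Submodule.subset_span ⟨φ f, ⟨f, hf, rfl⟩, φ g,
      (h g).trans (Nat.mul_le_mul_right _ hg), by simp⟩
  | zero => simp
  | add x y _ _ hx hy => rw [map_add]; exact add_mem hx hy
  | smul a x _ hx => rw [map_smul]; exact Submodule.smul_mem _ _ hx

lemma degSpan_span {k σ : Type*} [Field k] {S : Set (MvPolynomial σ k)} 
    {f g : MvPolynomial σ k} (hf : f ∈ Submodule.span k S) {b : ℕ} (hg : g.totalDegree ≤ b) :
    g * f ∈ degSpan S b := by
  induction hf using Submodule.span_induction with
  | mem x hx => exact Submodule.subset_span ⟨x, hx, g, hg, rfl⟩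
  | zero => simp
  | add x y _ _ hx hy => rw [mul_add]; exact add_mem hx hy
  | smul a x _ hx => rw [mul_smul_comm]; exact Submodule.smul_mem _ _ hx

lemma totalDegree_sylvester_le {k : Type*} [Field k] {s : ℕ}
    (f g : MvPolynomial (Fin (s+1)) k) (E m n : ℕ) (hf : f.totalDegree ≤ E)
    (hg : g.totalDegree ≤ E) (i j) :
    ((Polynomial.sylvester (finSuccEquiv k s f) (finSuccEquiv k s g) m n) i j).totalDegree ≤ E := by
  have key : ∀ (f : MvPolynomial (Fin (s+1)) k), f.totalDegree ≤ E → ∀ i,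
      ((finSuccEquiv k s f).coeff i).totalDegree ≤ E := by
    intro f hf i
    by_cases h : (finSuccEquiv k s f).coeff i = 0
    · simp [h]
    · have := totalDegree_coeff_finSuccEquiv_add_le f i h
      lia
  induction j using Fin.addCases <;> simp only [Polynomial.sylvester, Matrix.of_apply,
    Fin.addCases_left, Fin.addCases_right]
  all_goals split_ifs
  · exact key g hg _
  · simp
  · exact key f hf _
  · simp

lemma sylvester_col_sum {R : Type*} [CommRing R] (f g : Polynomial R) (m n : ℕ)
    (hf : f.natDegree ≤ m) (hg : g.natDegree ≤ n) (j : Fin (m + n)) :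
    ∃ (e : ℕ) (b : Bool), e ≤ m + n ∧
      ∑ i : Fin (m + n), Polynomial.C (f.sylvester g m n i j) * Polynomial.X ^ (i : ℕ)
        = Polynomial.X ^ e * (if b then f else g) := by
  induction j using Fin.addCases with
  | left j =>
    refine ⟨j, false, by lia, ?_⟩
    ext c
    simp only [Polynomial.finsetSum_coeff, Polynomial.coeff_C_mul, Polynomial.coeff_X_pow,
      Polynomial.coeff_X_pow_mul']
    by_cases hc : c < m + n
    · rw [Finset.sum_eq_single ⟨c, hc⟩]
      · simp only [Polynomial.sylvester, Matrix.of_apply, Fin.addCases_left]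
        simp only [Set.mem_Icc]
        split_ifs with h1 h2 h2 <;> simp_all
        rw [Polynomial.coeff_eq_zero_of_natDegree_lt (by lia)]
      · intro b _ hb
        have : c ≠ b := fun h => hb (by ext; simp [h])
        simp [this]
      · simp
    · rw [Finset.sum_eq_zero]
      · by_cases h : (j : ℕ) ≤ c
        · rw [if_pos h, if_neg (by simp)]
          rw [Polynomial.coeff_eq_zero_of_natDegree_lt (by lia)]
        · rw [if_neg h]
      · intro b _
        have : c ≠ b := by lia
        simp [this]
  | right j =>
    refine ⟨j, true, by lia, ?_⟩
    ext c
    simp only [Polynomial.finsetSum_coeff, Polynomial.coeff_C_mul, Polynomial.coeff_X_pow,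
      Polynomial.coeff_X_pow_mul']
    by_cases hc : c < m + n
    · rw [Finset.sum_eq_single ⟨c, hc⟩]
      · simp only [Polynomial.sylvester, Matrix.of_apply, Fin.addCases_right]
        simp only [Set.mem_Icc]
        split_ifs with h1 h2 h2 <;> simp_all
        rw [Polynomial.coeff_eq_zero_of_natDegree_lt (by lia)]
      · intro b _ hb
        have : c ≠ b := fun h => hb (by ext; simp [h])
        simp [this]
      · simp
    · rw [Finset.sum_eq_zero]
      · by_cases h : (j : ℕ) ≤ c
        · rw [if_pos h, if_pos (by simp)]
          rw [Polynomial.coeff_eq_zero_of_natDegree_lt (by lia)]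
        · rw [if_neg h]
      · intro b _
        have : c ≠ b := by lia
        simp [this]

lemma resultant_comb {R : Type*} [CommRing R] (f g : Polynomial R) (m n : ℕ) (hn : 0 < m + n) :
    Polynomial.C (f.resultant g m n) = ∑ j, Polynomial.C ((f.sylvester g m n).adjugate j ⟨0, hn⟩)
      * ∑ i : Fin (m + n), Polynomial.C (f.sylvester g m n i j) * Polynomial.X ^ (i : ℕ) := by
  simp_rw [Finset.mul_sum]
  rw [Finset.sum_comm]
  have h : ∀ i : Fin (m+n), ∑ j, Polynomial.C ((f.sylvester g m n).adjugate j ⟨0, hn⟩) *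
      (Polynomial.C (f.sylvester g m n i j) * Polynomial.X ^ (i : ℕ))
      = Polynomial.C ((f.sylvester g m n * (f.sylvester g m n).adjugate) i ⟨0, hn⟩)
        * Polynomial.X ^ (i:ℕ) := by
    intro i
    rw [Matrix.mul_apply, map_sum, Finset.sum_mul]
    apply Finset.sum_congr rfl
    intro j _
    rw [map_mul]; ring
  simp_rw [h, Matrix.mul_adjugate]
  rw [Finset.sum_eq_single ⟨0, hn⟩]
  · simp [Polynomial.resultant]
  · intro b _ hb
    simp [Matrix.one_apply, hb]
  · simp

lemma elim_comb {k : Type*} [Field k] {s : ℕ} (f g : MvPolynomial (Fin (s+1)) k) (E : ℕ)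
    (hf : f.totalDegree ≤ E) (hg : g.totalDegree ≤ E) (hE : 1 ≤ E) :
    rename Fin.succ (Polynomial.resultant (finSuccEquiv k s f) (finSuccEquiv k s g)
      (finSuccEquiv k s f).natDegree E) ∈ degSpan {f, g} (4 * E ^ 2) := by
  have hnd : ∀ f : MvPolynomial (Fin (s+1)) k, (finSuccEquiv k s f).natDegree ≤ f.totalDegree := by
    intro f
    rw [natDegree_finSuccEquiv]; exact degreeOf_le_totalDegree _ _
  set m := (finSuccEquiv k s f).natDegree with hm
  have hmE : m ≤ E := (hnd f).trans hf
  have hC : ∀ r : MvPolynomial (Fin s) k, rename Fin.succ r = (finSuccEquiv k s).symm (Polynomial.C r) := by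
    intro r
    rw [AlgEquiv.eq_symm_apply]
    induction r using MvPolynomial.induction_on with
    | C a => simp [finSuccEquiv_apply]
    | add p q hp hq => simp [hp, hq]
    | mul_X p i hp => rw [map_mul, map_mul, hp]; simp [finSuccEquiv_X_succ]
  have hn : 0 < m + E := by lia
  rw [hC, resultant_comb _ _ _ _ hn, map_sum]
  apply Submodule.sum_mem
  intro j _
  obtain ⟨e, b, he, hsum⟩ := sylvester_col_sum (finSuccEquiv k s f) (finSuccEquiv k s g) m E
    le_rfl ((hnd g).trans hg) j
  rw [hsum, map_mul, ← hC, map_mul, map_pow]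
  have hX : (finSuccEquiv k s).symm Polynomial.X = X 0 := by
    rw [AlgEquiv.symm_apply_eq, finSuccEquiv_X_zero]
  rw [hX, ← mul_assoc]
  have hfg : (finSuccEquiv k s).symm (if b = true then finSuccEquiv k s f else finSuccEquiv k s g)
      = if b then f else g := by split_ifs <;> simp
  rw [hfg]
  refine Submodule.subset_span ⟨if b then f else g, by split_ifs <;> simp, _, ?_, rfl⟩
  refine (totalDegree_mul _ _).trans ?_
  have h1 := totalDegree_adjugate_le _ E (totalDegree_sylvester_le f g E m E hf hg) j ⟨0, hn⟩
  have h2 := totalDegree_rename_le (Fin.succ) ((Polynomial.sylvester (finSuccEquiv k s f)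
    (finSuccEquiv k s g) m E).adjugate j ⟨0, hn⟩)
  rw [totalDegree_X_pow]
  simp only [Fintype.card_fin] at h1
  nlinarith

lemma finSucc_eval {k Ω : Type*} [Field k] [Field Ω] [Algebra k Ω] {s : ℕ} (x : Fin s → Ω) (ξ : Ω)
    (F : MvPolynomial (Fin (s+1)) k) :
    ((finSuccEquiv k s F).map (aeval x : MvPolynomial (Fin s) k →ₐ[k] Ω).toRingHom).eval ξ
      = aeval (Fin.cons ξ x : Fin (s+1) → Ω) F := by
  induction F using MvPolynomial.induction_on with
  | C a => simp [finSuccEquiv_apply]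
  | add p q hp hq => simp only [map_add, Polynomial.map_add, Polynomial.eval_add, hp, hq]
  | mul_X p i hp =>
    rw [map_mul, Polynomial.map_mul, Polynomial.eval_mul, hp, map_mul]
    congr 1
    cases i using Fin.cases with
    | zero => simp [finSuccEquiv_X_zero]
    | succ i => simp [finSuccEquiv_X_succ]

theorem degNull (k Ω : Type*) [Field k] [Infinite k] [Field Ω] [IsAlgClosed Ω] [Algebra k Ω]
    (s : ℕ) : ∀ (D : ℕ) (S : Set (MvPolynomial (Fin s) k)), (∀ f ∈ S, f.totalDegree ≤ D) →
    (¬ ∃ x : Fin s → Ω, ∀ f ∈ S, aeval x f = 0) → 1 ∈ degSpan S (nullB s D) := by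
  classical
  induction s with
  | zero =>
    intro D S _ hS
    push Not at hS
    obtain ⟨f, hf, hne⟩ := hS Fin.elim0
    obtain ⟨c, rfl⟩ := C_surjective (Fin 0) f
    have hc : c ≠ 0 := by rintro rfl; simp at hne
    refine Submodule.subset_span ⟨C c, hf, C c⁻¹, by simp, ?_⟩
    rw [← C_mul, inv_mul_cancel₀ hc, C_1]
  | succ s ih =>
    intro D S hD hS
    have h1 : ∃ f ∈ S, f ≠ 0 := by
      by_contra h
      push Not at h
      exact hS ⟨0, fun f hf => by simp [h f hf]⟩
    obtain ⟨f₁, hf₁, hne⟩ := h1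
    set U := (2 + D) ^ s with hU
    set E := D * U + 1 with hE
    have hTdeg : ∀ c p, (nT1 f₁ c p).totalDegree ≤ p.totalDegree * U := fun c p =>
      totalDegree_nT1_le f₁ c D (hD _ hf₁) p
    have hspan : ∀ F ∈ Submodule.span k S, F.totalDegree ≤ D := by
      intro F hF
      induction hF using Submodule.span_induction with
      | mem x hx => exact hD x hx
      | zero => simp
      | add x y _ _ hx hy => exact (totalDegree_add _ _).trans (max_le hx hy)
      | smul a x _ hx => exact (totalDegree_smul_le _ _).trans hx
    have hTE : ∀ F ∈ Submodule.span k S, (nT1 f₁ 1 F).totalDegree ≤ E := fun F hF =>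
      (hTdeg 1 F).trans ((Nat.mul_le_mul_right _ (hspan F hF)).trans (by lia))
    have hf₁' : f₁ ∈ Submodule.span k S := Submodule.subset_span hf₁
    set P := finSuccEquiv k s (nT1 f₁ 1 f₁) with hP
    have hPu : IsUnit P.leadingCoeff := nT_leadingcoeff_isUnit f₁ hne
    set Nf : MvPolynomial (Fin (s+1)) k → MvPolynomial (Fin s) k := fun F =>
      Polynomial.resultant P (finSuccEquiv k s (nT1 f₁ 1 F)) P.natDegree E with hNf
    have hnd : ∀ f : MvPolynomial (Fin (s+1)) k,
        (finSuccEquiv k s f).natDegree ≤ f.totalDegree := by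
      intro f
      rw [natDegree_finSuccEquiv]; exact degreeOf_le_totalDegree _ _
    have hPE : P.natDegree ≤ E := (hnd _).trans (hTE f₁ hf₁')
    set S' : Set (MvPolynomial (Fin s) k) := Nf '' (Submodule.span k S : Set _) with hS'
    have hS'D : ∀ f ∈ S', f.totalDegree ≤ 2 * E ^ 2 := by
      rintro _ ⟨F, hF, rfl⟩
      refine (totalDegree_det_le _ E (totalDegree_sylvester_le _ _ E _ _ (hTE _ hf₁')
        (hTE _ hF))).trans ?_
      simp only [Fintype.card_fin]
      nlinarith
    have hS'z : ¬ ∃ x : Fin s → Ω, ∀ f ∈ S', aeval x f = 0 := by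
      rintro ⟨x, hx⟩
      apply hS
      set ev : MvPolynomial (Fin s) k →+* Ω := (aeval x : MvPolynomial (Fin s) k →ₐ[k] Ω).toRingHom
      have hlead : ev P.leadingCoeff ≠ 0 := (hPu.map ev).ne_zero
      have hPne : P.map ev ≠ 0 := by
        intro h
        have := congrArg (fun q => q.coeff P.natDegree) h
        simp [Polynomial.coeff_map] at this
        exact hlead this
      have hroot : ∀ F ∈ Submodule.span k S, ∃ ξ ∈ (P.map ev).roots.toFinset,
          ((finSuccEquiv k s (nT1 f₁ 1 F)).map ev).eval ξ = 0 := by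
        intro F hF
        have h0 : ev (Nf F) = 0 := hx _ ⟨F, hF, rfl⟩
        rw [hNf] at h0
        simp only at h0
        rw [← Polynomial.resultant_map_map] at h0
        have hdeg : (P.map ev).natDegree = P.natDegree :=
          Polynomial.natDegree_map_of_leadingCoeff_ne_zero _ hlead
        rw [← hdeg, Polynomial.resultant_eq_prod_eval _ _ _
          (Polynomial.natDegree_map_le.trans ((hnd _).trans (hTE F hF)))
          (IsAlgClosed.splits _)] at h0
        rcases mul_eq_zero.mp h0 with h | h
        · exact absurd (pow_eq_zero_iff (n := E) (by lia) |>.mp h) (by simpa using hPne)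
        · rw [Multiset.prod_eq_zero_iff, Multiset.mem_map] at h
          obtain ⟨ξ, h1, h2⟩ := h
          exact ⟨ξ, by simpa using h1, h2⟩
      let L : Ω → (Submodule.span k S) →ₗ[k] Ω := fun ξ =>
        ((aeval (Fin.cons ξ x : Fin (s+1) → Ω) : MvPolynomial (Fin (s+1)) k →ₐ[k] Ω).comp
          (nT1 f₁ 1)).toLinearMap.comp (Submodule.subtype _)
      have hcov : ⋃ ξ : (P.map ev).roots.toFinset,
          ((LinearMap.ker (L ξ.1) : Submodule k (Submodule.span k S)) :
            Set (Submodule.span k S)) = Set.univ := by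
        rw [Set.eq_univ_iff_forall]
        intro F
        obtain ⟨ξ, h1, h2⟩ := hroot F.1 F.2
        rw [Set.mem_iUnion]
        refine ⟨⟨ξ, h1⟩, ?_⟩
        rw [finSucc_eval] at h2
        exact h2
      obtain ⟨ξ, hξ⟩ := Subspace.exists_eq_top_of_iUnion_eq_univ hcov
      refine ⟨fun i => aeval (Fin.cons ξ.1 x : Fin (s+1) → Ω) (nT1 f₁ 1 (X i)), ?_⟩
      intro f hf
      have h3 : (⟨f, Submodule.subset_span hf⟩ : Submodule.span k S) ∈ LinearMap.ker (L ξ.1) := by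
        rw [hξ]; trivial
      have h4 : aeval (Fin.cons ξ.1 x : Fin (s+1) → Ω) (nT1 f₁ 1 f) = 0 := h3
      rw [← h4]
      have : (aeval fun i => aeval (Fin.cons ξ.1 x : Fin (s+1) → Ω) (nT1 f₁ 1 (X i))) =
        (aeval (Fin.cons ξ.1 x : Fin (s+1) → Ω) : MvPolynomial (Fin (s+1)) k →ₐ[k] Ω).comp
          (nT1 f₁ 1) := by
        apply MvPolynomial.algHom_ext
        intro i
        simp
      rw [this]; rfl
    have h5 := ih _ S' hS'D hS'z
    have h6 := degSpan_map (c := 1) (rename Fin.succ : MvPolynomial (Fin s) k →ₐ[k] _)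
      (fun g => by rw [mul_one]; exact totalDegree_rename_le _ _) h5
    have h7 := degSpan_trans (S := nT1 f₁ 1 '' S) (c := 4 * E ^ 2) (by
      rintro _ ⟨_, ⟨F, hF, rfl⟩, rfl⟩
      have h8 := elim_comb (nT1 f₁ 1 f₁) (nT1 f₁ 1 F) E (hTE _ hf₁') (hTE _ hF) (by lia)
      unfold degSpan at h8
      refine Submodule.span_le.mpr ?_ h8
      rintro _ ⟨f, hf, g, hg, rfl⟩
      have : f ∈ Submodule.span k (nT1 f₁ 1 '' S) := by
        have himg : ∀ F ∈ Submodule.span k S, nT1 f₁ 1 F ∈ Submodule.span k (nT1 f₁ 1 '' S) := by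
          intro F hF
          have := Submodule.mem_map_of_mem (f := (nT1 f₁ 1).toLinearMap) hF
          rw [Submodule.map_span] at this
          exact this
        rcases hf with rfl | rfl
        · exact himg _ hf₁'
        · exact himg _ hF
      exact degSpan_span this hg) h6
    have h8 := degSpan_map (c := U) (nT1 f₁ (-1)) (hTdeg (-1)) h7
    have h9 : nT1 f₁ (-1) '' (nT1 f₁ 1 '' S) = S := by
      rw [Set.image_image]
      have : ∀ p, nT1 f₁ (-1) (nT1 f₁ 1 p) = p := fun p => by
        have := nt1_comp_t1_neg f₁ (-1)
        rw [neg_neg] at this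
        exact DFunLike.congr_fun this p
      simp only [this, Set.image_id']
    rw [h9, map_one, map_one] at h8
    simpa [nullB] using h8

end LG

namespace LG
open MvPolynomial

lemma cramer_int {R : Type*} [Fintype R] [DecidableEq R] (S : Set (R → ℤ)) (E : ℤ) (hE1 : 1 ≤ E)
    (hE : ∀ c ∈ S, ∀ i, |c i| ≤ E) (v : R → ℤ)
    (hv : (fun i => (v i : ℚ)) ∈ Submodule.span ℚ ((fun c i => ((c i : ℤ) : ℚ)) '' S)) :
    ∃ a : ℤ, a ≠ 0 ∧ |a| ≤ (Fintype.card R).factorial * E ^ (Fintype.card R) ∧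
      a • v ∈ Submodule.span ℤ S := by
  set ι : (R → ℤ) → (R → ℚ) := fun c i => ((c i : ℤ) : ℚ) with hι
  set t0 : Set (R → ℚ) := ι '' S
  set e : R → (R → ℤ) := fun j => Pi.single j 1
  set t1 : Set (R → ℚ) := t0 ∪ Set.range (fun j => ι (e j))
  obtain ⟨s, hst, -, hs2, hs3⟩ := exists_linearIndepOn_id_extension (K := ℚ) (V := R → ℚ)
    (s := ∅) (t := t0) (linearIndepOn_empty ℚ id) (Set.empty_subset _)
  obtain ⟨b, hbt, hsb, hb2, hb3⟩ := exists_linearIndepOn_id_extension (K := ℚ) (V := R → ℚ)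
    hs3 (hst.trans (Set.subset_union_left : t0 ⊆ t1))
  have hspan : ⊤ ≤ Submodule.span ℚ (Set.range ((↑) : b → (R → ℚ))) := by
    rw [Subtype.range_coe]
    have h1 : Submodule.span ℚ t1 ≤ Submodule.span ℚ b := Submodule.span_le.mpr hb2
    refine le_trans ?_ h1
    intro x _
    have : x = ∑ j, x j • ι (e j) := by
      ext i
      simp [hι, e, Pi.single_apply]
    rw [this]
    exact Submodule.sum_mem _ fun j _ => Submodule.smul_mem _ _
      (Submodule.subset_span (Or.inr ⟨j, rfl⟩))
  let bas : Module.Basis b ℚ (R → ℚ) := Module.Basis.mk hb3 hspan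
  haveI : Fintype b := FiniteDimensional.fintypeBasisIndex bas
  have hcard : Fintype.card R = Fintype.card b := by
    rw [← Module.finrank_eq_card_basis bas, Module.finrank_fintype_fun_eq_card]
  let eq : R ≃ b := Fintype.equivOfCardEq hcard
  let bas2 : Module.Basis R ℚ (R → ℚ) := bas.reindex eq.symm
  have hb2c : ∀ j, bas2 j = (eq j : R → ℚ) := fun j => by simp [bas2, bas]
  have hch : ∀ j : R, ∃ c : R → ℤ, ι c = bas2 j ∧ (∀ i, |c i| ≤ E) ∧
      (bas2 j ∈ s → c ∈ S) := by
    intro j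
    rw [hb2c]
    by_cases hj : (eq j : R → ℚ) ∈ s
    · obtain ⟨c, hc, hc2⟩ := hst hj
      exact ⟨c, hc2, hE c hc, fun _ => hc⟩
    · rcases hbt (eq j).2 with ⟨c, hc, hc2⟩ | ⟨i, hi⟩
      · exact ⟨c, hc2, hE c hc, fun _ => hc⟩
      · refine ⟨e i, hi, fun i' => ?_, fun h => absurd h hj⟩
        simp only [e, Pi.single_apply]
        split_ifs <;> simp <;> lia
  choose c hc1 hc2 hc3 using hch
  let Mz : Matrix R R ℤ := Matrix.of fun i j => c j i
  have hMq : Mz.map (Int.cast : ℤ → ℚ) = (Pi.basisFun ℚ R).toMatrix bas2 := by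
    ext i j
    simp [Mz, Module.Basis.toMatrix_apply, ← hc1, hι]
  have hdetq : ((Mz.det : ℤ) : ℚ) = ((Pi.basisFun ℚ R).toMatrix bas2).det := by
    rw [← hMq]
    exact (Int.castRingHom ℚ).map_det Mz
  have hdet : Mz.det ≠ 0 := by
    intro h
    rw [h] at hdetq
    have : IsUnit ((Pi.basisFun ℚ R).toMatrix bas2).det := by
      rw [← Module.Basis.det_apply]; exact (Pi.basisFun ℚ R).isUnit_det bas2
    rw [← hdetq] at this
    simp at this
  set y := bas2.repr (ι v) with hy
  have hvsum : ι v = ∑ j, y j • bas2 j := (bas2.sum_repr (ι v)).symm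
  have hyz : ∀ j, bas2 j ∉ s → y j = 0 := by
    intro j hj
    have h1 : ι v ∈ Submodule.span ℚ (bas2 '' {j | bas2 j ∈ s}) := by
      have h2 : bas2 '' {j | bas2 j ∈ s} = s := by
        ext x
        constructor
        · rintro ⟨j, hj, rfl⟩; exact hj
        · intro hx
          refine ⟨eq.symm ⟨x, hsb hx⟩, ?_, ?_⟩ <;> simp [hb2c, hx]
      rw [h2]
      exact (Submodule.span_le.mpr hs2) hv
    rw [Module.Basis.mem_span_image] at h1
    by_contra h
    exact hj (h1 (Finsupp.mem_support_iff.mpr h))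
  -- integral solution
  set z : R → ℤ := Mz.adjugate.mulVec v with hz
  have hyv : (Mz.map (Int.cast : ℤ → ℚ)).mulVec y = ι v := by
    rw [hvsum]
    ext i
    simp [Matrix.mulVec, dotProduct, Mz, ← hc1, hι, mul_comm]
  have hzy : ∀ j, ((z j : ℤ) : ℚ) = (Mz.det : ℚ) * y j := by
    have h1 : (Mz.map (Int.cast : ℤ → ℚ)).adjugate.mulVec (ι v) =
        (Mz.map (Int.cast : ℤ → ℚ)).det • (y : R → ℚ) := by
      rw [← hyv, Matrix.mulVec_mulVec, Matrix.adjugate_mul, Matrix.smul_mulVec, Matrix.one_mulVec]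
    intro j
    have h2 := congrFun h1 j
    have h3 : (Mz.map (Int.cast : ℤ → ℚ)).det = (Mz.det : ℚ) :=
      ((Int.castRingHom ℚ).map_det Mz).symm
    have h4 : (Mz.map (Int.cast : ℤ → ℚ)).adjugate = Mz.adjugate.map (Int.cast : ℤ → ℚ) :=
      ((Int.castRingHom ℚ).map_adjugate Mz).symm
    rw [h3, h4] at h2
    simp only [Pi.smul_apply, smul_eq_mul] at h2
    rw [← h2]
    simp [hz, Matrix.mulVec, dotProduct, hι]
  refine ⟨Mz.det, hdet, ?_, ?_⟩
  · have := Matrix.det_le (A := Mz) (abv := AbsoluteValue.abs) (x := E)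
      (fun i j => hc2 j i)
    simpa [nsmul_eq_mul] using this
  · have h1 : Mz.det • v = ∑ j, z j • c j := by
      have h2 : Mz.mulVec z = Mz.det • v := by
        rw [hz, Matrix.mulVec_mulVec, Matrix.mul_adjugate, Matrix.smul_mulVec, Matrix.one_mulVec]
      rw [← h2]
      ext i
      simp [Matrix.mulVec, dotProduct, Mz, mul_comm]
    rw [h1]
    refine Submodule.sum_mem _ fun j _ => ?_
    by_cases hj : bas2 j ∈ s
    · exact Submodule.smul_mem _ _ (Submodule.subset_span (hc3 j hj))
    · have : ((z j : ℤ) : ℚ) = 0 := by rw [hzy, hyz j hj, mul_zero]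
      have : z j = 0 := by exact_mod_cast this
      simp [this]

end LG

namespace LG
open MvPolynomial

/-- the number of monomials used -/
def nullR (s D : ℕ) : ℕ := (nullB s D + D + 1) ^ s

theorem effNull (s D : ℕ) (E : ℤ) (hE1 : 1 ≤ E) (S : Set (MvPolynomial (Fin s) ℤ))
    (hD : ∀ f ∈ S, f.totalDegree ≤ D) (hE : ∀ f ∈ S, ∀ m, |coeff m f| ≤ E)
    (hz : ¬ ∃ x : Fin s → AlgebraicClosure ℚ, ∀ f ∈ S, aeval x f = 0) :
    ∃ a : ℤ, a ≠ 0 ∧ |a| ≤ (nullR s D).factorial * E ^ nullR s D ∧ C a ∈ Ideal.span S := by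
  classical
  set B := nullB s D with hB
  set M := B + D with hM
  let R := Fin s → Fin (M + 1)
  let mon : R → (Fin s →₀ ℕ) := fun r => Finsupp.equivFunOnFinite.symm fun i => (r i : ℕ)
  let cz : MvPolynomial (Fin s) ℤ →ₗ[ℤ] (R → ℤ) := LinearMap.pi fun r => lcoeff ℤ (mon r)
  let cq : MvPolynomial (Fin s) ℚ →ₗ[ℚ] (R → ℚ) := LinearMap.pi fun r => lcoeff ℚ (mon r)
  let S1 : Set (MvPolynomial (Fin s) ℤ) := {q | ∃ f ∈ S, ∃ μ : Fin s →₀ ℕ, (μ.sum fun _ e => e) ≤ B ∧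
    q = monomial μ 1 * f}
  set φ : MvPolynomial (Fin s) ℤ →+* MvPolynomial (Fin s) ℚ := map (Int.castRingHom ℚ)
  have hcomp : ∀ q : MvPolynomial (Fin s) ℤ, cq (φ q) = fun i => ((cz q i : ℤ) : ℚ) := by
    intro q
    ext r
    simp [cq, cz, φ, coeff_map]
  have h1 : (1 : MvPolynomial (Fin s) ℚ) ∈ degSpan (φ '' S) B := by
    apply degNull ℚ (AlgebraicClosure ℚ) s D
    · rintro _ ⟨f, hf, rfl⟩
      refine le_trans ?_ (hD f hf)
      exact Finset.sup_mono (support_map_subset _ _)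
    · rintro ⟨x, hx⟩
      refine hz ⟨x, fun f hf => ?_⟩
      rw [← hx _ ⟨f, hf, rfl⟩]
      simp only [φ]
      rw [← algebraMap_int_eq, aeval_map_algebraMap]
  have h2 : (1 : MvPolynomial (Fin s) ℚ) ∈ Submodule.span ℚ (φ '' S1) := by
    unfold degSpan at h1
    refine Submodule.span_le.mpr ?_ h1
    rintro _ ⟨_, ⟨f, hf, rfl⟩, g, hg, rfl⟩
    rw [SetLike.mem_coe]
    rw [g.as_sum, Finset.sum_mul]
    refine Submodule.sum_mem _ fun μ hμ => ?_
    have : monomial μ (coeff μ g) * φ f = coeff μ g • φ (monomial μ 1 * f) := by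
      rw [map_mul, ← smul_mul_assoc]
      simp [φ, map_monomial, smul_monomial]
    rw [this]
    exact Submodule.smul_mem _ _ (Submodule.subset_span
      ⟨_, ⟨f, hf, μ, (le_totalDegree hμ).trans hg, rfl⟩, rfl⟩)
  have h3 : (fun i => ((cz 1 i : ℤ) : ℚ)) ∈
      Submodule.span ℚ ((fun c i => ((c i : ℤ) : ℚ)) '' (cz '' S1)) := by
    rw [← hcomp, map_one]
    have := Submodule.mem_map_of_mem (f := cq) h2
    rw [Submodule.map_span] at this
    convert! this using 3
    rw [Set.image_image, Set.image_image]
    simp only [hcomp]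
  have hcard : Fintype.card R = nullR s D := by
    simp [R, nullR, hM, hB]
  obtain ⟨a, ha0, ha, hmem⟩ := cramer_int (cz '' S1) E hE1 (by
    rintro _ ⟨_, ⟨f, hf, μ, hμ, rfl⟩, rfl⟩ r
    simp only [cz, LinearMap.pi_apply, lcoeff_apply]
    rw [coeff_monomial_mul']
    split_ifs
    · simpa using hE f hf _
    · simp; lia) (cz 1) h3
  rw [hcard] at ha
  refine ⟨a, ha0, ha, ?_⟩
  rw [← map_smul, ← Submodule.map_span] at hmem
  obtain ⟨q, hq, hqe⟩ := hmem
  have hqd : q.totalDegree ≤ M := by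
    clear hqe
    induction hq using Submodule.span_induction with
    | mem x hx =>
      obtain ⟨f, hf, μ, hμ, rfl⟩ := hx
      refine (totalDegree_mul _ _).trans (add_le_add ?_ (hD f hf))
      exact (totalDegree_monomial_le _ _).trans hμ
    | zero => simp
    | add x y _ _ hx hy => exact (totalDegree_add _ _).trans (max_le hx hy)
    | smul a x _ hx => exact (totalDegree_smul_le _ _).trans hx
  have hqe2 : q = C a := by
    ext m
    by_cases hm : ∀ i, m i < M + 1
    · have := congrFun hqe (fun i => ⟨m i, hm i⟩)
      simp only [cz, LinearMap.pi_apply, lcoeff_apply] at this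
      have hmm : mon (fun i => ⟨m i, hm i⟩) = m := by ext i; simp [mon]
      rw [hmm] at this
      rw [this, smul_eq_C_mul, mul_one]
    · push Not at hm
      obtain ⟨i, hi⟩ := hm
      have hle : m i ≤ m.sum fun _ e => e := by
        rw [Finsupp.sum_fintype _ _ (by simp)]
        exact Finset.single_le_sum (f := fun i => m i) (by simp) (Finset.mem_univ i)
      rw [coeff_eq_zero_of_totalDegree_lt (f := q), coeff_C, if_neg]
      · rintro rfl; simp at hi
      · refine lt_of_le_of_lt hqd ?_
        have : ∑ i ∈ m.support, m i = m.sum fun _ e => e := rfl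
        rw [this]
        lia
  rw [← hqe2]
  have : S1 ⊆ (Ideal.span S).restrictScalars ℤ := by
    rintro _ ⟨f, hf, μ, hμ, rfl⟩
    exact Ideal.mul_mem_left _ _ (Ideal.subset_span hf)
  exact (Submodule.span_le.mpr this) hq

theorem effNull' {σ : Type*} [Fintype σ] (D : ℕ) (E : ℤ) (hE1 : 1 ≤ E)
    (S : Set (MvPolynomial σ ℤ))
    (hD : ∀ f ∈ S, f.totalDegree ≤ D) (hE : ∀ f ∈ S, ∀ m, |coeff m f| ≤ E)
    (hz : ¬ ∃ x : σ → AlgebraicClosure ℚ, ∀ f ∈ S, aeval x f = 0) :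
    ∃ a : ℤ, a ≠ 0 ∧ |a| ≤ (nullR (Fintype.card σ) D).factorial * E ^ nullR (Fintype.card σ) D ∧
      ∀ (K : Type) [Field K] (x : σ → K), (∀ f ∈ S, aeval x f = 0) → (a : K) = 0 := by
  let e := Fintype.equivFin σ
  obtain ⟨a, h0, h1, h2⟩ := effNull (Fintype.card σ) D E hE1 (rename e '' S)
    (by rintro _ ⟨f, hf, rfl⟩; exact (totalDegree_rename_le _ _).trans (hD f hf))
    (by
      rintro _ ⟨f, hf, rfl⟩ m
      by_cases hm : coeff m (rename e f) = 0
      · rw [hm]; simp; lia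
      · obtain ⟨u, rfl, hu⟩ := coeff_rename_ne_zero _ _ _ hm
        rw [coeff_rename_mapDomain _ e.injective]
        exact hE f hf u)
    (by
      rintro ⟨x, hx⟩
      refine hz ⟨x ∘ e, fun f hf => ?_⟩
      rw [← aeval_rename]
      exact hx _ ⟨f, hf, rfl⟩)
  refine ⟨a, h0, h1, ?_⟩
  intro K _ x hx
  have hle : Ideal.span (rename e '' S) ≤ RingHom.ker (aeval (x ∘ e.symm) :
      MvPolynomial (Fin (Fintype.card σ)) ℤ →ₐ[ℤ] K) := by
    rw [Ideal.span_le]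
    rintro _ ⟨f, hf, rfl⟩
    simp only [SetLike.mem_coe, RingHom.mem_ker]
    rw [aeval_rename]
    have : (x ∘ e.symm) ∘ e = x := by ext; simp
    rw [this]; exact hx f hf
  have := hle h2
  simpa using this

lemma nullB_bound (s : ℕ) : ∃ c : ℕ, ∀ D, 1 ≤ D → nullB s D ≤ (c * D) ^ c := by
  induction s with
  | zero => exact ⟨1, fun D _ => by simp [nullB]⟩
  | succ s ih =>
    obtain ⟨c, hc⟩ := ih
    -- every quantity is bounded by a power of `T = 3 * D`
    have key : ∃ A e : ℕ, ∀ D, 1 ≤ D → nullB (s+1) D ≤ A * D ^ e := by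
      refine ⟨((c * (2 * (3 ^ s + 1) ^ 2)) ^ c + 4 * (3 ^ s + 1) ^ 2) * 3 ^ s,
        (2 * (s+1) * c + 2 * (s + 1)) + s, ?_⟩
      intro D hD
      have h1 : (2 + D) ^ s ≤ 3 ^ s * D ^ s := by
        rw [← mul_pow]; exact Nat.pow_le_pow_left (by lia) _
      have hDs : 1 ≤ D ^ (s+1) := Nat.one_le_pow _ _ hD
      have h2 : D * (2 + D) ^ s + 1 ≤ (3 ^ s + 1) * D ^ (s + 1) := by
        calc D * (2 + D) ^ s + 1 ≤ D * (3 ^ s * D ^ s) + D ^ (s+1) :=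
              add_le_add (Nat.mul_le_mul_left _ h1) hDs
          _ = _ := by ring
      set G := D * (2 + D) ^ s + 1
      have h3 : G ^ 2 ≤ (3 ^ s + 1) ^ 2 * D ^ (2 * (s + 1)) := by
        calc G ^ 2 ≤ ((3 ^ s + 1) * D ^ (s + 1)) ^ 2 := Nat.pow_le_pow_left h2 _
          _ = _ := by ring
      have h4 : nullB s (2 * G ^ 2) ≤ (c * (2 * (3 ^ s + 1) ^ 2)) ^ c * D ^ (2 * (s+1) * c) := by
        calc nullB s (2 * G ^ 2) ≤ (c * (2 * G ^ 2)) ^ c := hc _ (by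
                have : 1 ≤ G ^ 2 := Nat.one_le_pow _ _ (by lia)
                lia)
          _ ≤ (c * (2 * ((3 ^ s + 1) ^ 2 * D ^ (2 * (s + 1))))) ^ c := by gcongr
          _ = ((c * (2 * (3 ^ s + 1) ^ 2)) * D ^ (2 * (s+1))) ^ c := by congr 1; ring
          _ = _ := by rw [mul_pow, ← pow_mul]
      have hp : ∀ a b : ℕ, a ≤ b → D ^ a ≤ D ^ b := fun a b h => Nat.pow_le_pow_right hD h
      have h5 : nullB (s+1) D = (nullB s (2 * G ^ 2) + 4 * G ^ 2) * (2 + D) ^ s := rfl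
      rw [h5, pow_add]
      calc (nullB s (2 * G ^ 2) + 4 * G ^ 2) * (2 + D) ^ s
          ≤ ((c * (2 * (3 ^ s + 1) ^ 2)) ^ c * D ^ (2 * (s+1) * c + 2 * (s+1)) +
            4 * ((3 ^ s + 1) ^ 2 * D ^ (2 * (s+1) * c + 2 * (s+1)))) * (3 ^ s * D ^ s) := by
            refine Nat.mul_le_mul (add_le_add (h4.trans ?_) ?_) h1
            · exact Nat.mul_le_mul_left _ (hp _ _ (by lia))
            · exact Nat.mul_le_mul_left _ (h3.trans (Nat.mul_le_mul_left _ (hp _ _ (by lia))))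
        _ = _ := by ring
    obtain ⟨A, e, h⟩ := key
    refine ⟨A + e + 1, fun D hD => (h D hD).trans ?_⟩
    have h1 : 1 ≤ (A + e + 1) * D := Nat.mul_pos (by lia) hD
    calc A * D ^ e ≤ ((A + e + 1) * D) * ((A + e + 1) * D) ^ e := by
          refine Nat.mul_le_mul ?_ (Nat.pow_le_pow_left ?_ _)
          · calc A = A * 1 := by ring
              _ ≤ _ := Nat.mul_le_mul (by lia) hD
          · calc D = 1 * D := by ring
              _ ≤ _ := Nat.mul_le_mul_right _ (by lia)
      _ = ((A + e + 1) * D) ^ (e + 1) := by ring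
      _ ≤ _ := Nat.pow_le_pow_right h1 (by lia)

lemma nullR_bound (s : ℕ) : ∃ c : ℕ, 1 ≤ c ∧ ∀ D, 1 ≤ D → nullR s D ≤ (c * D) ^ c := by
  obtain ⟨c, hc⟩ := nullB_bound s
  refine ⟨(c + 2) * (s + 1) + c + 2, by lia, fun D hD => ?_⟩
  have h1 : nullB s D + D + 1 ≤ ((c + 2) * D) ^ (c + 2) := by
    have h2 : nullB s D ≤ ((c+2) * D) ^ c :=
      (hc D hD).trans (Nat.pow_le_pow_left (Nat.mul_le_mul_right _ (by lia)) _)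
    have h3 : 2 * D ≤ (c+2) * D := Nat.mul_le_mul_right _ (by lia)
    have h4 : 1 ≤ ((c+2) * D) ^ c := Nat.one_le_pow _ _ (Nat.mul_pos (by lia) hD)
    set T := (c+2) * D
    calc nullB s D + D + 1 ≤ T ^ c + T := by lia
      _ ≤ T ^ c * T + T * T ^ c:= by
        refine add_le_add (Nat.le_mul_of_pos_right _ (by lia)) (Nat.le_mul_of_pos_right _ h4)
      _ = T ^ c * (2 * T) := by ring
      _ ≤ T ^ c * (T * T) := by gcongr; lia
      _ = _ := by ring
  unfold nullR
  calc (nullB s D + D + 1) ^ s ≤ (((c + 2) * D) ^ (c + 2)) ^ s := Nat.pow_le_pow_left h1 _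
    _ = ((c+2) * D) ^ ((c+2) * s) := by rw [← pow_mul]
    _ ≤ ((((c + 2) * (s + 1) + c + 2)) * D) ^ ((c+2) * s) := by gcongr; nlinarith
    _ ≤ _ := Nat.pow_le_pow_right (Nat.mul_pos (by lia) hD) (by nlinarith)

end LG

namespace LG
open MvPolynomial

/-- The uniform statement over the algebraic numbers. -/
def T0 (d k : ℕ) : Prop :=
  ∃ (N₀ s : ℕ) (Q : Subgroup (FreeGroup (Fin k))), Q.index ≠ 0 ∧
    ∀ φ : FreeGroup (Fin k) →* GL (Fin d) (AlgebraicClosure ℚ),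
      (∀ a b : FreeGroup (Fin k), a.toWord.length ≤ N₀ → b.toWord.length ≤ N₀ →
        ∃ w : FreeGroup (Fin 2), w ≠ 1 ∧
          FreeGroup.lift (fun i : Fin 2 => if i = 0 then φ a else φ b) w = 1) →
      ∀ x ∈ (derivedSeries Q s).map Q.subtype, φ x = 1

/-- variables -/
abbrev Var (d k : ℕ) := (Fin k × Bool × Fin d × Fin d) ⊕ Unit

/-- generic matrix -/
noncomputable def xm (d k : ℕ) (p : Fin k × Bool) :
    Matrix (Fin d) (Fin d) (MvPolynomial (Var d k) ℤ) :=
  Matrix.of fun i j => X (Sum.inl (p.1, p.2, i, j))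

/-- generic word -/
noncomputable def xp (d k : ℕ) (L : List (Fin k × Bool)) :
    Matrix (Fin d) (Fin d) (MvPolynomial (Var d k) ℤ) := (L.map (xm d k)).prod

lemma xp_cons (d k : ℕ) (p) (L : List (Fin k × Bool)) : xp d k (p :: L) = xm d k p * xp d k L := by
  simp [xp]

lemma xp_eval {d k : ℕ} {K : Type*} [Field K] (x : Var d k → K)
    (φ : FreeGroup (Fin k) →* GL (Fin d) K)
    (hx : ∀ l b i j, x (Sum.inl (l, b, i, j)) = (φ (FreeGroup.mk [(l, b)]) : Matrix _ _ K) i j)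
    (L : List (Fin k × Bool)) (i j) :
    aeval x (xp d k L i j) = (φ (FreeGroup.mk L) : Matrix _ _ K) i j := by
  induction L generalizing i with
  | nil =>
    have : (FreeGroup.mk ([] : List (Fin k × Bool))) = 1 := rfl
    rw [this, map_one]
    by_cases h : i = j <;> simp [xp, h, Matrix.one_apply]
  | cons p L ih =>
    have : FreeGroup.mk (p :: L) = FreeGroup.mk [p] * FreeGroup.mk L := by
      rw [FreeGroup.mul_mk]; rfl
    rw [this, map_mul, Units.val_mul, Matrix.mul_apply, xp_cons, Matrix.mul_apply, map_sum]
    refine Finset.sum_congr rfl fun m _ => ?_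
    rw [map_mul, ih]
    congr 1
    simp [xm, hx]

lemma xp_degree (d k : ℕ) (L : List (Fin k × Bool)) (i j) :
    (xp d k L i j).totalDegree ≤ L.length := by
  induction L generalizing i with
  | nil => by_cases h : i = j <;> simp [xp, h, Matrix.one_apply]
  | cons p L ih =>
    rw [xp_cons, Matrix.mul_apply]
    refine totalDegree_finsetSum_le fun m _ => ?_
    refine (totalDegree_mul _ _).trans ?_
    have := ih m
    simp [xm]; lia

lemma xp_coeff (d k : ℕ) (L : List (Fin k × Bool)) (i j m) :
    |coeff m (xp d k L i j)| ≤ (d : ℤ) ^ L.length := by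
  classical
  induction L generalizing i m with
  | nil =>
    by_cases h : i = j
    · simp [xp, h]; rw [coeff_one]; split_ifs <;> simp
    · simp [xp, h, Matrix.one_apply]
  | cons p L ih =>
    rw [xp_cons, Matrix.mul_apply, coeff_sum]
    refine (Finset.abs_sum_le_sum_abs _ _).trans ?_
    have : ∀ n ∈ Finset.univ, |coeff m (xm d k p i n * xp d k L n j)| ≤ (d : ℤ) ^ L.length := by
      intro n _
      simp only [xm, Matrix.of_apply]
      rw [coeff_X_mul']
      split_ifs
      · exact ih _ _
      · simp
    refine (Finset.sum_le_card_nsmul _ _ _ this).trans ?_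
    simp [pow_succ, mul_comm]

lemma length_lift_le {k : ℕ} (a b : FreeGroup (Fin k)) (N : ℕ) (ha : a.toWord.length ≤ N)
    (hb : b.toWord.length ≤ N) (w : FreeGroup (Fin 2)) :
    (FreeGroup.lift (fun i : Fin 2 => if i = 0 then a else b) w).toWord.length
      ≤ N * w.toWord.length := by
  have key : ∀ L : List (Fin 2 × Bool), (FreeGroup.lift (fun i : Fin 2 => if i = 0 then a else b)
      (FreeGroup.mk L)).norm ≤ N * L.length := by
    intro L
    induction L with
    | nil =>
      have : (FreeGroup.mk ([] : List (Fin 2 × Bool))) = 1 := rfl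
      simp [this]
    | cons p L ih =>
      have : FreeGroup.mk (p :: L) = FreeGroup.mk [p] * FreeGroup.mk L := by
        rw [FreeGroup.mul_mk]; rfl
      rw [this, map_mul]
      refine (FreeGroup.norm_mul_le _ _).trans ?_
      have h1 : (FreeGroup.lift (fun i : Fin 2 => if i = 0 then a else b)
          (FreeGroup.mk [p])).norm ≤ N := by
        obtain ⟨i, e⟩ := p
        cases e <;> by_cases hi : i = 0 <;> simp [FreeGroup.lift_mk, hi, FreeGroup.norm_inv_eq] <;>
          simpa [FreeGroup.norm]
      simp only [List.length_cons]
      lia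
  have := key w.toWord
  rwa [FreeGroup.mk_toWord] at this

/-- finite test set -/
lemma exists_test (d k : ℕ) (Δ : Set (FreeGroup (Fin k))) : ∃ T : Finset (FreeGroup (Fin k)),
    (T : Set _) ⊆ Δ ∧ ∀ (K : Type) [Field K] (φ : FreeGroup (Fin k) →* GL (Fin d) K),
      (∀ q ∈ T, φ q = 1) → ∀ q ∈ Δ, φ q = 1 := by
  classical
  let P : FreeGroup (Fin k) × Fin d × Fin d → MvPolynomial (Var d k) ℤ := fun q =>
    xp d k q.1.toWord q.2.1 q.2.2 - (1 : Matrix (Fin d) (Fin d) (MvPolynomial (Var d k) ℤ)) q.2.1 q.2.2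
  let J : Ideal (MvPolynomial (Var d k) ℤ) := Ideal.span (P '' (Δ ×ˢ Set.univ))
  have hfg : J.FG := IsNoetherian.noetherian J
  obtain ⟨T', hT', hJ⟩ := Submodule.fg_span_iff_fg_span_finset_subset _ |>.mp hfg
  have hch : ∀ t : T', ∃ q : FreeGroup (Fin k) × Fin d × Fin d, q.1 ∈ Δ ∧ P q = t := by
    intro t
    obtain ⟨q, hq, h⟩ := hT' t.2
    exact ⟨q, hq.1, h⟩
  choose g hg1 hg2 using hch
  refine ⟨Finset.univ.image fun t => (g t).1, ?_, ?_⟩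
  · intro q hq
    simp at hq
    obtain ⟨a, b, h⟩ := hq
    rw [← h]; exact hg1 _
  · intro K _ φ hφ q hq
    let x : Var d k → K := Sum.elim (fun v => (φ (FreeGroup.mk [(v.1, v.2.1)]) : Matrix _ _ K)
      v.2.2.1 v.2.2.2) (fun _ => 0)
    have hxe := xp_eval x φ (fun l b i j => rfl)
    have hPe : ∀ q i j, aeval x (P (q, i, j)) = (φ q : Matrix _ _ K) i j -
        (1 : Matrix (Fin d) (Fin d) K) i j := by
      intro q i j
      simp only [P, map_sub]
      rw [hxe, FreeGroup.mk_toWord]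
      congr 1
      by_cases h : i = j <;> simp [h, Matrix.one_apply]
    have hle : J ≤ RingHom.ker (aeval x : MvPolynomial (Var d k) ℤ →ₐ[ℤ] K) := by
      change Submodule.span _ _ ≤ _
      rw [hJ, Submodule.span_le]
      intro t ht
      simp only [SetLike.mem_coe, RingHom.mem_ker]
      have h1 := hφ (g ⟨t, ht⟩).1 (by simp)
      have h2 := hPe (g ⟨t, ht⟩).1 (g ⟨t, ht⟩).2.1 (g ⟨t, ht⟩).2.2
      rw [h1] at h2
      have h3 : aeval x (P (g ⟨t, ht⟩)) = 0 := by rw [h2]; simp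
      rwa [hg2] at h3
    ext i j
    have h2 : P (q, i, j) ∈ J := Ideal.subset_span ⟨(q, i, j), ⟨hq, trivial⟩, rfl⟩
    have h3 : aeval x (P (q, i, j)) = 0 := hle h2
    rw [hPe, sub_eq_zero] at h3
    simpa using h3

end LG

namespace LG
open MvPolynomial

lemma solv_of_derived {G G' : Type*} [Group G] [Group G'] (φ : G →* G') (Q : Subgroup G) (s : ℕ)
    (h : ∀ x ∈ (derivedSeries Q s).map Q.subtype, φ x = 1) : IsSolvable (Q.map φ) := by
  refine ⟨s, ?_⟩
  have hsurj : Function.Surjective (φ.subgroupMap Q) := φ.subgroupMap_surjective Q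
  rw [← map_derivedSeries_eq hsurj, eq_bot_iff]
  rintro _ ⟨x, hx, rfl⟩
  rw [Subgroup.mem_bot]
  ext
  exact h _ ⟨x, hx, rfl⟩

/-- key numerical bound. `ℓ` bounds the lengths of the relations. -/
lemma char_bound (d k N₀ s : ℕ) (Q : Subgroup (FreeGroup (Fin k)))
    (hT : ∀ φ : FreeGroup (Fin k) →* GL (Fin d) (AlgebraicClosure ℚ),
      (∀ a b : FreeGroup (Fin k), a.toWord.length ≤ N₀ → b.toWord.length ≤ N₀ →
        ∃ w : FreeGroup (Fin 2), w ≠ 1 ∧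
          FreeGroup.lift (fun i : Fin 2 => if i = 0 then φ a else φ b) w = 1) →
      ∀ x ∈ (derivedSeries Q s).map Q.subtype, φ x = 1) :
    ∃ D₁ c : ℕ, 1 ≤ D₁ ∧ 1 ≤ c ∧ ∀ (p : ℕ), p.Prime → ∀ (K : Type) [Field K] [CharP K p]
      (φ : FreeGroup (Fin k) →* GL (Fin d) K) (ℓ : ℕ), 1 ≤ ℓ →
      (∃ x ∈ (derivedSeries Q s).map Q.subtype, φ x ≠ 1) →
      (∀ a b : FreeGroup (Fin k), a.toWord.length ≤ N₀ → b.toWord.length ≤ N₀ →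
        ∃ w : FreeGroup (Fin 2), w ≠ 1 ∧ w.toWord.length ≤ ℓ ∧
          FreeGroup.lift (fun i : Fin 2 => if i = 0 then φ a else φ b) w = 1) →
      ∃ R : ℕ, R ≤ (c * (D₁ * ℓ)) ^ c ∧ p ≤ R.factorial * (D₁ ^ ℓ) ^ R := by
  classical
  obtain ⟨T, hTs, hTt⟩ := exists_test d k ((derivedSeries Q s).map Q.subtype : Set _)
  obtain ⟨c, hc1, hc⟩ := nullR_bound (Fintype.card (Var d k))
  obtain ⟨M, hM⟩ : ∃ M : ℕ, ∀ q ∈ T, ∀ i j, (xp d k q.toWord i j - (1 : Matrix (Fin d) (Fin d)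
      (MvPolynomial (Var d k) ℤ)) i j).totalDegree ≤ M ∧ ∀ m, |coeff m (xp d k q.toWord i j -
      (1 : Matrix (Fin d) (Fin d) (MvPolynomial (Var d k) ℤ)) i j)| ≤ M := by
    let LL := T.sup fun q => q.toWord.length
    refine ⟨LL + (d+1) ^ LL + 1, fun q hq i j => ?_⟩
    have hq : q.toWord.length ≤ LL := Finset.le_sup (f := fun q : FreeGroup (Fin k) => q.toWord.length) hq
    constructor
    · refine (totalDegree_sub _ _).trans (max_le ((xp_degree _ _ _ _ _).trans (by lia)) ?_)
      by_cases h : i = j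
      · subst h; rw [Matrix.one_apply_eq]; simp
      · rw [Matrix.one_apply_ne h]; simp
    · intro m
      rw [coeff_sub]
      refine (abs_sub (_ : ℤ) _).trans ?_
      have h1 := xp_coeff d k q.toWord i j m
      have h2 : (d : ℤ) ^ q.toWord.length ≤ (d + 1) ^ LL :=
        (pow_le_pow_left₀ (by positivity) (by lia) _).trans (pow_le_pow_right₀ (by lia) hq)
      have h3 : |coeff m ((1 : Matrix (Fin d) (Fin d) (MvPolynomial (Var d k) ℤ)) i j)| ≤ 1 := by
        by_cases h : i = j
        · subst h; rw [Matrix.one_apply_eq, coeff_one]; split_ifs <;> simp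
        · simp [h, Matrix.one_apply]
      push_cast
      lia
  refine ⟨(d + 1) ^ (N₀ + 2) + N₀ + M + d + 3, c, by lia, hc1, ?_⟩
  set D₁ := (d + 1) ^ (N₀ + 2) + N₀ + M + d + 3 with hD₁
  intro p hp K _ _ φ ℓ hℓ hne hrel
  obtain ⟨q, hqT, hq1⟩ : ∃ q ∈ T, φ q ≠ 1 := by
    by_contra h
    push Not at h
    obtain ⟨x, hx, hx1⟩ := hne
    exact hx1 (hTt K φ h x hx)
  obtain ⟨i₀, j₀, hij⟩ : ∃ i j, (φ q : Matrix _ _ K) i j - (1 : Matrix (Fin d) (Fin d) K) i j ≠ 0 := by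
    by_contra h
    push Not at h
    apply hq1
    ext i j
    simpa [sub_eq_zero] using h i j
  let one : Matrix (Fin d) (Fin d) (MvPolynomial (Var d k) ℤ) := 1
  have hone_eval : ∀ (K : Type) [Field K] (x : Var d k → K) i j, aeval x (one i j) =
      (1 : Matrix (Fin d) (Fin d) K) i j := by
    intro K _ x i j
    by_cases h : i = j <;> simp [h, Matrix.one_apply, one]
  let t : MvPolynomial (Var d k) ℤ := xp d k q.toWord i₀ j₀ - one i₀ j₀
  let S : Set (MvPolynomial (Var d k) ℤ) :=
    {f | ∃ L : List (Fin k × Bool), L.length ≤ N₀ * ℓ + 2 ∧ φ (FreeGroup.mk L) = 1 ∧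
      ∃ i j, f = xp d k L i j - one i j}
      ∪ {X (Sum.inr ()) * t - 1}
  have main : ∀ (Ω : Type) [Field Ω] (hTΩ : ∀ φ : FreeGroup (Fin k) →* GL (Fin d) Ω,
      (∀ a b : FreeGroup (Fin k), a.toWord.length ≤ N₀ → b.toWord.length ≤ N₀ →
        ∃ w : FreeGroup (Fin 2), w ≠ 1 ∧
          FreeGroup.lift (fun i : Fin 2 => if i = 0 then φ a else φ b) w = 1) →
      ∀ x ∈ (derivedSeries Q s).map Q.subtype, φ x = 1),
      ¬ ∃ x : Var d k → Ω, ∀ f ∈ S, aeval x f = 0 := by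
    intro Ω _ hTΩ
    rintro ⟨x, hx⟩
    have hrelx : ∀ L : List (Fin k × Bool), L.length ≤ N₀ * ℓ + 2 → φ (FreeGroup.mk L) = 1 →
        ∀ i j, aeval x (xp d k L i j) = (1 : Matrix (Fin d) (Fin d) (Ω)) i j := by
      intro L hL h1 i j
      have := hx _ (Or.inl ⟨L, hL, h1, i, j, rfl⟩)
      rw [map_sub, hone_eval, sub_eq_zero] at this
      exact this
    let Y : Fin k → Bool → Matrix (Fin d) (Fin d) (Ω) := fun l b =>
      Matrix.of fun i j => x (Sum.inl (l, b, i, j))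
    have hY2 : ∀ l b b', φ (FreeGroup.mk [(l, b), (l, b')]) = 1 → Y l b * Y l b' = 1 := by
      intro l b b' h
      ext i j
      rw [← hrelx _ (by simp) h i j]
      simp [xp, xm, Matrix.mul_apply, Y]
    have hmk : ∀ (l : Fin k) b, FreeGroup.mk [(l, b), (l, !b)] = 1 := by
      intro l b
      have := FreeGroup.Red.Step.not (L₁ := []) (L₂ := []) (x := l) (b := b)
      exact Quot.sound this
    let u : Fin k → GL (Fin d) (Ω) := fun l =>
      ⟨Y l true, Y l false, hY2 _ _ _ (by have := hmk l true; simp only [Bool.not_true] at this; rw [this, map_one]),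
        hY2 _ _ _ (by have := hmk l false; simp only [Bool.not_false] at this; rw [this, map_one])⟩
    let φ' := FreeGroup.lift u
    have hxe := xp_eval x φ' (by
      intro l b i j
      cases b <;> simp [φ', FreeGroup.lift_mk, u, Y])
    have hφ' := hTΩ φ' (by
      intro a b ha hb
      obtain ⟨w, hw1, hwl, hw⟩ := hrel a b ha hb
      refine ⟨w, hw1, ?_⟩
      let W : FreeGroup (Fin k) := FreeGroup.lift (fun i : Fin 2 => if i = 0 then a else b) w
      have hcomp : ∀ {G : Type} [Group G] (χ : FreeGroup (Fin k) →* G),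
          FreeGroup.lift (fun i : Fin 2 => if i = 0 then χ a else χ b) w = χ W := by
        intro G _ χ
        have : FreeGroup.lift (fun i : Fin 2 => if i = 0 then χ a else χ b) =
          χ.comp (FreeGroup.lift (fun i : Fin 2 => if i = 0 then a else b)) := by
          ext i
          fin_cases i <;> simp
        rw [this]; rfl
      rw [hcomp] at hw ⊢
      have hWl : W.toWord.length ≤ N₀ * ℓ := (length_lift_le a b N₀ ha hb w).trans
        (Nat.mul_le_mul_left _ hwl)
      ext i j
      have h1 := hrelx W.toWord (by lia) (by rwa [FreeGroup.mk_toWord]) i j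
      rw [hxe, FreeGroup.mk_toWord] at h1
      simpa using h1)
    have h2 := hx _ (Or.inr rfl)
    rw [map_sub, map_mul] at h2
    simp only [t, map_sub] at h2
    rw [hxe, hone_eval, FreeGroup.mk_toWord, hφ' q (hTs hqT)] at h2
    simp at h2
  have hE1 : (1:ℤ) ≤ (D₁ : ℤ) ^ ℓ := one_le_pow₀ (by lia)
  have hDD : D₁ ≤ D₁ * ℓ := Nat.le_mul_of_pos_right _ hℓ
  have hDe : (D₁ : ℤ) ≤ (D₁ : ℤ) ^ ℓ := le_self_pow₀ (by lia) (by lia)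
  obtain ⟨a, ha0, hab, haK⟩ := effNull' (D₁ * ℓ) ((D₁ : ℤ) ^ ℓ) hE1 S (by
      rintro f (⟨L, hL, -, i, j, rfl⟩ | rfl)
      · refine (totalDegree_sub _ _).trans (max_le ((xp_degree _ _ _ _ _).trans (hL.trans ?_)) ?_)
        · calc N₀ * ℓ + 2 ≤ N₀ * ℓ + 2 * ℓ := by lia
            _ = (N₀ + 2) * ℓ := by ring
            _ ≤ _ := Nat.mul_le_mul_right _ (by lia)
        · by_cases h : i = j <;> simp [h, one, Matrix.one_apply]
      · refine (totalDegree_sub _ _).trans (max_le ((totalDegree_mul _ _).trans ?_) (by simp))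
        have := (hM q hqT i₀ j₀).1
        rw [totalDegree_X]
        refine le_trans ?_ hDD
        have h2 : t.totalDegree ≤ M := this
        lia) (by
      rintro f (⟨L, hL, -, i, j, rfl⟩ | rfl) m
      · rw [coeff_sub]
        refine (abs_sub (_ : ℤ) _).trans ?_
        have h1 := xp_coeff d k L i j m
        have h3 : |coeff m (one i j)| ≤ 1 := by
          by_cases h : i = j
          · subst h; simp only [one]; rw [Matrix.one_apply_eq, coeff_one]; split_ifs <;> simp
          · simp [h, one, Matrix.one_apply]
        have h4 : (d:ℤ) ^ L.length + 1 ≤ (D₁ : ℤ) ^ ℓ := by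
          have e1 : (d : ℤ) ^ L.length ≤ (d + 1) ^ (N₀ * ℓ + 2) :=
            (pow_le_pow_left₀ (by positivity) (by lia) _).trans (pow_le_pow_right₀ (by lia) hL)
          have e2 : ((d:ℤ) + 1) ^ (N₀ * ℓ + 2) ≤ ((d + 1) ^ (N₀ + 2)) ^ ℓ := by
            rw [← pow_mul]
            exact pow_le_pow_right₀ (by lia) (by nlinarith)
          have e3 : (((d:ℤ) + 1) ^ (N₀ + 2)) ^ ℓ + 1 ≤ (D₁ : ℤ) ^ ℓ := by
            have : (((d:ℤ) + 1) ^ (N₀ + 2)) ^ ℓ < (D₁ : ℤ) ^ ℓ := by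
              apply pow_lt_pow_left₀ _ (by positivity) (by lia)
              rw [hD₁]; push_cast; lia
            lia
          lia
        lia
      · rw [coeff_sub]
        refine (abs_sub (_ : ℤ) _).trans ?_
        have h3 : |coeff m (1 : MvPolynomial (Var d k) ℤ)| ≤ 1 := by
          rw [coeff_one]; split_ifs <;> simp
        have h4 : |coeff m (X (Sum.inr ()) * t)| ≤ (M:ℤ) := by
          rw [coeff_X_mul']
          split_ifs
          · exact (hM q hqT i₀ j₀).2 _
          · simp
        have : (M:ℤ) + 1 ≤ D₁ := by
          have : M + 1 ≤ D₁ := by rw [hD₁]; lia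
          exact_mod_cast this
        lia) (by
      rintro ⟨x, hx⟩
      refine main _ hT ⟨x, fun f hf => ?_⟩
      rw [← hx f hf]
      congr!)
  have hz := haK K (Sum.elim (fun v => (φ (FreeGroup.mk [(v.1, v.2.1)]) : Matrix _ _ K)
      v.2.2.1 v.2.2.2) (fun _ => ((φ q : Matrix _ _ K) i₀ j₀ - (1 : Matrix (Fin d) (Fin d) K) i₀ j₀)⁻¹)) (by
    have hxe := xp_eval (Sum.elim (fun v => (φ (FreeGroup.mk [(v.1, v.2.1)]) : Matrix _ _ K)
      v.2.2.1 v.2.2.2) (fun _ => ((φ q : Matrix _ _ K) i₀ j₀ - (1 : Matrix (Fin d) (Fin d) K) i₀ j₀)⁻¹))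
      φ (fun l b i j => rfl)
    rintro f (⟨L, hL, h1, i, j, rfl⟩ | rfl)
    · rw [map_sub, hone_eval, hxe, h1]; simp
    · rw [map_sub, map_mul]
      simp only [t, map_sub]
      rw [hxe, hone_eval, FreeGroup.mk_toWord]
      simp [inv_mul_cancel₀ hij])
  refine ⟨nullR (Fintype.card (Var d k)) (D₁ * ℓ), hc _ (le_trans (by lia) hDD), ?_⟩
  have hd : (p : ℤ) ∣ a := (CharP.intCast_eq_zero_iff K p a).mp hz
  have h1 : (p : ℤ) ≤ |a| := Int.le_of_dvd (abs_pos.mpr ha0) ((dvd_abs _ _).mpr hd)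
  have := h1.trans hab
  exact_mod_cast this

end LG

namespace LG
open scoped MatrixGroups Pointwise

lemma numeric (D₁ c : ℕ) (hD : 1 ≤ D₁) (hc : 1 ≤ c) : ∃ ε C : ℝ, 0 < ε ∧ 0 < C ∧ ∀ p : ℕ, p.Prime →
    ∀ ℓ R : ℕ, 1 ≤ ℓ → (ℓ : ℝ) ≤ C * Real.log p ^ ε → R ≤ (c * (D₁ * ℓ)) ^ c →
      p ≤ R.factorial * (D₁ ^ ℓ) ^ R → False := by
  have hD' : (1:ℝ) ≤ D₁ := by exact_mod_cast hD
  have hc' : (1:ℝ) ≤ c := by exact_mod_cast hc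
  refine ⟨1 / (2 * c : ℕ), 1 / (4 * c * D₁), by positivity, by positivity, ?_⟩
  intro p hp ℓ R hℓ hℓ2 hR hpR
  have hL : 0 < Real.log p := Real.log_pos (by exact_mod_cast hp.one_lt)
  have hℓ' : (1:ℝ) ≤ ℓ := by exact_mod_cast hℓ
  set X : ℝ := c * (D₁ * ℓ) with hX
  have hR' : (R:ℝ) ≤ X ^ c := by rw [hX]; exact_mod_cast hR
  have hDl : 1 ≤ (D₁:ℝ) * ℓ := one_le_mul_of_one_le_of_one_le hD' hℓ'
  have hXD : (D₁:ℝ) * ℓ ≤ X := le_mul_of_one_le_left (by linarith) hc'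
  have hX1 : 1 ≤ X := hDl.trans hXD
  have h1 : Real.log p ≤ R * R + R * (ℓ * D₁) := by
    have hp0 : (0:ℝ) < p := by exact_mod_cast hp.pos
    have h2 : (p:ℝ) ≤ (R:ℝ) ^ R * ((D₁:ℝ) ^ ℓ) ^ R := by
      have : p ≤ R ^ R * (D₁ ^ ℓ) ^ R := hpR.trans (Nat.mul_le_mul_right _ (Nat.factorial_le_pow R))
      exact_mod_cast this
    have hRR : (R:ℝ) ^ R ≤ Real.exp (R * R) := by
      rw [Real.exp_nat_mul]
      exact pow_le_pow_left₀ (by positivity) (by linarith [Real.add_one_le_exp (R:ℝ)]) _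
    have hDD : ((D₁:ℝ) ^ ℓ) ^ R ≤ Real.exp (R * (ℓ * D₁)) := by
      rw [Real.exp_nat_mul, Real.exp_nat_mul]
      exact pow_le_pow_left₀ (by positivity) (pow_le_pow_left₀ (by positivity)
        (by linarith [Real.add_one_le_exp (D₁:ℝ)]) _) _
    rw [Real.log_le_iff_le_exp hp0, Real.exp_add]
    exact h2.trans (mul_le_mul hRR hDD (by positivity) (by positivity))
  have h2 : Real.log p ≤ 2 * X ^ (2 * c) := by
    have hXc : X ≤ X ^ c := le_self_pow₀ hX1 (by lia)
    have : X ^ (2 * c) = X ^ c * X ^ c := by rw [two_mul, pow_add]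
    have hR0 : (0:ℝ) ≤ R := by positivity
    rw [this]
    have e1 : (R:ℝ) * R ≤ X ^ c * X ^ c := mul_le_mul hR' hR' hR0 (by positivity)
    have e2 : (R:ℝ) * (ℓ * D₁) ≤ X ^ c * X ^ c :=
      mul_le_mul hR' (by linarith [mul_comm (ℓ:ℝ) D₁]) (by positivity) (by positivity)
    linarith
  have h3 : 2 * X ≤ (1 / 2 * (2:ℝ)) * Real.log p ^ (1 / ((2 * c : ℕ) : ℝ)) / 2 * 1 := by
    rw [hX]
    have : (2:ℝ) * (c * (D₁ * ℓ)) ≤ 2 * (c * (D₁ * (1 / (4 * c * D₁) * Real.log p ^ (1 / ((2 * c : ℕ) : ℝ))))) := by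
      gcongr
    refine this.trans (le_of_eq ?_)
    field_simp
    norm_num
  have h4 : (2 * X) ^ (2 * c) ≤ (Real.log p ^ (1 / ((2 * c : ℕ) : ℝ)) / 2) ^ (2 * c) :=
    pow_le_pow_left₀ (by positivity) (by linarith) _
  rw [div_pow, ← Real.rpow_natCast (Real.log p ^ _), ← Real.rpow_mul hL.le, one_div_mul_cancel (by positivity),
    Real.rpow_one, mul_pow] at h4
  have h5 : (4:ℝ) ≤ 2 ^ (2 * c) := by
    calc (4:ℝ) = 2 ^ 2 := by norm_num
      _ ≤ _ := pow_le_pow_right₀ (by norm_num) (by lia)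
  have h6 : Real.log p / 2 ^ (2 * c) ≤ Real.log p / 4 := by gcongr
  nlinarith [pow_pos (by linarith : 0 < X) (2 * c)]

theorem main_of_T0 (hT0 : ∀ d k, T0 d k) :
    ∀ d k : ℕ, 1 ≤ d → 1 ≤ k →
      ∃ N₀ N : ℕ, 1 ≤ N₀ ∧ 1 ≤ N ∧ ∃ ε₀ C : ℝ, 0 < ε₀ ∧ 0 < C ∧
        ∀ (p : ℕ), p.Prime → ∀ (K : Type) [Field K], ∀ _ : CharP K p,
          ∀ F : Set (GL (Fin d) K), F.Finite → F.ncard = k →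
          (∀ H : Subgroup ↥(Subgroup.closure F), IsSolvable ↥H →
            H.index = 0 ∨ N < H.index) →
          ∃ a b : GL (Fin d) K,
            (∃ l : List (GL (Fin d) K), l.length ≤ N₀ ∧ (∀ g ∈ l, g ∈ F ∪ F⁻¹) ∧
              l.prod = a) ∧
            (∃ l : List (GL (Fin d) K), l.length ≤ N₀ ∧ (∀ g ∈ l, g ∈ F ∪ F⁻¹) ∧
              l.prod = b) ∧
            ∀ w : FreeGroup (Fin 2), w ≠ 1 →
              ((FreeGroup.toWord w).length : ℝ) ≤ C * Real.log p ^ ε₀ →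
              FreeGroup.lift (fun i : Fin 2 => if i = 0 then a else b) w ≠ 1 := by
  intro d k hd hk
  obtain ⟨N₀, s, Q, hQ, hT⟩ := hT0 d k
  obtain ⟨D₁, c, hD, hc, hcb⟩ := char_bound d k N₀ s Q hT
  obtain ⟨ε, C, hε, hC, hnum⟩ := numeric D₁ c hD hc
  refine ⟨N₀ + 1, Q.index, by lia, Nat.one_le_iff_ne_zero.mpr hQ, ε, C, hε, hC, ?_⟩
  intro p hp K _ hchar F hF hcard hsol
  by_contra hcon
  push Not at hcon
  have := hF.fintype
  have hc' : Fintype.card F = k := by rw [← hcard, ← Nat.card_coe_set_eq, Nat.card_eq_fintype_card]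
  let e : Fin k ≃ F := (finCongr hc'.symm).trans (Fintype.equivFin F).symm
  let φ : FreeGroup (Fin k) →* GL (Fin d) K := FreeGroup.lift fun i => (e i : GL (Fin d) K)
  have hφ : ∀ g : FreeGroup (Fin k), ∃ l : List (GL (Fin d) K), l.length ≤ g.toWord.length ∧
      (∀ g ∈ l, g ∈ F ∪ F⁻¹) ∧ l.prod = φ g := by
    intro g
    refine ⟨g.toWord.map fun x => cond x.2 (e x.1 : GL (Fin d) K) (e x.1 : GL (Fin d) K)⁻¹, by simp, ?_, ?_⟩
    · intro y hy
      obtain ⟨⟨i, b⟩, hx, rfl⟩ := List.mem_map.mp hy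
      cases b
      · right; simp
      · left; simp
    · conv_rhs => rw [← FreeGroup.mk_toWord (x := g)]
      simp [φ, FreeGroup.lift_mk]
  have hrange : φ.range = Subgroup.closure F := by
    simp only [φ]
    rw [FreeGroup.range_lift_eq_closure]
    congr 1
    ext x; constructor
    · rintro ⟨i, rfl⟩; exact (e i).2
    · intro hx; exact ⟨e.symm ⟨x, hx⟩, by simp⟩
  have hne : ∃ x ∈ (derivedSeries Q s).map Q.subtype, φ x ≠ 1 := by
    by_contra h
    push Not at h
    let φ' : FreeGroup (Fin k) →* ↥(Subgroup.closure F) := φ.codRestrict _ (fun x => by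
      rw [← hrange]; exact ⟨x, rfl⟩)
    have hs' : Function.Surjective φ' := by
      rintro ⟨y, hy⟩
      rw [← hrange] at hy
      obtain ⟨x, rfl⟩ := hy
      exact ⟨x, rfl⟩
    have h1 := solv_of_derived φ' Q s (fun x hx => by
      ext : 1
      exact h x hx)
    have h2 := Subgroup.index_map_dvd Q hs'
    rcases hsol _ h1 with h3 | h3
    · rw [h3] at h2; exact hQ (by simpa using h2)
    · exact absurd (Nat.le_of_dvd (Nat.pos_of_ne_zero hQ) h2) (by lia)
  have hrel : ∀ a b : FreeGroup (Fin k), a.toWord.length ≤ N₀ → b.toWord.length ≤ N₀ →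
        ∃ w : FreeGroup (Fin 2), w ≠ 1 ∧ (w.toWord.length : ℝ) ≤ C * Real.log p ^ ε ∧
          FreeGroup.lift (fun i : Fin 2 => if i = 0 then φ a else φ b) w = 1 := by
    intro a b ha hb
    obtain ⟨la, ha1, ha2, ha3⟩ := hφ a
    obtain ⟨lb, hb1, hb2, hb3⟩ := hφ b
    exact hcon (φ a) (φ b) ⟨la, by lia, ha2, ha3⟩ ⟨lb, by lia, hb2, hb3⟩
  have hX0 : 0 ≤ C * Real.log p ^ ε := by
    have : 0 ≤ Real.log p := Real.log_natCast_nonneg p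
    positivity
  have hℓ : 1 ≤ ⌊C * Real.log p ^ ε⌋₊ := by
    obtain ⟨w, hw1, hw2, -⟩ := hrel 1 1 (by simp) (by simp)
    rw [Nat.one_le_floor_iff]
    refine le_trans ?_ hw2
    have : w.toWord.length ≠ 0 := by
      rw [Ne, List.length_eq_zero_iff, FreeGroup.toWord_eq_nil_iff]; exact hw1
    exact_mod_cast Nat.one_le_iff_ne_zero.mpr this
  obtain ⟨R, hR1, hR2⟩ := hcb p hp K φ _ hℓ hne (by
    intro a b ha hb
    obtain ⟨w, hw1, hw2, hw3⟩ := hrel a b ha hb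
    exact ⟨w, hw1, Nat.le_floor hw2, hw3⟩)
  exact hnum p hp _ R hℓ (Nat.floor_le hX0) hR1 hR2

end LG

namespace LG
open Matrix

/-- inverse letter -/
def linv (x : Fin 2 × Bool) : Fin 2 × Bool := (x.1, !x.2)

lemma abv_dot_le {L : Type*} [Field L] (v : AbsoluteValue L ℝ) {ι : Type*} [Fintype ι] (a b : ι → L)
    (A B : ℝ) (hA : ∀ i, v (a i) ≤ A) (hB : ∀ i, v (b i) ≤ B) :
    v (a ⬝ᵥ b) ≤ Fintype.card ι * (A * B) := by
  refine (v.sum_le _ _).trans ?_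
  rw [← nsmul_eq_mul, ← Finset.card_univ, ← Finset.sum_const]
  refine Finset.sum_le_sum fun i _ => ?_
  rw [map_mul]
  exact mul_le_mul (hA i) (hB i) (v.nonneg _) ((v.nonneg _).trans (hA i))

/-- ping-pong certificate -/
theorem cert {L : Type*} [Field L] (v : AbsoluteValue L ℝ) {ι : Type*} [Fintype ι] [DecidableEq ι]
    (ψ : Fin 2 × Bool → Matrix ι ι L) (c : Fin 2 × Bool → L) (u f : Fin 2 × Bool → ι → L)
    (E : Fin 2 × Bool → Matrix ι ι L) (B ρ δ η K : ℝ) (hρ : 0 < ρ) (hη : 0 < η) (hB : 0 < B) (hK : 0 < K)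
    (hψ : ∀ x, ψ x = c x • (vecMulVec (u x) (f x) + E x))
    (hE : ∀ x i j, v (E x i j) ≤ δ) (hu : ∀ x i, v (u x i) ≤ B) (hf : ∀ x i, v (f x i) ≤ B)
    (hfu : ∀ x y, y ≠ linv x → η ≤ v (f x ⬝ᵥ u y)) (hc : ∀ x, K ≤ v (c x))
    (h1 : Fintype.card ι * (B * ρ) ≤ η / 2)
    (h2 : Fintype.card ι * (δ * (B + ρ)) ≤ ρ * (η / 2))
    (h3 : 1 ≤ K * (η / 2)) (h4 : Fintype.card ι * (B * B) < K * (η / 2) * (η / 2))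
    (l : List (Fin 2 × Bool)) (hl : FreeGroup.IsReduced l) (hne : l ≠ []) :
    (l.map ψ).prod ≠ 1 := by
  have step : ∀ x y : Fin 2 × Bool, y ≠ linv x → ∀ e : ι → L, (∀ i, v (e i) ≤ ρ) →
      η / 2 ≤ v (f x ⬝ᵥ (u y + e)) := by
    intro x y hxy e he
    have e1 := hfu x y hxy
    have e2 : v (f x ⬝ᵥ e) ≤ η / 2 := (abv_dot_le v _ _ B ρ (hf x) he).trans h1
    have e3 : v (f x ⬝ᵥ u y) ≤ v (f x ⬝ᵥ (u y + e)) + v (f x ⬝ᵥ e) := by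
      have : f x ⬝ᵥ u y = f x ⬝ᵥ (u y + e) + -(f x ⬝ᵥ e) := by rw [dotProduct_add]; ring
      rw [this]
      exact (v.add_le _ _).trans (by rw [v.map_neg, dotProduct_add])
    linarith
  have step2 : ∀ x y : Fin 2 × Bool, y ≠ linv x → ∀ e : ι → L, (∀ i, v (e i) ≤ ρ) →
      ∃ (t : L) (e' : ι → L), (∀ i, v (e' i) ≤ ρ) ∧ K * (η / 2) ≤ v t ∧
        ψ x *ᵥ (u y + e) = t • (u x + e') := by
    intro x y hxy e he
    have hs := step x y hxy e he
    set s := f x ⬝ᵥ (u y + e) with hsdef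
    have hs0 : s ≠ 0 := by
      intro h; rw [h, map_zero] at hs; linarith
    refine ⟨c x * s, s⁻¹ • (E x *ᵥ (u y + e)), ?_, ?_, ?_⟩
    · intro i
      have : v ((E x *ᵥ (u y + e)) i) ≤ ρ * (η / 2) := by
        refine (abv_dot_le v _ _ δ (B + ρ) (hE x i) ?_).trans h2
        intro j
        exact (v.add_le _ _).trans (add_le_add (hu _ _) (he _))
      rw [Pi.smul_apply, smul_eq_mul, map_mul, map_inv₀, inv_mul_le_iff₀ (by linarith)]
      nlinarith
    · rw [map_mul]
      exact mul_le_mul (hc x) hs (by positivity) (v.nonneg _)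
    · rw [hψ, smul_mulVec, add_mulVec, vecMulVec_mulVec, ← hsdef]
      ext i
      simp
      field_simp
  have key : ∀ l : List (Fin 2 × Bool), ∀ x, FreeGroup.IsReduced (x :: l) → ∃ (y : Fin 2 × Bool) (t : L) (e' : ι → L),
      (∀ i, v (e' i) ≤ ρ) ∧ K * (η / 2) ≤ v t ∧ ((x :: l).map ψ).prod *ᵥ (u y) = t • (u x + e') := by
    intro l
    induction l with
    | nil =>
      intro x _
      obtain ⟨t, e', h1, h2, h3⟩ := step2 x x (by
        intro h; have := congrArg Prod.snd h; simp [linv] at this) 0 (by simp [hρ.le])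
      refine ⟨x, t, e', h1, h2, ?_⟩
      simpa using h3
    | cons z l ih =>
      intro x hx
      rw [FreeGroup.isReduced_cons_cons] at hx
      obtain ⟨y, t, e, h1, h2, h3⟩ := ih z hx.2
      obtain ⟨t', e', h1', h2', h3'⟩ := step2 x z (by
        intro h
        rw [h] at hx
        simp [linv] at hx) e h1
      refine ⟨y, t * t', e', h1', ?_, ?_⟩
      · rw [map_mul]
        nlinarith
      · rw [List.map_cons, List.prod_cons, ← mulVec_mulVec, h3, mulVec_smul, h3', smul_smul]
  obtain ⟨x, l', rfl⟩ := List.exists_cons_of_ne_nil hne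
  intro hone
  obtain ⟨y, t, e, he, ht, h⟩ := key l' x hl
  rw [hone, one_mulVec] at h
  have e1 := abv_dot_le v _ _ B B (hf x) (hu y)
  rw [h, dotProduct_smul, smul_eq_mul, map_mul] at e1
  have e2 := step x x (by
        intro h; have := congrArg Prod.snd h; simp [linv] at this) e he
  have : K * (η / 2) * (η / 2) ≤ v t * v (f x ⬝ᵥ (u x + e)) := mul_le_mul ht e2 (by positivity) (v.nonneg _)
  linarith

end LG

namespace LG
open Matrix Filter Topology

lemma real_rec (x y : ℕ → ℝ) (q : ℝ) (hq0 : 0 ≤ q) (hq : q < 1) (hx : ∀ n, 0 ≤ x n)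
    (h : ∀ n, x (n+1) ≤ q * x n + y n) (hy : Tendsto y atTop (𝓝 0)) : Tendsto x atTop (𝓝 0) := by
  rw [Metric.tendsto_atTop]
  intro ε hε
  obtain ⟨N, hN⟩ := (Metric.tendsto_atTop.mp hy) (ε / 2 * (1 - q)) (mul_pos (by linarith) (by linarith))
  have hb : ∀ j, x (N + j) ≤ q ^ j * x N + ε / 2 := by
    intro j
    induction j with
    | zero => simp; linarith
    | succ j ih =>
      have e1 := h (N + j)
      have e2 := hN (N + j) (by lia)
      rw [Real.dist_eq, sub_zero] at e2
      have e3 := (abs_lt.mp e2).2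
      have : x (N + (j+1)) ≤ q * (q ^ j * x N + ε / 2) + ε / 2 * (1 - q) := by
        have := mul_le_mul_of_nonneg_left ih hq0
        calc x (N + (j+1)) = x (N + j + 1) := by congr 1
          _ ≤ _ := by linarith
      calc _ ≤ _ := this
        _ = _ := by ring
  have ht : Tendsto (fun j => q ^ j * x N) atTop (𝓝 (0 * x N)) :=
    (tendsto_pow_atTop_nhds_zero_of_lt_one hq0 hq).mul_const _
  rw [zero_mul] at ht
  obtain ⟨J, hJ⟩ := (Metric.tendsto_atTop.mp ht) (ε / 2) (by linarith)
  refine ⟨N + J, fun n hn => ?_⟩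
  obtain ⟨j, rfl⟩ : ∃ j, n = N + j := ⟨n - N, by lia⟩
  have e1 := hb j
  have e2 := hJ j (by lia)
  rw [Real.dist_eq, sub_zero] at e2 ⊢
  rw [abs_of_nonneg (hx _)]
  linarith [(abs_lt.mp e2).2]

variable {k : Type*} [NormedField k] {ι : Type*} [Fintype ι] [DecidableEq ι]

lemma mat_tendsto {κ α : Type*} {F : α → Matrix ι κ k} {l : Filter α} {A : Matrix ι κ k} :
    Tendsto F l (𝓝 A) ↔ ∀ i j, Tendsto (fun x => F x i j) l (𝓝 (A i j)) := by
  constructor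
  · intro h i j
    exact (tendsto_pi_nhds.mp ((tendsto_pi_nhds.mp h) i)) j
  · intro h
    exact tendsto_pi_nhds.mpr fun i => tendsto_pi_nhds.mpr fun j => h i j

lemma pow_tendsto (M : Matrix ι ι k) : ∀ (μs : List k) (W : Matrix ι ι k),
    (∀ μ ∈ μs, ‖μ‖ < 1) → (μs.map fun μ => M - scalar ι μ).prod * W = 0 →
    Tendsto (fun N : ℕ => M ^ N * W) atTop (𝓝 0) := by
  intro μs
  induction μs with
  | nil => intro W _ h; simp at h; simp [h]
  | cons μ μs ih =>
    intro W hμ h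
    have hcomm : ∀ ν : List k, Commute M (ν.map fun μ => M - scalar ι μ).prod := by
      intro ν
      refine Commute.list_prod_right _ _ ?_
      intro y hy
      obtain ⟨z, -, rfl⟩ := List.mem_map.mp hy
      exact (Commute.refl M).sub_right (scalar_commute z (fun r => Commute.all _ _) M).symm
    have h1 := ih ((M - scalar ι μ) * W) (fun ν hν => hμ ν (by simp [hν])) (by
      rw [List.map_cons, List.prod_cons] at h
      rw [← mul_assoc]
      rw [← h]
      congr 1
      exact (((hcomm μs).sub_left (scalar_commute μ (fun r => Commute.all _ _) _)).eq).symm)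
    rw [mat_tendsto]
    intro i j
    have h2 : Tendsto (fun N => (M ^ N * ((M - scalar ι μ) * W)) i j) atTop (𝓝 0) :=
      mat_tendsto.mp h1 i j
    rw [tendsto_zero_iff_norm_tendsto_zero] at h2
    change Tendsto (fun N => (M ^ N * W) i j) atTop (𝓝 0)
    rw [tendsto_zero_iff_norm_tendsto_zero]
    refine real_rec _ _ ‖μ‖ (norm_nonneg _) (hμ μ (by simp)) (fun n => norm_nonneg _) ?_ h2
    intro n
    have : M ^ (n+1) * W = scalar ι μ * (M ^ n * W) + M ^ n * ((M - scalar ι μ) * W) := by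
      have hs := (scalar_commute μ (fun r => Commute.all _ _) (M ^ n)).eq
      rw [← mul_assoc (scalar ι μ), hs, pow_succ]; noncomm_ring
    rw [this, ← norm_mul]
    refine (norm_add_le _ _).trans (le_of_eq ?_)
    simp [scalar_apply]

/-- the expansion functional -/
def Fe (e g : Matrix ι ι k) : k := (1 - e + e * g * e).det

set_option maxHeartbeats 2000000 in
lemma Fe_limit (e h hi : Matrix ι ι k) (σ : k) (hσ : σ ≠ 0) (he : e * e = e) (hh : h * hi = 1)
    (hc : e * h = h * e)
    (h1 : Tendsto (fun N : ℕ => (σ⁻¹ • h) ^ N * (1 - e)) atTop (𝓝 0))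
    (h2 : Tendsto (fun N : ℕ => (σ • hi) ^ N * e) atTop (𝓝 0)) (g' g : Matrix ι ι k) :
    Fe e h ≠ 0 ∧ Tendsto (fun N : ℕ => (Fe e h)⁻¹ ^ N * Fe e (g' * h ^ N * g)) atTop (𝓝 (Fe e g' * Fe e g)) := by
  have hhi : hi * h = 1 := mul_eq_one_comm.mp hh
  have hci : e * hi = hi * e := by
    calc e * hi = hi * h * (e * hi) := by rw [hhi, one_mul]
      _ = hi * (h * e) * hi := by noncomm_ring
      _ = hi * e * (h * hi) := by rw [← hc]; noncomm_ring
      _ = _ := by rw [hh, mul_one]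
  obtain ⟨s, hs⟩ : ∃ s : Matrix ι ι k, s = σ⁻¹ • h := ⟨_, rfl⟩
  obtain ⟨si, hsi⟩ : ∃ s : Matrix ι ι k, s = σ • hi := ⟨_, rfl⟩
  rw [← hs] at h1
  rw [← hsi] at h2
  have hss : s * si = 1 := by rw [hs, hsi, smul_mul_smul_comm, inv_mul_cancel₀ hσ, hh, one_smul]
  have hsis : si * s = 1 := mul_eq_one_comm.mp hss
  have hcs : e * s = s * e := by simp [hs, hc]
  have hcsi : e * si = si * e := by simp [hsi, hci]
  have hssN : ∀ N, s ^ N * si ^ N = 1 := fun N => by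
    rw [← (show Commute s si from hss.trans hsis.symm).mul_pow, hss, one_pow]
  have hcsN : ∀ N, e * s ^ N = s ^ N * e := fun N => (Commute.pow_right (show Commute e s from hcs) N).eq
  have hcsiN : ∀ N, e * si ^ N = si ^ N * e :=
    fun N => (Commute.pow_right (show Commute e si from hcsi) N).eq
  obtain ⟨D, hD⟩ : ∃ D : ℕ → Matrix ι ι k, D = fun N => 1 - e + si ^ N * e := ⟨_, rfl⟩
  have he' : e * (1 - e) = 0 := by rw [mul_sub, he]; simp
  have he'' : (1 - e) * e = 0 := by rw [sub_mul, he]; simp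
  have heA : ∀ A : Matrix ι ι k, e * (e * A) = e * A := fun A => by rw [← mul_assoc, he]
  have hDinv : ∀ N, D N * (1 - e + s ^ N * e) = 1 := by
    intro N
    have e1 : D N * (1 - e + s ^ N * e) = (1 - e) * (1 - e) + (s ^ N * e - e * s ^ N * e) +
        si ^ N * (e * (1 - e)) + si ^ N * (e * s ^ N) * e := by
      simp only [hD]; noncomm_ring
    have hsiN : si ^ N * s ^ N = 1 := by
      rw [← (show Commute si s from hsis.trans hss.symm).mul_pow, hsis, one_pow]
    rw [e1, he', hcsN, mul_assoc (s ^ N) e e, he, ← mul_assoc (si ^ N), hsiN, one_mul, he]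
    have : (1 - e) * (1 - e) = 1 - e := by rw [mul_sub, he'']; simp
    rw [this]; simp
  have hDlim : Tendsto D atTop (𝓝 (1 - e)) := by
    have := (tendsto_const_nhds (x := 1 - e)).add h2
    rw [add_zero] at this
    rw [hD]; exact this
  -- block
  obtain ⟨X, hX⟩ : ∃ X, X = 1 - e + e * g' * e := ⟨_, rfl⟩
  obtain ⟨Y, hY⟩ : ∃ X, X = 1 - e + e * g * e := ⟨_, rfl⟩
  obtain ⟨Z, hZ⟩ : ∃ Z : ℕ → Matrix ι ι k, Z = fun N => e * g' * (s ^ N * (1 - e)) * (g * e) := ⟨_, rfl⟩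
  have hZlim : Tendsto Z atTop (𝓝 0) := by
    have := ((tendsto_const_nhds (x := e * g')).mul h1).mul (tendsto_const_nhds (x := g * e))
    rw [hZ]; simpa using this
  have hblk : Tendsto (fun N => (fromBlocks (D N) (-Y) X (Z N)).det) atTop
      (𝓝 (fromBlocks (1 - e) (-Y) X 0).det) := by
    have hcont : Continuous fun p : Matrix ι ι k × Matrix ι ι k => (fromBlocks p.1 (-Y) X p.2).det :=
      (Continuous.matrix_fromBlocks continuous_fst continuous_const continuous_const
        continuous_snd).matrix_det
    exact (hcont.tendsto (1 - e, 0)).comp (hDlim.prodMk_nhds hZlim)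
  have hblk0 : (fromBlocks (1 - e) (-Y) X 0).det = X.det * Y.det := by
    have e1 : (fromBlocks (1 - e) (-Y) X (0 : Matrix ι ι k)) =
        fromBlocks Y (1 - e) 0 X * fromBlocks 0 (-1) 1 0 := by
      rw [fromBlocks_multiply]; simp
    have e2 : (fromBlocks (0 : Matrix ι ι k) (-1) 1 (0 : Matrix ι ι k)).det = 1 := by
      have e3 : (fromBlocks (0 : Matrix ι ι k) (-1) 1 (0 : Matrix ι ι k)) =
          fromBlocks 1 (-1) 0 1 * fromBlocks 1 0 1 1 * fromBlocks 1 (-1) 0 1 := by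
        rw [fromBlocks_multiply, fromBlocks_multiply]; simp
      rw [e3, det_mul, det_mul, det_fromBlocks_zero₂₁, det_fromBlocks_zero₁₂]; simp
    rw [e1, det_mul, e2, det_fromBlocks_zero₂₁]; ring
  have hblkN : ∀ N, (fromBlocks (D N) (-Y) X (Z N)).det = (D N).det *
      (1 - e + e * (g' * s ^ N * g) * e).det := by
    intro N
    letI : Invertible (D N) := ⟨1 - e + s ^ N * e, mul_eq_one_comm.mp (hDinv N), hDinv N⟩
    rw [det_fromBlocks₁₁]
    congr 2
    change Z N - X * (1 - e + s ^ N * e) * (-Y) = _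
    have a1 : (1 - e + e * g' * e) * (1 - e + s ^ N * e) = 1 - e + e * g' * s ^ N * e := by
      have : (1 - e + e * g' * e) * (1 - e + s ^ N * e) = (1 - e) - e * (1 - e) + (s ^ N * e - e * s ^ N * e) +
        e * g' * (e * (1 - e)) + e * g' * (e * s ^ N * e) := by noncomm_ring
      rw [this, he', hcsN, mul_assoc (s ^ N) e e, he]; noncomm_ring
    have a2 : (1 - e + e * g' * s ^ N * e) * (1 - e + e * g * e) = 1 - e + e * g' * s ^ N * e * g * e := by
      have : (1 - e + e * g' * s ^ N * e) * (1 - e + e * g * e) = (1 - e) - (1 - e) * e + ((1 - e) * e) * g * e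
        + e * g' * s ^ N * (e * (1 - e)) + e * g' * s ^ N * (e * e) * g * e := by noncomm_ring
      rw [this, he', he'', he]; noncomm_ring
    rw [mul_neg, hX, hY, a1, a2]
    simp only [hZ]
    noncomm_ring
  -- scaling
  obtain ⟨S, hS⟩ : ∃ S : Matrix ι ι k, S = 1 - e + σ • e := ⟨_, rfl⟩
  have hSpow : ∀ N, S ^ N = 1 - e + σ ^ N • e := by
    intro N
    induction N with
    | zero => simp
    | succ N ih =>
      rw [pow_succ, ih, hS]
      simp only [mul_add, add_mul, mul_sub, sub_mul, smul_mul_assoc, mul_smul_comm, he, mul_one, one_mul, pow_succ, smul_smul]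
      module
  have hScale : ∀ N (A B : Matrix ι ι k), Fe e (A * h ^ N * B) = S.det ^ N *
      (1 - e + e * (A * s ^ N * B) * e).det := by
    intro N A B
    rw [← det_pow, hSpow, ← det_mul, Fe]
    congr 1
    have e1 : (1 - e + σ ^ N • e) * (1 - e + e * (A * s ^ N * B) * e) =
        (1 - e) - e * (1 - e) + ((1 - e) * e) * (A * s ^ N * B) * e + σ ^ N • (e * (1 - e)) +
          σ ^ N • ((e * e) * (A * s ^ N * B) * e) := by
      simp only [mul_add, add_mul, mul_sub, sub_mul, smul_mul_assoc, mul_one, one_mul, smul_sub, mul_assoc]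
      abel
    rw [e1, he', he'', he]
    have e2 : s ^ N = (σ ^ N)⁻¹ • h ^ N := by rw [hs, smul_pow, inv_pow]
    rw [e2]
    simp [smul_smul, hσ]
  have hFD : ∀ N, Fe e h ^ N * (D N).det = S.det ^ N := by
    intro N
    have e1 : Fe e h = S.det * (1 - e + s * e).det := by
      have := hScale 1 1 1
      simp only [pow_one, one_mul, mul_one] at this
      rw [this, hcs, mul_assoc, he]
    have e2 : (1 - e + s * e) ^ N = 1 - e + s ^ N * e := by
      induction N with
      | zero => simp
      | succ N ih =>
        rw [pow_succ, ih]
        have : (1 - e + s ^ N * e) * (1 - e + s * e) = (1 - e) - e * (1 - e) + (s * e - e * s * e) +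
          s ^ N * (e * (1 - e)) + s ^ N * (e * s) * e := by noncomm_ring
        rw [this, he', hcs, mul_assoc s e e, he, pow_succ, ← mul_assoc (s ^ N), mul_assoc (s ^ N * s) e e, he]
        noncomm_ring
    rw [e1, mul_pow, ← det_pow (1 - e + s * e), e2, mul_assoc, ← det_mul, mul_eq_one_comm.mp (hDinv N)]
    simp
  have hS0 : S.det ≠ 0 := by
    have : S * (1 - e + σ⁻¹ • e) = 1 := by
      rw [hS]
      simp only [mul_add, add_mul, mul_sub, sub_mul, smul_mul_assoc, mul_smul_comm, he, mul_one, one_mul, smul_add, smul_sub, smul_smul, inv_mul_cancel₀ hσ]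
      module
    intro h0
    have h3 := congrArg det this
    rw [det_mul, h0] at h3; simp at h3
  have hF0 : Fe e h ≠ 0 := by
    intro h0
    have := hFD 1
    simp [h0] at this
    exact hS0 this.symm
  rw [hblk0] at hblk
  have hfin : Fe e g' * Fe e g = X.det * Y.det := by rw [hX, hY]; rfl
  rw [hfin]
  refine ⟨hF0, ?_⟩
  refine hblk.congr fun N => ?_
  rw [hblkN, hScale, ← hFD N]
  rw [inv_pow]
  field_simp

lemma Fe_gt_one (e h hi : Matrix ι ι k) (he : e * e = e) (he0 : e ≠ 0) (hh : h * hi = 1)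
    (hc : e * h = h * e) (h2 : Tendsto (fun N : ℕ => hi ^ N * e) atTop (𝓝 0)) : 1 < ‖Fe e h‖ := by
  have hhi : hi * h = 1 := mul_eq_one_comm.mp hh
  have hci : e * hi = hi * e := by
    calc e * hi = hi * h * (e * hi) := by rw [hhi, one_mul]
      _ = hi * (h * e) * hi := by noncomm_ring
      _ = hi * e * (h * hi) := by rw [← hc]; noncomm_ring
      _ = _ := by rw [hh, mul_one]
  have he' : e * (1 - e) = 0 := by rw [mul_sub, he]; simp
  have hp : ∀ N, (1 - e + hi * e) ^ N = 1 - e + hi ^ N * e := by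
    intro N
    induction N with
    | zero => simp
    | succ N ih =>
      rw [pow_succ, ih]
      have : (1 - e + hi ^ N * e) * (1 - e + hi * e) = (1 - e) - e * (1 - e) + (hi * e - e * hi * e) +
        hi ^ N * (e * (1 - e)) + hi ^ N * (e * hi) * e := by noncomm_ring
      rw [this, he', hci, mul_assoc hi e e, he, pow_succ, ← mul_assoc (hi ^ N), mul_assoc (hi ^ N * hi) e e, he]
      noncomm_ring
  have hprod : Fe e h * (1 - e + hi * e).det = 1 := by
    rw [Fe, ← det_mul]
    have : (1 - e + e * h * e) * (1 - e + hi * e) = (1 - e) - e * (1 - e) + (hi * e - e * hi * e) +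
        e * h * (e * (1 - e)) + e * h * (e * hi) * e := by noncomm_ring
    rw [this, he', hci, mul_assoc hi e e, he, ← mul_assoc (e * h), mul_assoc e h hi, hh, mul_one, he, he]
    simp
  have hlim : Tendsto (fun N : ℕ => (1 - e + hi * e).det ^ N) atTop (𝓝 0) := by
    have h3 : Tendsto (fun N : ℕ => 1 - e + hi ^ N * e) atTop (𝓝 (1 - e)) := by
      simpa using (tendsto_const_nhds (x := 1 - e)).add h2
    have h4 : (1 - e).det = 0 := by
      by_contra h0
      have : IsUnit (1 - e).det := isUnit_iff_ne_zero.mpr h0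
      apply he0
      have h5 := congrArg (· * (1 - e)⁻¹) he'
      simpa [mul_assoc, mul_nonsing_inv _ this] using h5
    have h5 := ((continuous_id.matrix_det (R := k) (n := ι)).tendsto (1 - e)).comp h3
    simp only [id, h4] at h5
    refine h5.congr fun N => ?_
    simp [← hp, det_pow]
  have hlt : ‖(1 - e + hi * e).det‖ < 1 := by
    by_contra hge
    push Not at hge
    have h6 : Tendsto (fun N : ℕ => ‖(1 - e + hi * e).det ^ N‖) atTop (𝓝 0) := by
      simpa using hlim.norm
    have := ge_of_tendsto h6 (b := 1) (Eventually.of_forall fun N => by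
      rw [norm_pow]; exact one_le_pow₀ hge)
    linarith
  have h7 := congrArg norm hprod
  rw [norm_mul, norm_one] at h7
  by_contra h8
  push Not at h8
  nlinarith [norm_nonneg (Fe e h), norm_nonneg (1 - e + hi * e).det]

end LG

namespace LG
open Matrix Filter Topology Polynomial

lemma list_prod_factor {R α : Type*} [Monoid R] (f q g : α → R) (hf : ∀ ν, f ν = q ν * g ν)
    (hc : ∀ μ ν, Commute (q μ) (g ν)) (l : List α) :
    ∃ Q, (∀ Z, (∀ ν, Commute (q ν) Z) → Commute Q Z) ∧ (l.map f).prod = Q * (l.map g).prod := by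
  induction l with
  | nil => exact ⟨1, fun Z _ => Commute.one_left Z, by simp⟩
  | cons a l ih =>
    obtain ⟨Q, h1, h2⟩ := ih
    refine ⟨q a * Q, fun Z hZ => (hZ a).mul_left (h1 Z hZ), ?_⟩
    simp only [List.map_cons, List.prod_cons, hf, h2]
    have := (h1 (g a) fun ν => hc ν a).eq
    rw [mul_assoc, ← mul_assoc (g a), ← this]
    simp only [mul_assoc]

lemma coprime_list {R : Type*} [CommRing R] (p : R) (l : List R) (h : ∀ q ∈ l, IsCoprime p q) :
    IsCoprime p l.prod := by
  induction l with
  | nil => simpa using isCoprime_one_right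
  | cons a l ih =>
    rw [List.prod_cons]
    exact (h a (by simp)).mul_right (ih fun q hq => h q (by simp [hq]))

variable {k : Type*} [NormedField k] {ι : Type*} [Fintype ι] [DecidableEq ι]

lemma sc_comm (h : Matrix ι ι k) (ν : k) : Commute (scalar ι ν) h :=
  scalar_commute ν (fun r => Commute.all _ _) h

lemma aeval_list (h : Matrix ι ι k) (l : List k) :
    aeval h (l.map fun a => (X - C a)).prod = (l.map fun ν => h - scalar ι ν).prod := by
  rw [map_list_prod, List.map_map]
  congr 2
  ext1 a
  simp
  rfl

lemma exists_proj [IsAlgClosed k] (h hi : Matrix ι ι k) (hh : h * hi = 1) (ν : k) (hν : h.charpoly.IsRoot ν)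
    (hν1 : 1 < ‖ν‖) : ∃ (e : Matrix ι ι k) (σ : k), σ ≠ 0 ∧ e * e = e ∧ e ≠ 0 ∧ e * h = h * e ∧
      Tendsto (fun N : ℕ => (σ⁻¹ • h) ^ N * (1 - e)) atTop (𝓝 0) ∧
      Tendsto (fun N : ℕ => (σ • hi) ^ N * e) atTop (𝓝 0) ∧
      Tendsto (fun N : ℕ => hi ^ N * e) atTop (𝓝 0) := by
  classical
  have hhi : hi * h = 1 := mul_eq_one_comm.mp hh
  have hmon := h.charpoly_monic
  have hne := hmon.ne_zero
  obtain ⟨ν₀, hν₀, hmin⟩ := Finset.exists_min_image (h.charpoly.roots.toFinset.filter fun a => 1 < ‖a‖)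
    (fun a => ‖a‖) ⟨ν, by simp [hν1, hne]; exact hν⟩
  simp only [Finset.mem_filter, Multiset.mem_toFinset] at hν₀ hmin
  obtain ⟨σ, hσ⟩ := IsAlgClosed.exists_pow_nat_eq ν₀ (n := 2) (by norm_num)
  have hσn : ‖σ‖ ^ 2 = ‖ν₀‖ := by rw [← norm_pow, hσ]
  have hσ1 : 1 < ‖σ‖ := by
    by_contra h0
    push Not at h0
    nlinarith [norm_nonneg σ, hν₀.2]
  have hσ2 : ‖σ‖ < ‖ν₀‖ := by nlinarith
  have hσ0 : σ ≠ 0 := by intro h0; rw [h0, norm_zero] at hσ1; linarith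
  set R := h.charpoly.roots.toList with hR
  set lp := R.filter (fun a => 1 < ‖a‖) with hlp
  set lm := R.filter (fun a => ¬ 1 < ‖a‖) with hlm
  have hlp' : ∀ a ∈ lp, ‖σ‖ < ‖a‖ ∧ 1 < ‖a‖ := by
    intro a ha
    rw [hlp, List.mem_filter] at ha
    simp only [decide_eq_true_eq] at ha
    exact ⟨hσ2.trans_le (hmin a ⟨by simpa [hR] using ha.1, ha.2⟩), ha.2⟩
  have hlm' : ∀ a ∈ lm, ‖a‖ ≤ 1 := by
    intro a ha
    rw [hlm, List.mem_filter] at ha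
    simpa using ha.2
  set Pp : k[X] := (lp.map fun a => (X - C a)).prod with hPp
  set Pm : k[X] := (lm.map fun a => (X - C a)).prod with hPm
  have hchar : Pp * Pm = h.charpoly := by
    have h1 := (IsAlgClosed.splits h.charpoly).eq_prod_roots_of_monic hmon
    have h2 : (h.charpoly.roots.map fun a => (X - C a)).prod = (R.map fun a => (X - C a)).prod := by
      conv_lhs => rw [← Multiset.coe_toList h.charpoly.roots]
      rw [Multiset.map_coe, Multiset.prod_coe]
    rw [h1, h2, hPp, hPm, ← List.prod_append, ← List.map_append]
    apply List.Perm.prod_eq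
    apply List.Perm.map
    rw [hlp, hlm]
    have := List.filter_append_perm (fun a : k => decide (1 < ‖a‖)) R
    refine (List.Perm.of_eq ?_).trans this
    congr 2
    ext a; exact decide_not
  have hcop1 : ∀ a, 1 < ‖a‖ → IsCoprime (X - C a) Pm := by
    intro a ha
    rw [hPm]
    refine coprime_list _ _ ?_
    intro q hq
    obtain ⟨b, hb, rfl⟩ := List.mem_map.mp hq
    apply isCoprime_X_sub_C_of_isUnit_sub
    rw [isUnit_iff_ne_zero, sub_ne_zero]
    rintro rfl
    linarith [hlm' _ hb]
  have hcop : IsCoprime Pp Pm := by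
    rw [hPp]
    refine (coprime_list _ _ ?_).symm
    intro q hq
    obtain ⟨b, hb, rfl⟩ := List.mem_map.mp hq
    exact (hcop1 b (hlp' b hb).2).symm
  obtain ⟨a, b, hab⟩ := hcop
  set e := aeval h (b * Pm) with he
  have h1e : 1 - e = aeval h (a * Pp) := by
    rw [he, ← map_one (aeval (R := k) h), ← map_sub, ← hab]; congr 1; ring
  have hCH : aeval h h.charpoly = 0 := Matrix.aeval_self_charpoly h
  have hPpe : aeval h Pp * e = 0 := by
    rw [he, ← map_mul, show Pp * (b * Pm) = b * (Pp * Pm) by ring, hchar, map_mul, hCH, mul_zero]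
  have hPme : aeval h Pm * (1 - e) = 0 := by
    rw [h1e, ← map_mul, show Pm * (a * Pp) = a * (Pp * Pm) by ring, hchar, map_mul, hCH, mul_zero]
  have hee : (1 - e) * e = 0 := by
    rw [h1e, map_mul, mul_assoc, hPpe, mul_zero]
  have hec : e * h = h * e := by
    have : aeval h (b * Pm * X) = aeval h (X * (b * Pm)) := by rw [mul_comm]
    rw [map_mul _ (b * Pm), map_mul _ X, aeval_X] at this
    exact this
  have hci : Commute hi h := hhi.trans hh.symm
  refine ⟨e, σ, hσ0, ?_, ?_, hec, ?_, ?_, ?_⟩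
  · rw [sub_mul, one_mul, sub_eq_zero] at hee; exact hee.symm
  · intro h0
    rw [h0, sub_zero, mul_one] at hPme
    obtain ⟨u, w, huw⟩ := hcop1 ν hν1
    have h3 := congrArg (aeval h) huw
    rw [map_add, map_mul, map_mul, hPme, mul_zero, add_zero, map_one] at h3
    have h4 := congrArg det h3
    rw [det_mul, det_one] at h4
    have h5 : (aeval h (X - C ν)).det = 0 := by
      have h6 := hν
      rw [IsRoot, eval_charpoly] at h6
      have h7 : aeval h (X - C ν) = -(scalar ι ν - h) := by
        simp; rfl
      rw [h7, det_neg, h6, mul_zero]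
    rw [h5, mul_zero] at h4
    exact zero_ne_one h4
  · refine pow_tendsto _ (lm.map fun ν => σ⁻¹ * ν) _ ?_ ?_
    · intro μ hμ
      obtain ⟨c, hc, rfl⟩ := List.mem_map.mp hμ
      rw [norm_mul, norm_inv, inv_mul_lt_iff₀ (by linarith)]
      linarith [hlm' _ hc]
    · rw [List.map_map]
      obtain ⟨Q, -, hQ⟩ := list_prod_factor (fun ν => σ⁻¹ • h - scalar ι (σ⁻¹ * ν)) (fun _ => scalar ι σ⁻¹)
        (fun ν => h - scalar ι ν) (fun ν => by
          rw [mul_sub, map_mul]; congr 1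
          rw [scalar_apply, ← smul_eq_diagonal_mul])
        (fun μ ν => sc_comm _ _) lm
      change (lm.map fun ν => σ⁻¹ • h - scalar ι (σ⁻¹ * ν)).prod * _ = 0
      rw [hQ, mul_assoc, ← aeval_list, hPme, mul_zero]
  · refine pow_tendsto _ (lp.map fun ν => σ * ν⁻¹) _ ?_ ?_
    · intro μ hμ
      obtain ⟨c, hc, rfl⟩ := List.mem_map.mp hμ
      rw [norm_mul, norm_inv, mul_inv_lt_iff₀ (by linarith [(hlp' _ hc).2])]
      linarith [hlp' _ hc]
    · rw [List.map_map]
      have e0 : lp.map ((fun μ => σ • hi - scalar ι μ) ∘ fun ν => σ * ν⁻¹) = 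
          lp.map fun ν => (- scalar ι (σ * ν⁻¹) * hi) * (h - scalar ι ν) := by
        refine List.map_congr_left ?_
        intro ν hν
        have hν0 : ν ≠ 0 := by
          rintro rfl; have := (hlp' _ hν).2; rw [norm_zero] at this; linarith
        have e1 : scalar ι (σ * ν⁻¹) * hi * scalar ι ν = σ • hi := by
          rw [mul_assoc, ← (sc_comm hi ν).eq, ← mul_assoc, ← map_mul, mul_assoc, inv_mul_cancel₀ hν0, mul_one,
            scalar_apply, ← smul_eq_diagonal_mul]
        simp only [Function.comp]
        rw [neg_mul, neg_mul, mul_sub, e1, mul_assoc, hhi, mul_one, neg_sub]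
      rw [e0]
      obtain ⟨Q, -, hQ⟩ := list_prod_factor (fun ν => (- scalar ι (σ * ν⁻¹) * hi) * (h - scalar ι ν))
        (fun ν => - scalar ι (σ * ν⁻¹) * hi) (fun ν => h - scalar ι ν) (fun ν => rfl)
        (fun μ ν => ((sc_comm (h - scalar ι ν) _).neg_left).mul_left (hci.sub_right (sc_comm _ _).symm)) lp
      rw [hQ, mul_assoc, ← aeval_list, hPpe, mul_zero]
  · refine pow_tendsto _ (lp.map fun ν => ν⁻¹) _ ?_ ?_
    · intro μ hμ
      obtain ⟨c, hc, rfl⟩ := List.mem_map.mp hμ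
      rw [norm_inv]
      exact inv_lt_one_of_one_lt₀ (hlp' _ hc).2
    · rw [List.map_map]
      have e0 : lp.map ((fun μ => hi - scalar ι μ) ∘ fun ν => ν⁻¹) = 
          lp.map fun ν => (- scalar ι (ν⁻¹) * hi) * (h - scalar ι ν) := by
        refine List.map_congr_left ?_
        intro ν hν
        have hν0 : ν ≠ 0 := by
          rintro rfl; have := (hlp' _ hν).2; rw [norm_zero] at this; linarith
        have e1 : scalar ι (ν⁻¹) * hi * scalar ι ν = hi := by
          rw [mul_assoc, ← (sc_comm hi ν).eq, ← mul_assoc, ← map_mul, inv_mul_cancel₀ hν0, map_one, one_mul]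
        simp only [Function.comp]
        rw [neg_mul, neg_mul, mul_sub, e1, mul_assoc, hhi, mul_one, neg_sub]
      rw [e0]
      obtain ⟨Q, -, hQ⟩ := list_prod_factor (fun ν => (- scalar ι (ν⁻¹) * hi) * (h - scalar ι ν))
        (fun ν => - scalar ι (ν⁻¹) * hi) (fun ν => h - scalar ι ν) (fun ν => rfl)
        (fun μ ν => ((sc_comm (h - scalar ι ν) _).neg_left).mul_left (hci.sub_right (sc_comm _ _).symm)) lp
      rw [hQ, mul_assoc, ← aeval_list, hPpe, mul_zero]

end LG

namespace LG
open Matrix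

section
variable {R : Type*} [CommRing R] {κ lam : Type*} [Fintype κ] [DecidableEq κ] [Fintype lam] [DecidableEq lam]

lemma det_mul_expand (P : Matrix κ lam R) (M : Matrix lam κ R) :
    (P * M).det = ∑ a : κ → lam, (∏ i, P i (a i)) * (M.submatrix a id).det := by
  have h1 : (P * M).det = detRowAlternating (fun i => ∑ j, P i j • M j) := by
    change det _ = det _
    congr 1
    ext i j
    simp [mul_apply, Finset.sum_apply]
  rw [h1]
  have h2 := (detRowAlternating (R := R) (n := κ)).toMultilinearMap.map_sum (fun i j => P i j • M j)
  refine h2.trans (Finset.sum_congr rfl fun a _ => ?_)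
  have h3 := (detRowAlternating (R := R) (n := κ)).toMultilinearMap.map_smul_univ (fun i => P i (a i))
    (fun i => M (a i))
  refine h3.trans ?_
  rw [smul_eq_mul]; rfl

/-- tensor power of a matrix -/
def tpow (κ : Type*) [Fintype κ] (A : Matrix lam lam R) : Matrix (κ → lam) (κ → lam) R :=
  fun a b => ∏ i, A (a i) (b i)

lemma tpow_mul (A B : Matrix lam lam R) : tpow κ (A * B) = tpow κ A * tpow κ B := by
  ext a b
  simp only [tpow, mul_apply]
  rw [Finset.prod_univ_sum, Fintype.piFinset_univ]
  exact Finset.sum_congr rfl fun x _ => Finset.prod_mul_distrib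

lemma tpow_one : tpow κ (1 : Matrix lam lam R) = 1 := by
  ext a b
  simp only [tpow, one_apply]
  split_ifs with h
  · simp [h]
  · obtain ⟨i, hi⟩ := Function.ne_iff.mp h
    exact Finset.prod_eq_zero (Finset.mem_univ i) (by simp [hi])

lemma det_sandwich (P : Matrix κ lam R) (A : Matrix lam lam R) (S : Matrix lam κ R) :
    (P * A * S).det = (fun a => ∏ i, P i (a i)) ⬝ᵥ (tpow κ A *ᵥ fun b => (S.submatrix b id).det) := by
  rw [Matrix.mul_assoc, det_mul_expand]
  refine Finset.sum_congr rfl fun a _ => ?_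
  congr 1
  have : (A * S).submatrix a id = A.submatrix a id * S := by
    ext i j; simp [mul_apply]
  rw [this, det_mul_expand]
  rfl
end

section
variable {k : Type*} [Field k] {ι : Type*} [Fintype ι] [DecidableEq ι]

lemma split_lemma (W : Submodule k (ι → k)) : ∃ (r s : ℕ) (C : Matrix ι (Fin r) k) (D : Matrix (Fin r) ι k)
    (R : Matrix (Fin s) ι k) (E : Matrix ι (Fin s) k), D * C = 1 ∧ R * E = 1 ∧ C * D + E * R = 1 ∧
      R * C = 0 ∧ D * E = 0 ∧ ∀ v, v ∈ W ↔ R *ᵥ v = 0 := by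
  obtain ⟨W', hW⟩ := W.exists_isCompl
  let b := Module.finBasis k W
  let b' := Module.finBasis k W'
  let Cl : (Fin (Module.finrank k W) → k) →ₗ[k] (ι → k) := W.subtype ∘ₗ b.equivFun.symm.toLinearMap
  let Dl : (ι → k) →ₗ[k] (Fin (Module.finrank k W) → k) :=
    b.equivFun.toLinearMap ∘ₗ W.projectionOnto W' hW
  let El : (Fin (Module.finrank k W') → k) →ₗ[k] (ι → k) := W'.subtype ∘ₗ b'.equivFun.symm.toLinearMap
  let Rl : (ι → k) →ₗ[k] (Fin (Module.finrank k W') → k) :=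
    b'.equivFun.toLinearMap ∘ₗ W'.projectionOnto W hW.symm
  refine ⟨_, _, LinearMap.toMatrix' Cl, LinearMap.toMatrix' Dl, LinearMap.toMatrix' Rl, LinearMap.toMatrix' El, 
    ?_, ?_, ?_, ?_, ?_, ?_⟩
  · rw [← LinearMap.toMatrix'_comp, ← LinearMap.toMatrix'_id]
    congr 1
    refine LinearMap.ext fun v => ?_
    simp only [Cl, Dl, Submodule.projectionOnto_apply_left, LinearMap.comp_apply, LinearEquiv.coe_coe,
      LinearEquiv.symm_apply_apply, LinearEquiv.apply_symm_apply, map_zero, LinearMap.zero_apply, Submodule.subtype_apply, LinearMap.id_apply]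
  · rw [← LinearMap.toMatrix'_comp, ← LinearMap.toMatrix'_id]
    congr 1
    refine LinearMap.ext fun v => ?_
    simp only [El, Rl, Submodule.projectionOnto_apply_left, LinearMap.comp_apply, LinearEquiv.coe_coe,
      LinearEquiv.symm_apply_apply, LinearEquiv.apply_symm_apply, map_zero, LinearMap.zero_apply, Submodule.subtype_apply, LinearMap.id_apply]
  · rw [← LinearMap.toMatrix'_comp, ← LinearMap.toMatrix'_comp, ← map_add, ← LinearMap.toMatrix'_id]
    congr 1
    refine LinearMap.ext fun v => ?_
    simp only [Cl, Dl, El, Rl, LinearMap.add_apply, LinearMap.comp_apply, LinearEquiv.coe_coe,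
      LinearEquiv.symm_apply_apply, Submodule.subtype_apply, LinearMap.id_apply]
    exact LinearMap.congr_fun (Submodule.projection_add_projection_eq_id hW) v
  · rw [← LinearMap.toMatrix'_comp, ← map_zero LinearMap.toMatrix']
    congr 1
    refine LinearMap.ext fun v => ?_
    simp only [Cl, Rl, Submodule.projectionOnto_apply_right, LinearMap.comp_apply, LinearEquiv.coe_coe,
      LinearEquiv.symm_apply_apply, LinearEquiv.apply_symm_apply, map_zero, LinearMap.zero_apply, Submodule.subtype_apply, LinearMap.id_apply]
  · rw [← LinearMap.toMatrix'_comp, ← map_zero LinearMap.toMatrix']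
    congr 1
    refine LinearMap.ext fun v => ?_
    simp only [El, Dl, Submodule.projectionOnto_apply_right, LinearMap.comp_apply, LinearEquiv.coe_coe,
      LinearEquiv.symm_apply_apply, LinearEquiv.apply_symm_apply, map_zero, LinearMap.zero_apply, Submodule.subtype_apply, LinearMap.id_apply]
  · intro v
    rw [LinearMap.toMatrix'_mulVec]
    simp only [Rl, LinearMap.comp_apply, LinearEquiv.coe_coe, LinearEquiv.map_eq_zero_iff]
    rw [Submodule.projectionOnto_apply_eq_zero_iff]

lemma span_top_of_dual (S : Set (ι → k)) (h : ∀ lam : ι → k, (∀ s ∈ S, lam ⬝ᵥ s = 0) → lam = 0) :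
    Submodule.span k S = ⊤ := by
  by_contra hne
  obtain ⟨f, hf0, hf⟩ := Submodule.exists_le_ker_of_lt_top _ (lt_top_iff_ne_top.mpr hne)
  apply hf0
  have hfe : ∀ v, f v = (fun i => f (Pi.single i 1)) ⬝ᵥ v := by
    intro v
    conv_lhs => rw [← Finset.univ_sum_single v]
    rw [map_sum]
    refine Finset.sum_congr rfl fun i _ => ?_
    have : (Pi.single i (v i) : ι → k) = v i • Pi.single i 1 := by
      rw [← Pi.single_smul]; simp
    rw [this, map_smul, smul_eq_mul, mul_comm]
  have h0 := h (fun i => f (Pi.single i 1)) fun s hs => by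
    rw [← hfe]; exact hf (Submodule.subset_span hs)
  refine LinearMap.ext fun v => ?_
  rw [hfe, h0]; simp
end

section
variable {k : Type*} [Field k] {ι : Type*} [Fintype ι] [DecidableEq ι] {Q : Type*} [Group Q]

/-- sub/quotient reduction -/
lemma cyc_reduce (T : Q →* Matrix ι ι k) (f u : ι → k) : ∃ (s r : ℕ) (ψ' : Q →* Matrix (Fin s) (Fin s) k)
    (ψ : Q →* Matrix (Fin r) (Fin r) k) (R : Matrix (Fin s) ι k) (E : Matrix ι (Fin s) k)
    (C : Matrix (Fin s) (Fin r) k) (D : Matrix (Fin r) (Fin s) k) (f' u' : Fin r → k),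
    R * E = 1 ∧ D * C = 1 ∧ (∀ g, ψ' g * R = R * T g) ∧ (∀ g, C * ψ g = ψ' g * C) ∧
    (∀ g, f' ⬝ᵥ (ψ g *ᵥ u') = f ⬝ᵥ (T g *ᵥ u)) ∧
    (∀ w, (∀ g, f' ⬝ᵥ (ψ g *ᵥ w) = 0) → w = 0) ∧
    (∀ lam : Fin r → k, (∀ g, lam ⬝ᵥ (ψ g *ᵥ u') = 0) → lam = 0) ∧
    (∀ g, ψ g = D * R * T g * E * C) := by
  let W : Submodule k (ι → k) :=
    { carrier := {v | ∀ g, f ⬝ᵥ (T g *ᵥ v) = 0}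
      zero_mem' := by simp
      add_mem' := by intro a b ha hb g; rw [mulVec_add, dotProduct_add, ha g, hb g, add_zero]
      smul_mem' := by intro c a ha g; rw [mulVec_smul, dotProduct_smul, ha g, smul_zero] }
  have hW : ∀ v, v ∈ W ↔ ∀ g, f ⬝ᵥ (T g *ᵥ v) = 0 := fun v => Iff.rfl
  obtain ⟨_, s, -, -, R, E, -, hRE, -, -, -, hR⟩ := split_lemma W
  have hker : ∀ v, v - E *ᵥ (R *ᵥ v) ∈ W := by
    intro v
    rw [hR, mulVec_sub, mulVec_mulVec, hRE, one_mulVec, sub_self]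
  have hstab : ∀ g v, v ∈ W → T g *ᵥ v ∈ W := by
    intro g v hv g'
    rw [mulVec_mulVec, ← map_mul]; exact hv _
  have hint : ∀ g, R * T g * E * R = R * T g := by
    intro g
    refine ext_of_mulVec_single fun i => ?_
    obtain ⟨v, hv⟩ : ∃ v : ι → k, v = Pi.single i 1 := ⟨_, rfl⟩
    rw [← hv]
    have h1 := (hR _).mp (hstab g _ (hker v))
    rw [mulVec_sub, mulVec_sub, sub_eq_zero] at h1
    simp only [mulVec_mulVec] at h1
    rw [← Matrix.mul_assoc] at h1
    simp only [Matrix.mul_assoc] at h1 ⊢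
    exact h1.symm
  let ψ' : Q →* Matrix (Fin s) (Fin s) k :=
    { toFun := fun g => R * T g * E
      map_one' := by rw [map_one, Matrix.mul_one, hRE]
      map_mul' := by
        intro a b
        have h1 : R * T (a * b) * E = R * T a * (T b * E) := by rw [map_mul]; simp only [Matrix.mul_assoc]
        calc _ = R * T a * E * R * (T b * E) := by rw [hint a, h1]
          _ = _ := by simp only [Matrix.mul_assoc] }
  have hψ' : ∀ g, ψ' g = R * T g * E := fun g => rfl
  have hfE : ∀ g v, (f ᵥ* E) ⬝ᵥ (ψ' g *ᵥ (R *ᵥ v)) = f ⬝ᵥ (T g *ᵥ v) := by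
    intro g v
    rw [mulVec_mulVec, hψ', hint, ← dotProduct_mulVec, mulVec_mulVec]
    have h1 := hker (T g *ᵥ v) 1
    rw [map_one, one_mulVec, dotProduct_sub, sub_eq_zero] at h1
    rw [h1]; simp only [mulVec_mulVec, Matrix.mul_assoc]
  have hsep' : ∀ w, (∀ g, (f ᵥ* E) ⬝ᵥ (ψ' g *ᵥ w) = 0) → w = 0 := by
    intro w hw
    have h1 : E *ᵥ w ∈ W := by
      intro g
      rw [← hfE]
      rw [mulVec_mulVec w R E, hRE, one_mulVec]; exact hw g
    rw [hR, mulVec_mulVec, hRE, one_mulVec] at h1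
    exact h1
  let W₂ : Submodule k (Fin s → k) := Submodule.span k (Set.range fun g => ψ' g *ᵥ (R *ᵥ u))
  obtain ⟨r, _, C, D, R₂, E₂, hDC, hRE₂, hsum, hRC, -, hR₂⟩ := split_lemma W₂
  have hCW : ∀ x, C *ᵥ x ∈ W₂ := by
    intro x; rw [hR₂, mulVec_mulVec, hRC, zero_mulVec]
  have hCD : ∀ v ∈ W₂, C *ᵥ (D *ᵥ v) = v := by
    intro v hv
    have h1 := congrArg (· *ᵥ v) hsum
    simp only [add_mulVec, one_mulVec, ← mulVec_mulVec] at h1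
    rw [(hR₂ v).mp hv, mulVec_zero, add_zero] at h1
    exact h1
  have hst₂ : ∀ g, ∀ v ∈ W₂, ψ' g *ᵥ v ∈ W₂ := by
    intro g v hv
    induction hv using Submodule.span_induction with
    | mem x hx =>
      obtain ⟨g', rfl⟩ := hx
      refine Submodule.subset_span ⟨g * g', ?_⟩
      simp only [map_mul, mulVec_mulVec, Matrix.mul_assoc]
    | zero => rw [mulVec_zero]; exact zero_mem _
    | add x y _ _ hx hy => rw [mulVec_add]; exact add_mem hx hy
    | smul c x _ hx => rw [mulVec_smul]; exact Submodule.smul_mem _ _ hx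
  have hint₂ : ∀ g, C * (D * ψ' g * C) = ψ' g * C := by
    intro g
    refine ext_of_mulVec_single fun i => ?_
    have := hCD _ (hst₂ g _ (hCW (Pi.single i 1)))
    simp only [mulVec_mulVec] at this
    simp only [Matrix.mul_assoc] at this ⊢
    exact this
  let ψ : Q →* Matrix (Fin r) (Fin r) k :=
    { toFun := fun g => D * ψ' g * C
      map_one' := by rw [map_one, Matrix.mul_one, hDC]
      map_mul' := by
        intro a b
        rw [map_mul, Matrix.mul_assoc D, Matrix.mul_assoc (ψ' a), ← hint₂ b]
        simp only [Matrix.mul_assoc] }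
  have hψ : ∀ g, ψ g = D * ψ' g * C := fun g => rfl
  have hRu : R *ᵥ u ∈ W₂ := Submodule.subset_span ⟨1, by simp⟩
  have hCψ : ∀ g x, C *ᵥ (ψ g *ᵥ x) = ψ' g *ᵥ (C *ᵥ x) := by
    intro g x; rw [mulVec_mulVec, mulVec_mulVec, hψ, hint₂]
  refine ⟨s, r, ψ', ψ, R, E, C, D, (f ᵥ* E) ᵥ* C, D *ᵥ (R *ᵥ u), hRE, hDC, hint, hint₂, ?_, ?_, ?_, ?_⟩
  · intro g
    rw [← dotProduct_mulVec, hCψ, hCD _ hRu, hfE]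
  · intro w hw
    have h1 : C *ᵥ w = 0 := by
      apply hsep'
      intro g
      rw [← hCψ, dotProduct_mulVec]; exact hw g
    have h2 := congrArg (D *ᵥ ·) h1
    simp only [mulVec_mulVec, hDC, one_mulVec, mulVec_zero] at h2
    exact h2
  · intro lam hlam
    have h1 : ∀ v ∈ W₂, lam ⬝ᵥ (D *ᵥ v) = 0 := by
      intro v hv
      induction hv using Submodule.span_induction with
      | mem x hx =>
        obtain ⟨g, rfl⟩ := hx
        have h2 := hlam g
        have h3 : ψ g *ᵥ (D *ᵥ (R *ᵥ u)) = D *ᵥ (ψ' g *ᵥ (R *ᵥ u)) := by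
          have h4 := congrArg (D *ᵥ ·) (hCψ g (D *ᵥ (R *ᵥ u)))
          simp only [hCD _ hRu] at h4
          rw [mulVec_mulVec, hDC, one_mulVec] at h4
          exact h4
        rw [h3] at h2; exact h2
      | zero => simp
      | add x y _ _ hx hy => rw [mulVec_add, dotProduct_add, hx, hy, add_zero]
      | smul c x _ hx => rw [mulVec_smul, dotProduct_smul, hx, smul_zero]
    ext i
    have h2 := h1 _ (hCW (Pi.single i 1))
    rw [mulVec_mulVec, hDC, one_mulVec] at h2
    simpa using h2
  · intro g
    rw [hψ, hψ']; simp only [Matrix.mul_assoc]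
end

end LG

namespace LG
open Matrix Filter Topology

section
variable {k : Type*} [CommRing k] {κ : Type*} [Fintype κ] [DecidableEq κ] {Q : Type*} [Group Q]

/-- tensor power of `1 ⊕ c` -/
def Trep (c : Q →* Matrix κ κ k) : Q →* Matrix (κ → κ ⊕ κ) (κ → κ ⊕ κ) k where
  toFun g := tpow κ (fromBlocks 1 0 0 (c g))
  map_one' := by rw [map_one, fromBlocks_one, tpow_one]
  map_mul' a b := by
    rw [← tpow_mul, fromBlocks_multiply]; simp

lemma Trep_apply (c : Q →* Matrix κ κ k) (g : Q) : Trep c g = tpow κ (fromBlocks 1 0 0 (c g)) := rfl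
end

variable {k : Type*} [NormedField k] [IsAlgClosed k] {κ : Type*} [Fintype κ] [DecidableEq κ] {Q : Type*} [Group Q]

lemma Fe_Trep (c : Q →* Matrix κ κ k) (e : Matrix κ κ k) (he : e * e = e) (g : Q) :
    Fe e (c g) = (fun a : κ → κ ⊕ κ => ∏ i, (fromCols (1 - e) e) i (a i)) ⬝ᵥ (Trep c g *ᵥ fun b =>
      ((fromRows (1 - e) e).submatrix b id).det) := by
  rw [Trep_apply, ← det_sandwich, Fe]
  congr 1
  rw [fromCols_mul_fromBlocks, fromCols_mul_fromRows]
  have : (1 - e) * (1 - e) = 1 - e := by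
    rw [mul_sub, sub_mul, sub_mul, he]; simp
  simp [this]

lemma exists_prox (c : Q →* Matrix κ κ k) (h : Q) (ν : k) (hν : (c h).charpoly.IsRoot ν) (hν1 : 1 < ‖ν‖) :
    ∃ (s r : ℕ) (ψ' : Q →* Matrix (Fin s) (Fin s) k)
    (ψ : Q →* Matrix (Fin r) (Fin r) k) (R : Matrix (Fin s) (κ → κ ⊕ κ) k) (E : Matrix (κ → κ ⊕ κ) (Fin s) k)
    (C : Matrix (Fin s) (Fin r) k) (D : Matrix (Fin r) (Fin s) k) (f u : Fin r → k) (θ : k),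
    R * E = 1 ∧ D * C = 1 ∧ (∀ g, ψ' g * R = R * Trep c g) ∧ (∀ g, C * ψ g = ψ' g * C) ∧
    (∀ g, ψ g = D * R * Trep c g * E * C) ∧ f ⬝ᵥ u = 1 ∧ 1 < ‖θ‖ ∧
    (∀ i j, Tendsto (fun N : ℕ => θ⁻¹ ^ N * ψ (h ^ N) i j) atTop (𝓝 (u i * f j))) ∧
    (∀ lam w : Fin r → k, lam ≠ 0 → w ≠ 0 → ∃ g, lam ⬝ᵥ (ψ g *ᵥ w) ≠ 0) := by
  have hh : c h * c h⁻¹ = 1 := by rw [← map_mul, mul_inv_cancel, map_one]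
  obtain ⟨e, σ, hσ, he, he0, hec, l1, l2, l3⟩ := exists_proj (c h) (c h⁻¹) hh ν hν hν1
  have hθ := Fe_gt_one e _ _ he he0 hh hec l3
  have hlim := fun g' g : Q => (Fe_limit e _ _ σ hσ he hh hec l1 l2 (c g') (c g)).2
  obtain ⟨s, r, ψ', ψ, R, E, C, D, f, u, hRE, hDC, h1, h2, h3, h4, h5, h6⟩ := cyc_reduce (Trep c)
    (fun a : κ → κ ⊕ κ => ∏ i, (fromCols (1 - e) e) i (a i))
    (fun b => ((fromRows (1 - e) e).submatrix b id).det)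
  have hF : ∀ g, f ⬝ᵥ (ψ g *ᵥ u) = Fe e (c g) := fun g => by rw [h3, Fe_Trep c e he]
  obtain ⟨θ, hθd⟩ : ∃ θ, θ = Fe e (c h) := ⟨_, rfl⟩
  rw [← hθd] at hθ
  have hlim' : ∀ g' g : Q, Tendsto (fun N : ℕ => θ⁻¹ ^ N * (f ⬝ᵥ (ψ g' *ᵥ (ψ (h ^ N) *ᵥ (ψ g *ᵥ u))))) atTop
      (𝓝 ((f ⬝ᵥ (ψ g' *ᵥ u)) * (f ⬝ᵥ (ψ g *ᵥ u)))) := by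
    intro g' g
    rw [hF, hF]
    refine (hlim g' g).congr fun N => ?_
    rw [hθd, mulVec_mulVec, mulVec_mulVec, ← map_mul, ← map_mul, hF, map_mul, map_mul, map_pow, mul_assoc]
  -- extend in the right variable
  have hspan : Submodule.span k (Set.range fun g => ψ g *ᵥ u) = ⊤ := by
    apply span_top_of_dual
    intro lam hl
    exact h5 lam fun g => hl _ ⟨g, rfl⟩
  have hspan' : Submodule.span k (Set.range fun g => f ᵥ* ψ g) = ⊤ := by
    apply span_top_of_dual
    intro w hl
    refine h4 w fun g => ?_
    rw [dotProduct_mulVec, dotProduct_comm]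
    exact hl _ ⟨g, rfl⟩
  have s1 : ∀ g' v, Tendsto (fun N : ℕ => θ⁻¹ ^ N * (f ⬝ᵥ (ψ g' *ᵥ (ψ (h ^ N) *ᵥ v)))) atTop
      (𝓝 ((f ⬝ᵥ (ψ g' *ᵥ u)) * (f ⬝ᵥ v))) := by
    intro g' v
    have hv : v ∈ Submodule.span k (Set.range fun g => ψ g *ᵥ u) := by rw [hspan]; trivial
    induction hv using Submodule.span_induction with
    | mem x hx => obtain ⟨g, rfl⟩ := hx; exact hlim' g' g
    | zero => simp
    | add x y _ _ hx hy =>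
      have := hx.add hy
      simp only [mulVec_add, dotProduct_add, mul_add] 
      exact this
    | smul t x _ hx =>
      have := hx.const_mul t
      simp only [mulVec_smul, dotProduct_smul, smul_eq_mul]
      simpa only [mul_left_comm] using this
  have s2 : ∀ lam v : Fin r → k, Tendsto (fun N : ℕ => θ⁻¹ ^ N * (lam ⬝ᵥ (ψ (h ^ N) *ᵥ v))) atTop
      (𝓝 ((lam ⬝ᵥ u) * (f ⬝ᵥ v))) := by
    intro lam v
    have hv : lam ∈ Submodule.span k (Set.range fun g => f ᵥ* ψ g) := by rw [hspan']; trivial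
    induction hv using Submodule.span_induction with
    | mem x hx =>
      obtain ⟨g, rfl⟩ := hx
      simp only [← dotProduct_mulVec]
      exact s1 g v
    | zero => simp
    | add x y _ _ hx hy =>
      have := hx.add hy
      simp only [add_dotProduct, mul_add, add_mul]
      exact this
    | smul t x _ hx =>
      have := hx.const_mul t
      simp only [smul_dotProduct, smul_eq_mul]
      simpa only [mul_left_comm, mul_assoc] using this
  refine ⟨s, r, ψ', ψ, R, E, C, D, f, u, θ, hRE, hDC, h1, h2, h6, ?_, hθ, ?_, ?_⟩
  · have := hF 1
    rw [map_one, one_mulVec, map_one] at this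
    rw [this, Fe]; simp [he]
  · intro i j
    have := s2 (Pi.single i 1) (Pi.single j 1)
    simpa using this
  · intro lam w hl hw
    obtain ⟨g2, hg2⟩ : ∃ g, lam ⬝ᵥ (ψ g *ᵥ u) ≠ 0 := by
      by_contra hcon; push Not at hcon; exact hl (h5 lam hcon)
    obtain ⟨g1, hg1⟩ : ∃ g, f ⬝ᵥ (ψ g *ᵥ w) ≠ 0 := by
      by_contra hcon; push Not at hcon; exact hw (h4 w hcon)
    by_contra hcon
    push Not at hcon
    have := s2 (lam ᵥ* ψ g2) (ψ g1 *ᵥ w)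
    have h7 : ∀ N : ℕ, θ⁻¹ ^ N * ((lam ᵥ* ψ g2) ⬝ᵥ (ψ (h ^ N) *ᵥ (ψ g1 *ᵥ w))) = 0 := by
      intro N
      rw [← dotProduct_mulVec, mulVec_mulVec, mulVec_mulVec, ← map_mul, ← map_mul, hcon, mul_zero]
    simp only [h7] at this
    have h8 := tendsto_nhds_unique tendsto_const_nhds this
    rw [← dotProduct_mulVec] at h8
    exact mul_ne_zero hg2 hg1 h8.symm

end LG

namespace LG
open Matrix Filter Topology

lemma mv_eval_bound {k : Type*} [NormedField k] {V : Type*} [Finite V] (A : MvPolynomial V k) : ∃ M : ℝ, 0 ≤ M ∧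
    ∀ x : V → k, (∀ v, ‖x v‖ ≤ 1) → ‖MvPolynomial.eval x A‖ ≤ M := by
  cases nonempty_fintype V
  refine ⟨∑ m ∈ A.support, ‖A.coeff m‖, Finset.sum_nonneg fun _ _ => norm_nonneg _, fun x hx => ?_⟩
  rw [MvPolynomial.eval_eq]
  refine (norm_sum_le _ _).trans (Finset.sum_le_sum fun m _ => ?_)
  rw [norm_mul]
  refine mul_le_of_le_one_right (norm_nonneg _) ?_
  rw [norm_prod]
  refine Finset.prod_le_one (fun _ _ => norm_nonneg _) fun i _ => ?_
  rw [norm_pow]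
  exact pow_le_one₀ (norm_nonneg _) (hx i)

lemma dot_norm_le {k : Type*} [NormedField k] {ι : Type*} [Fintype ι] (a b : ι → k) :
    ‖a ⬝ᵥ b‖ ≤ Fintype.card ι * (‖a‖ * ‖b‖) := by
  refine (norm_sum_le _ _).trans ?_
  rw [← nsmul_eq_mul, ← Finset.card_univ, ← Finset.sum_const]
  refine Finset.sum_le_sum fun i _ => ?_
  rw [norm_mul]
  exact mul_le_mul (norm_le_pi_norm a i) (norm_le_pi_norm b i) (norm_nonneg _) (norm_nonneg _)

/-- entry norm -/
noncomputable def nb {k : Type*} [NormedField k] {ι κ : Type*} [Fintype ι] [Fintype κ] (A : Matrix ι κ k) : ℝ :=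
  ‖(fun p : ι × κ => A p.1 p.2)‖

section
variable {k : Type*} [NormedField k] {ι : Type*} [Fintype ι]

lemma nb_entry (A : Matrix ι ι k) (i j) : ‖A i j‖ ≤ nb A := norm_le_pi_norm (fun p : ι × ι => A p.1 p.2) (i, j)
lemma nb_nonneg (A : Matrix ι ι k) : 0 ≤ nb A := norm_nonneg _
lemma nb_le {A : Matrix ι ι k} {c : ℝ} (hc : 0 ≤ c) (h : ∀ i j, ‖A i j‖ ≤ c) : nb A ≤ c :=
  (pi_norm_le_iff_of_nonneg hc).mpr fun p => h p.1 p.2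
lemma nb_row (A : Matrix ι ι k) (i) : ‖A i‖ ≤ nb A :=
  (pi_norm_le_iff_of_nonneg (nb_nonneg A)).mpr fun j => nb_entry A i j
lemma nb_col (A : Matrix ι ι k) (j) : ‖(fun i => A i j)‖ ≤ nb A :=
  (pi_norm_le_iff_of_nonneg (nb_nonneg A)).mpr fun i => nb_entry A i j
lemma nb_mul (A B : Matrix ι ι k) : nb (A * B) ≤ Fintype.card ι * (nb A * nb B) := by
  refine nb_le (by have := nb_nonneg A; have := nb_nonneg B; positivity) fun i j => ?_
  refine (dot_norm_le (A i) (fun l => B l j)).trans ?_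
  gcongr
  · exact nb_nonneg A
  · exact nb_row A i
  · exact nb_col B j
lemma nb_mulVec (A : Matrix ι ι k) (v : ι → k) : ‖A *ᵥ v‖ ≤ Fintype.card ι * (nb A * ‖v‖) := by
  refine (pi_norm_le_iff_of_nonneg (by have := nb_nonneg A; positivity)).mpr fun i => ?_
  refine (dot_norm_le (A i) v).trans ?_
  gcongr
  exact nb_row A i
lemma nb_vecMul (A : Matrix ι ι k) (v : ι → k) : ‖v ᵥ* A‖ ≤ Fintype.card ι * (‖v‖ * nb A) := by
  refine (pi_norm_le_iff_of_nonneg (by have := nb_nonneg A; positivity)).mpr fun i => ?_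
  refine (dot_norm_le v (fun l => A l i)).trans ?_
  gcongr
  exact nb_col A i
end

lemma exists_normalize {k : Type*} [NormedField k] {ι : Type*} [Fintype ι] (v : ι → k) (hv : v ≠ 0) :
    ∃ a, ‖v a‖ = ‖v‖ ∧ v a ≠ 0 ∧ (∀ b, ‖((v a)⁻¹ • v) b‖ ≤ 1) ∧ ((v a)⁻¹ • v) a = 1 := by
  have hne : Nonempty ι := by
    by_contra h
    rw [not_nonempty_iff] at h
    exact hv (Subsingleton.elim _ _)
  obtain ⟨a, ha⟩ := Finite.exists_max fun a => ‖v a‖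
  have h1 : ‖v a‖ = ‖v‖ := le_antisymm (norm_le_pi_norm v a)
    ((pi_norm_le_iff_of_nonneg (norm_nonneg _)).mpr ha)
  have h2 : v a ≠ 0 := by
    rw [← norm_ne_zero_iff, h1, norm_ne_zero_iff]; exact hv
  refine ⟨a, h1, h2, fun b => ?_, by simp [h2]⟩
  rw [Pi.smul_apply, smul_eq_mul, norm_mul, norm_inv, inv_mul_le_iff₀ (norm_pos_iff.mpr h2), mul_one]
  exact ha b

open MvPolynomial in
lemma transversal {k : Type*} [NormedField k] [IsAlgClosed k] {r : ℕ} {J : Type} [Fintype J] [DecidableEq J] {Q : Type*}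
    (ψ : Q → J → Matrix (Fin r) (Fin r) k)
    (hirr : ∀ lam w : J → Fin r → k, (∀ i, lam i ≠ 0) → (∀ i, w i ≠ 0) → ∃ g, ∀ i, lam i ⬝ᵥ (ψ g i *ᵥ w i) ≠ 0) :
    ∃ (S : Finset Q) (η : ℝ), 0 < η ∧ ∀ lam w : J → Fin r → k, (∀ i, lam i ≠ 0) → (∀ i, w i ≠ 0) →
      ∃ g ∈ S, ∀ i, η * (‖lam i‖ * ‖w i‖) ≤ ‖lam i ⬝ᵥ (ψ g i *ᵥ w i)‖ := by
  classical
  let V := J × Fin 4 × Fin r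
  let P : Q → MvPolynomial V k := fun g => ∏ i, ∑ a, ∑ b, X (i, 0, a) * (C (ψ g i a b) * X (i, 1, b))
  let R1 : J → MvPolynomial V k := fun i => (∑ a, X (i, 2, a) * X (i, 0, a)) - 1
  let R2 : J → MvPolynomial V k := fun i => (∑ a, X (i, 3, a) * X (i, 1, a)) - 1
  have hP : ∀ g (x : V → k), eval x (P g) = ∏ i, ((fun a => x (i, 0, a)) ⬝ᵥ (ψ g i *ᵥ fun b => x (i, 1, b))) := by
    intro g x
    simp only [P, map_prod, map_sum, map_mul, eval_X, eval_C]
    refine Finset.prod_congr rfl fun i _ => ?_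
    simp only [dotProduct, mulVec, Finset.mul_sum]
  let I : Ideal (MvPolynomial V k) := Ideal.span (Set.range P) ⊔ Ideal.span (Set.range R1 ∪ Set.range R2)
  have hI : (1 : MvPolynomial V k) ∈ I := by
    by_contra h1
    have hne : I ≠ ⊤ := fun h => h1 (h ▸ Submodule.mem_top)
    obtain ⟨M, hM, hIM⟩ := I.exists_le_maximal hne
    rw [MvPolynomial.isMaximal_iff_eq_vanishingIdeal_singleton] at hM
    obtain ⟨x, rfl⟩ := hM
    have hz : ∀ p ∈ I, eval x p = 0 := by
      intro p hp
      have := hIM hp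
      rw [mem_vanishingIdeal_singleton_iff] at this
      rw [← this]; rfl
    have h2 : ∀ i, (fun a => x (i, 0, a)) ≠ 0 := by
      intro i h0
      have h3 := hz (R1 i) (Ideal.mem_sup_right (Ideal.subset_span (Or.inl ⟨i, rfl⟩)))
      simp only [R1, map_sub, map_sum, map_mul, eval_X, map_one] at h3
      have h4 : ∀ a, x (i, 0, a) = 0 := fun a => congrFun h0 a
      simp [h4] at h3
    have h2' : ∀ i, (fun a => x (i, 1, a)) ≠ 0 := by
      intro i h0
      have h3 := hz (R2 i) (Ideal.mem_sup_right (Ideal.subset_span (Or.inr ⟨i, rfl⟩)))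
      simp only [R2, map_sub, map_sum, map_mul, eval_X, map_one] at h3
      have h4 : ∀ a, x (i, 1, a) = 0 := fun a => congrFun h0 a
      simp [h4] at h3
    obtain ⟨g, hg⟩ := hirr _ _ h2 h2'
    have h5 := hz (P g) (Ideal.mem_sup_left (Ideal.subset_span ⟨g, rfl⟩))
    rw [hP] at h5
    exact Finset.prod_ne_zero_iff.mpr (fun i _ => hg i) h5
  obtain ⟨p, hp, q, hq, hpq⟩ := Submodule.mem_sup.mp hI
  rw [Finsupp.mem_ideal_span_range_iff_exists_finsupp] at hp
  obtain ⟨c, hc⟩ := hp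
  choose M hM0 hM using fun g => mv_eval_bound (c g)
  obtain ⟨B, hB1, hB⟩ : ∃ B : ℝ, 1 ≤ B ∧ ∀ g ∈ c.support, ∀ i, r * (r * (nb (ψ g i))) ≤ B := by
    refine ⟨1 + ∑ g ∈ c.support, ∑ i, r * (r * nb (ψ g i)), ?_, ?_⟩
    · have : 0 ≤ ∑ g ∈ c.support, ∑ i, r * (r * nb (ψ g i)) := Finset.sum_nonneg fun g _ => Finset.sum_nonneg fun i _ => by
        have := nb_nonneg (ψ g i); positivity
      linarith
    · intro g hg i
      have h0 : ∀ g i, 0 ≤ r * (r * nb (ψ g i)) := fun g i => by have := nb_nonneg (ψ g i); positivity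
      have h1 := Finset.single_le_sum (f := fun i => r * (r * nb (ψ g i))) (fun i _ => h0 g i) (Finset.mem_univ i)
      have h2 := Finset.single_le_sum (f := fun g => ∑ i, r * (r * nb (ψ g i)))
        (fun g _ => Finset.sum_nonneg fun i _ => h0 g i) hg
      linarith
  obtain ⟨Mt, hMt⟩ : ∃ Mt : ℝ, Mt = 1 + ∑ g ∈ c.support, M g := ⟨_, rfl⟩
  have hMt0 : 0 < Mt := by
    have : 0 ≤ ∑ g ∈ c.support, M g := Finset.sum_nonneg fun g _ => hM0 g
    linarith
  have hBn : 0 < B ^ Fintype.card J := by positivity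
  refine ⟨c.support, Mt⁻¹ / B ^ Fintype.card J, by positivity, ?_⟩
  -- normalized statement
  have key : ∀ lam w : J → Fin r → k, (∀ i, (∀ a, ‖lam i a‖ ≤ 1) ∧ ∃ a, lam i a = 1) →
      (∀ i, (∀ a, ‖w i a‖ ≤ 1) ∧ ∃ a, w i a = 1) →
      ∃ g ∈ c.support, ∀ i, Mt⁻¹ / B ^ Fintype.card J ≤ ‖lam i ⬝ᵥ (ψ g i *ᵥ w i)‖ := by
    intro lam w hl hw
    choose hl1 pl hpl using hl
    choose hw1 pw hpw using hw
    let x : V → k := fun v => if v.2.1 = 0 then lam v.1 v.2.2 else if v.2.1 = 1 then w v.1 v.2.2 else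
      if v.2.1 = 2 then (if v.2.2 = pl v.1 then 1 else 0) else (if v.2.2 = pw v.1 then 1 else 0)
    have hx : ∀ v, ‖x v‖ ≤ 1 := by
      intro v
      simp only [x]
      split_ifs <;> simp [hl1, hw1]
    have hx0 : ∀ i a, x (i, 0, a) = lam i a := fun i a => by simp [x]
    have hx1 : ∀ i a, x (i, 1, a) = w i a := fun i a => by simp [x]
    have hx2 : ∀ i a, x (i, 2, a) = if a = pl i then 1 else 0 := fun i a => by simp [x]
    have hx3 : ∀ i a, x (i, 3, a) = if a = pw i then 1 else 0 := fun i a => by simp [x]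
    have hq0 : eval x q = 0 := by
      have : Ideal.span (Set.range R1 ∪ Set.range R2) ≤ RingHom.ker (eval x) := by
        rw [Ideal.span_le]
        rintro _ (⟨i, rfl⟩ | ⟨i, rfl⟩)
        · simp [RingHom.mem_ker, R1, hx2, hx0, hpl]
        · simp [RingHom.mem_ker, R2, hx3, hx1, hpw]
      exact this hq
    have h1 := congrArg (eval x) hpq
    rw [map_add, hq0, add_zero, map_one, ← hc, Finsupp.sum, map_sum] at h1
    simp only [map_mul, hP, hx0, hx1] at h1
    by_contra hcon
    push Not at hcon
    have h2 : ∀ g ∈ c.support, ‖∏ i, (lam i ⬝ᵥ (ψ g i *ᵥ w i))‖ ≤ Mt⁻¹ := by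
      intro g hg
      obtain ⟨i, hi⟩ := hcon g hg
      rw [norm_prod, ← Finset.mul_prod_erase _ _ (Finset.mem_univ i)]
      have h3 : ∏ j ∈ Finset.univ.erase i, ‖lam j ⬝ᵥ (ψ g j *ᵥ w j)‖ ≤ B ^ Fintype.card J := by
        calc _ ≤ ∏ j ∈ Finset.univ.erase i, B := by
              refine Finset.prod_le_prod (fun _ _ => norm_nonneg _) fun j _ => ?_
              refine (dot_norm_le _ _).trans (le_trans ?_ (hB g hg j))
              have e1 : ‖lam j‖ ≤ 1 := (pi_norm_le_iff_of_nonneg zero_le_one).mpr (hl1 j)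
              have e2 : ‖w j‖ ≤ 1 := (pi_norm_le_iff_of_nonneg zero_le_one).mpr (hw1 j)
              rw [Fintype.card_fin]
              have e3 := nb_mulVec (ψ g j) (w j)
              rw [Fintype.card_fin] at e3
              have e4 := nb_nonneg (ψ g j)
              have e5 : ‖ψ g j *ᵥ w j‖ ≤ r * nb (ψ g j) := e3.trans (by gcongr; exact mul_le_of_le_one_right e4 e2)
              refine mul_le_mul_of_nonneg_left ?_ (Nat.cast_nonneg r)
              calc _ ≤ 1 * ‖ψ g j *ᵥ w j‖ := mul_le_mul_of_nonneg_right e1 (norm_nonneg _)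
                _ ≤ _ := by rw [one_mul]; exact e5
          _ = B ^ (Finset.univ.erase i).card := by rw [Finset.prod_const]
          _ ≤ _ := pow_le_pow_right₀ hB1 (by rw [← Finset.card_univ]; exact Finset.card_le_card (Finset.erase_subset _ _))
      calc _ ≤ Mt⁻¹ / B ^ Fintype.card J * B ^ Fintype.card J := by gcongr
        _ = _ := by field_simp
    have h3 : ‖(1 : k)‖ < 1 := by
      rw [← h1]
      refine (norm_sum_le _ _).trans_lt ?_
      calc _ ≤ ∑ g ∈ c.support, M g * Mt⁻¹ := by
            refine Finset.sum_le_sum fun g hg => ?_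
            rw [norm_mul]
            exact mul_le_mul (hM g x hx) (h2 g hg) (norm_nonneg _) (hM0 g)
        _ = (Mt - 1) * Mt⁻¹ := by rw [← Finset.sum_mul, hMt]; ring
        _ < 1 := by rw [sub_mul, mul_inv_cancel₀ hMt0.ne']; have := inv_pos.mpr hMt0; linarith
    rw [norm_one] at h3
    exact lt_irrefl _ h3
  intro lam w hl hw
  choose al hal1 hal2 hal3 hal4 using fun i => exists_normalize (lam i) (hl i)
  choose aw haw1 haw2 haw3 haw4 using fun i => exists_normalize (w i) (hw i)
  obtain ⟨g, hg, hgi⟩ := key (fun i => (lam i (al i))⁻¹ • lam i) (fun i => (w i (aw i))⁻¹ • w i)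
    (fun i => ⟨hal3 i, al i, hal4 i⟩) (fun i => ⟨haw3 i, aw i, haw4 i⟩)
  refine ⟨g, hg, fun i => ?_⟩
  have h1 := hgi i
  simp only [mulVec_smul, dotProduct_smul, smul_dotProduct, smul_eq_mul, norm_mul, norm_inv, hal1, haw1] at h1
  have p1 : 0 < ‖lam i‖ := norm_pos_iff.mpr (hl i)
  have p2 : 0 < ‖w i‖ := norm_pos_iff.mpr (hw i)
  calc _ ≤ (‖w i‖⁻¹ * (‖lam i‖⁻¹ * ‖lam i ⬝ᵥ ψ g i *ᵥ w i‖)) * (‖lam i‖ * ‖w i‖) := by gcongr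
    _ = _ := by field_simp

end LG

namespace LG
open Matrix Filter Topology

/-- letters of a pair -/
def lett {Q : Type*} [Group Q] (a : Fin 2 → Q) (x : Fin 2 × Bool) : Q := if x.2 then a x.1 else (a x.1)⁻¹

lemma pp_uniform {k : Type*} [NormedField k] [IsAlgClosed k] {r : ℕ} {Q : Type*} [Group Q]
    (ψ : Q →* Matrix (Fin r) (Fin r) k)
    (hirr : ∀ lam w : Bool × Bool × Bool → Fin r → k, (∀ i, lam i ≠ 0) → (∀ i, w i ≠ 0) →
      ∃ g : Q, ∀ i, lam i ⬝ᵥ (ψ (if i.2.2 then g else g⁻¹) *ᵥ w i) ≠ 0)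
    (f u : Fin r → k) (hfu : f ⬝ᵥ u = 1) : ∃ (M η : ℝ), 1 ≤ M ∧ 0 < η ∧ ∀ Y : Matrix (Fin r) (Fin r) k, nb Y ≤ 1 →
      (∃ i j, Y i j = 1) → ∃ g1 g2 κ : Q, nb (ψ g1) ≤ M ∧ nb (ψ g1⁻¹) ≤ M ∧ nb (ψ g2) ≤ M ∧ nb (ψ g2⁻¹) ≤ M ∧
        nb (ψ κ) ≤ M ∧ nb (ψ κ⁻¹) ≤ M ∧ nb (ψ 1) ≤ M ∧ ‖f‖ ≤ M ∧ ‖u‖ ≤ M ∧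
        ∀ fb ub : Bool → Fin r → k, fb true = f ᵥ* ψ g1 ᵥ* Y ᵥ* ψ g2 → ub true = u →
          fb false = f ᵥ* ψ g1⁻¹ ᵥ* Y → ub false = ψ g2⁻¹ *ᵥ u →
          (∀ b, η < ‖fb b ⬝ᵥ ub b‖) ∧ ∀ (b b' s : Bool), η < ‖fb b ⬝ᵥ (ψ (if s then κ else κ⁻¹) *ᵥ ub b')‖ := by
  classical
  obtain ⟨S, η0, hη0, hS⟩ := transversal (J := Bool × Bool × Bool) (fun (g : Q) i => ψ (if i.2.2 then g else g⁻¹)) hirr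
  have hr : (1 : ℝ) ≤ r := by
    rcases Nat.eq_zero_or_pos r with h | h
    · subst h; simp [dotProduct] at hfu
    · exact_mod_cast h
  have hf0 : f ≠ 0 := by rintro rfl; simp at hfu
  have hu0 : u ≠ 0 := by rintro rfl; simp at hfu
  have hfp := norm_pos_iff.mpr hf0
  have hup := norm_pos_iff.mpr hu0
  obtain ⟨M, hM1, hM2, hM3, hMf, hMu, hMS⟩ : ∃ M : ℝ, 1 ≤ M ∧ nb (ψ 1) ≤ M ∧ 0 ≤ M ∧ ‖f‖ ≤ M ∧ ‖u‖ ≤ M ∧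
      ∀ g ∈ S, nb (ψ g) ≤ M ∧ nb (ψ g⁻¹) ≤ M := by
    have h0 : ∀ g, 0 ≤ nb (ψ g) + nb (ψ g⁻¹) := fun g => add_nonneg (nb_nonneg _) (nb_nonneg _)
    have h1 : 0 ≤ ∑ g ∈ S, (nb (ψ g) + nb (ψ g⁻¹)) := Finset.sum_nonneg fun g _ => h0 g
    have h2 := nb_nonneg (ψ 1)
    refine ⟨1 + nb (ψ 1) + ‖f‖ + ‖u‖ + ∑ g ∈ S, (nb (ψ g) + nb (ψ g⁻¹)), by linarith, by linarith, by linarith,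
      by linarith, by linarith, fun g hg => ?_⟩
    have h3 := Finset.single_le_sum (f := fun g => nb (ψ g) + nb (ψ g⁻¹)) (fun g _ => h0 g) hg
    have := nb_nonneg (ψ g)
    have := nb_nonneg (ψ g⁻¹)
    constructor <;> linarith
  obtain ⟨B, hB⟩ : ∃ B : ℝ, B = r * (r * (r * (M * M) * 1) * M) := ⟨_, rfl⟩
  have hB1 : 0 < B := by rw [hB]; positivity
  obtain ⟨η2, hη2⟩ : ∃ η2 : ℝ, η2 = η0 * ((η0 * ‖f‖) * ‖u‖) := ⟨_, rfl⟩
  have hη2p : 0 < η2 := by rw [hη2]; positivity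
  obtain ⟨η3, hη3⟩ : ∃ η3 : ℝ, η3 = η2 / (r * B) := ⟨_, rfl⟩
  have hη3p : 0 < η3 := by rw [hη3]; positivity
  refine ⟨M, min η2 (η0 * (η3 * η3)) / 2, hM1, by positivity, fun Y hY ⟨i0, j0, hij⟩ => ?_⟩
  -- step 1
  obtain ⟨g1, hg1, hg1'⟩ := hS (fun _ => f) (fun _ i => Y i j0) (fun _ => hf0)
    (fun _ h => by have := congrFun h i0; simp [hij] at this)
  have hw : 1 ≤ ‖fun i => Y i j0‖ := by
    have := norm_le_pi_norm (fun i => Y i j0) i0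
    simpa [hij] using this
  have s1 : ∀ s : Bool, η0 * ‖f‖ ≤ ‖f ᵥ* ψ (if s then g1 else g1⁻¹) ᵥ* Y‖ := by
    intro s
    have h1 := hg1' (true, true, s)
    have h2 : f ⬝ᵥ (ψ (if s then g1 else g1⁻¹) *ᵥ fun i => Y i j0) = (f ᵥ* ψ (if s then g1 else g1⁻¹) ᵥ* Y) j0 := by
      rw [dotProduct_mulVec]; rfl
    calc η0 * ‖f‖ = η0 * (‖f‖ * 1) := by ring
      _ ≤ η0 * (‖f‖ * ‖fun i => Y i j0‖) := by gcongr
      _ ≤ _ := h1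
      _ = ‖(f ᵥ* ψ (if s then g1 else g1⁻¹) ᵥ* Y) j0‖ := by rw [← h2]
      _ ≤ _ := norm_le_pi_norm _ _
  have hpos1 : 0 < η0 * ‖f‖ := by positivity
  obtain ⟨g2, hg2, hg2'⟩ := hS (fun i => f ᵥ* ψ (if i.2.2 then g1 else g1⁻¹) ᵥ* Y) (fun _ => u)
    (fun i h => by have := s1 i.2.2; rw [h, norm_zero] at this; linarith) (fun _ => hu0)
  have s2 : ∀ s : Bool, η2 ≤ ‖(f ᵥ* ψ (if s then g1 else g1⁻¹) ᵥ* Y) ⬝ᵥ (ψ (if s then g2 else g2⁻¹) *ᵥ u)‖ := by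
    intro s
    refine le_trans ?_ (hg2' (true, true, s))
    rw [hη2]
    gcongr
    exact s1 s
  obtain ⟨fb, hfb⟩ : ∃ fb : Bool → Fin r → k, fb = fun b => if b then f ᵥ* ψ g1 ᵥ* Y ᵥ* ψ g2 else f ᵥ* ψ g1⁻¹ ᵥ* Y := ⟨_, rfl⟩
  obtain ⟨ub, hub⟩ : ∃ ub : Bool → Fin r → k, ub = fun b => if b then u else ψ g2⁻¹ *ᵥ u := ⟨_, rfl⟩
  have s3 : ∀ b, η2 ≤ ‖fb b ⬝ᵥ ub b‖ := by
    intro b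
    cases b
    · have := s2 false
      simpa [hfb, hub] using this
    · have := s2 true
      simpa [hfb, hub, dotProduct_mulVec] using this
  have hn1 : ∀ s : Bool, ‖f ᵥ* ψ (if s then g1 else g1⁻¹) ᵥ* Y‖ ≤ r * (r * (M * M) * 1) := by
    intro s
    have a1 := nb_vecMul (ψ (if s then g1 else g1⁻¹)) f
    have a2 := nb_vecMul Y (f ᵥ* ψ (if s then g1 else g1⁻¹))
    rw [Fintype.card_fin] at a1 a2
    refine a2.trans ?_
    have a3 : nb (ψ (if s then g1 else g1⁻¹)) ≤ M := by
      split_ifs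
      · exact (hMS g1 hg1).1
      · exact (hMS g1 hg1).2
    have a4 := nb_nonneg (ψ (if s then g1 else g1⁻¹))
    have a5 := nb_nonneg Y
    refine mul_le_mul_of_nonneg_left (mul_le_mul (a1.trans ?_) hY a5 (by positivity)) (by positivity)
    gcongr
  have hrM : 1 ≤ r * M := one_le_mul_of_one_le_of_one_le hr hM1
  have hfbB : ∀ b, ‖fb b‖ ≤ B := by
    intro b
    cases b
    · have := hn1 false
      simp only [hfb, Bool.false_eq_true, if_false] at this ⊢
      refine this.trans ?_
      rw [hB]
      nlinarith [show 0 ≤ r * (r * (M * M) * 1) by positivity]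
    · have h1 := hn1 true
      simp only [hfb, if_true] at h1 ⊢
      have a2 := nb_vecMul (ψ g2) (f ᵥ* ψ g1 ᵥ* Y)
      rw [Fintype.card_fin] at a2
      refine a2.trans ?_
      rw [hB]
      refine mul_le_mul_of_nonneg_left (mul_le_mul h1 (hMS g2 hg2).1 (nb_nonneg _) (by positivity)) (by positivity)|>.trans ?_
      have e : (r:ℝ) * (r * (r * (M * M) * 1) * M) = r * (r * (r * (M * M) * 1) * M) := rfl
      linarith
  have hubB : ∀ b, ‖ub b‖ ≤ B := by
    have hMB : r * (M * M) ≤ B := by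
      rw [hB]
      have : r * (M * M) * 1 ≤ r * (M * M) * (r * (r * M)) := by
        refine mul_le_mul_of_nonneg_left ?_ (by positivity)
        nlinarith
      nlinarith
    intro b
    cases b
    · have a1 := nb_mulVec (ψ g2⁻¹) u
      rw [Fintype.card_fin] at a1
      simp only [hub, Bool.false_eq_true, if_false]
      refine a1.trans (le_trans ?_ hMB)
      refine mul_le_mul_of_nonneg_left (mul_le_mul (hMS g2 hg2).2 hMu (norm_nonneg _) (by positivity)) (by positivity)
    · simp only [hub, if_true]
      refine hMu.trans (le_trans ?_ hMB)
      nlinarith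
  have s4 : ∀ b, η3 ≤ ‖fb b‖ ∧ η3 ≤ ‖ub b‖ := by
    intro b
    have h1 := (s3 b).trans (dot_norm_le _ _)
    rw [Fintype.card_fin] at h1
    have h2 := hfbB b
    have h3 := hubB b
    rw [hη3]
    constructor
    · rw [div_le_iff₀ (by positivity)]
      refine h1.trans ?_
      have : ‖fb b‖ * ‖ub b‖ ≤ ‖fb b‖ * B := by gcongr
      nlinarith
    · rw [div_le_iff₀ (by positivity)]
      refine h1.trans ?_
      have : ‖fb b‖ * ‖ub b‖ ≤ B * ‖ub b‖ := by gcongr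
      nlinarith
  obtain ⟨κ, hκ, hκ'⟩ := hS (fun i => fb i.1) (fun i => ub i.2.1)
    (fun i h => by have := (s4 i.1).1; rw [h, norm_zero] at this; linarith)
    (fun i h => by have := (s4 i.2.1).2; rw [h, norm_zero] at this; linarith)
  have hmin : 0 < min η2 (η0 * (η3 * η3)) := by positivity
  refine ⟨g1, g2, κ, (hMS g1 hg1).1, (hMS g1 hg1).2, (hMS g2 hg2).1, (hMS g2 hg2).2, (hMS κ hκ).1, (hMS κ hκ).2,
    hM2, hMf, hMu, ?_⟩
  intro fb' ub' e1 e2 e3 e4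
  have ef : fb' = fb := by
    funext b; cases b
    · rw [e3, hfb]; simp
    · rw [e1, hfb]; simp
  have eu : ub' = ub := by
    funext b; cases b
    · rw [e4, hub]; simp
    · rw [e2, hub]; simp
  rw [ef, eu]
  constructor
  · intro b
    have := s3 b
    have := min_le_left η2 (η0 * (η3 * η3))
    linarith
  · intro b b' s
    have h1 := hκ' (b, b', s)
    have h2 := min_le_right η2 (η0 * (η3 * η3))
    have h3 : η0 * (η3 * η3) ≤ η0 * (‖fb b‖ * ‖ub b'‖) := by
      have := (s4 b).1
      have := (s4 b').2
      gcongr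
    simp only at h1
    linarith

set_option maxHeartbeats 2000000 in
theorem pingpong {k : Type*} [NormedField k] [IsAlgClosed k] {r : ℕ} {Q : Type*} [Group Q]
    (ψ : Q →* Matrix (Fin r) (Fin r) k)
    (hirr : ∀ lam w : Bool × Bool × Bool → Fin r → k, (∀ i, lam i ≠ 0) → (∀ i, w i ≠ 0) →
      ∃ g : Q, ∀ i, lam i ⬝ᵥ (ψ (if i.2.2 then g else g⁻¹) *ᵥ w i) ≠ 0)
    (f u : Fin r → k) (hfu : f ⬝ᵥ u = 1) (h : Q) (hdet : (ψ h).det = 1) (θ : k) (hθ : 1 < ‖θ‖)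
    (hlim : ∀ i j, Tendsto (fun N : ℕ => θ⁻¹ ^ N * ψ (h ^ N) i j) atTop (𝓝 (u i * f j))) :
    ∃ (a : Fin 2 → Q) (c : k) (uu ff : Fin 2 × Bool → Fin r → k) (E : Fin 2 × Bool → Matrix (Fin r) (Fin r) k)
      (B ρ δ η K : ℝ), 0 < ρ ∧ 0 < η ∧ 0 < B ∧ 0 < K ∧
      (∀ x, ψ (lett a x) = c • (vecMulVec (uu x) (ff x) + E x)) ∧
      (∀ x i j, ‖E x i j‖ < δ) ∧ (∀ x i, ‖uu x i‖ < B) ∧ (∀ x i, ‖ff x i‖ < B) ∧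
      (∀ x y, y ≠ linv x → η < ‖ff x ⬝ᵥ uu y‖) ∧ K < ‖c‖ ∧
      r * (B * ρ) ≤ η / 2 ∧ r * (δ * (B + ρ)) ≤ ρ * (η / 2) ∧ 1 ≤ K * (η / 2) ∧
      r * (B * B) < K * (η / 2) * (η / 2) := by
  classical
  obtain ⟨M, η, hM1, hη, huni⟩ := pp_uniform ψ hirr f u hfu
  have hr : (1 : ℝ) ≤ r := by
    rcases Nat.eq_zero_or_pos r with h | h
    · subst h; simp [dotProduct] at hfu
    · exact_mod_cast h
  have hθ0 : θ ≠ 0 := by rintro rfl; simp at hθ; linarith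
  obtain ⟨B, hB⟩ : ∃ B : ℝ, B = r ^ 4 * M ^ 4 + 1 := ⟨_, rfl⟩
  have hB0 : 0 < B := by rw [hB]; positivity
  obtain ⟨ρ, hρ⟩ : ∃ ρ : ℝ, ρ = η / (2 * r * B) := ⟨_, rfl⟩
  have hρ0 : 0 < ρ := by rw [hρ]; positivity
  obtain ⟨K, hK⟩ : ∃ K : ℝ, K = 2 / η + 4 * r * B ^ 2 / η ^ 2 + 1 := ⟨_, rfl⟩
  have hK0 : 0 < K := by rw [hK]; positivity
  obtain ⟨δ, hδ⟩ : ∃ δ : ℝ, δ = ρ * (η / 2) / (r * (B + ρ)) := ⟨_, rfl⟩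
  have hδ0 : 0 < δ := by rw [hδ]; positivity
  obtain ⟨ε, hε⟩ : ∃ ε : ℝ, ε = δ / (2 * (r ^ 5 * M ^ 4)) := ⟨_, rfl⟩
  have hε0 : 0 < ε := by rw [hε]; positivity
  -- choose N
  obtain ⟨N, hN1, hN2⟩ : ∃ N : ℕ, (∀ i j, ‖θ⁻¹ ^ N * ψ (h ^ N) i j - u i * f j‖ ≤ ε) ∧ K * (r.factorial) < ‖θ‖ ^ N := by
    have h1 : ∀ᶠ N : ℕ in atTop, ∀ i j, ‖θ⁻¹ ^ N * ψ (h ^ N) i j - u i * f j‖ ≤ ε := by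
      rw [eventually_all]; intro i
      rw [eventually_all]; intro j
      filter_upwards [(Metric.tendsto_nhds.mp (hlim i j)) ε hε0] with N hN
      rw [← dist_eq_norm]; exact hN.le
    have h2 : ∀ᶠ N : ℕ in atTop, K * (r.factorial) < ‖θ‖ ^ N :=
      (tendsto_pow_atTop_atTop_of_one_lt hθ).eventually_gt_atTop _
    exact (h1.and h2).exists
  -- normalize ψ (h^-N)
  obtain ⟨Z, hZ⟩ : ∃ Z, Z = ψ (h ^ N)⁻¹ := ⟨_, rfl⟩
  have hZdet : Z.det = 1 := by
    have h1 : ψ (h ^ N) * Z = 1 := by rw [hZ, ← map_mul, mul_inv_cancel, map_one]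
    have h2 := congrArg det h1
    rw [det_mul, map_pow, det_pow, hdet, one_pow, one_mul, det_one] at h2
    exact h2
  have hnbZ : 1 ≤ r.factorial * nb Z := by
    by_contra hcon
    push Not at hcon
    have h1 := Matrix.det_le (A := Z) (abv := (NormedField.toAbsoluteValue k)) (x := nb Z) (fun i j => nb_entry Z i j)
    have h2 : (NormedField.toAbsoluteValue k) Z.det = 1 := by rw [hZdet, map_one]
    rw [h2, Fintype.card_fin, nsmul_eq_mul] at h1
    have h3 : (1 : ℝ) ≤ r.factorial := by exact_mod_cast r.factorial_pos
    have h4 := nb_nonneg Z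
    have h5 : nb Z ≤ 1 := by nlinarith
    have h6 : nb Z ^ r ≤ nb Z := by
      have : r ≠ 0 := by rintro rfl; norm_num at hr
      exact pow_le_of_le_one h4 h5 this
    nlinarith
  have hZ0 : (fun p : Fin r × Fin r => Z p.1 p.2) ≠ 0 := by
    intro h0
    have : nb Z = 0 := by rw [nb, h0, norm_zero]
    rw [this] at hnbZ; linarith
  obtain ⟨⟨p, q⟩, hy1, hy2, hy3, hy4⟩ := exists_normalize _ hZ0
  obtain ⟨y, hy⟩ : ∃ y, y = Z p q := ⟨_, rfl⟩
  simp only [← hy] at hy1 hy2 hy3 hy4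
  obtain ⟨Y, hY⟩ : ∃ Y, Y = y⁻¹ • Z := ⟨_, rfl⟩
  have hZY : Z = y • Y := by rw [hY, smul_smul, mul_inv_cancel₀ hy2, one_smul]
  have hyn : ‖y‖ = nb Z := hy1
  have hYnb : nb Y ≤ 1 := nb_le zero_le_one fun i j => by rw [hY]; exact hy3 (i, j)
  obtain ⟨g1, g2, κ, b1, b1', b2, b2', bκ, bκ', b0, bf, bu, hpq⟩ := huni Y hYnb ⟨p, q, by rw [hY]; exact hy4⟩
  obtain ⟨X, hX⟩ : ∃ X, X = θ⁻¹ ^ N • ψ (h ^ N) := ⟨_, rfl⟩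
  obtain ⟨E0, hE0⟩ : ∃ E0, E0 = X - vecMulVec u f := ⟨_, rfl⟩
  have hXE : ψ (h ^ N) = θ ^ N • (vecMulVec u f + E0) := by
    rw [hE0, add_sub_cancel, hX, smul_smul, ← mul_pow, mul_inv_cancel₀ hθ0, one_pow, one_smul]
  have hE0n : nb E0 ≤ ε := nb_le hε0.le fun i j => by
    rw [hE0, hX]; exact hN1 i j
  obtain ⟨kk, hkk⟩ : ∃ kk : Fin 2 → Q, kk = fun i => if i = 0 then 1 else κ := ⟨_, rfl⟩
  obtain ⟨a0, ha0⟩ : ∃ a0, a0 = h ^ N * g1 * (h ^ N)⁻¹ * g2 := ⟨_, rfl⟩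
  obtain ⟨fb, hfb⟩ : ∃ fb : Bool → Fin r → k, fb = fun b => if b then f ᵥ* ψ g1 ᵥ* Y ᵥ* ψ g2 else f ᵥ* ψ g1⁻¹ ᵥ* Y := ⟨_, rfl⟩
  obtain ⟨ub, hub⟩ : ∃ ub : Bool → Fin r → k, ub = fun b => if b then u else ψ g2⁻¹ *ᵥ u := ⟨_, rfl⟩
  obtain ⟨Eb, hEb⟩ : ∃ Eb : Bool → Matrix (Fin r) (Fin r) k, Eb = fun b => if b then E0 * ψ g1 * Y * ψ g2 else
    ψ g2⁻¹ * E0 * ψ g1⁻¹ * Y := ⟨_, rfl⟩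
  obtain ⟨hp1, hp2⟩ := hpq fb ub (by simp [hfb]) (by simp [hub]) (by simp [hfb]) (by simp [hub])
  have key : ∀ b : Bool, ψ (if b then a0 else a0⁻¹) = (θ ^ N * y) • (vecMulVec (ub b) (fb b) + Eb b) := by
    intro b
    cases b
    · have : a0⁻¹ = g2⁻¹ * (h ^ N) * g1⁻¹ * (h ^ N)⁻¹ := by rw [ha0]; group
      simp only [Bool.false_eq_true, if_false, hub, hfb, hEb]
      rw [this, map_mul, map_mul, map_mul, ← hZ, hZY, hXE]
      have e : vecMulVec (ψ g2⁻¹ *ᵥ u) (f ᵥ* ψ g1⁻¹ ᵥ* Y) = ψ g2⁻¹ * vecMulVec u f * ψ g1⁻¹ * Y := by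
        rw [mul_vecMulVec, vecMulVec_mul, vecMulVec_mul]
      rw [e]
      simp only [mul_smul_comm, smul_mul_assoc, smul_smul, mul_add, add_mul, mul_comm y]
    · simp only [if_true, hub, hfb, hEb]
      rw [ha0, map_mul, map_mul, map_mul, ← hZ, hZY, hXE]
      have e : vecMulVec u (f ᵥ* ψ g1 ᵥ* Y ᵥ* ψ g2) = vecMulVec u f * ψ g1 * Y * ψ g2 := by
        rw [vecMulVec_mul, vecMulVec_mul, vecMulVec_mul]
      rw [e]
      simp only [mul_smul_comm, smul_mul_assoc, smul_smul, mul_add, add_mul, mul_comm y]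
  have hM0 : 0 ≤ M := by linarith
  have hkkM : ∀ i, nb (ψ (kk i)) ≤ M ∧ nb (ψ (kk i)⁻¹) ≤ M := by
    intro i
    rw [hkk]
    by_cases hi : i = 0
    · simp only [hi, if_true, inv_one]; exact ⟨b0, b0⟩
    · simp only [hi, if_false]; exact ⟨bκ, bκ'⟩
  have mB : ∀ (A C : Matrix (Fin r) (Fin r) k) (s t : ℝ), 0 ≤ s → nb A ≤ s → nb C ≤ t → nb (A * C) ≤ r * (s * t) := by
    intro A C s t hs h1 h2
    refine (nb_mul A C).trans ?_
    rw [Fintype.card_fin]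
    exact mul_le_mul_of_nonneg_left (mul_le_mul h1 h2 (nb_nonneg _) hs) (by positivity)
  have vB : ∀ (v : Fin r → k) (C : Matrix (Fin r) (Fin r) k) (s t : ℝ), 0 ≤ s → ‖v‖ ≤ s → nb C ≤ t → ‖v ᵥ* C‖ ≤ r * (s * t) := by
    intro A C s t hs h1 h2
    refine (nb_vecMul C A).trans ?_
    rw [Fintype.card_fin]
    exact mul_le_mul_of_nonneg_left (mul_le_mul h1 h2 (nb_nonneg _) hs) (by positivity)
  have wB : ∀ (v : Fin r → k) (C : Matrix (Fin r) (Fin r) k) (s t : ℝ), 0 ≤ s → nb C ≤ s → ‖v‖ ≤ t → ‖C *ᵥ v‖ ≤ r * (s * t) := by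
    intro A C s t hs h1 h2
    refine (nb_mulVec C A).trans ?_
    rw [Fintype.card_fin]
    exact mul_le_mul_of_nonneg_left (mul_le_mul h1 h2 (norm_nonneg _) hs) (by positivity)
  have hrM : 1 ≤ r * M := one_le_mul_of_one_le_of_one_le hr hM1
  have hrM2 : 1 ≤ (r * M) ^ 2 := one_le_pow₀ hrM
  refine ⟨fun i => kk i * a0 * (kk i)⁻¹, θ ^ N * y, fun x => ψ (kk x.1) *ᵥ ub x.2, fun x => fb x.2 ᵥ* ψ (kk x.1)⁻¹,
    fun x => ψ (kk x.1) * Eb x.2 * ψ (kk x.1)⁻¹, B, ρ, δ, η, K, hρ0, hη, hB0, hK0, ?_, ?_, ?_, ?_, ?_, ?_, ?_, ?_, ?_, ?_⟩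
  · rintro ⟨i, b⟩
    have h1 : lett (fun i => kk i * a0 * (kk i)⁻¹) (i, b) = kk i * (if b then a0 else a0⁻¹) * (kk i)⁻¹ := by
      cases b
      · simp [lett, mul_assoc]
      · simp [lett]
    rw [h1, map_mul, map_mul, key]
    rw [mul_smul_comm, smul_mul_assoc, mul_add, add_mul, mul_vecMulVec, vecMulVec_mul]
  · rintro ⟨i, b⟩ i' j'
    refine (nb_entry _ i' j').trans_lt ?_
    have h1 : nb (Eb b) ≤ r ^ 3 * M ^ 2 * ε := by
      cases b
      · have := mB _ _ _ _ (by positivity) (mB _ _ _ _ (by positivity) (mB _ _ _ _ (by positivity) b2' hE0n) b1') hYnb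
        simp only [hEb, Bool.false_eq_true, if_false]
        refine this.trans (le_of_eq (by ring))
      · have := mB _ _ _ _ (by positivity) (mB _ _ _ _ (by positivity) (mB _ _ _ _ (by positivity) hE0n b1) hYnb) b2
        simp only [hEb, if_true]
        refine this.trans (le_of_eq (by ring))
    have h2 := mB _ _ _ _ (by positivity) (mB _ _ _ _ (by positivity) (hkkM i).1 h1) (hkkM i).2
    refine h2.trans_lt ?_
    calc _ = (r ^ 5 * M ^ 4) * ε := by ring
      _ = δ / 2 := by rw [hε]; field_simp
      _ < δ := by linarith
  · rintro ⟨i, b⟩ i'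
    refine (norm_le_pi_norm _ i').trans_lt ?_
    have h1 : ‖ub b‖ ≤ r * M ^ 2 := by
      cases b
      · simp only [hub, Bool.false_eq_true, if_false]
        exact (wB _ _ _ _ (by positivity) b2' bu).trans (le_of_eq (by ring))
      · simp only [hub, if_true]
        refine bu.trans ?_
        nlinarith
    refine (wB _ _ _ _ (by positivity) (hkkM i).1 h1).trans_lt ?_
    rw [hB]
    have e1 : r * (M * (r * M ^ 2)) = (r * M) ^ 2 * M := by ring
    have e2 : (r:ℝ) ^ 4 * M ^ 4 = (r * M) ^ 2 * ((r * M) * (r * M)) := by ring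
    have e3 : M ≤ (r * M) * (r * M) := by nlinarith
    rw [e1, e2]
    nlinarith
  · rintro ⟨i, b⟩ i'
    refine (norm_le_pi_norm _ i').trans_lt ?_
    have h1 : ‖fb b‖ ≤ r ^ 3 * M ^ 3 := by
      cases b
      · simp only [hfb, Bool.false_eq_true, if_false]
        refine (vB _ _ _ _ (by positivity) (vB _ _ _ _ (by positivity) bf b1') hYnb).trans ?_
        have e1 : r * (r * (M * M) * 1) = (r * M) * (r * M) := by ring
        have e2 : (r:ℝ) ^ 3 * M ^ 3 = (r * M) * (r * M) * (r * M) := by ring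
        rw [e1, e2]
        nlinarith
      · simp only [hfb, if_true]
        refine (vB _ _ _ _ (by positivity) (vB _ _ _ _ (by positivity) (vB _ _ _ _ (by positivity) bf b1) hYnb) b2).trans ?_
        exact le_of_eq (by ring)
    refine (vB _ _ _ _ (by positivity) h1 (hkkM i).2).trans_lt ?_
    rw [hB]
    have : (r:ℝ) * (r ^ 3 * M ^ 3 * M) = r ^ 4 * M ^ 4 := by ring
    linarith
  · rintro ⟨i, b⟩ ⟨j, b'⟩ hxy
    have h1 : (fb b ᵥ* ψ (kk i)⁻¹) ⬝ᵥ (ψ (kk j) *ᵥ ub b') = fb b ⬝ᵥ (ψ ((kk i)⁻¹ * kk j) *ᵥ ub b') := by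
      rw [← dotProduct_mulVec, mulVec_mulVec, ← map_mul]
    show η < ‖(fb b ᵥ* ψ (kk i)⁻¹) ⬝ᵥ (ψ (kk j) *ᵥ ub b')‖
    rw [h1]
    by_cases hij : i = j
    · subst hij
      have hb : b' = b := by
        have e : ∀ b b' : Bool, b' ≠ !b → b' = b := by decide
        exact e b b' fun h => hxy (by rw [h]; rfl)
      subst hb
      rw [inv_mul_cancel, map_one, one_mulVec]
      exact hp1 b'
    · have : (kk i)⁻¹ * kk j = if (decide (i = 0)) then κ else κ⁻¹ := by
        rw [hkk]
        have e : ∀ i j : Fin 2, i ≠ j → (i = 0 ∧ j = 1) ∨ (i = 1 ∧ j = 0) := by decide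
        rcases e i j hij with ⟨rfl, rfl⟩ | ⟨rfl, rfl⟩ <;> simp
      rw [this]
      exact hp2 b b' _
  · rw [norm_mul, norm_pow, hyn]
    have h3 : (0 : ℝ) < r.factorial := by exact_mod_cast r.factorial_pos
    have h4 : 0 < nb Z := by
      by_contra hc
      push Not at hc
      nlinarith
    calc K ≤ K * (r.factorial * nb Z) := le_mul_of_one_le_right hK0.le hnbZ
      _ = (K * r.factorial) * nb Z := by ring
      _ < _ := by gcongr
  · rw [hρ]; apply le_of_eq; field_simp
  · rw [hδ]; apply le_of_eq; field_simp
  · have : K * (η / 2) = 1 + (4 * r * B ^ 2 / η ^ 2 + 1) * (η / 2) := by rw [hK]; field_simp; ring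
    rw [this]
    have : 0 < (4 * r * B ^ 2 / η ^ 2 + 1) * (η / 2) := by positivity
    linarith
  · have : K * (η / 2) * (η / 2) = r * (B * B) + (2 / η + 1) * (η / 2) * (η / 2) := by rw [hK]; field_simp; ring
    rw [this]
    have : 0 < (2 / η + 1) * (η / 2) * (η / 2) := by positivity
    linarith

end LG

namespace LG
open Matrix Filter Topology

/-- eventually multiplicative evaluation maps -/
structure EvHom {k : Type*} [Field k] (U : Filter ℕ) {L : ℕ → Type*} [∀ n, Field (L n)] (ev : ∀ n, k → L n) : Prop where
  add : ∀ a b, ∀ᶠ n in U, ev n (a + b) = ev n a + ev n b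
  mul : ∀ a b, ∀ᶠ n in U, ev n (a * b) = ev n a * ev n b
  one : ∀ᶠ n in U, ev n 1 = 1

namespace EvHom
variable {k : Type*} [Field k] {U : Filter ℕ} {L : ℕ → Type*} [∀ n, Field (L n)] {ev : ∀ n, k → L n}

lemma zero (h : EvHom U ev) : ∀ᶠ n in U, ev n 0 = 0 := by
  filter_upwards [h.add 0 0] with n hn
  rw [add_zero] at hn
  exact left_eq_add.mp hn

lemma neg (h : EvHom U ev) (a : k) : ∀ᶠ n in U, ev n (-a) = -ev n a := by
  filter_upwards [h.zero, h.add a (-a)] with n h0 h1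
  rw [add_neg_cancel, h0] at h1
  exact (neg_eq_of_add_eq_zero_right h1.symm).symm

lemma sub (h : EvHom U ev) (a b : k) : ∀ᶠ n in U, ev n (a - b) = ev n a - ev n b := by
  filter_upwards [h.neg b, h.add a (-b)] with n h0 h1
  rw [sub_eq_add_neg, h1, h0, sub_eq_add_neg]

lemma inv (h : EvHom U ev) (a : k) : ∀ᶠ n in U, ev n (a⁻¹) = (ev n a)⁻¹ := by
  by_cases ha : a = 0
  · subst ha
    filter_upwards [h.zero] with n h0
    rw [_root_.inv_zero, h0, _root_.inv_zero]
  · filter_upwards [h.mul a a⁻¹, h.one] with n h1 h2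
    rw [mul_inv_cancel₀ ha, h2] at h1
    exact eq_inv_of_mul_eq_one_right h1.symm

lemma ne_zero (h : EvHom U ev) {a : k} (ha : a ≠ 0) : ∀ᶠ n in U, ev n a ≠ 0 := by
  filter_upwards [h.mul a a⁻¹, h.one] with n h1 h2 h3
  rw [mul_inv_cancel₀ ha, h2, h3, zero_mul] at h1
  exact one_ne_zero h1

lemma sum (h : EvHom U ev) {ι : Type*} (s : Finset ι) (f : ι → k) :
    ∀ᶠ n in U, ev n (∑ i ∈ s, f i) = ∑ i ∈ s, ev n (f i) := by
  classical
  induction s using Finset.induction_on with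
  | empty => simpa using h.zero
  | insert a s ha ih =>
    filter_upwards [ih, h.add (f a) (∑ i ∈ s, f i)] with n h1 h2
    rw [Finset.sum_insert ha, Finset.sum_insert ha, h2, h1]

lemma prod (h : EvHom U ev) {ι : Type*} (s : Finset ι) (f : ι → k) :
    ∀ᶠ n in U, ev n (∏ i ∈ s, f i) = ∏ i ∈ s, ev n (f i) := by
  classical
  induction s using Finset.induction_on with
  | empty => simpa using h.one
  | insert a s ha ih =>
    filter_upwards [ih, h.mul (f a) (∏ i ∈ s, f i)] with n h1 h2
    rw [Finset.prod_insert ha, Finset.prod_insert ha, h2, h1]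

lemma pow (h : EvHom U ev) (a : k) (m : ℕ) : ∀ᶠ n in U, ev n (a ^ m) = ev n a ^ m := by
  have := h.prod (Finset.range m) (fun _ => a)
  simpa using this

lemma comp {k' : Type*} [Field k'] (h : EvHom U ev) (f : k' →+* k) : EvHom U (fun n x => ev n (f x)) :=
  ⟨fun a b => by simpa using h.add (f a) (f b), fun a b => by simpa using h.mul (f a) (f b), by simpa using h.one⟩

variable {ι κ μ : Type*} [Fintype ι] [Fintype κ] [Fintype μ]

lemma mat_mul (h : EvHom U ev) (A : Matrix ι κ k) (B : Matrix κ μ k) :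
    ∀ᶠ n in U, (A * B).map (ev n) = A.map (ev n) * B.map (ev n) := by
  have : ∀ i j, ∀ᶠ n in U, ev n ((A * B) i j) = (A.map (ev n) * B.map (ev n)) i j := by
    intro i j
    have h2 : ∀ l, ∀ᶠ n in U, ev n (A i l * B l j) = ev n (A i l) * ev n (B l j) := fun l => h.mul _ _
    filter_upwards [h.sum Finset.univ (fun l => A i l * B l j), eventually_all.mpr h2] with n h3 h4
    rw [mul_apply, h3, mul_apply]
    exact Finset.sum_congr rfl fun l _ => h4 l
  filter_upwards [eventually_all.mpr fun i => eventually_all.mpr (this i)] with n hn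
  ext i j
  exact hn i j

lemma mat_one [DecidableEq ι] (h : EvHom U ev) : ∀ᶠ n in U, (1 : Matrix ι ι k).map (ev n) = 1 := by
  filter_upwards [h.zero, h.one] with n h0 h1
  exact Matrix.map_one _ h0 h1

lemma mat_smul (h : EvHom U ev) (c : k) (A : Matrix ι κ k) :
    ∀ᶠ n in U, (c • A).map (ev n) = ev n c • A.map (ev n) := by
  have : ∀ i j, ∀ᶠ n in U, ev n (c * A i j) = ev n c * ev n (A i j) := fun i j => h.mul _ _
  filter_upwards [eventually_all.mpr fun i => eventually_all.mpr (this i)] with n hn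
  ext i j
  exact hn i j

lemma mat_add (h : EvHom U ev) (A B : Matrix ι κ k) :
    ∀ᶠ n in U, (A + B).map (ev n) = A.map (ev n) + B.map (ev n) := by
  have : ∀ i j, ∀ᶠ n in U, ev n (A i j + B i j) = ev n (A i j) + ev n (B i j) := fun i j => h.add _ _
  filter_upwards [eventually_all.mpr fun i => eventually_all.mpr (this i)] with n hn
  ext i j
  exact hn i j

lemma mat_vecMulVec (h : EvHom U ev) (u : ι → k) (f : κ → k) :
    ∀ᶠ n in U, (vecMulVec u f).map (ev n) = vecMulVec (fun i => ev n (u i)) (fun i => ev n (f i)) := by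
  have : ∀ i j, ∀ᶠ n in U, ev n (u i * f j) = ev n (u i) * ev n (f j) := fun i j => h.mul _ _
  filter_upwards [eventually_all.mpr fun i => eventually_all.mpr (this i)] with n hn
  ext i j
  exact hn i j

lemma dot (h : EvHom U ev) (u f : ι → k) :
    ∀ᶠ n in U, ev n (u ⬝ᵥ f) = (fun i => ev n (u i)) ⬝ᵥ (fun i => ev n (f i)) := by
  have h2 : ∀ l, ∀ᶠ n in U, ev n (u l * f l) = ev n (u l) * ev n (f l) := fun l => h.mul _ _
  filter_upwards [h.sum Finset.univ (fun l => u l * f l), eventually_all.mpr h2] with n h3 h4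
  rw [dotProduct, h3]
  exact Finset.sum_congr rfl fun l _ => h4 l

lemma mat_trace (h : EvHom U ev) (A : Matrix ι ι k) : ∀ᶠ n in U, ev n A.trace = (A.map (ev n)).trace := by
  filter_upwards [h.sum Finset.univ (fun i => A i i)] with n hn
  exact hn

lemma mat_det [DecidableEq ι] (h : EvHom U ev) (A : Matrix ι ι k) : ∀ᶠ n in U, ev n A.det = (A.map (ev n)).det := by
  simp only [det_apply']
  have h1 : ∀ σ : Equiv.Perm ι, ∀ᶠ n in U, ev n (((Equiv.Perm.sign σ : ℤ) : k) * ∏ i, A (σ i) i) =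
      ((Equiv.Perm.sign σ : ℤ) : L n) * ∏ i, ev n (A (σ i) i) := by
    intro σ
    rcases Int.units_eq_one_or (Equiv.Perm.sign σ) with hs | hs
    · simpa [hs] using h.prod _ _
    · filter_upwards [h.prod Finset.univ (fun i => A (σ i) i), h.neg (∏ i, A (σ i) i)] with n h1 h2
      simp [hs, h1, h2]
  filter_upwards [eventually_all.mpr h1, h.sum Finset.univ (fun σ : Equiv.Perm ι => ((Equiv.Perm.sign σ : ℤ) : k) * ∏ i, A (σ i) i)] with n h2 h3
  rw [h3]
  exact Finset.sum_congr rfl fun σ _ => h2 σ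

end EvHom

section good
variable {U : Filter ℕ} {L : ℕ → Type*} [∀ n, Field (L n)] {Q : Type*} [Group Q]
variable {ι κ μ : Type*} [Fintype ι] [Fintype κ] [Fintype μ] [DecidableEq ι] [DecidableEq κ] [DecidableEq μ]

/-- words killed by the first family are killed by the second one -/
def Good (U : Filter ℕ) (Φ : Q → ∀ n, Matrix ι ι (L n)) (Ψ : Q → ∀ n, Matrix κ κ (L n)) : Prop :=
  ∀ a : Fin 2 → Q, ∀ᶠ n in U, ∀ l : List (Fin 2 × Bool),
    (l.map fun x => Φ (lett a x) n).prod = 1 → (l.map fun x => Ψ (lett a x) n).prod = 1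

lemma Good.refl (Φ : Q → ∀ n, Matrix ι ι (L n)) : Good U Φ Φ := fun _ => Eventually.of_forall fun _ _ h => h

lemma Good.trans {Φ : Q → ∀ n, Matrix ι ι (L n)} {Ψ : Q → ∀ n, Matrix κ κ (L n)} {X : Q → ∀ n, Matrix μ μ (L n)}
    (h1 : Good U Φ Ψ) (h2 : Good U Ψ X) : Good U Φ X := fun a => by
  filter_upwards [h1 a, h2 a] with n h3 h4 l hl
  exact h4 l (h3 l hl)

lemma good_sub {Φ : Q → ∀ n, Matrix ι ι (L n)} {Ψ : Q → ∀ n, Matrix κ κ (L n)} (C : ∀ n, Matrix ι κ (L n))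
    (D : ∀ n, Matrix κ ι (L n)) (hDC : ∀ᶠ n in U, D n * C n = 1) (h : ∀ g, ∀ᶠ n in U, C n * Ψ g n = Φ g n * C n) :
    Good U Φ Ψ := by
  intro a
  filter_upwards [hDC, eventually_all.mpr fun x => h (lett a x)] with n h1 h2 l hl
  have : ∀ l : List (Fin 2 × Bool), C n * (l.map fun x => Ψ (lett a x) n).prod =
      (l.map fun x => Φ (lett a x) n).prod * C n := by
    intro l
    induction l with
    | nil => simp
    | cons x l ih => rw [List.map_cons, List.prod_cons, List.map_cons, List.prod_cons, ← Matrix.mul_assoc, h2,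
        Matrix.mul_assoc, ih, Matrix.mul_assoc]
  have h3 := congrArg (D n * ·) (this l)
  simp only [hl, Matrix.one_mul, ← Matrix.mul_assoc, h1] at h3
  exact h3

lemma good_quot {Φ : Q → ∀ n, Matrix ι ι (L n)} {Ψ : Q → ∀ n, Matrix κ κ (L n)} (R : ∀ n, Matrix κ ι (L n))
    (E : ∀ n, Matrix ι κ (L n)) (hRE : ∀ᶠ n in U, R n * E n = 1) (h : ∀ g, ∀ᶠ n in U, Ψ g n * R n = R n * Φ g n) :
    Good U Φ Ψ := by
  intro a
  filter_upwards [hRE, eventually_all.mpr fun x => h (lett a x)] with n h1 h2 l hl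
  have : ∀ l : List (Fin 2 × Bool), (l.map fun x => Ψ (lett a x) n).prod * R n =
      R n * (l.map fun x => Φ (lett a x) n).prod := by
    intro l
    induction l with
    | nil => simp
    | cons x l ih => rw [List.map_cons, List.prod_cons, List.map_cons, List.prod_cons, Matrix.mul_assoc, ih,
        ← Matrix.mul_assoc, h2, Matrix.mul_assoc]
  have h3 := congrArg (· * E n) (this l)
  simp only [hl, Matrix.mul_one, Matrix.mul_assoc, h1] at h3
  exact h3

lemma good_hom {Φ : Q → ∀ n, Matrix ι ι (L n)} {Ψ : Q → ∀ n, Matrix κ κ (L n)}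
    (T : ∀ n, Matrix ι ι (L n) →* Matrix κ κ (L n)) (h : ∀ g, ∀ᶠ n in U, Ψ g n = T n (Φ g n)) : Good U Φ Ψ := by
  intro a
  filter_upwards [eventually_all.mpr fun x => h (lett a x)] with n h2 l hl
  have : (l.map fun x => Ψ (lett a x) n) = (l.map fun x => Φ (lett a x) n).map (T n) := by
    rw [List.map_map]
    exact List.map_congr_left fun x _ => h2 x
  rw [this, ← map_list_prod, hl, map_one]

variable {k : Type*} [Field k]
/-- evaluated representation -/
def em (ev : ∀ n, k → L n) (ψ : Q →* Matrix ι ι k) (g : Q) (n : ℕ) : Matrix ι ι (L n) := (ψ g).map (ev n)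

lemma em_sub {ev : ∀ n, k → L n} (hev : EvHom U ev) (φ : Q →* Matrix ι ι k) (ψ : Q →* Matrix κ κ k)
    (C : Matrix ι κ k) (D : Matrix κ ι k) (hDC : D * C = 1) (h : ∀ g, C * ψ g = φ g * C) :
    Good U (em ev φ) (em ev ψ) := by
  refine good_sub (fun n => C.map (ev n)) (fun n => D.map (ev n)) ?_ fun g => ?_
  · filter_upwards [hev.mat_mul D C, hev.mat_one (ι := κ)] with n h1 h2
    rw [← h1, hDC, h2]
  · filter_upwards [hev.mat_mul C (ψ g), hev.mat_mul (φ g) C] with n h1 h2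
    rw [em, em, ← h1, ← h2, h]

lemma em_quot {ev : ∀ n, k → L n} (hev : EvHom U ev) (φ : Q →* Matrix ι ι k) (ψ : Q →* Matrix κ κ k)
    (R : Matrix κ ι k) (E : Matrix ι κ k) (hRE : R * E = 1) (h : ∀ g, ψ g * R = R * φ g) :
    Good U (em ev φ) (em ev ψ) := by
  refine good_quot (fun n => R.map (ev n)) (fun n => E.map (ev n)) ?_ fun g => ?_
  · filter_upwards [hev.mat_mul R E, hev.mat_one (ι := κ)] with n h1 h2
    rw [← h1, hRE, h2]
  · filter_upwards [hev.mat_mul (ψ g) R, hev.mat_mul R (φ g)] with n h1 h2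
    rw [em, em, ← h1, ← h2, h]

open Kronecker in
/-- `A ↦ A ⊗ (A⁻¹)ᵀ` -/
noncomputable def Kr (F : Type*) [Field F] (ι : Type*) [Fintype ι] [DecidableEq ι] : Matrix ι ι F →* Matrix (ι × ι) (ι × ι) F where
  toFun A := A ⊗ₖ (A⁻¹)ᵀ
  map_one' := by simp
  map_mul' A B := by rw [Matrix.mul_inv_rev, transpose_mul, mul_kronecker_mul]

lemma rep_inv (φ : Q →* Matrix ι ι k) (g : Q) : (φ g)⁻¹ = φ g⁻¹ :=
  inv_eq_right_inv (by rw [← map_mul, mul_inv_cancel, map_one])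

lemma em_inv {ev : ∀ n, k → L n} (hev : EvHom U ev) (φ : Q →* Matrix ι ι k) (g : Q) :
    ∀ᶠ n in U, (em ev φ g n)⁻¹ = em ev φ g⁻¹ n := by
  filter_upwards [hev.mat_mul (φ g) (φ g⁻¹), hev.mat_one (ι := ι)] with n h1 h2
  refine inv_eq_right_inv ?_
  rw [em, em, ← h1, ← map_mul, mul_inv_cancel, map_one, h2]

lemma em_Kr {ev : ∀ n, k → L n} (hev : EvHom U ev) (φ : Q →* Matrix ι ι k) :
    Good U (em ev φ) (em ev ((Kr k ι).comp φ)) := by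
  refine good_hom (fun n => Kr (L n) ι) fun g => ?_
  have h1 : ∀ p q : ι × ι, ∀ᶠ n in U, ev n (φ g p.1 q.1 * φ g⁻¹ q.2 p.2) = ev n (φ g p.1 q.1) * ev n (φ g⁻¹ q.2 p.2) :=
    fun p q => hev.mul _ _
  filter_upwards [em_inv hev φ g, eventually_all.mpr fun p => eventually_all.mpr (h1 p)] with n h2 h3
  ext p q
  show ev n ((φ g) p.1 q.1 * ((φ g)⁻¹)ᵀ p.2 q.2) = em ev φ g n p.1 q.1 * ((em ev φ g n)⁻¹)ᵀ p.2 q.2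
  rw [h2, rep_inv, transpose_apply, h3, transpose_apply, em, em, map_apply, map_apply]

/-- tensor power of `1 ⊕ A` -/
def TT (F : Type*) [Field F] (κ : Type*) [Fintype κ] [DecidableEq κ] :
    Matrix κ κ F →* Matrix (κ → κ ⊕ κ) (κ → κ ⊕ κ) F where
  toFun A := tpow κ (fromBlocks 1 0 0 A)
  map_one' := by rw [fromBlocks_one, tpow_one]
  map_mul' a b := by
    rw [← tpow_mul, fromBlocks_multiply]; simp

lemma em_Trep {ev : ∀ n, k → L n} (hev : EvHom U ev) (φ : Q →* Matrix ι ι k) :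
    Good U (em ev φ) (em ev (Trep φ)) := by
  refine good_hom (fun n => TT (L n) ι) fun g => ?_
  have h1 : ∀ p q : ι → ι ⊕ ι, ∀ᶠ n in U, ev n (∏ i, fromBlocks 1 0 0 (φ g) (p i) (q i)) =
      ∏ i, ev n (fromBlocks 1 0 0 (φ g) (p i) (q i)) := fun p q => hev.prod _ _
  filter_upwards [hev.zero, hev.mat_one (ι := ι), eventually_all.mpr fun p => eventually_all.mpr (h1 p)] with n h2 h3 h4
  ext p q
  show ev n (∏ i, fromBlocks 1 0 0 (φ g) (p i) (q i)) = ∏ i, fromBlocks 1 0 0 (em ev φ g n) (p i) (q i)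
  rw [h4]
  refine Finset.prod_congr rfl fun i _ => ?_
  rw [← Matrix.map_apply (f := ev n) (M := fromBlocks 1 0 0 (φ g)), fromBlocks_map, h3]
  congr 2 <;> ext i j <;> simp [h2]

end good
end LG

namespace LG
open Matrix Filter Topology

/-- an algebra of functions on a group which is a domain, stable under inversion -/
structure Dom {k Q : Type*} [Field k] [Group Q] (𝒜 : Subalgebra k (Q → k)) : Prop where
  dom : ∀ f ∈ 𝒜, ∀ g ∈ 𝒜, f * g = 0 → f = 0 ∨ g = 0
  inv : ∀ f ∈ 𝒜, (fun x => f x⁻¹) ∈ 𝒜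

section
variable {k Q : Type*} [Field k] [Group Q] {𝒜 : Subalgebra k (Q → k)}

lemma Dom.prod_ne (h : Dom 𝒜) {J : Type*} [Fintype J] (f : J → Q → k) (hf : ∀ i, f i ∈ 𝒜) (h0 : ∀ i, f i ≠ 0) :
    ∃ g, ∀ i, f i g ≠ 0 := by
  classical
  have : ∀ s : Finset J, ∏ i ∈ s, f i ≠ 0 ∧ ∏ i ∈ s, f i ∈ 𝒜 := by
    intro s
    induction s using Finset.induction_on with
    | empty =>
      refine ⟨?_, by simpa using 𝒜.one_mem⟩
      intro h; exact one_ne_zero (congrFun h 1)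
    | insert a s ha ih =>
      rw [Finset.prod_insert ha]
      refine ⟨fun h1 => ?_, mul_mem (hf a) ih.2⟩
      rcases h.dom _ (hf a) _ ih.2 h1 with h2 | h2
      · exact h0 a h2
      · exact ih.1 h2
  have h1 := (this Finset.univ).1
  obtain ⟨g, hg⟩ := Function.ne_iff.mp h1
  refine ⟨g, fun i => ?_⟩
  rw [Finset.prod_apply, Pi.zero_apply] at hg
  exact Finset.prod_ne_zero_iff.mp hg i (Finset.mem_univ i)

/-- coefficients in 𝒜 -/
def Coef {ι κ : Type*} (𝒜 : Subalgebra k (Q → k)) (ψ : Q → Matrix ι κ k) : Prop := ∀ i j, (fun g => ψ g i j) ∈ 𝒜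

variable {ι κ μ : Type*} [Fintype ι] [Fintype κ] [Fintype μ]

lemma Coef.mul {ψ : Q → Matrix ι κ k} {χ : Q → Matrix κ μ k} (h1 : Coef 𝒜 ψ) (h2 : Coef 𝒜 χ) :
    Coef 𝒜 (fun g => ψ g * χ g) := by
  intro i j
  have : (fun g => (ψ g * χ g) i j) = ∑ l, (fun g => ψ g i l) * (fun g => χ g l j) := by
    ext g; simp [mul_apply]
  rw [this]
  exact sum_mem fun l _ => mul_mem (h1 i l) (h2 l j)

lemma Coef.const (A : Matrix ι κ k) : Coef 𝒜 (fun _ : Q => A) := fun i j => 𝒜.algebraMap_mem (A i j)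

lemma Coef.inv (hD : Dom 𝒜) {ψ : Q → Matrix ι κ k} (h : Coef 𝒜 ψ) : Coef 𝒜 (fun g => ψ g⁻¹) :=
  fun i j => hD.inv _ (h i j)

lemma Coef.sandwich {ψ : Q → Matrix ι κ k} (h : Coef 𝒜 ψ) (lam : ι → k) (w : κ → k) :
    (fun g => lam ⬝ᵥ (ψ g *ᵥ w)) ∈ 𝒜 := by
  have : (fun g => lam ⬝ᵥ (ψ g *ᵥ w)) = ∑ i, ∑ j, (lam i * w j) • (fun g => ψ g i j) := by
    ext g
    simp only [dotProduct, mulVec, Finset.sum_apply, Pi.smul_apply, smul_eq_mul, Finset.mul_sum]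
    refine Finset.sum_congr rfl fun i _ => Finset.sum_congr rfl fun j _ => by ring
  rw [this]
  exact sum_mem fun i _ => sum_mem fun j _ => 𝒜.smul_mem (h i j) _

lemma Coef.trace {ψ : Q → Matrix ι ι k} (h : Coef 𝒜 ψ) : (fun g => (ψ g).trace) ∈ 𝒜 := by
  have : (fun g => (ψ g).trace) = ∑ i, (fun g => ψ g i i) := by ext g; simp [Matrix.trace]
  rw [this]
  exact sum_mem fun i _ => h i i

lemma Coef.Trep [DecidableEq κ] {c : Q →* Matrix κ κ k} (h : Coef 𝒜 c) : Coef 𝒜 (Trep c) := by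
  intro a b
  have : (fun g => LG.Trep c g a b) = ∏ i, (fun g => fromBlocks 1 0 0 (c g) (a i) (b i)) := by
    ext g; simp [Trep_apply, tpow]
  rw [this]
  refine prod_mem fun i _ => ?_
  rcases a i with x | x <;> rcases b i with y | y
  · exact 𝒜.algebraMap_mem ((1 : Matrix κ κ k) x y)
  · exact 𝒜.algebraMap_mem 0
  · exact 𝒜.algebraMap_mem 0
  · exact h x y
end

theorem transferF {k : Type*} [NormedField k] [IsAlgClosed k] {Q : Type*} [Group Q] {𝒜 : Subalgebra k (Q → k)} (hD : Dom 𝒜)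
    {κ : Type*} [Fintype κ] [DecidableEq κ] (c : Q →* Matrix κ κ k) (hc : Coef 𝒜 c)
    {U : Filter ℕ} {L : ℕ → Type*} [∀ n, Field (L n)] {ev : ∀ n, k → L n} (hev : EvHom U ev)
    (vn : ∀ n, AbsoluteValue (L n) ℝ) (hlim : ∀ α, Tendsto (fun n => vn n (ev n α)) U (𝓝 ‖α‖))
    (h : Q) (hh : h ∈ commutator Q) (ν : k) (hν : (c h).charpoly.IsRoot ν) (hν1 : 1 < ‖ν‖) :
    ∃ a : Fin 2 → Q, ∀ᶠ n in U, ∀ l : List (Fin 2 × Bool), FreeGroup.IsReduced l → l ≠ [] →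
      (l.map fun x => em ev c (lett a x) n).prod ≠ 1 := by
  obtain ⟨s, r, ψ', ψ, R, E, C, D, f, u, θ, hRE, hDC, h1, h2, h3, hfu, hθ, hl, hnz⟩ := exists_prox c h ν hν hν1
  have hψ : Coef 𝒜 ψ := by
    have := (((Coef.const (𝒜 := 𝒜) (D * R)).mul hc.Trep).mul (Coef.const E)).mul (Coef.const C)
    intro i j
    have e := this i j
    simp only [← h3] at e
    exact e
  have hgood : Good U (em ev c) (em ev ψ) :=
    ((em_Trep hev c).trans (em_quot hev (Trep c) ψ' R E hRE h1)).trans (em_sub hev ψ' ψ C D hDC h2)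
  have hdet : (ψ h).det = 1 := by
    have hd : ∀ x : Q, IsUnit (ψ x).det := fun x => by
      have : (ψ x).det * (ψ x⁻¹).det = 1 := by rw [← det_mul, ← map_mul, mul_inv_cancel, map_one, det_one]
      exact IsUnit.of_mul_eq_one _ this
    let δ : Q →* k := Matrix.detMonoidHom.comp ψ
    have := Abelianization.commutator_subset_ker δ.toHomUnits hh
    rw [MonoidHom.mem_ker] at this
    have e := congrArg Units.val this
    simpa [δ] using e
  have hirr : ∀ lam w : Bool × Bool × Bool → Fin r → k, (∀ i, lam i ≠ 0) → (∀ i, w i ≠ 0) →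
      ∃ g : Q, ∀ i, lam i ⬝ᵥ (ψ (if i.2.2 then g else g⁻¹) *ᵥ w i) ≠ 0 := by
    intro lam w hlam hw
    refine hD.prod_ne (fun i g => lam i ⬝ᵥ (ψ (if i.2.2 then g else g⁻¹) *ᵥ w i)) (fun i => ?_) fun i h0 => ?_
    · rcases hi : i.2.2 with _ | _
      · simpa [hi] using (hψ.inv hD).sandwich (lam i) (w i)
      · simpa [hi] using hψ.sandwich (lam i) (w i)
    · obtain ⟨g, hg⟩ := hnz (lam i) (w i) (hlam i) (hw i)
      apply hg
      rcases hi : i.2.2 with _ | _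
      · have := congrFun h0 g⁻¹
        simpa [hi] using this
      · have := congrFun h0 g
        simpa [hi] using this
  obtain ⟨a, cc, uu, ff, EE, B, ρ, δ, η, K, hρ, hη, hB, hK, p1, p2, p3, p4, p5, p6, q1, q2, q3, q4⟩ :=
    pingpong ψ hirr f u hfu h hdet θ hθ hl
  refine ⟨a, ?_⟩
  have hlt : ∀ (α : k) (t : ℝ), ‖α‖ < t → ∀ᶠ n in U, vn n (ev n α) ≤ t := fun α t ht => by
    filter_upwards [(hlim α).eventually_lt_const ht] with n hn using hn.le
  have hgt : ∀ (α : k) (t : ℝ), t < ‖α‖ → ∀ᶠ n in U, t ≤ vn n (ev n α) := fun α t ht => by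
    filter_upwards [(hlim α).eventually_const_lt ht] with n hn using hn.le
  have e1 : ∀ x, ∀ᶠ n in U, em ev ψ (lett a x) n = ev n cc •
      (vecMulVec (fun i => ev n (uu x i)) (fun i => ev n (ff x i)) + (EE x).map (ev n)) := by
    intro x
    filter_upwards [hev.mat_smul cc (vecMulVec (uu x) (ff x) + EE x), hev.mat_add (vecMulVec (uu x) (ff x)) (EE x),
      hev.mat_vecMulVec (uu x) (ff x)] with n f1 f2 f3
    rw [em, p1, f1, f2, f3]
  have e2 : ∀ x i j, ∀ᶠ n in U, vn n (ev n (EE x i j)) ≤ δ := fun x i j => hlt _ _ (p2 x i j)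
  have e3 : ∀ x i, ∀ᶠ n in U, vn n (ev n (uu x i)) ≤ B := fun x i => hlt _ _ (p3 x i)
  have e4 : ∀ x i, ∀ᶠ n in U, vn n (ev n (ff x i)) ≤ B := fun x i => hlt _ _ (p4 x i)
  have e5 : ∀ x y, ∀ᶠ n in U, y ≠ linv x → η ≤ vn n ((fun i => ev n (ff x i)) ⬝ᵥ (fun i => ev n (uu y i))) := by
    intro x y
    by_cases hxy : y = linv x
    · exact Eventually.of_forall fun n h => absurd hxy h
    · filter_upwards [hgt _ _ (p5 x y hxy), hev.dot (ff x) (uu y)] with n f1 f2 _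
      rw [← f2]; exact f1
  filter_upwards [eventually_all.mpr e1, eventually_all.mpr fun x => eventually_all.mpr fun i => eventually_all.mpr (e2 x i),
    eventually_all.mpr fun x => eventually_all.mpr (e3 x), eventually_all.mpr fun x => eventually_all.mpr (e4 x),
    eventually_all.mpr fun x => eventually_all.mpr (e5 x), hgt _ _ p6, hgood a] with n f1 f2 f3 f4 f5 f6 f7 l hl hne hcon
  refine cert (vn n) (fun x => em ev ψ (lett a x) n) (fun _ => ev n cc) (fun x i => ev n (uu x i))
    (fun x i => ev n (ff x i)) (fun x => (EE x).map (ev n)) B ρ δ η K hρ hη hB hK f1 (fun x i j => f2 x i j) f3 f4 f5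
    (fun _ => f6) (by simpa using q1) (by simpa using q2) q3 (by simpa using q4) l hl hne (f7 l hcon)

end LG

namespace LG
open Matrix

section
variable {k : Type*} [Field k] [CharZero k] {ι : Type*} [Fintype ι] [DecidableEq ι]

lemma idem_trace_zero (e : Matrix ι ι k) (he : e * e = e) (h : e.trace = 0) : e = 0 := by
  have h1 : IsIdempotentElem (Matrix.toLin' e) := by
    rw [IsIdempotentElem, Module.End.mul_eq_comp, ← Matrix.toLin'_mul, he]
  have h2 := LinearMap.IsIdempotentElem.eq_zero_of_trace_eq_zero h1 (by rw [Matrix.trace_toLin'_eq, h])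
  simpa using h2

open Polynomial in
lemma nil_of_trace (a : Matrix ι ι k) (h : ∀ n : ℕ, (a ^ (n + 1)).trace = 0) : ∃ m, a ^ m = 0 := by
  obtain ⟨q, hq, hnd⟩ := exists_eq_pow_rootMultiplicity_mul_and_not_dvd (X * a.charpoly)
    (mul_ne_zero X_ne_zero a.charpoly_monic.ne_zero) 0
  rw [map_zero, sub_zero] at hq hnd
  set m := rootMultiplicity 0 (X * a.charpoly) with hm
  have hm1 : 1 ≤ m := (le_rootMultiplicity_iff (mul_ne_zero X_ne_zero a.charpoly_monic.ne_zero)).mpr (by simp)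
  have hcop : IsCoprime (X ^ m) q := by
    refine IsCoprime.pow_left ?_
    rw [Prime.coprime_iff_not_dvd prime_X]
    exact hnd
  obtain ⟨s, t, hst⟩ := hcop
  have h0 : aeval a (X ^ m * q) = 0 := by rw [← hq, map_mul, aeval_self_charpoly, mul_zero]
  set e := aeval a (s * X ^ m) with he
  have he1 : e * e = e := by
    rw [he, ← map_mul]
    have : s * X ^ m * (s * X ^ m) = s * X ^ m - (s * t) * (X ^ m * q) := by
      linear_combination (s * X ^ m) * hst
    rw [this, map_sub, map_mul _ (s * t), h0, mul_zero, sub_zero]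
  have he2 : e.trace = 0 := by
    obtain ⟨m', hm'⟩ : ∃ m', m = m' + 1 := ⟨m - 1, by lia⟩
    rw [he, hm', pow_succ, ← mul_assoc, aeval_eq_sum_range, trace_sum]
    refine Finset.sum_eq_zero fun i _ => ?_
    rcases i with _ | i
    · simp
    · rw [trace_smul, h, smul_zero]
  have he3 := idem_trace_zero e he1 he2
  refine ⟨m, ?_⟩
  have h1 : aeval a (X ^ m * (s * X ^ m + t * q)) = a ^ m := by rw [hst, mul_one]; simp
  rw [← h1, mul_add, map_add, map_mul, ← he, he3, mul_zero, zero_add,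
    show X ^ m * (t * q) = t * (X ^ m * q) by ring, map_mul, h0, mul_zero]

variable {Q : Type*} [Group Q]

/-- irreducibility -/
def Irr (ψ : Q →* Matrix ι ι k) : Prop :=
  ∀ W : Submodule k (ι → k), (∀ g, ∀ v ∈ W, ψ g *ᵥ v ∈ W) → W = ⊥ ∨ W = ⊤

/-- enveloping space of a subgroup -/
def Env (ψ : Q →* Matrix ι ι k) (Δ : Subgroup Q) : Submodule k (Matrix ι ι k) := Submodule.span k (ψ '' Δ)

lemma Env.mul {ψ : Q →* Matrix ι ι k} {Δ : Subgroup Q} {a b : Matrix ι ι k} (ha : a ∈ Env ψ Δ) (hb : b ∈ Env ψ Δ) :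
    a * b ∈ Env ψ Δ := by
  have h := Submodule.mul_mem_mul ha hb
  unfold Env at h
  rw [Submodule.span_mul_span] at h
  refine Submodule.span_mono ?_ h
  rintro _ ⟨_, ⟨x, hx, rfl⟩, _, ⟨y, hy, rfl⟩, rfl⟩
  exact ⟨x * y, mul_mem hx hy, map_mul _ _ _⟩

lemma Env.of_mem {ψ : Q →* Matrix ι ι k} {Δ : Subgroup Q} {x : Q} (hx : x ∈ Δ) : ψ x ∈ Env ψ Δ :=
  Submodule.subset_span ⟨x, hx, rfl⟩

lemma Env.one {ψ : Q →* Matrix ι ι k} {Δ : Subgroup Q} : (1 : Matrix ι ι k) ∈ Env ψ Δ := by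
  rw [← map_one ψ]; exact Env.of_mem (one_mem _)

lemma Env.conj {ψ : Q →* Matrix ι ι k} {Δ : Subgroup Q} [Δ.Normal] (g : Q) {a : Matrix ι ι k} (ha : a ∈ Env ψ Δ) :
    ψ g * a * ψ g⁻¹ ∈ Env ψ Δ := by
  induction ha using Submodule.span_induction with
  | mem x hx =>
    obtain ⟨y, hy, rfl⟩ := hx
    rw [← map_mul, ← map_mul]
    exact Env.of_mem (Subgroup.Normal.conj_mem inferInstance y hy g)
  | zero => simp
  | add x y _ _ hx hy => rw [mul_add, add_mul]; exact add_mem hx hy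
  | smul c x _ hx => rw [mul_smul_comm, smul_mul_assoc]; exact Submodule.smul_mem _ _ hx

theorem nondeg {ψ : Q →* Matrix ι ι k} (hirr : Irr ψ) (Δ : Subgroup Q) [Δ.Normal] {a : Matrix ι ι k} (ha : a ∈ Env ψ Δ)
    (h : ∀ b ∈ Env ψ Δ, (a * b).trace = 0) : a = 0 := by
  classical
  let N : Submodule k (Matrix ι ι k) :=
    { carrier := {n | n ∈ Env ψ Δ ∧ ∀ b ∈ Env ψ Δ, (n * b).trace = 0}
      zero_mem' := ⟨zero_mem _, by simp⟩
      add_mem' := fun ha hb => ⟨add_mem ha.1 hb.1, fun b hb' => by rw [add_mul, trace_add, ha.2 b hb', hb.2 b hb', add_zero]⟩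
      smul_mem' := fun c x hx => ⟨Submodule.smul_mem _ _ hx.1, fun b hb' => by
        rw [smul_mul_assoc, trace_smul, hx.2 b hb', smul_zero]⟩ }
  have hNmem : ∀ n, n ∈ N ↔ n ∈ Env ψ Δ ∧ ∀ b ∈ Env ψ Δ, (n * b).trace = 0 := fun n => Iff.rfl
  have hNr : ∀ n ∈ N, ∀ b ∈ Env ψ Δ, n * b ∈ N := fun n hn b hb =>
    ⟨Env.mul hn.1 hb, fun c hc => by rw [Matrix.mul_assoc]; exact hn.2 _ (Env.mul hb hc)⟩
  have hNnil : ∀ n ∈ N, ∃ m, n ^ m = 0 := fun n hn => by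
    refine nil_of_trace n fun i => ?_
    rw [pow_succ']
    refine hn.2 _ ?_
    induction i with
    | zero => rw [pow_zero]; exact Env.one
    | succ i ih => rw [pow_succ]; exact Env.mul ih hn.1
  have hNc : ∀ g, ∀ n ∈ N, ψ g * n * ψ g⁻¹ ∈ N := fun g n hn => by
    refine ⟨Env.conj g hn.1, fun b hb => ?_⟩
    have := hn.2 _ (Env.conj g⁻¹ hb)
    rw [inv_inv] at this
    rw [← this, Matrix.mul_assoc, Matrix.mul_assoc, Matrix.trace_mul_comm, ← Matrix.mul_assoc, ← Matrix.mul_assoc,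
      ← Matrix.mul_assoc]
  have hψ : ∀ g, ψ g * ψ g⁻¹ = 1 := fun g => by rw [← map_mul, mul_inv_cancel, map_one]
  have hψ' : ∀ g, ψ g⁻¹ * ψ g = 1 := fun g => by rw [← map_mul, inv_mul_cancel, map_one]
  let W : Submodule k (ι → k) :=
    { carrier := {v | ∀ n ∈ N, n *ᵥ v = 0}
      zero_mem' := by simp
      add_mem' := fun ha hb n hn => by rw [mulVec_add, ha n hn, hb n hn, add_zero]
      smul_mem' := fun c v hv n hn => by rw [mulVec_smul, hv n hn, smul_zero] }
  have hW := hirr W (by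
    intro g v hv n hn
    have h1 := hv _ (hNc g⁻¹ n hn)
    rw [inv_inv] at h1
    have h2 : n *ᵥ (ψ g *ᵥ v) = ψ g *ᵥ ((ψ g⁻¹ * n * ψ g) *ᵥ v) := by
      rw [mulVec_mulVec, mulVec_mulVec, ← Matrix.mul_assoc, ← Matrix.mul_assoc, hψ, Matrix.one_mul]
    rw [h2, h1, mulVec_zero])
  have haN : a ∈ N := ⟨ha, h⟩
  rcases hW with hW | hW
  · -- contradiction unless trivial
    rcases isEmpty_or_nonempty ι with he | he
    · ext i; exact he.elim i
    exfalso
    let Ev : (ι → k) → Matrix ι ι k →ₗ[k] (ι → k) := fun v =>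
      { toFun := fun n => n *ᵥ v
        map_add' := fun a b => add_mulVec a b v
        map_smul' := fun c a => smul_mulVec c a v }
    obtain ⟨v, hv0, hmin⟩ : ∃ v : ι → k, v ≠ 0 ∧ ∀ w : ι → k, w ≠ 0 →
        Module.finrank k (N.map (Ev v)) ≤ Module.finrank k (N.map (Ev w)) := by
      let S : Set (ι → k) := {v | v ≠ 0}
      have hne : S.Nonempty := ⟨fun _ => 1, fun h => by
        obtain ⟨i⟩ := he
        exact one_ne_zero (congrFun h i)⟩
      obtain ⟨v, hv, hm⟩ := WellFounded.has_min (measure fun v : ι → k => Module.finrank k (N.map (Ev v))).wf S hne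
      exact ⟨v, hv, fun w hw => not_lt.mp (hm w hw)⟩
    have hvW : v ∉ W := by rw [hW]; simpa using hv0
    obtain ⟨n, hn, hnv⟩ : ∃ n ∈ N, n *ᵥ v ≠ 0 := by
      by_contra hc
      push Not at hc
      exact hvW hc
    have hle : N.map (Ev (n *ᵥ v)) ≤ N.map (Ev v) := by
      rintro _ ⟨n', hn', rfl⟩
      refine ⟨n' * n, hNr n' hn' n hn.1, ?_⟩
      show (n' * n) *ᵥ v = n' *ᵥ (n *ᵥ v)
      rw [mulVec_mulVec]
    have heq := Submodule.eq_of_le_of_finrank_le hle (hmin _ hnv)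
    have hin : n *ᵥ v ∈ N.map (Ev (n *ᵥ v)) := by rw [heq]; exact ⟨n, hn, rfl⟩
    obtain ⟨n', hn', hn''⟩ := hin
    have hn3 : n' *ᵥ (n *ᵥ v) = n *ᵥ v := hn''
    obtain ⟨m, hm⟩ := hNnil n' hn'
    have : ∀ i, n' ^ i *ᵥ (n *ᵥ v) = n *ᵥ v := by
      intro i
      induction i with
      | zero => simp
      | succ i ih => rw [pow_succ, ← mulVec_mulVec, hn3, ih]
    have h4 := this m
    rw [hm, zero_mulVec] at h4
    exact hnv h4.symm
  · refine Matrix.toLin'.injective (LinearMap.ext fun v => ?_)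
    have : v ∈ W := by rw [hW]; trivial
    simpa using this a haN

end
end LG

namespace LG
open Matrix Filter

section
variable {k : Type*} [Field k] [CharZero k] {Q : Type*} [Group Q]

/-- non-solvable image -/
def NS {ι : Type*} [Fintype ι] [DecidableEq ι] (ψ : Q →* Matrix ι ι k) : Prop := ∀ s, ∃ x ∈ derivedSeries Q s, ψ x ≠ 1

lemma derived_mono {a b : ℕ} (h : a ≤ b) : derivedSeries Q b ≤ derivedSeries Q a := derivedSeries_antitone Q h

lemma trivial_succ {ι : Type*} [Fintype ι] [DecidableEq ι] (ψ : Q →* Matrix ι ι k) (s : ℕ)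
    (h : ∀ x ∈ derivedSeries Q s, ∀ y ∈ derivedSeries Q s, ψ x * ψ y = ψ y * ψ x) :
    ∀ z ∈ derivedSeries Q (s + 1), ψ z = 1 := by
  have : derivedSeries Q (s + 1) ≤ ψ.toHomUnits.ker := by
    rw [derivedSeries_succ, Subgroup.commutator_le]
    intro x hx y hy
    rw [MonoidHom.mem_ker, map_commutatorElement, commutatorElement_eq_one_iff_commute]
    ext1
    simpa using h x hx y hy
  intro z hz
  have := this hz
  rw [MonoidHom.mem_ker] at this
  simpa using congrArg Units.val this

variable {𝒜 : Subalgebra k (Q → k)}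
  {U : Filter ℕ} {L : ℕ → Type*} [∀ n, Field (L n)] {ev : ∀ n, k → L n}

theorem exists_irr (hev : EvHom U ev) {d : ℕ} (φ : Q →* Matrix (Fin d) (Fin d) k) (hφ : Coef 𝒜 φ) (hns : NS φ) :
    ∃ (m : ℕ) (ψ : Q →* Matrix (Fin m) (Fin m) k), Coef 𝒜 ψ ∧ Good U (em ev φ) (em ev ψ) ∧ NS ψ ∧ Irr ψ := by
  classical
  let P : ℕ → Prop := fun m => ∃ ψ : Q →* Matrix (Fin m) (Fin m) k, Coef 𝒜 ψ ∧ Good U (em ev φ) (em ev ψ) ∧ NS ψ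
  have hP : ∃ m, P m := ⟨d, φ, hφ, Good.refl _, hns⟩
  obtain ⟨ψ, h1, h2, h3⟩ := Nat.find_spec hP
  have hmin : ∀ m', m' < Nat.find hP → ¬ P m' := fun m' h => Nat.find_min hP h
  generalize Nat.find hP = m at ψ h1 h2 h3 hmin
  refine ⟨m, ψ, h1, h2, h3, fun W hW => ?_⟩
  by_contra hcon
  push Not at hcon
  obtain ⟨r, s, C, D, R, E, hDC, hRE, hCD, hRC, hDE, hWR⟩ := split_lemma W
  have hdim : r + s = m := by
    have h4 := congrArg Matrix.trace hCD
    rw [trace_add, Matrix.trace_mul_comm C, Matrix.trace_mul_comm E, hDC, hRE] at h4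
    simp only [Matrix.trace_one, Fintype.card_fin] at h4
    exact_mod_cast h4
  have hr : r ≠ 0 := by
    rintro rfl
    apply hcon.1
    rw [eq_bot_iff]
    intro v hv
    rw [hWR] at hv
    have : C * D = 0 := by ext i j; simp [mul_apply]
    rw [this, zero_add] at hCD
    rw [Submodule.mem_bot, ← one_mulVec v, ← hCD, ← mulVec_mulVec, hv, mulVec_zero]
  have hs : s ≠ 0 := by
    rintro rfl
    apply hcon.2
    rw [eq_top_iff]
    intro v _
    rw [hWR]
    exact Subsingleton.elim _ _
  have hstab : ∀ g, R * ψ g * C = 0 := by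
    intro g
    refine Matrix.toLin'.injective (LinearMap.ext fun v => ?_)
    have h4 : C *ᵥ v ∈ W := by rw [hWR, mulVec_mulVec, hRC, zero_mulVec]
    have h5 := (hWR _).mp (hW g _ h4)
    rw [mulVec_mulVec, mulVec_mulVec] at h5
    simpa [Matrix.mul_assoc] using h5
  have hCs : ∀ g, C * (D * ψ g * C) = ψ g * C := by
    intro g
    have : (C * D + E * R) * (ψ g * C) = ψ g * C := by rw [hCD, Matrix.one_mul]
    rw [Matrix.add_mul, Matrix.mul_assoc E R, ← Matrix.mul_assoc R, hstab, Matrix.mul_zero, add_zero] at this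
    rw [← this]; simp only [Matrix.mul_assoc]
  have hRq : ∀ g, (R * ψ g * E) * R = R * ψ g := by
    intro g
    have : (R * ψ g) * (C * D + E * R) = R * ψ g := by rw [hCD, Matrix.mul_one]
    rw [Matrix.mul_add, ← Matrix.mul_assoc _ C, hstab, Matrix.zero_mul, zero_add] at this
    rw [Matrix.mul_assoc _ E R, this]
  let ψs : Q →* Matrix (Fin r) (Fin r) k :=
    { toFun := fun g => D * ψ g * C
      map_one' := by simp [hDC]
      map_mul' := fun a b => by
        rw [Matrix.mul_assoc D (ψ a) C, Matrix.mul_assoc D (ψ a * C), Matrix.mul_assoc (ψ a), hCs, map_mul]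
        simp only [Matrix.mul_assoc] }
  let ψq : Q →* Matrix (Fin s) (Fin s) k :=
    { toFun := fun g => R * ψ g * E
      map_one' := by simp [hRE]
      map_mul' := fun a b => by
        have : R * ψ a * E * (R * ψ b * E) = (R * ψ a * E * R) * ψ b * E := by simp only [Matrix.mul_assoc]
        rw [this, hRq, map_mul]
        simp only [Matrix.mul_assoc] }
  have n1 : ¬ NS ψs := fun hn => hmin r (by lia) ⟨ψs, ((Coef.const D).mul h1).mul (Coef.const C),
    h2.trans (em_sub hev ψ ψs C D hDC hCs), hn⟩
  have n2 : ¬ NS ψq := fun hn => hmin s (by lia) ⟨ψq, ((Coef.const R).mul h1).mul (Coef.const E),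
    h2.trans (em_quot hev ψ ψq R E hRE hRq), hn⟩
  simp only [NS] at n1 n2
  push Not at n1 n2
  obtain ⟨s1, n1⟩ := n1
  obtain ⟨s2, n2⟩ := n2
  have key : ∀ x ∈ derivedSeries Q (max s1 s2), ∀ y ∈ derivedSeries Q (max s1 s2), (ψ x - 1) * (ψ y - 1) = 0 := by
    intro x hx y hy
    have f1 : (ψ x - 1) * C = 0 := by
      rw [Matrix.sub_mul, Matrix.one_mul, ← hCs]
      have := n1 x (derived_mono (le_max_left _ _) hx)
      simp only [ψs, MonoidHom.coe_mk, OneHom.coe_mk] at this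
      rw [this, Matrix.mul_one, sub_self]
    have f2 : R * (ψ y - 1) = 0 := by
      rw [Matrix.mul_sub, Matrix.mul_one, ← hRq]
      have := n2 y (derived_mono (le_max_right _ _) hy)
      simp only [ψq, MonoidHom.coe_mk, OneHom.coe_mk] at this
      rw [this, Matrix.one_mul, sub_self]
    calc (ψ x - 1) * (ψ y - 1) = (ψ x - 1) * ((C * D + E * R) * (ψ y - 1)) := by rw [hCD, Matrix.one_mul]
      _ = ((ψ x - 1) * C) * D * (ψ y - 1) + (ψ x - 1) * E * (R * (ψ y - 1)) := by
        rw [Matrix.add_mul, Matrix.mul_add]; simp only [Matrix.mul_assoc]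
      _ = 0 := by rw [f1, f2]; simp
  obtain ⟨z, hz, hz1⟩ := h3 (max s1 s2 + 1)
  refine hz1 (trivial_succ ψ _ (fun x hx y hy => ?_) z hz)
  have e1 := key x hx y hy
  have e2 := key y hy x hx
  have e3 : (ψ x - 1) * (ψ y - 1) = ψ x * ψ y - ψ x - ψ y + 1 := by noncomm_ring
  have e4 : (ψ y - 1) * (ψ x - 1) = ψ y * ψ x - ψ y - ψ x + 1 := by noncomm_ring
  rw [e3] at e1
  rw [e4] at e2
  have e5 : ψ x * ψ y - ψ y * ψ x = (ψ x * ψ y - ψ x - ψ y + 1) - (ψ y * ψ x - ψ y - ψ x + 1) := by abel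
  rw [e1, e2, sub_zero] at e5
  exact sub_eq_zero.mp e5

lemma exists_stable {ι : Type*} [Fintype ι] [DecidableEq ι] (ψ : Q →* Matrix ι ι k) :
    ∃ s, Env ψ (derivedSeries Q s) = Env ψ (derivedSeries Q (s + 1)) := by
  let f : ℕ → ℕ := fun s => Module.finrank k (Env ψ (derivedSeries Q s))
  obtain ⟨s, -, hs⟩ := WellFounded.has_min (measure f).wf Set.univ ⟨0, trivial⟩
  refine ⟨s, ?_⟩
  have hle : Env ψ (derivedSeries Q (s + 1)) ≤ Env ψ (derivedSeries Q s) :=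
    Submodule.span_mono (Set.image_mono (derived_mono (Nat.le_succ s)))
  exact (Submodule.eq_of_le_of_finrank_le hle (not_lt.mp (hs (s + 1) trivial))).symm

end
end LG

namespace LG
open Matrix Filter

section
variable {k : Type*} [Field k] [CharZero k] {Q : Type*} [Group Q] {ι : Type*} [Fintype ι] [DecidableEq ι]

/-- a basis of the enveloping space consisting of group elements -/
structure SB (ψ : Q →* Matrix ι ι k) (Δ : Subgroup Q) {m : ℕ} (x : Fin m → Q) : Prop where
  mem : ∀ j, x j ∈ Δ
  li : LinearIndependent k (fun j => ψ (x j))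
  span : Submodule.span k (Set.range fun j => ψ (x j)) = Env ψ Δ

theorem exists_SB (ψ : Q →* Matrix ι ι k) (Δ : Subgroup Q) : ∃ (m : ℕ) (x : Fin m → Q), SB ψ Δ x := by
  obtain ⟨b, hb, hsp, hli⟩ := exists_linearIndependent k (ψ '' (Δ : Set Q))
  have hfin : b.Finite := hli.setFinite
  obtain ⟨m, f, hf⟩ : ∃ (m : ℕ) (f : Fin m ≃ b), True := by
    have := hfin.fintype
    exact ⟨_, (Fintype.equivFin b).symm, trivial⟩
  choose g hg using fun j : Fin m => hb (f j).2
  refine ⟨m, g, fun j => (hg j).1, ?_, ?_⟩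
  · simp only [(hg _).2]
    exact hli.comp f f.injective
  · simp only [(hg _).2, Env]
    rw [← hsp]
    congr 1
    ext a
    constructor
    · rintro ⟨j, rfl⟩; exact (f j).2
    · intro ha; exact ⟨f.symm ⟨a, ha⟩, by simp⟩

/-- Gram matrix of the trace form -/
def gram (ψ : Q →* Matrix ι ι k) {m : ℕ} (x : Fin m → Q) : Matrix (Fin m) (Fin m) k := of fun i j => (ψ (x i * x j)).trace
/-- numerator of conjugation -/
def cnum (ψ : Q →* Matrix ι ι k) {m : ℕ} (x : Fin m → Q) (g : Q) : Matrix (Fin m) (Fin m) k :=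
  of fun i j => (ψ (x i * (g * x j * g⁻¹))).trace
/-- numerator of left multiplication -/
def lnum (ψ : Q →* Matrix ι ι k) {m : ℕ} (x : Fin m → Q) (y : Q) : Matrix (Fin m) (Fin m) k :=
  of fun i j => (ψ (x i * (y * x j))).trace
/-- conjugation in the basis -/
noncomputable def cfun (ψ : Q →* Matrix ι ι k) {m : ℕ} (x : Fin m → Q) (g : Q) : Matrix (Fin m) (Fin m) k := (gram ψ x)⁻¹ * cnum ψ x g
/-- left multiplication in the basis -/
noncomputable def lfun (ψ : Q →* Matrix ι ι k) {m : ℕ} (x : Fin m → Q) (y : Q) : Matrix (Fin m) (Fin m) k := (gram ψ x)⁻¹ * lnum ψ x y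

variable {ψ : Q →* Matrix ι ι k} {Δ : Subgroup Q} {m : ℕ} {x : Fin m → Q}

lemma SB.exists_coord (h : SB ψ Δ x) {a : Matrix ι ι k} (ha : a ∈ Env ψ Δ) : ∃ c : Fin m → k, ∑ i, c i • ψ (x i) = a := by
  rw [← h.span] at ha
  exact (Submodule.mem_span_range_iff_exists_fun k).mp ha

lemma SB.uniq (h : SB ψ Δ x) {c c' : Fin m → k} (hc : ∑ i, c i • ψ (x i) = ∑ i, c' i • ψ (x i)) : c = c' :=
  (linearIndependent_iff_injective_fintypeLinearCombination.mp h.li) (by simpa [Fintype.linearCombination_apply] using hc)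

lemma SB.uniqM (h : SB ψ Δ x) {A B : Matrix (Fin m) (Fin m) k}
    (hc : ∀ j, ∑ i, A i j • ψ (x i) = ∑ i, B i j • ψ (x i)) : A = B := by
  ext i j
  exact congrFun (h.uniq (hc j)) i

lemma gram_mulVec (c : Fin m → k) (i : Fin m) : (gram ψ x *ᵥ c) i = (ψ (x i) * ∑ j, c j • ψ (x j)).trace := by
  simp only [mulVec, dotProduct, gram, of_apply, Finset.mul_sum, trace_sum, mul_smul_comm, trace_smul, smul_eq_mul, map_mul]
  exact Finset.sum_congr rfl fun j _ => mul_comm _ _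

lemma SB.gram_det [Δ.Normal] (h : SB ψ Δ x) (hirr : Irr ψ) : (gram ψ x).det ≠ 0 := by
  intro h0
  obtain ⟨v, hv0, hv⟩ := Matrix.exists_mulVec_eq_zero_iff.mpr h0
  apply hv0
  refine h.uniq (c' := 0) ?_
  simp only [Pi.zero_apply, zero_smul, Finset.sum_const_zero]
  have hmem : ∑ i, v i • ψ (x i) ∈ Env ψ Δ := sum_mem fun i _ => Submodule.smul_mem _ _ (Env.of_mem (h.mem i))
  refine nondeg hirr Δ hmem fun b hb => ?_
  obtain ⟨c, rfl⟩ := h.exists_coord hb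
  rw [Matrix.trace_mul_comm, Finset.sum_mul, trace_sum]
  refine Finset.sum_eq_zero fun i _ => ?_
  rw [smul_mul_assoc, trace_smul, ← gram_mulVec, hv, Pi.zero_apply, smul_zero]

lemma SB.coord (h : SB ψ Δ x) (hG : (gram ψ x).det ≠ 0) {a : Matrix ι ι k} (ha : a ∈ Env ψ Δ) :
    ∑ i, ((gram ψ x)⁻¹ *ᵥ fun l => (ψ (x l) * a).trace) i • ψ (x i) = a := by
  obtain ⟨c, rfl⟩ := h.exists_coord ha
  have : (fun l => (ψ (x l) * ∑ i, c i • ψ (x i)).trace) = gram ψ x *ᵥ c := by ext l; rw [gram_mulVec]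
  rw [this, mulVec_mulVec, nonsing_inv_mul _ (isUnit_iff_ne_zero.mpr hG), one_mulVec]

lemma SB.cfun_spec [Δ.Normal] (h : SB ψ Δ x) (hG : (gram ψ x).det ≠ 0) (g : Q) (j : Fin m) :
    ∑ i, cfun ψ x g i j • ψ (x i) = ψ g * ψ (x j) * ψ g⁻¹ := by
  rw [← h.coord hG (Env.conj g (Env.of_mem (h.mem j)))]
  refine Finset.sum_congr rfl fun i _ => ?_
  congr 1
  simp [cfun, mul_apply, mulVec, dotProduct, cnum, Matrix.mul_assoc]

lemma SB.lfun_spec (h : SB ψ Δ x) (hG : (gram ψ x).det ≠ 0) {y : Q} (hy : y ∈ Δ) (j : Fin m) :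
    ∑ i, lfun ψ x y i j • ψ (x i) = ψ y * ψ (x j) := by
  rw [← h.coord hG (Env.mul (Env.of_mem hy) (Env.of_mem (h.mem j)))]
  refine Finset.sum_congr rfl fun i _ => ?_
  congr 1
  simp [lfun, mul_apply, mulVec, dotProduct, lnum]

lemma sum_mul_col (A B : Matrix (Fin m) (Fin m) k) (j : Fin m) :
    ∑ i, (A * B) i j • ψ (x i) = ∑ l, B l j • ∑ i, A i l • ψ (x i) := by
  simp only [mul_apply, Finset.sum_smul, Finset.smul_sum, smul_smul]
  rw [Finset.sum_comm]
  exact Finset.sum_congr rfl fun _ _ => Finset.sum_congr rfl fun _ _ => by rw [mul_comm]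

lemma sum_one_col (j : Fin m) : ∑ i, (1 : Matrix (Fin m) (Fin m) k) i j • ψ (x i) = ψ (x j) := by
  rw [Finset.sum_eq_single j]
  · simp
  · intro b _ hb; simp [one_apply, hb]
  · simp

lemma sum_sand (c : Fin m → k) (P R : Matrix ι ι k) : ∑ i, c i • (P * ψ (x i) * R) = P * (∑ i, c i • ψ (x i)) * R := by
  simp only [Finset.mul_sum, Finset.sum_mul, mul_smul_comm, smul_mul_assoc]

lemma sum_left (c : Fin m → k) (P : Matrix ι ι k) : ∑ i, c i • (P * ψ (x i)) = P * (∑ i, c i • ψ (x i)) := by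
  simp only [Finset.mul_sum, mul_smul_comm]

/-- conjugation as a representation -/
noncomputable def chom [Δ.Normal] (h : SB ψ Δ x) (hG : (gram ψ x).det ≠ 0) : Q →* Matrix (Fin m) (Fin m) k where
  toFun := cfun ψ x
  map_one' := h.uniqM fun j => by rw [h.cfun_spec hG, sum_one_col]; simp
  map_mul' a b := h.uniqM fun j => by
    rw [h.cfun_spec hG, sum_mul_col]
    simp only [h.cfun_spec hG, sum_sand]
    simp only [_root_.mul_inv_rev, map_mul, Matrix.mul_assoc]

lemma SB.lfun_one (h : SB ψ Δ x) (hG : (gram ψ x).det ≠ 0) : lfun ψ x 1 = 1 :=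
  h.uniqM fun j => by rw [h.lfun_spec hG (one_mem _), sum_one_col]; simp

lemma SB.lfun_mul (h : SB ψ Δ x) (hG : (gram ψ x).det ≠ 0) {y z : Q} (hy : y ∈ Δ) (hz : z ∈ Δ) :
    lfun ψ x (y * z) = lfun ψ x y * lfun ψ x z :=
  h.uniqM fun j => by
    rw [h.lfun_spec hG (mul_mem hy hz), sum_mul_col]
    simp only [h.lfun_spec hG hy, sum_left, h.lfun_spec hG hz, map_mul, Matrix.mul_assoc]

lemma SB.lfun_conj [Δ.Normal] (h : SB ψ Δ x) (hG : (gram ψ x).det ≠ 0) {y : Q} (hy : y ∈ Δ) (g : Q) :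
    lfun ψ x (g * y * g⁻¹) = cfun ψ x g * lfun ψ x y * cfun ψ x g⁻¹ := by
  have h1 : lfun ψ x (g * y * g⁻¹) * cfun ψ x g = cfun ψ x g * lfun ψ x y := h.uniqM fun j => by
    rw [sum_mul_col, sum_mul_col]
    simp only [h.lfun_spec hG (Subgroup.Normal.conj_mem inferInstance y hy g), h.cfun_spec hG]
    simp only [sum_left, sum_sand, h.cfun_spec hG, h.lfun_spec hG hy]
    have : ψ g⁻¹ * ψ g = 1 := by rw [← map_mul, inv_mul_cancel, map_one]
    simp only [map_mul, Matrix.mul_assoc]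
    rw [← Matrix.mul_assoc (ψ g⁻¹) (ψ g), this, Matrix.one_mul]
  rw [← h1, Matrix.mul_assoc]
  have := map_mul (chom h hG) g g⁻¹
  rw [mul_inv_cancel, map_one] at this
  change 1 = cfun ψ x g * cfun ψ x g⁻¹ at this
  rw [← this, Matrix.mul_one]

variable {𝒜 : Subalgebra k (Q → k)}

lemma coef_chom [Δ.Normal] (hD : Dom 𝒜) (h : SB ψ Δ x) (hG : (gram ψ x).det ≠ 0) (hc : Coef 𝒜 ψ) : Coef 𝒜 (chom h hG) := by
  refine Coef.mul (ψ := fun _ => (gram ψ x)⁻¹) (χ := cnum ψ x) (Coef.const _) fun i j => ?_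
  have : Coef 𝒜 (fun g => ψ (x i) * (ψ g * ψ (x j) * ψ g⁻¹)) :=
    (Coef.const _).mul ((hc.mul (Coef.const _)).mul (Coef.inv hD hc))
  simpa [cnum] using this.trace

variable {U : Filter ℕ} {L : ℕ → Type*} [∀ n, Field (L n)] {ev : ∀ n, k → L n}

lemma good_chom [Δ.Normal] (hev : EvHom U ev) (h : SB ψ Δ x) (hG : (gram ψ x).det ≠ 0) :
    Good U (em ev ψ) (em ev (chom h hG)) := by
  refine (em_Kr hev ψ).trans ?_
  let Cm : Matrix (ι × ι) (Fin m) k := of fun p j => ψ (x j) p.1 p.2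
  let R : Matrix (Fin m) (ι × ι) k := of fun i p => ψ (x i) p.2 p.1
  have hRC : R * Cm = gram ψ x := by
    ext i j
    simp only [R, Cm, gram, mul_apply, of_apply, map_mul, Matrix.trace, diag_apply, Fintype.sum_prod_type]
    rw [Finset.sum_comm]
  refine em_sub hev _ _ Cm ((gram ψ x)⁻¹ * R) ?_ fun g => ?_
  · rw [Matrix.mul_assoc, hRC, nonsing_inv_mul _ (isUnit_iff_ne_zero.mpr hG)]
  · ext p j
    have := congrFun (congrFun (h.cfun_spec hG g j) p.1) p.2
    simp only [Matrix.sum_apply, Matrix.smul_apply, smul_eq_mul] at this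
    have e1 : (Cm * (chom h hG) g) p j = ∑ i, cfun ψ x g i j * ψ (x i) p.1 p.2 := by
      rw [mul_apply]
      exact Finset.sum_congr rfl fun i _ => mul_comm _ _
    rw [e1, this]
    simp only [MonoidHom.comp_apply, Kr, mul_apply, MonoidHom.coe_mk, OneHom.coe_mk, kroneckerMap_apply, transpose_apply, rep_inv,
      Fintype.sum_prod_type, Cm, of_apply, Finset.sum_mul]
    rw [Finset.sum_comm]
    exact Finset.sum_congr rfl fun _ _ => Finset.sum_congr rfl fun _ _ => by ring
end
end LG

namespace LG
open Matrix Filter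

section
variable {k : Type*} [Field k] [CharZero k] {Q : Type*} [Group Q] {ι : Type*} [Fintype ι] [DecidableEq ι]
variable {ψ : Q →* Matrix ι ι k} {Δ : Subgroup Q} {m : ℕ} {x : Fin m → Q}

lemma root_of_conj [Δ.Normal] (h : SB ψ Δ x) (hG : (gram ψ x).det ≠ 0) (y : Q) (a : Matrix ι ι k) (ha : a ∈ Env ψ Δ) (ha0 : a ≠ 0)
    (μ : k) (hμ : ψ y * a * ψ y⁻¹ = μ • a) : (chom h hG y).charpoly.IsRoot μ := by
  obtain ⟨v, hv⟩ := h.exists_coord ha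
  have hv0 : v ≠ 0 := by
    rintro rfl
    exact ha0 (by rw [← hv]; simp)
  have h1 : chom h hG y *ᵥ v = μ • v := by
    refine h.uniq ?_
    have e1 : ∑ i, (μ • v) i • ψ (x i) = μ • a := by
      rw [← hv, Finset.smul_sum]
      exact Finset.sum_congr rfl fun i _ => by rw [Pi.smul_apply, smul_smul, smul_eq_mul]
    have e2 : ∑ i, (chom h hG y *ᵥ v) i • ψ (x i) = ∑ j, v j • ∑ i, cfun ψ x y i j • ψ (x i) := by
      simp only [mulVec, dotProduct, Finset.sum_smul, Finset.smul_sum, smul_smul]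
      rw [Finset.sum_comm]
      exact Finset.sum_congr rfl fun _ _ => Finset.sum_congr rfl fun _ _ => by rw [mul_comm]; rfl
    rw [e1, e2]
    simp only [h.cfun_spec hG]
    rw [sum_sand, hv, hμ]
  rw [Polynomial.IsRoot, eval_charpoly]
  refine Matrix.exists_mulVec_eq_zero_iff.mp ⟨v, hv0, ?_⟩
  rw [sub_mulVec, h1]
  ext i
  simp [scalar_apply, mulVec_diagonal]

theorem lemmaE [IsAlgClosed k] [Δ.Normal] (h : SB ψ Δ x) (hG : (gram ψ x).det ≠ 0) (y : Q) (hy : y ∈ ⁅Δ, Δ⁆) (lam : k)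
    (hl : (ψ y).charpoly.IsRoot lam) :
    ∃ (r : ℕ) (s : Multiset k), 0 < r ∧ s.prod = lam ^ r ∧ ∀ μ ∈ s, (chom h hG y).charpoly.IsRoot μ := by
  have hyΔ : y ∈ Δ := Subgroup.commutator_le_left Δ Δ hy
  let A : Submodule k (Matrix ι ι k) :=
    { carrier := {a | a ∈ Env ψ Δ ∧ ψ y * a = lam • a}
      zero_mem' := ⟨zero_mem _, by simp⟩
      add_mem' := fun ha hb => ⟨add_mem ha.1 hb.1, by rw [mul_add, ha.2, hb.2, smul_add]⟩
      smul_mem' := fun c a ha => ⟨Submodule.smul_mem _ _ ha.1, by rw [mul_smul_comm, ha.2, smul_comm]⟩ }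
  have hAne : A ≠ ⊥ := by
    intro hbot
    have hmem : ∀ a ∈ Env ψ Δ, (ψ y - lam • (1 : Matrix ι ι k)) * a ∈ Env ψ Δ := fun a ha =>
      Env.mul (sub_mem (Env.of_mem hyΔ) (Submodule.smul_mem _ _ Env.one)) ha
    let f : Env ψ Δ →ₗ[k] Env ψ Δ :=
      { toFun := fun a => ⟨_, hmem a a.2⟩
        map_add' := fun a b => by ext1; simp [mul_add]
        map_smul' := fun c a => by ext1; simp }
    have hinj : Function.Injective f := by
      rw [← LinearMap.ker_eq_bot, LinearMap.ker_eq_bot']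
      intro a ha
      have h1 : (ψ y - lam • (1 : Matrix ι ι k)) * a = 0 := congrArg Subtype.val ha
      have h2 : (a : Matrix ι ι k) ∈ A := ⟨a.2, by
        rw [sub_mul, smul_mul_assoc, Matrix.one_mul] at h1
        exact sub_eq_zero.mp h1⟩
      rw [hbot, Submodule.mem_bot] at h2
      exact Subtype.ext h2
    obtain ⟨b, hb⟩ := LinearMap.surjective_of_injective hinj ⟨1, Env.one⟩
    have hb' : (ψ y - lam • (1 : Matrix ι ι k)) * b = 1 := congrArg Subtype.val hb
    have h3 := congrArg det hb'
    rw [det_mul, det_one] at h3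
    rw [Polynomial.IsRoot, eval_charpoly] at hl
    have h4 : (ψ y - lam • (1 : Matrix ι ι k)).det = 0 := by
      rw [← neg_sub, det_neg, smul_one_eq_diagonal, ← scalar_apply, hl, mul_zero]
    rw [h4, zero_mul] at h3
    exact zero_ne_one h3
  have hR : ∀ z ∈ Δ, ∀ a ∈ A, a * ψ z⁻¹ ∈ A := fun z hz a ha =>
    ⟨Env.mul ha.1 (Env.of_mem (inv_mem hz)), by rw [← Matrix.mul_assoc, ha.2, smul_mul_assoc]⟩
  let R : Δ →* (A →ₗ[k] A) :=
    { toFun := fun z =>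
        { toFun := fun a => ⟨_, hR z z.2 a a.2⟩
          map_add' := fun a b => by ext1; simp [add_mul]
          map_smul' := fun c a => by ext1; simp }
      map_one' := by ext1 a; ext1; simp
      map_mul' := fun z w => by
        ext1 a; ext1
        simp [Matrix.mul_assoc] }
  have hdet1 : LinearMap.det (R ⟨y, hyΔ⟩) = 1 := by
    have h1 : ∀ z ∈ commutator Δ, LinearMap.det (R z) = 1 := by
      intro z hz
      have := Abelianization.commutator_subset_ker (LinearMap.det.comp R).toHomUnits hz
      rw [MonoidHom.mem_ker] at this
      simpa using congrArg Units.val this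
    refine h1 _ ?_
    have h2 : y ∈ (commutator Δ).map Δ.subtype := by
      rw [map_commutator_eq]
      simpa using hy
    obtain ⟨z, hz, rfl⟩ := h2
    exact hz
  let T : A →ₗ[k] A := lam • R ⟨y, hyΔ⟩
  have hT : LinearMap.det T = lam ^ Module.finrank k A := by rw [LinearMap.det_smul, hdet1, mul_one]
  rw [Module.End.det_eq_prod_roots_charpoly_of_splits (IsAlgClosed.splits _)] at hT
  refine ⟨_, _, ?_, hT, fun μ hμ => ?_⟩
  · rw [Nat.pos_iff_ne_zero, Ne, Submodule.finrank_eq_zero]; exact hAne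
  · have h1 : T.charpoly.IsRoot μ := (Polynomial.mem_roots'.mp hμ).2
    rw [← Module.End.hasEigenvalue_iff_isRoot_charpoly] at h1
    obtain ⟨a, ha⟩ := h1.exists_hasEigenvector
    have ha1 := congrArg Subtype.val ha.apply_eq_smul
    refine root_of_conj h hG y a a.2.1 (fun h0 => ha.2 (Subtype.ext h0)) μ ?_
    rw [a.2.2, smul_mul_assoc]
    exact ha1
end
end LG

namespace LG
open Matrix Filter
open scoped commutatorElement

section
variable {k : Type*} [Field k] [CharZero k] {Q : Type*} [Group Q] {𝒜 : Subalgebra k (Q → k)}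

lemma Dom.finite_const (hD : Dom 𝒜) {f : Q → k} (hf : f ∈ 𝒜) (T : Finset k) (hT : ∀ g, f g ∈ T) (g g' : Q) : f g = f g' := by
  by_contra hne
  obtain ⟨q, hq⟩ := hD.prod_ne (J := T) (fun t => f - fun _ => (t : k)) (fun t => sub_mem hf (𝒜.algebraMap_mem (t : k)))
    (fun t h0 => by
      have h1 : ∀ q, f q = t := fun q => sub_eq_zero.mp (congrFun h0 q)
      exact hne ((h1 g).trans (h1 g').symm))
  exact hq ⟨f q, hT q⟩ (sub_self _)

variable {d : ℕ} {ψ : Q →* Matrix (Fin d) (Fin d) k}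

/-- iterated commutators -/
def comseq (y : Q) (g : ℕ → Q) : ℕ → Q
  | 0 => y
  | j + 1 => ⁅comseq y g j, g j * comseq y g j * (g j)⁻¹⁆

lemma comseq_congr (y : Q) {g g' : ℕ → Q} {j : ℕ} (h : ∀ i < j, g i = g' i) : comseq y g j = comseq y g' j := by
  induction j with
  | zero => rfl
  | succ j ih =>
    rw [comseq, comseq, ih fun i hi => h i (by lia), h j (by lia)]

lemma comseq_mem {y : Q} {Δ : Subgroup Q} [Δ.Normal] (hy : y ∈ Δ) (g : ℕ → Q) (j : ℕ) : comseq y g j ∈ Δ := by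
  induction j with
  | zero => exact hy
  | succ j ih =>
    rw [comseq, commutatorElement_def]
    have := Subgroup.Normal.conj_mem inferInstance _ ih (g j)
    exact mul_mem (mul_mem (mul_mem ih this) (inv_mem ih)) (inv_mem this)

lemma det_one_of_commutator {y : Q} (hy : y ∈ commutator Q) : (ψ y).det = 1 := by
  have := Abelianization.commutator_subset_ker (Matrix.detMonoidHom.comp ψ).toHomUnits hy
  rw [MonoidHom.mem_ker] at this
  simpa using congrArg Units.val this

lemma common_eigenvector [IsAlgClosed k] {X : Type*} (hd : d ≠ 0) (a : X → Matrix (Fin d) (Fin d) k) (hc : ∀ i j, a i * a j = a j * a i) :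
    ∃ (v : Fin d → k) (χ : X → k), v ≠ 0 ∧ ∀ i, a i *ᵥ v = χ i • v := by
  let S : Set (Submodule k (Fin d → k)) := {W | W ≠ ⊥ ∧ ∀ i, ∀ v ∈ W, a i *ᵥ v ∈ W}
  have hne : S.Nonempty := by
    refine ⟨⊤, ?_, fun _ _ _ => trivial⟩
    have : Nonempty (Fin d) := ⟨⟨0, Nat.pos_of_ne_zero hd⟩⟩
    exact top_ne_bot
  obtain ⟨W, ⟨hW0, hWs⟩, hmin⟩ := WellFounded.has_min (measure fun W : Submodule k (Fin d → k) => Module.finrank k W).wf S hne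
  have key : ∀ i, ∃ μ : k, ∀ v ∈ W, a i *ᵥ v = μ • v := by
    intro i
    have : Nontrivial W := (Submodule.nontrivial_iff_ne_bot).mpr hW0
    let f : Module.End k W := ((Matrix.toLin' (a i)).restrict (p := W) (q := W) (fun v hv => by simpa using hWs i v hv))
    obtain ⟨μ, hμ⟩ := Module.End.exists_eigenvalue f
    obtain ⟨w, hw⟩ := hμ.exists_hasEigenvector
    refine ⟨μ, ?_⟩
    let W' : Submodule k (Fin d → k) :=
      { carrier := {v | v ∈ W ∧ a i *ᵥ v = μ • v}
        zero_mem' := ⟨zero_mem _, by simp⟩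
        add_mem' := fun ha hb => ⟨add_mem ha.1 hb.1, by rw [mulVec_add, ha.2, hb.2, smul_add]⟩
        smul_mem' := fun c v hv => ⟨Submodule.smul_mem _ _ hv.1, by rw [mulVec_smul, hv.2, smul_comm]⟩ }
    have hW' : W' ∈ S := by
      refine ⟨fun hb => ?_, fun j v hv => ⟨hWs j v hv.1, ?_⟩⟩
      · have h1 : (w : Fin d → k) ∈ W' := ⟨w.2, by
          have := congrArg Subtype.val hw.apply_eq_smul
          simpa [f] using this⟩
        rw [hb, Submodule.mem_bot] at h1
        exact hw.2 (Subtype.ext h1)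
      · rw [mulVec_mulVec, hc, ← mulVec_mulVec, hv.2, mulVec_smul]
    have hle : W' ≤ W := fun v hv => hv.1
    have heq := Submodule.eq_of_le_of_finrank_le hle (not_lt.mp (hmin W' hW'))
    intro v hv
    rw [← heq] at hv
    exact hv.2
  choose χ hχ using key
  obtain ⟨v, hv, hv0⟩ := Submodule.exists_mem_ne_zero_of_ne_bot hW0
  exact ⟨v, χ, hv0, fun i => hχ i v hv⟩

lemma scalar_of_comm [IsAlgClosed k] (hD : Dom 𝒜) (hC : Coef 𝒜 ψ) (hirr : Irr ψ) (hd : d ≠ 0) {y : Q} (hy : y ∈ commutator Q)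
    (h : ∀ g, ψ ⁅y, g * y * g⁻¹⁆ = 1) : ∃ lam : k, lam ^ d = 1 ∧ ψ y = lam • 1 := by
  classical
  have hc1 : ∀ g, Commute (ψ y) (ψ (g * y * g⁻¹)) := fun g => by
    have h1 : y * (g * y * g⁻¹) = ⁅y, g * y * g⁻¹⁆ * ((g * y * g⁻¹) * y) := by rw [commutatorElement_def]; group
    rw [Commute, SemiconjBy, ← map_mul, h1, map_mul, h, one_mul, map_mul]
  have hc : ∀ g g' : Q, ψ (g * y * g⁻¹) * ψ (g' * y * g'⁻¹) = ψ (g' * y * g'⁻¹) * ψ (g * y * g⁻¹) := by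
    intro g g'
    have h1 := (hc1 (g⁻¹ * g')).eq
    have e1 : g * y * g⁻¹ * (g' * y * g'⁻¹) = g * (y * (g⁻¹ * g' * y * (g⁻¹ * g')⁻¹)) * g⁻¹ := by group
    have e2 : g' * y * g'⁻¹ * (g * y * g⁻¹) = g * ((g⁻¹ * g' * y * (g⁻¹ * g')⁻¹) * y) * g⁻¹ := by group
    rw [← map_mul, ← map_mul, e1, e2, map_mul, map_mul, map_mul ψ _ g⁻¹, map_mul ψ g, map_mul ψ y, h1, ← map_mul ψ _ y]
  obtain ⟨v, χ, hv0, hv⟩ := common_eigenvector hd (fun g => ψ (g * y * g⁻¹)) hc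
  obtain ⟨i, hi⟩ := Function.ne_iff.mp hv0
  have hψ : ∀ g, ψ g * ψ g⁻¹ = 1 := fun g => by rw [← map_mul, mul_inv_cancel, map_one]
  have hψ' : ∀ g, ψ g⁻¹ * ψ g = 1 := fun g => by rw [← map_mul, inv_mul_cancel, map_one]
  have hχA : χ ∈ 𝒜 := by
    have h1 : Coef 𝒜 (fun g => ψ g * ψ y * ψ g⁻¹) := (hC.mul (Coef.const _)).mul (Coef.inv hD hC)
    have h2 := 𝒜.smul_mem (h1.sandwich (Pi.single i 1) v) (v i)⁻¹
    convert h2 using 1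
    ext g
    have h3 := hv g
    rw [map_mul, map_mul] at h3
    rw [Pi.smul_apply, h3, single_one_dotProduct, Pi.smul_apply, smul_eq_mul, smul_eq_mul]
    rw [mul_left_comm, inv_mul_cancel₀ hi, mul_one]
  have hroot : ∀ g, χ g ∈ (ψ y).charpoly.roots.toFinset := by
    intro g
    rw [Multiset.mem_toFinset, Polynomial.mem_roots (charpoly_monic _).ne_zero, Polynomial.IsRoot, eval_charpoly]
    refine Matrix.exists_mulVec_eq_zero_iff.mp ⟨ψ g⁻¹ *ᵥ v, fun h0 => hv0 ?_, ?_⟩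
    · have := congrArg (ψ g *ᵥ ·) h0
      simpa [mulVec_mulVec, hψ] using this
    · have h3 := congrArg (ψ g⁻¹ *ᵥ ·) (hv g)
      simp only [mulVec_mulVec, map_mul, mulVec_smul] at h3
      rw [← Matrix.mul_assoc, ← Matrix.mul_assoc, hψ', Matrix.one_mul] at h3
      rw [sub_mulVec, mulVec_mulVec _ (ψ y), h3]
      ext i
      rw [Pi.sub_apply, scalar_apply, mulVec_diagonal]
      simp
  have hconst : ∀ g, χ g = χ 1 := fun g => hD.finite_const hχA _ hroot g 1
  let W : Submodule k (Fin d → k) :=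
    { carrier := {w | ∀ g, ψ y *ᵥ (ψ g *ᵥ w) = χ 1 • (ψ g *ᵥ w)}
      zero_mem' := by simp
      add_mem' := fun ha hb g => by rw [mulVec_add, mulVec_add, ha g, hb g, smul_add]
      smul_mem' := fun c v hv g => by rw [mulVec_smul, mulVec_smul, hv g, smul_comm] }
  have hvW : v ∈ W := by
    intro g
    have h3 := congrArg (ψ g *ᵥ ·) (hv g⁻¹)
    simp only [mulVec_mulVec, map_mul, mulVec_smul, inv_inv] at h3
    rw [← Matrix.mul_assoc, ← Matrix.mul_assoc, hψ, Matrix.one_mul, hconst] at h3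
    rw [mulVec_mulVec, h3]
  have hWtop : W = ⊤ := by
    refine (hirr W ?_).resolve_left ?_
    · intro g w hw g'
      have := hw (g' * g)
      rw [map_mul, ← mulVec_mulVec] at this
      exact this
    · intro hb
      rw [hb, Submodule.mem_bot] at hvW
      exact hv0 hvW
  have hsc : ψ y = χ 1 • 1 := by
    refine Matrix.toLin'.injective (LinearMap.ext fun w => ?_)
    have hw : w ∈ W := by rw [hWtop]; trivial
    have := hw 1
    rw [map_one, one_mulVec] at this
    simpa using this
  refine ⟨χ 1, ?_, hsc⟩
  have := det_one_of_commutator (ψ := ψ) hy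
  rw [hsc, det_smul, det_one, mul_one, Fintype.card_fin] at this
  exact this

lemma descent [IsAlgClosed k] (hD : Dom 𝒜) (hC : Coef 𝒜 ψ) (hirr : Irr ψ) (hd : d ≠ 0) {y : Q} (hy : y ∈ commutator Q) :
    ∀ J, (∀ g, ψ (comseq y g J) = 1) → ψ (y ^ d) = 1 := by
  classical
  intro J
  induction J with
  | zero => intro h; rw [map_pow]; have := h 1; rw [comseq] at this; rw [this, one_pow]
  | succ J ih =>
    intro h
    have hsc : ∀ g, ∃ lam : k, lam ^ d = 1 ∧ ψ (comseq y g J) = lam • 1 := by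
      intro g
      refine scalar_of_comm hD hC hirr hd (comseq_mem hy g J) fun q => ?_
      have := h (Function.update g J q)
      rw [comseq, Function.update_self, comseq_congr y (g' := g) (fun i hi => Function.update_of_ne (by lia) _ _)] at this
      exact this
    rcases J with _ | J
    · obtain ⟨lam, h1, h2⟩ := hsc 1
      rw [comseq] at h2
      rw [map_pow, h2, smul_pow, h1, one_pow, one_smul]
    · refine ih fun g => ?_
      have hc0 : ∀ q, comseq y (Function.update g J q) (J + 1) = ⁅comseq y g J, q * comseq y g J * q⁻¹⁆ := by
        intro q
        rw [comseq, Function.update_self, comseq_congr y (g' := g) (fun i hi => Function.update_of_ne (by lia) _ _)]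
      have hsc' : ∀ q, ∃ lam : k, lam ^ d = 1 ∧ ψ ⁅comseq y g J, q * comseq y g J * q⁻¹⁆ = lam • 1 := by
        intro q; rw [← hc0]; exact hsc _
      obtain ⟨c, hc⟩ : ∃ c, c = comseq y g J := ⟨_, rfl⟩
      rw [← hc] at hsc'
      have hf : (fun q => (ψ ⁅c, q * c * q⁻¹⁆).trace) ∈ 𝒜 := by
        have i1 : Coef 𝒜 (fun q => ψ q * ψ c * ψ q⁻¹) := (hC.mul (Coef.const _)).mul (Coef.inv hD hC)
        have i2 : Coef 𝒜 (fun q => ψ q * ψ c⁻¹ * ψ q⁻¹) := (hC.mul (Coef.const _)).mul (Coef.inv hD hC)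
        have i3 : Coef 𝒜 (fun q => ψ c * (ψ q * ψ c * ψ q⁻¹) * ψ c⁻¹ * (ψ q * ψ c⁻¹ * ψ q⁻¹)) :=
          (((Coef.const _).mul i1).mul (Coef.const _)).mul i2
        convert i3.trace using 1
        ext q
        simp only [← map_mul]
        congr 3
        rw [commutatorElement_def]; group
      have hX : (Polynomial.X ^ d - Polynomial.C (1 : k)) ≠ 0 := Polynomial.X_pow_sub_C_ne_zero (Nat.pos_of_ne_zero hd) 1
      have hval := hD.finite_const hf ((Polynomial.X ^ d - Polynomial.C (1 : k)).roots.toFinset.image fun t => t * d) (fun q => by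
        obtain ⟨lam, h1, h2⟩ := hsc' q
        rw [Finset.mem_image]
        refine ⟨lam, ?_, ?_⟩
        · rw [Multiset.mem_toFinset, Polynomial.mem_roots hX]
          simp [h1]
        · rw [h2, trace_smul, trace_one, Fintype.card_fin, smul_eq_mul]) (g J) 1
      obtain ⟨lam, h1, h2⟩ := hsc' (g J)
      simp only [h2, one_mul, inv_one, mul_one, commutatorElement_self, map_one, trace_smul, trace_one, smul_eq_mul] at hval
      have hlam : lam = 1 := by
        rw [Fintype.card_fin] at hval
        have hd' : (d : k) ≠ 0 := Nat.cast_ne_zero.mpr hd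
        exact mul_right_cancel₀ hd' (hval.trans (one_mul _).symm)
      rw [comseq, ← hc, h2, hlam, one_smul]

lemma trace_finite [IsAlgClosed k] (d n : ℕ) (hn : n ≠ 0) : ∃ T : Finset k, ∀ A : Matrix (Fin d) (Fin d) k, A ^ n = 1 → A.trace ∈ T := by
  classical
  let R := (Polynomial.X ^ n - Polynomial.C (1 : k)).roots.toFinset
  refine ⟨(Finset.univ : Finset (Fin d → R)).image fun f => ∑ i, (f i : k), fun A hA => ?_⟩
  have hcard : A.charpoly.roots.toList.length = d := by
    rw [Multiset.length_toList, ← (IsAlgClosed.splits A.charpoly).natDegree_eq_card_roots, charpoly_natDegree_eq_dim, Fintype.card_fin]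
  have hR : ∀ μ ∈ A.charpoly.roots, μ ∈ R := by
    intro μ hμ
    rw [Polynomial.mem_roots (charpoly_monic _).ne_zero, Polynomial.IsRoot, eval_charpoly] at hμ
    obtain ⟨v, hv0, hv⟩ := Matrix.exists_mulVec_eq_zero_iff.mpr hμ
    have h1 : A *ᵥ v = μ • v := by
      rw [sub_mulVec] at hv
      have : (scalar (Fin d) μ) *ᵥ v = μ • v := by ext i; simp [scalar_apply, mulVec_diagonal]
      rw [this] at hv
      exact (sub_eq_zero.mp hv).symm
    have h2 : ∀ j : ℕ, A ^ j *ᵥ v = μ ^ j • v := by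
      intro j
      induction j with
      | zero => simp
      | succ j ih => rw [pow_succ, ← mulVec_mulVec, h1, mulVec_smul, ih, smul_smul, pow_succ, mul_comm]
    have h3 := h2 n
    rw [hA, one_mulVec] at h3
    obtain ⟨i, hi⟩ := Function.ne_iff.mp hv0
    have h4 := congrFun h3 i
    rw [Pi.smul_apply, smul_eq_mul] at h4
    have h5 : μ ^ n = 1 := mul_right_cancel₀ hi (h4.symm.trans (one_mul _).symm)
    rw [Multiset.mem_toFinset, Polynomial.mem_roots (Polynomial.X_pow_sub_C_ne_zero (Nat.pos_of_ne_zero hn) 1)]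
    simp [h5]
  have hfin : ∀ l : List k, l.length = d → (∀ μ ∈ l, μ ∈ R) → l.sum ∈ (Finset.univ : Finset (Fin d → R)).image fun f => ∑ i, (f i : k) := by
    intro l hl hlR
    subst hl
    rw [Finset.mem_image]
    refine ⟨fun i => ⟨l[i.1], hlR _ (List.getElem_mem _)⟩, Finset.mem_univ _, ?_⟩
    simp [Fin.sum_univ_getElem]
  rw [Matrix.trace_eq_sum_roots_charpoly, ← Multiset.sum_toList]
  exact hfin _ hcard fun μ hμ => hR μ (Multiset.mem_toList.mp hμ)

theorem gap_alg [IsAlgClosed k] (hD : Dom 𝒜) (hC : Coef 𝒜 ψ) (hirr : Irr ψ) (hd : d ≠ 0) (s M : ℕ)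
    (h : ∀ x ∈ derivedSeries Q (s + 1), ∃ i, 1 ≤ i ∧ i ≤ M ∧ ∃ J, ∀ g, ψ (comseq (x ^ i) g J) = 1) :
    ∀ z ∈ derivedSeries Q (s + 2), ψ z = 1 := by
  classical
  have hcom : derivedSeries Q (s + 1) ≤ commutator Q := by
    have : derivedSeries Q 1 = commutator Q := derivedSeries_one Q
    rw [← this]; exact derived_mono (by lia)
  obtain ⟨n, hn⟩ : ∃ n, n = M.factorial * d := ⟨_, rfl⟩
  have hn0 : n ≠ 0 := by rw [hn]; exact mul_ne_zero (Nat.factorial_ne_zero _) hd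
  have hpow : ∀ x ∈ derivedSeries Q (s + 1), ψ x ^ n = 1 := by
    intro x hx
    obtain ⟨i, h1, h2, J, hJ⟩ := h x hx
    have h3 := descent hD hC hirr hd (pow_mem (hcom hx) i) J hJ
    obtain ⟨c, hc⟩ : i ∣ M.factorial := Nat.dvd_factorial h1 h2
    rw [hn, hc, show i * c * d = i * d * c by ring, pow_mul, ← map_pow, pow_mul, h3, one_pow]
  obtain ⟨T, hT⟩ := trace_finite (k := k) d n hn0
  have htriv : ∀ x ∈ derivedSeries Q (s + 1), ∀ g, ψ ⁅x, g⁆ = 1 := by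
    intro x hx g
    have hmem : ∀ g, ⁅x, g⁆ ∈ derivedSeries Q (s + 1) := fun g => by
      rw [commutatorElement_def, mul_assoc, mul_assoc, ← mul_assoc g]
      exact mul_mem hx (Subgroup.Normal.conj_mem inferInstance _ (inv_mem hx) g)
    have hA : Coef 𝒜 (fun g => ψ ⁅x, g⁆) := by
      have i3 : Coef 𝒜 (fun q => ψ x * ψ q * ψ x⁻¹ * ψ q⁻¹) :=
          (((Coef.const _).mul hC).mul (Coef.const _)).mul (Coef.inv hD hC)
      convert i3 using 2 with q
      simp only [← map_mul]
      rw [commutatorElement_def]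
    have hAj : ∀ j : ℕ, Coef 𝒜 (fun g => ψ ⁅x, g⁆ ^ j) := by
      intro j
      induction j with
      | zero => simpa using Coef.const (𝒜 := 𝒜) (1 : Matrix (Fin d) (Fin d) k)
      | succ j ih => simpa only [pow_succ] using ih.mul hA
    have htr : ∀ j : ℕ, (ψ ⁅x, g⁆ ^ j).trace = d := by
      intro j
      have := hD.finite_const (hAj j).trace T (fun q => hT _ (by rw [← pow_mul, mul_comm, pow_mul, hpow _ (hmem q), one_pow])) g 1
      simpa using this
    obtain ⟨y, hy⟩ : ∃ y, y = ψ ⁅x, g⁆ := ⟨_, rfl⟩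
    rw [← hy] at htr ⊢
    have hyn : y ^ n = 1 := by rw [hy]; exact hpow _ (hmem g)
    let e : Matrix (Fin d) (Fin d) k := (n : k)⁻¹ • ∑ j ∈ Finset.range n, y ^ j
    have hnk : (n : k) ≠ 0 := Nat.cast_ne_zero.mpr hn0
    have hye : y * e = e := by
      simp only [e, mul_smul_comm]
      congr 1
      have h1 := mul_geom_sum y n
      rw [hyn, sub_self, sub_mul, one_mul] at h1
      exact sub_eq_zero.mp h1
    have hyje : ∀ j : ℕ, y ^ j * e = e := by
      intro j
      induction j with
      | zero => simp
      | succ j ih => rw [pow_succ, Matrix.mul_assoc, hye, ih]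
    have hee : e * e = e := by
      conv_lhs => enter [1]; simp only [e]
      rw [smul_mul_assoc, Finset.sum_mul]
      simp only [hyje, Finset.sum_const, Finset.card_range]
      rw [← Nat.cast_smul_eq_nsmul k, smul_smul, inv_mul_cancel₀ hnk, one_smul]
    have hte : e.trace = d := by
      simp only [e, trace_smul, trace_sum, htr, Finset.sum_const, Finset.card_range, nsmul_eq_mul, smul_eq_mul]
      rw [← mul_assoc, inv_mul_cancel₀ hnk, one_mul]
    have h1e : 1 - e = 0 := by
      refine idem_trace_zero _ ?_ ?_
      · rw [sub_mul, mul_sub, mul_sub, hee]; simp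
      · rw [trace_sub, hte, trace_one, Fintype.card_fin, sub_self]
    rw [sub_eq_zero] at h1e
    rw [← h1e, mul_one] at hye
    exact hye
  refine trivial_succ ψ (s + 1) fun x hx y hy => ?_
  have := htriv x hx y
  rw [commutatorElement_def] at this
  have h2 : x * y = (x * y * x⁻¹ * y⁻¹) * (y * x) := by group
  rw [← map_mul, h2, map_mul, this, one_mul, map_mul]
end
end LG

namespace LG
open Filter

section place
variable {F : Type*} [Field F]

/-- an absolute value which is archimedean (weight a = 1) or non-archimedean (a = 0) -/
def PT (av : AbsoluteValue F ℝ) (a : ℝ) : Prop :=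
  (a = 1 ∧ ∃ σ : F →+* ℂ, ∀ x, av x = ‖σ x‖) ∨ (a = 0 ∧ IsNonarchimedean av)

variable {av : AbsoluteValue F ℝ} {a : ℝ}

lemma PT.nonneg (h : PT av a) : 0 ≤ a := by
  rcases h with ⟨h, -⟩ | ⟨h, -⟩ <;> simp [h]

lemma PT.le_one (h : PT av a) : a ≤ 1 := by
  rcases h with ⟨h, -⟩ | ⟨h, -⟩ <;> simp [h]

lemma PT.sum {J : Type*} (h : PT av a) (s : Finset J) (f : J → F) :
    Real.posLog (av (∑ i ∈ s, f i)) ≤ ∑ i ∈ s, Real.posLog (av (f i)) + a * Real.log s.card := by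
  rcases h with ⟨rfl, σ, hσ⟩ | ⟨rfl, hna⟩
  · simp only [hσ, map_sum, one_mul]
    rw [add_comm]
    exact Real.posLog_norm_sum_le s _
  · rw [zero_mul, add_zero]
    rcases s.eq_empty_or_nonempty with rfl | hs
    · simp
    · obtain ⟨b, hb, hle⟩ := hna.finset_image_add_of_nonempty f hs
      refine (Real.posLog_le_posLog (av.nonneg _) hle).trans ?_
      exact Finset.single_le_sum (f := fun i => Real.posLog (av (f i))) (fun i _ => Real.posLog_nonneg) hb

lemma PT.add (h : PT av a) (x y : F) :
    Real.posLog (av (x + y)) ≤ Real.posLog (av x) + Real.posLog (av y) + a * Real.log 2 := by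
  have := h.sum Finset.univ ![x, y]
  simpa using this

lemma PT.mul (x y : F) : Real.posLog (av (x * y)) ≤ Real.posLog (av x) + Real.posLog (av y) := by
  rw [map_mul]; exact Real.posLog_mul

lemma PT.root (h : PT av a) (N : ℕ) (c : ℕ → F) (x : F) (hx : x ^ N + ∑ i ∈ Finset.range N, c i * x ^ i = 0) :
    Real.posLog (av x) ≤ ∑ i ∈ Finset.range N, Real.posLog (av (c i)) + a * Real.log N := by
  have hrhs : 0 ≤ ∑ i ∈ Finset.range N, Real.posLog (av (c i)) + a * Real.log N :=
    add_nonneg (Finset.sum_nonneg fun _ _ => Real.posLog_nonneg) (mul_nonneg h.nonneg (Real.log_natCast_nonneg N))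
  by_cases h1 : av x ≤ 1
  · rw [(Real.posLog_eq_zero_iff _).mpr (by rwa [abs_of_nonneg (av.nonneg _)])]
    exact hrhs
  push Not at h1
  have hx0 : x ≠ 0 := by rintro rfl; simp at h1; linarith
  have hN : N ≠ 0 := by rintro rfl; simp at hx
  have key : x = ∑ i ∈ Finset.range N, (-c i) * (x⁻¹) ^ (N - 1 - i) := by
    have h2 : x ^ N = ∑ i ∈ Finset.range N, (-c i) * x ^ i := by
      rw [eq_neg_of_add_eq_zero_left hx, ← Finset.sum_neg_distrib]
      exact Finset.sum_congr rfl fun i _ => by ring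
    have h3 : x = x ^ N * (x⁻¹) ^ (N - 1) := by
      obtain ⟨M, rfl⟩ : ∃ M, N = M + 1 := ⟨N - 1, by lia⟩
      rw [Nat.add_sub_cancel, pow_succ', mul_assoc, ← mul_pow, mul_inv_cancel₀ hx0, one_pow, mul_one]
    rw [h2, Finset.sum_mul] at h3
    rw [h3]
    conv_rhs => rw [← h3]
    refine Finset.sum_congr rfl fun i hi => ?_
    rw [Finset.mem_range] at hi
    have : N - 1 = i + (N - 1 - i) := by lia
    conv_lhs => rw [this]
    rw [pow_add, mul_assoc, ← mul_assoc (x ^ i), ← mul_pow, mul_inv_cancel₀ hx0, one_pow, one_mul]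
  have h4 := h.sum (Finset.range N) fun i => (-c i) * (x⁻¹) ^ (N - 1 - i)
  rw [← key, Finset.card_range] at h4
  refine h4.trans (add_le_add (Finset.sum_le_sum fun i _ => ?_) le_rfl)
  refine Real.posLog_le_posLog (av.nonneg _) ?_
  rw [map_mul, map_neg_eq_map, map_pow, map_inv₀]
  refine mul_le_of_le_one_right (av.nonneg _) (pow_le_one₀ (inv_nonneg.mpr (av.nonneg _)) (inv_le_one_of_one_le₀ h1.le))

end place

/-- finitely many weighted places at each level with a product formula -/
structure Lev {k : Type*} [Field k] (U : Filter ℕ) {L : ℕ → Type*} [∀ n, Field (L n)] (ev : ∀ n, k → L n) where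
  P : ℕ → Type
  fin : ∀ n, Fintype (P n)
  wt : ∀ n, P n → ℝ
  wt_nonneg : ∀ n v, 0 ≤ wt n v
  av : ∀ n, P n → AbsoluteValue (L n) ℝ
  a : ∀ n, P n → ℝ
  pt : ∀ n v, PT (av n v) (a n v)
  sum_arch : ∀ n, ∑ v, wt n v * a n v = 1
  pf : ∀ α : k, α ≠ 0 → ∀ᶠ n in U, ∑ v, wt n v * Real.log (av n v (ev n α)) = 0

namespace Lev
variable {k : Type*} [Field k] {U : Filter ℕ} {L : ℕ → Type*} [∀ n, Field (L n)] {ev : ∀ n, k → L n}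

instance (Λ : Lev U ev) (n : ℕ) : Fintype (Λ.P n) := Λ.fin n

/-- height -/
noncomputable def ht (Λ : Lev U ev) (n : ℕ) (α : k) : ℝ := ∑ v, Λ.wt n v * Real.posLog (Λ.av n v (ev n α))

variable (Λ : Lev U ev) (hev : EvHom U ev)

lemma ht_nonneg (n : ℕ) (α : k) : 0 ≤ Λ.ht n α :=
  Finset.sum_nonneg fun v _ => mul_nonneg (Λ.wt_nonneg n v) Real.posLog_nonneg

/-- summing local inequalities -/
lemma sum_le {n : ℕ} (f g : Λ.P n → ℝ) (c : ℝ) (h : ∀ v, f v ≤ g v + Λ.a n v * c) :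
    ∑ v, Λ.wt n v * f v ≤ ∑ v, Λ.wt n v * g v + c := by
  calc ∑ v, Λ.wt n v * f v ≤ ∑ v, (Λ.wt n v * g v + (Λ.wt n v * Λ.a n v) * c) :=
        Finset.sum_le_sum fun v _ => by
          have := mul_le_mul_of_nonneg_left (h v) (Λ.wt_nonneg n v)
          linarith
    _ = _ := by rw [Finset.sum_add_distrib, ← Finset.sum_mul, Λ.sum_arch, one_mul]


lemma ht_zero (hev : EvHom U ev) : ∀ᶠ n in U, Λ.ht n 0 = 0 := by
  filter_upwards [hev.zero] with n h
  simp [ht, h]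

lemma ht_one (hev : EvHom U ev) : ∀ᶠ n in U, Λ.ht n 1 = 0 := by
  filter_upwards [hev.one] with n h
  simp [ht, h]

lemma ht_neg (hev : EvHom U ev) (α : k) : ∀ᶠ n in U, Λ.ht n (-α) = Λ.ht n α := by
  filter_upwards [hev.neg α] with n h
  simp only [ht, h]
  exact Finset.sum_congr rfl fun v _ => by rw [map_neg_eq_map]

lemma ht_add (hev : EvHom U ev) (α β : k) : ∀ᶠ n in U, Λ.ht n (α + β) ≤ Λ.ht n α + Λ.ht n β + Real.log 2 := by
  filter_upwards [hev.add α β] with n h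
  simp only [ht, h]
  rw [← Finset.sum_add_distrib]
  simp only [← mul_add]
  exact Λ.sum_le _ _ _ fun v => (Λ.pt n v).add _ _

lemma ht_mul (hev : EvHom U ev) (α β : k) : ∀ᶠ n in U, Λ.ht n (α * β) ≤ Λ.ht n α + Λ.ht n β := by
  filter_upwards [hev.mul α β] with n h
  simp only [ht, h]
  rw [← Finset.sum_add_distrib]
  simp only [← mul_add]
  exact Finset.sum_le_sum fun v _ => mul_le_mul_of_nonneg_left (PT.mul _ _) (Λ.wt_nonneg n v)

lemma ht_inv (hev : EvHom U ev) (α : k) : ∀ᶠ n in U, Λ.ht n α⁻¹ = Λ.ht n α := by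
  by_cases h0 : α = 0
  · subst h0; simp
  filter_upwards [hev.inv α, Λ.pf α h0] with n h h1
  have h2 : ∀ v, Real.log (Λ.av n v (ev n α)) = Real.posLog (Λ.av n v (ev n α)) - Real.posLog (Λ.av n v (ev n α⁻¹)) := fun v => by
    rw [h, map_inv₀, Real.posLog_sub_posLog_inv]
  simp only [h2, mul_sub, Finset.sum_sub_distrib] at h1
  exact (sub_eq_zero.mp h1).symm

lemma ht_root (hev : EvHom U ev) (N : ℕ) (c : ℕ → k) (α : k) (hα : α ^ N + ∑ i ∈ Finset.range N, c i * α ^ i = 0) :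
    ∀ᶠ n in U, Λ.ht n α ≤ ∑ i ∈ Finset.range N, Λ.ht n (c i) + Real.log N := by
  have e1 : ∀ᶠ n in U, (ev n α) ^ N + ∑ i ∈ Finset.range N, ev n (c i) * (ev n α) ^ i = 0 := by
    have h1 : ∀ᶠ n in U, ∀ i : Fin N, ev n (c i * α ^ (i : ℕ)) = ev n (c i) * (ev n α) ^ (i : ℕ) := by
      rw [eventually_all]
      intro i
      filter_upwards [hev.mul (c i) (α ^ (i : ℕ)), hev.pow α i] with n h2 h3
      rw [h2, h3]
    filter_upwards [hev.zero, hev.add (α ^ N) (∑ i ∈ Finset.range N, c i * α ^ i), hev.pow α N,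
      hev.sum (Finset.range N) (fun i => c i * α ^ i), h1] with n h2 h3 h4 h5 h6
    rw [hα, h2, h4, h5] at h3
    rw [h3]
    congr 1
    exact Finset.sum_congr rfl fun i hi => (h6 ⟨i, Finset.mem_range.mp hi⟩).symm
  filter_upwards [e1] with n hn
  have : ∑ i ∈ Finset.range N, Λ.ht n (c i) = ∑ v, Λ.wt n v * ∑ i ∈ Finset.range N, Real.posLog (Λ.av n v (ev n (c i))) := by
    simp only [ht, Finset.mul_sum]
    exact Finset.sum_comm
  rw [this]
  exact Λ.sum_le _ _ _ fun v => (Λ.pt n v).root N (fun i => ev n (c i)) _ hn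

/-- the subfield of elements of height O(h) -/
def B (h : ℕ → ℝ) (hh : ∃ ε > 0, ∀ᶠ n in U, ε ≤ h n) : Subfield k where
  carrier := {α | ∃ C : ℝ, 0 ≤ C ∧ ∀ᶠ n in U, Λ.ht n α ≤ C * h n}
  zero_mem' := ⟨0, le_rfl, by filter_upwards [Λ.ht_zero hev] with n h1; simp [h1]⟩
  one_mem' := ⟨0, le_rfl, by filter_upwards [Λ.ht_one hev] with n h1; simp [h1]⟩
  neg_mem' := fun {α} ⟨C, hC0, hC⟩ => ⟨C, hC0, by filter_upwards [hC, Λ.ht_neg hev α] with n h1 h2; rwa [h2]⟩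
  inv_mem' := fun α ⟨C, hC0, hC⟩ => ⟨C, hC0, by filter_upwards [hC, Λ.ht_inv hev α] with n h1 h2; rwa [h2]⟩
  mul_mem' := fun {α β} ⟨C, hC0, hC⟩ ⟨C', hC0', hC'⟩ => ⟨C + C', by positivity, by
    filter_upwards [hC, hC', Λ.ht_mul hev α β] with n h1 h2 h3
    linarith⟩
  add_mem' := fun {α β} ⟨C, hC0, hC⟩ ⟨C', hC0', hC'⟩ => by
    obtain ⟨ε, hε, he⟩ := hh
    have hl : 0 ≤ Real.log 2 := Real.log_nonneg (by norm_num)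
    refine ⟨C + C' + Real.log 2 / ε, by positivity, ?_⟩
    filter_upwards [hC, hC', Λ.ht_add hev α β, he] with n h1 h2 h3 h4
    have : Real.log 2 ≤ Real.log 2 / ε * h n := by
      rw [div_mul_eq_mul_div, le_div_iff₀ hε]
      exact mul_le_mul_of_nonneg_left h4 hl
    linarith

lemma mem_B {h : ℕ → ℝ} {hh : ∃ ε > 0, ∀ᶠ n in U, ε ≤ h n} {α : k} :
    α ∈ Λ.B hev h hh ↔ ∃ C : ℝ, 0 ≤ C ∧ ∀ᶠ n in U, Λ.ht n α ≤ C * h n := Iff.rfl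

lemma root_mem_B {h : ℕ → ℝ} {hh : ∃ ε > 0, ∀ᶠ n in U, ε ≤ h n} (N : ℕ) (c : ℕ → k) (hc : ∀ i, c i ∈ Λ.B hev h hh) (α : k)
    (hα : α ^ N + ∑ i ∈ Finset.range N, c i * α ^ i = 0) : α ∈ Λ.B hev h hh := by
  choose C hC0 hC using hc
  obtain ⟨ε, hε, he⟩ := id hh
  have hl : 0 ≤ Real.log N := Real.log_natCast_nonneg N
  refine ⟨∑ i ∈ Finset.range N, C i + Real.log N / ε, add_nonneg (Finset.sum_nonneg fun i _ => hC0 i) (by positivity), ?_⟩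
  have hall : ∀ᶠ n in U, ∀ i : Fin N, Λ.ht n (c i) ≤ C i * h n := eventually_all.mpr fun i => hC i
  filter_upwards [hall, Λ.ht_root hev N c α hα, he] with n h1 h2 h3
  have h4 : Real.log N ≤ Real.log N / ε * h n := by
    rw [div_mul_eq_mul_div, le_div_iff₀ hε]
    exact mul_le_mul_of_nonneg_left h3 hl
  have h5 : ∑ i ∈ Finset.range N, Λ.ht n (c i) ≤ ∑ i ∈ Finset.range N, C i * h n :=
    Finset.sum_le_sum fun i hi => h1 ⟨i, Finset.mem_range.mp hi⟩
  rw [add_mul, Finset.sum_mul]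
  linarith

open Polynomial in
lemma isAlgClosed_B [IsAlgClosed k] {h : ℕ → ℝ} {hh : ∃ ε > 0, ∀ᶠ n in U, ε ≤ h n} : IsAlgClosed (Λ.B hev h hh) := by
  refine IsAlgClosed.of_exists_root _ fun p hp hirr => ?_
  obtain ⟨α, hα⟩ := IsAlgClosed.exists_root (p.map (algebraMap (Λ.B hev h hh) k))
    (by rw [degree_map]; exact hirr.degree_pos.ne')
  rw [IsRoot, eval_map] at hα
  have hmem : α ∈ Λ.B hev h hh := by
    refine Λ.root_mem_B hev p.natDegree (fun i => algebraMap (Λ.B hev h hh) k (p.coeff i)) (fun i => (p.coeff i).2) α ?_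
    rw [eval₂_eq_sum_range, Finset.sum_range_succ, hp.coeff_natDegree, map_one, one_mul, add_comm] at hα
    exact hα
  refine ⟨⟨α, hmem⟩, ?_⟩
  apply (algebraMap (Λ.B hev h hh) k).injective
  rw [map_zero, ← hα]
  exact (Polynomial.eval₂_at_apply (algebraMap (Λ.B hev h hh) k) ⟨α, hmem⟩).symm

end Lev
end LG

namespace LG
universe u

section contraction
variable {A : Type*} [NormedRing A]

lemma inv_bound (h1 : ‖(1 : A)‖ ≤ 1) {a b : A} (hab : a * b = 1) (ha : ‖a - 1‖ ≤ 1 / 2) : ‖b‖ ≤ 2 := by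
  have e : b = 1 - (a - 1) * b := by rw [sub_mul, hab, one_mul]; abel
  have h2 : ‖b‖ ≤ 1 + 1 / 2 * ‖b‖ := by
    calc ‖b‖ = ‖1 - (a - 1) * b‖ := by rw [← e]
      _ ≤ ‖(1 : A)‖ + ‖(a - 1) * b‖ := norm_sub_le _ _
      _ ≤ 1 + ‖a - 1‖ * ‖b‖ := add_le_add h1 (norm_mul_le _ _)
      _ ≤ 1 + 1 / 2 * ‖b‖ := by gcongr
  linarith

lemma comm_bound (h1 : ‖(1 : A)‖ ≤ 1) {a b a' b' : A} (hab : a * b = 1) (hab' : a' * b' = 1)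
    {δ δ' : ℝ} (ha : ‖a - 1‖ ≤ δ) (ha' : ‖a' - 1‖ ≤ δ') (hδ : δ ≤ 1 / 2) (hδ' : δ' ≤ 1 / 2) :
    ‖a * a' * b * b' - 1‖ ≤ 8 * δ * δ' := by
  have hb := inv_bound h1 hab (ha.trans hδ)
  have hb' := inv_bound h1 hab' (ha'.trans hδ')
  have e : a * a' * b * b' - 1 = ((a - 1) * (a' - 1) - (a' - 1) * (a - 1)) * (b * b') := by
    have : (a - 1) * (a' - 1) - (a' - 1) * (a - 1) = a * a' - a' * a := by noncomm_ring
    rw [this, sub_mul]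
    have h3 : a' * a * (b * b') = 1 := by
      rw [mul_assoc, ← mul_assoc a b, hab, one_mul, hab']
    rw [h3]
    simp only [mul_assoc]
  have hd : 0 ≤ δ := (norm_nonneg _).trans ha
  have hd' : 0 ≤ δ' := (norm_nonneg _).trans ha'
  rw [e]
  calc _ ≤ ‖(a - 1) * (a' - 1) - (a' - 1) * (a - 1)‖ * ‖b * b'‖ := norm_mul_le _ _
    _ ≤ (‖a - 1‖ * ‖a' - 1‖ + ‖a' - 1‖ * ‖a - 1‖) * (‖b‖ * ‖b'‖) := by
      gcongr
      · exact (norm_sub_le _ _).trans (add_le_add (norm_mul_le _ _) (norm_mul_le _ _))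
      · exact norm_mul_le _ _
    _ ≤ (δ * δ' + δ' * δ) * (2 * 2) := by gcongr
    _ = _ := by ring

/-- relations making up one contraction chain -/
structure Chain (B : ℝ) (J : ℕ) (a b c c' : ℕ → A) : Prop where
  inv : ∀ j < J, a j * b j = 1
  cinv : ∀ j < J, c j * c' j = 1
  cinv' : ∀ j < J, c' j * c j = 1
  cb : ∀ j < J, ‖c j‖ ≤ B
  cb' : ∀ j < J, ‖c' j‖ ≤ B
  step : ∀ j < J, a (j + 1) = a j * (c j * a j * c' j) * b j * (c j * b j * c' j)

lemma Chain.bound (h1 : ‖(1 : A)‖ ≤ 1) {B : ℝ} (hB : 1 ≤ B) {J : ℕ} {a b c c' : ℕ → A} (h : Chain B J a b c c')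
    (h0 : ‖a 0 - 1‖ ≤ 1 / (16 * B ^ 2)) : ∀ j ≤ J, ‖a j - 1‖ ≤ 1 / (16 * B ^ 2) * (1 / 2) ^ j := by
  intro j
  induction j with
  | zero => intro _; simpa using h0
  | succ j ih =>
    intro hj
    have hj' : j < J := hj
    obtain ⟨δ, hδ⟩ : ∃ δ, δ = 1 / (16 * B ^ 2) * (1 / 2 : ℝ) ^ j := ⟨_, rfl⟩
    have h2 : ‖a j - 1‖ ≤ δ := by rw [hδ]; exact ih hj'.le
    have hB2 : 1 ≤ B ^ 2 := one_le_pow₀ hB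
    have hδ0 : 0 ≤ δ := by rw [hδ]; positivity
    have hδ1 : δ * B ^ 2 ≤ 1 / 16 := by
      have : δ ≤ 1 / (16 * B ^ 2) := by
        rw [hδ]; exact mul_le_of_le_one_right (by positivity) (pow_le_one₀ (by norm_num) (by norm_num))
      calc δ * B ^ 2 ≤ 1 / (16 * B ^ 2) * B ^ 2 := by gcongr
        _ = 1 / 16 := by field_simp
    have hδ2 : δ ≤ 1 / 16 := le_trans (by nlinarith) hδ1
    have h3 : ‖c j * a j * c' j - 1‖ ≤ B ^ 2 * δ := by
      have e : c j * a j * c' j - 1 = c j * (a j - 1) * c' j := by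
        rw [mul_sub, sub_mul, mul_one, h.cinv j hj']
      rw [e]
      calc _ ≤ ‖c j‖ * ‖a j - 1‖ * ‖c' j‖ := (norm_mul_le _ _).trans (mul_le_mul_of_nonneg_right (norm_mul_le _ _) (norm_nonneg _))
        _ ≤ B * δ * B := by
          have := h.cb j hj'; have := h.cb' j hj'
          gcongr
        _ = _ := by ring
    have h4 : (c j * a j * c' j) * (c j * b j * c' j) = 1 := by
      calc (c j * a j * c' j) * (c j * b j * c' j) = c j * a j * (c' j * c j) * b j * c' j := by noncomm_ring
        _ = 1 := by rw [h.cinv' j hj', mul_one, mul_assoc (c j), h.inv j hj', mul_one, h.cinv j hj']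
    have h5 := comm_bound h1 (h.inv j hj') h4 h2 h3 (by linarith) (by linarith)
    rw [h.step j hj']
    refine h5.trans ?_
    have e5 : 1 / (16 * B ^ 2) * (1 / 2) ^ (j + 1) = δ * (1 / 2) := by rw [hδ, pow_succ (1 / 2 : ℝ) j, mul_assoc]
    rw [e5]
    nlinarith

lemma pigeon [ProperSpace A] (R δ : ℝ) (hδ : 0 < δ) : ∃ M : ℕ, 1 ≤ M ∧ ∀ X : ℕ → A, (∀ i ≤ M, ‖X i‖ ≤ R) →
    ∃ i i', i < i' ∧ i' ≤ M ∧ ‖X i' - X i‖ ≤ δ := by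
  classical
  obtain ⟨t, ht, hcov⟩ := Metric.totallyBounded_iff.mp (isCompact_closedBall (0 : A) R).totallyBounded (δ / 2) (by positivity)
  refine ⟨ht.toFinset.card + 1, by lia, fun X hX => ?_⟩
  have h1 : ∀ i : ℕ, ∃ y : A, i ≤ ht.toFinset.card + 1 → y ∈ ht.toFinset ∧ dist (X i) y < δ / 2 := by
    intro i
    by_cases hi : i ≤ ht.toFinset.card + 1
    · have := hcov (mem_closedBall_zero_iff.mpr (hX i hi))
      simp only [Set.mem_iUnion, Metric.mem_ball] at this
      obtain ⟨y, hy, hd⟩ := this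
      exact ⟨y, fun _ => ⟨ht.mem_toFinset.mpr hy, hd⟩⟩
    · exact ⟨0, fun h => absurd h hi⟩
  choose f hf using h1
  obtain ⟨i, hi, i', hi', hne, he⟩ := Finset.exists_ne_map_eq_of_card_lt_of_maps_to (s := Finset.range (ht.toFinset.card + 2))
    (t := ht.toFinset) (by simp) (f := f) (fun i hi => (hf i (by have := Finset.mem_range.mp hi; lia)).1)
  rw [Finset.mem_range] at hi hi'
  have key : ∀ i i', i < ht.toFinset.card + 2 → i' < ht.toFinset.card + 2 → f i = f i' → ‖X i' - X i‖ ≤ δ := by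
    intro i i' hi hi' he
    have a1 := (hf i (by lia)).2
    have a2 := (hf i' (by lia)).2
    rw [← dist_eq_norm]
    have := dist_triangle_right (X i') (X i) (f i)
    rw [← he] at a2
    linarith
  rcases lt_or_gt_of_ne hne with h | h
  · exact ⟨i, i', h, by lia, key i i' hi hi' he⟩
  · exact ⟨i', i, h, by lia, key i' i hi' hi he.symm⟩

/-- at a place of bounded complexity some power is contracted -/
theorem place_lemma [ProperSpace A] (h1 : ‖(1 : A)‖ ≤ 1) (B : ℝ) (hB : 1 ≤ B) : ∃ M : ℕ, 1 ≤ M ∧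
    ∀ (J : ℕ) (X Y : ℕ → A) (a b c c' : Fin M → ℕ → A),
    (∀ i ≤ M, ‖X i‖ ≤ B) → (∀ i ≤ M, ‖Y i‖ ≤ B) → (∀ i ≤ M, ∀ j ≤ M, X (i + j) = X i * X j) → (∀ i ≤ M, Y i * X i = 1) →
    (∀ i, a i 0 = X (i + 1) ∧ Chain B J (a i) (b i) (c i) (c' i)) →
    ∃ i, ‖a i J - 1‖ ≤ (1 / 2) ^ J := by
  obtain ⟨M, hM1, hM⟩ := pigeon (A := A) B (1 / (16 * B ^ 2) / B) (by positivity)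
  refine ⟨M, hM1, fun J X Y a b c c' hX hY hmul hinv hch => ?_⟩
  obtain ⟨i, i', hlt, hi', hd⟩ := hM X hX
  have e : X (i' - i) - 1 = Y i * (X i' - X i) := by
    have h2 := hmul i (by lia) (i' - i) (by lia)
    rw [show i + (i' - i) = i' by lia] at h2
    rw [mul_sub, hinv i (by lia), h2, ← mul_assoc, hinv i (by lia), one_mul]
  have h0 : ‖X (i' - i) - 1‖ ≤ 1 / (16 * B ^ 2) := by
    rw [e]
    calc _ ≤ ‖Y i‖ * ‖X i' - X i‖ := norm_mul_le _ _
      _ ≤ B * (1 / (16 * B ^ 2) / B) := by have := hY i (by lia); gcongr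
      _ = _ := by field_simp
  obtain ⟨h2, h3⟩ := hch ⟨i' - i - 1, by lia⟩
  rw [show i' - i - 1 + 1 = i' - i by lia] at h2
  rw [← h2] at h0
  refine ⟨⟨i' - i - 1, by lia⟩, (h3.bound h1 hB h0 J le_rfl).trans ?_⟩
  refine mul_le_of_le_one_left (by positivity) ?_
  rw [div_le_one (by positivity)]
  have : 1 ≤ B ^ 2 := one_le_pow₀ hB
  linarith

end contraction

/-- the algebraic relations of a chain -/
structure Rel {A : Type*} [Ring A] (J : ℕ) (a b c c' : ℕ → A) : Prop where
  inv : ∀ j < J, a j * b j = 1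
  cinv : ∀ j < J, c j * c' j = 1
  cinv' : ∀ j < J, c' j * c j = 1
  step : ∀ j < J, a (j + 1) = a j * (c j * a j * c' j) * b j * (c j * b j * c' j)

lemma Rel.map {A A' : Type*} [Ring A] [Ring A'] (f : A →+* A') {J : ℕ} {a b c c' : ℕ → A} (h : Rel J a b c c') :
    Rel J (fun j => f (a j)) (fun j => f (b j)) (fun j => f (c j)) (fun j => f (c' j)) where
  inv j hj := by rw [← map_mul, h.inv j hj, map_one]
  cinv j hj := by rw [← map_mul, h.cinv j hj, map_one]
  cinv' j hj := by rw [← map_mul, h.cinv' j hj, map_one]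
  step j hj := by simp only [← map_mul]; rw [h.step j hj]

section mat
attribute [local instance] Matrix.linftyOpNormedRing Matrix.linftyOpNormedAddCommGroup Matrix.linftyOpNormedSpace

lemma entry_le {m : ℕ} (A : Matrix (Fin m) (Fin m) ℂ) (i j : Fin m) : ‖A i j‖ ≤ ‖A‖ := by
  rw [Matrix.linfty_opNorm_def]
  have h1 : ‖A i j‖₊ ≤ ∑ j, ‖A i j‖₊ := Finset.single_le_sum (f := fun j => ‖A i j‖₊) (fun _ _ => zero_le) (Finset.mem_univ j)
  have h2 : ∑ j, ‖A i j‖₊ ≤ Finset.univ.sup fun i => ∑ j, ‖A i j‖₊ :=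
    Finset.le_sup (f := fun i => ∑ j, ‖A i j‖₊) (Finset.mem_univ i)
  exact_mod_cast h1.trans h2

lemma norm_le_of_entry {m : ℕ} (A : Matrix (Fin m) (Fin m) ℂ) (b : ℝ) (hb : 0 ≤ b) (h : ∀ i j, ‖A i j‖ ≤ b) : ‖A‖ ≤ m * b := by
  rw [Matrix.linfty_opNorm_def]
  lift b to NNReal using hb
  have : (Finset.univ.sup fun i => ∑ j, ‖A i j‖₊) ≤ m * b := by
    refine Finset.sup_le fun i _ => ?_
    calc ∑ j, ‖A i j‖₊ ≤ ∑ j : Fin m, b := Finset.sum_le_sum fun j _ => by exact_mod_cast h i j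
      _ = _ := by simp
  exact_mod_cast this

lemma norm_one_le {m : ℕ} : ‖(1 : Matrix (Fin m) (Fin m) ℂ)‖ ≤ 1 := by
  rw [Matrix.linfty_opNorm_def]
  have : (Finset.univ.sup fun i => ∑ j, ‖(1 : Matrix (Fin m) (Fin m) ℂ) i j‖₊) ≤ 1 := by
    refine Finset.sup_le fun i _ => ?_
    rw [Finset.sum_eq_single i]
    · simp
    · intro j _ hj; simp [Matrix.one_apply, hj.symm]
    · simp
  exact_mod_cast this

theorem place_mat (m : ℕ) (b0 : ℝ) (hb : 0 ≤ b0) : ∃ M : ℕ, 1 ≤ M ∧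
    ∀ {F : Type u} [Field F] (σ : F →+* ℂ) (J : ℕ) (X Y : ℕ → Matrix (Fin m) (Fin m) F) (a b c c' : Fin M → ℕ → Matrix (Fin m) (Fin m) F),
    (∀ i ≤ M, ∀ p q, ‖σ (X i p q)‖ ≤ b0) → (∀ i ≤ M, ∀ p q, ‖σ (Y i p q)‖ ≤ b0) →
    (∀ i, ∀ j < J, ∀ p q, ‖σ (c i j p q)‖ ≤ b0) → (∀ i, ∀ j < J, ∀ p q, ‖σ (c' i j p q)‖ ≤ b0) →
    (∀ i ≤ M, ∀ j ≤ M, X (i + j) = X i * X j) → (∀ i ≤ M, Y i * X i = 1) →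
    (∀ i, a i 0 = X (i + 1)) → (∀ i, Rel J (a i) (b i) (c i) (c' i)) →
    ∃ i, ∀ p q, ‖σ ((a i J - 1) p q)‖ ≤ (1 / 2) ^ J := by
  haveI : ProperSpace (Matrix (Fin m) (Fin m) ℂ) := FiniteDimensional.proper_rclike ℂ _
  obtain ⟨M, hM, h⟩ := place_lemma (A := Matrix (Fin m) (Fin m) ℂ) norm_one_le (1 + m * b0) (by
    have : 0 ≤ (m : ℝ) * b0 := by positivity
    linarith)
  refine ⟨M, hM, fun {F} _ σ J X Y a b c c' hX hY hc hc' hmul hinv h0 hrel => ?_⟩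
  have bd : ∀ A : Matrix (Fin m) (Fin m) F, (∀ p q, ‖σ (A p q)‖ ≤ b0) → ‖σ.mapMatrix A‖ ≤ 1 + m * b0 := fun A hA =>
    (norm_le_of_entry _ b0 hb (by simpa using hA)).trans (by linarith)
  obtain ⟨i, hi⟩ := h J (fun i => σ.mapMatrix (X i)) (fun i => σ.mapMatrix (Y i)) (fun i j => σ.mapMatrix (a i j))
    (fun i j => σ.mapMatrix (b i j)) (fun i j => σ.mapMatrix (c i j)) (fun i j => σ.mapMatrix (c' i j))
    (fun i hi => bd _ (hX i hi)) (fun i hi => bd _ (hY i hi)) (fun i hi j hj => by simp only [hmul i hi j hj, map_mul])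
    (fun i hi => by simp only [← map_mul, hinv i hi, map_one])
    (fun i => ⟨by simp only [h0], by
      have := (hrel i).map σ.mapMatrix
      exact ⟨this.inv, this.cinv, this.cinv', fun j hj => bd _ (hc i j hj), fun j hj => bd _ (hc' i j hj), this.step⟩⟩)
  refine ⟨i, fun p q => le_trans ?_ hi⟩
  have : σ ((a i J - 1) p q) = (σ.mapMatrix (a i J) - 1) p q := by
    rw [← map_one σ.mapMatrix, ← map_sub]; rfl
  rw [this]
  exact entry_le _ p q

end mat

end LG

namespace LG
open Filter Matrix
open scoped commutatorElement
universe u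

namespace Lev
variable {k : Type*} [Field k] {U : Filter ℕ} {L : ℕ → Type u} [∀ n, Field (L n)] {ev : ∀ n, k → L n} (Λ : Lev U ev)

/-- local excess of a trace -/
noncomputable def loc (d n : ℕ) (v : Λ.P n) (t : k) : ℝ := max 0 (Real.log (Λ.av n v (ev n t)) - Λ.a n v * Real.log d)
/-- total excess -/
noncomputable def eta (d n : ℕ) (t : k) : ℝ := ∑ v, Λ.wt n v * Λ.loc d n v t

lemma loc_nonneg {d n : ℕ} (v : Λ.P n) (t : k) : 0 ≤ Λ.loc d n v t := le_max_left _ _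

lemma eta_nonneg {d n : ℕ} (t : k) : 0 ≤ Λ.eta d n t :=
  Finset.sum_nonneg fun v _ => mul_nonneg (Λ.wt_nonneg n v) (Λ.loc_nonneg v t)

lemma log_le_loc {d n : ℕ} (v : Λ.P n) (t : k) :
    Real.log (Λ.av n v (ev n t)) ≤ Λ.loc d n v t + Λ.a n v * Real.log d := by
  have := le_max_right 0 (Real.log (Λ.av n v (ev n t)) - Λ.a n v * Real.log d)
  rw [loc]; linarith

lemma posLog_le_loc {d n : ℕ} (v : Λ.P n) (t : k) :
    Real.posLog (Λ.av n v (ev n t)) ≤ Λ.loc d n v t + Λ.a n v * Real.log d := by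
  rw [Real.posLog_def]
  refine max_le (add_nonneg (Λ.loc_nonneg v t) (mul_nonneg (Λ.pt n v).nonneg (Real.log_natCast_nonneg d))) (Λ.log_le_loc v t)

lemma ht_le_eta {d n : ℕ} (t : k) : Λ.ht n t ≤ Λ.eta d n t + Real.log d :=
  Λ.sum_le _ _ _ fun v => Λ.posLog_le_loc v t

end Lev

lemma inv_mem_subfield {k : Type*} [Field k] (S : Subfield k) {m : ℕ} (G : Matrix (Fin m) (Fin m) k) (hG : G.det ≠ 0)
    (h : ∀ i j, G i j ∈ S) (i j : Fin m) : G⁻¹ i j ∈ S := by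
  let G0 : Matrix (Fin m) (Fin m) S := of fun i j => ⟨G i j, h i j⟩
  have e : S.subtype.mapMatrix G0 = G := by ext i j; rfl
  have hdet : G0.det ≠ 0 := by
    intro h0
    apply hG
    rw [← e, ← RingHom.map_det, h0, map_zero]
  have : G⁻¹ = S.subtype.mapMatrix G0⁻¹ := by
    apply Matrix.inv_eq_right_inv
    conv_lhs => rw [← e]
    rw [← map_mul, mul_nonsing_inv _ (isUnit_iff_ne_zero.mpr hdet), map_one]
  rw [this]
  exact (G0⁻¹ i j).2

section gap
variable {k : Type*} [Field k] [CharZero k] {L : ℕ → Type u} [∀ n, Field (L n)] {ev : ∀ n, k → L n}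
variable {Q : Type*} [Group Q] {d : ℕ} {ψ : Q →* Matrix (Fin d) (Fin d) k} {Δ : Subgroup Q} {m : ℕ} {x : Fin m → Q}

section rels
variable {U : Filter ℕ} (hev : EvHom U ev) (h : SB ψ Δ x) (hG : (gram ψ x).det ≠ 0)

lemma lE_mul (hev : EvHom U ev) (h : SB ψ Δ x) (hG : (gram ψ x).det ≠ 0) {y z : Q} (hy : y ∈ Δ) (hz : z ∈ Δ) : ∀ᶠ n in U,
    (lfun ψ x (y * z)).map (ev n) = (lfun ψ x y).map (ev n) * (lfun ψ x z).map (ev n) := by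
  rw [h.lfun_mul hG hy hz]; exact hev.mat_mul _ _

lemma lE_inv (hev : EvHom U ev) (h : SB ψ Δ x) (hG : (gram ψ x).det ≠ 0) {y : Q} (hy : y ∈ Δ) : ∀ᶠ n in U, (lfun ψ x y).map (ev n) * (lfun ψ x y⁻¹).map (ev n) = 1 := by
  filter_upwards [lE_mul hev h hG hy (inv_mem hy), hev.mat_one (ι := Fin m)] with n h1 h2
  rw [← h1, mul_inv_cancel, h.lfun_one hG, h2]

lemma cE_inv (hev : EvHom U ev) (h : SB ψ Δ x) (hG : (gram ψ x).det ≠ 0) [Δ.Normal] (g : Q) : ∀ᶠ n in U, (cfun ψ x g).map (ev n) * (cfun ψ x g⁻¹).map (ev n) = 1 := by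
  filter_upwards [hev.mat_mul (cfun ψ x g) (cfun ψ x g⁻¹), hev.mat_one (ι := Fin m)] with n h1 h2
  rw [← h1, ← h2]
  congr 1
  have := map_mul (chom h hG) g g⁻¹
  rw [mul_inv_cancel, map_one] at this
  exact this.symm

lemma lE_conj (hev : EvHom U ev) (h : SB ψ Δ x) (hG : (gram ψ x).det ≠ 0) [Δ.Normal] {y : Q} (hy : y ∈ Δ) (g : Q) : ∀ᶠ n in U,
    (lfun ψ x (g * y * g⁻¹)).map (ev n) = (cfun ψ x g).map (ev n) * (lfun ψ x y).map (ev n) * (cfun ψ x g⁻¹).map (ev n) := by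
  rw [h.lfun_conj hG hy g]
  filter_upwards [hev.mat_mul (cfun ψ x g * lfun ψ x y) (cfun ψ x g⁻¹), hev.mat_mul (cfun ψ x g) (lfun ψ x y)] with n h1 h2
  rw [h1, h2]

lemma rel_ev (hev : EvHom U ev) (h : SB ψ Δ x) (hG : (gram ψ x).det ≠ 0) [Δ.Normal] {y : Q} (hy : y ∈ Δ) (g : ℕ → Q) (J : ℕ) : ∀ᶠ n in U,
    Rel J (fun j => (lfun ψ x (comseq y g j)).map (ev n)) (fun j => (lfun ψ x (comseq y g j)⁻¹).map (ev n))
      (fun j => (cfun ψ x (g j)).map (ev n)) (fun j => (cfun ψ x (g j)⁻¹).map (ev n)) := by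
  have key : ∀ j : Fin J, ∀ᶠ n in U,
      (lfun ψ x (comseq y g j)).map (ev n) * (lfun ψ x (comseq y g j)⁻¹).map (ev n) = 1 ∧
      (cfun ψ x (g j)).map (ev n) * (cfun ψ x (g j)⁻¹).map (ev n) = 1 ∧
      (cfun ψ x (g j)⁻¹).map (ev n) * (cfun ψ x (g j)).map (ev n) = 1 ∧
      (lfun ψ x (comseq y g (j + 1))).map (ev n) = (lfun ψ x (comseq y g j)).map (ev n) *
        ((cfun ψ x (g j)).map (ev n) * (lfun ψ x (comseq y g j)).map (ev n) * (cfun ψ x (g j)⁻¹).map (ev n)) *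
        (lfun ψ x (comseq y g j)⁻¹).map (ev n) *
        ((cfun ψ x (g j)).map (ev n) * (lfun ψ x (comseq y g j)⁻¹).map (ev n) * (cfun ψ x (g j)⁻¹).map (ev n)) := by
    intro j
    obtain ⟨c, hc⟩ : ∃ c, c = comseq y g j := ⟨_, rfl⟩
    obtain ⟨q, hq⟩ : ∃ q, q = g j := ⟨_, rfl⟩
    have hcm : c ∈ Δ := by rw [hc]; exact comseq_mem hy g j
    have hcj : q * c * q⁻¹ ∈ Δ := Subgroup.Normal.conj_mem inferInstance c hcm q
    have e : comseq y g (j + 1) = c * (q * c * q⁻¹) * c⁻¹ * (q * c⁻¹ * q⁻¹) := by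
      rw [comseq, ← hc, ← hq, commutatorElement_def]; group
    rw [e, ← hc, ← hq]
    have i1 := cE_inv hev h hG q⁻¹
    rw [inv_inv] at i1
    filter_upwards [lE_inv hev h hG hcm, cE_inv hev h hG q, i1, lE_conj hev h hG hcm q,
      lE_conj hev h hG (inv_mem hcm) q, lE_mul hev h hG hcm hcj,
      lE_mul hev h hG (mul_mem hcm hcj) (inv_mem hcm),
      lE_mul hev h hG (mul_mem (mul_mem hcm hcj) (inv_mem hcm)) (Subgroup.Normal.conj_mem inferInstance _ (inv_mem hcm) q)]
      with n h1 h2 h3 h4 h5 h6 h7 h8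
    refine ⟨h1, h2, h3, ?_⟩
    rw [h8, h7, h6, h5, h4]
  filter_upwards [eventually_all.mpr key] with n hn
  exact ⟨fun j hj => (hn ⟨j, hj⟩).1, fun j hj => (hn ⟨j, hj⟩).2.1, fun j hj => (hn ⟨j, hj⟩).2.2.1,
    fun j hj => (hn ⟨j, hj⟩).2.2.2⟩

end rels

/-- a good archimedean place -/
def GoodP {U : Filter ℕ} (Λ : Lev U ev) (ψ : Q →* Matrix (Fin d) (Fin d) k) (x : Fin m → Q) (W : Finset Q) (c : ℝ) (n : ℕ) (v : Λ.P n) : Prop :=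
  Λ.a n v = 1 ∧ (∀ i j, Real.posLog (Λ.av n v (ev n ((gram ψ x)⁻¹ i j))) ≤ c) ∧ ∀ w ∈ W, Λ.loc d n v (ψ w).trace ≤ 1

open Classical in
lemma good_mass {U : Filter ℕ} (Λ : Lev U ev) (W : Finset Q) (C : ℝ) (hC : 0 ≤ C) (n : ℕ)
    (h1 : ∀ i j, Λ.ht n ((gram ψ x)⁻¹ i j) ≤ C) (h2 : ∑ w ∈ W, Λ.eta d n (ψ w).trace ≤ 1 / 4) :
    1 / 2 ≤ ∑ v, Λ.wt n v * (if GoodP Λ ψ x W (4 * m ^ 2 * C + 1) n v then 1 else 0) := by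
  obtain ⟨c, hc⟩ : ∃ c : ℝ, c = 4 * m ^ 2 * C + 1 := ⟨_, rfl⟩
  rw [← hc]
  have hcpos : 0 < c := by rw [hc]; positivity
  have key : ∀ v, Λ.a n v ≤ (if GoodP Λ ψ x W c n v then 1 else 0) +
      (∑ p : Fin m × Fin m, Real.posLog (Λ.av n v (ev n ((gram ψ x)⁻¹ p.1 p.2))) / c + ∑ w ∈ W, Λ.loc d n v (ψ w).trace) := by
    intro v
    have n1 : 0 ≤ ∑ p : Fin m × Fin m, Real.posLog (Λ.av n v (ev n ((gram ψ x)⁻¹ p.1 p.2))) / c :=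
      Finset.sum_nonneg fun p _ => div_nonneg Real.posLog_nonneg hcpos.le
    have n2 : 0 ≤ ∑ w ∈ W, Λ.loc d n v (ψ w).trace := Finset.sum_nonneg fun w _ => Λ.loc_nonneg v _
    have hle := (Λ.pt n v).le_one
    split_ifs with hg
    · linarith
    by_cases ha : Λ.a n v = 1
    swap
    · have : Λ.a n v = 0 := by
        rcases Λ.pt n v with ⟨h, _⟩ | ⟨h, _⟩
        · exact absurd h ha
        · exact h
      rw [this]; linarith
    rw [GoodP] at hg
    push Not at hg
    by_cases hb : ∀ i j, Real.posLog (Λ.av n v (ev n ((gram ψ x)⁻¹ i j))) ≤ c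
    · obtain ⟨w, hw, hw1⟩ := hg ha hb
      have := Finset.single_le_sum (f := fun w => Λ.loc d n v (ψ w).trace) (fun w _ => Λ.loc_nonneg v _) hw
      linarith
    · push Not at hb
      obtain ⟨i, j, hij⟩ := hb
      have := Finset.single_le_sum (f := fun p : Fin m × Fin m => Real.posLog (Λ.av n v (ev n ((gram ψ x)⁻¹ p.1 p.2))) / c)
        (fun p _ => div_nonneg Real.posLog_nonneg hcpos.le) (Finset.mem_univ (i, j))
      have h3 : 1 ≤ Real.posLog (Λ.av n v (ev n ((gram ψ x)⁻¹ i j))) / c := by rw [le_div_iff₀ hcpos]; linarith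
      linarith
  have hs : ∑ v, Λ.wt n v * Λ.a n v ≤ ∑ v, Λ.wt n v * ((if GoodP Λ ψ x W c n v then 1 else 0) +
      (∑ p : Fin m × Fin m, Real.posLog (Λ.av n v (ev n ((gram ψ x)⁻¹ p.1 p.2))) / c + ∑ w ∈ W, Λ.loc d n v (ψ w).trace)) :=
    Finset.sum_le_sum fun v _ => mul_le_mul_of_nonneg_left (key v) (Λ.wt_nonneg n v)
  rw [Λ.sum_arch] at hs
  simp only [mul_add, Finset.sum_add_distrib] at hs
  have s1 : ∑ v, Λ.wt n v * ∑ p : Fin m × Fin m, Real.posLog (Λ.av n v (ev n ((gram ψ x)⁻¹ p.1 p.2))) / c ≤ 1 / 4 := by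
    have : ∑ v, Λ.wt n v * ∑ p : Fin m × Fin m, Real.posLog (Λ.av n v (ev n ((gram ψ x)⁻¹ p.1 p.2))) / c =
        ∑ p : Fin m × Fin m, Λ.ht n ((gram ψ x)⁻¹ p.1 p.2) / c := by
      simp only [Lev.ht, Finset.sum_div, Finset.mul_sum]
      rw [Finset.sum_comm]
      exact Finset.sum_congr rfl fun _ _ => Finset.sum_congr rfl fun _ _ => by ring
    rw [this]
    calc _ ≤ ∑ p : Fin m × Fin m, C / c := Finset.sum_le_sum fun p _ => by have := h1 p.1 p.2; gcongr
      _ = m ^ 2 * C / c := by simp; ring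
      _ ≤ 1 / 4 := by rw [div_le_iff₀ hcpos, hc]; linarith
  have s2 : ∑ v, Λ.wt n v * ∑ w ∈ W, Λ.loc d n v (ψ w).trace ≤ 1 / 4 := by
    refine le_trans (le_of_eq ?_) h2
    simp only [Lev.eta, Finset.mul_sum]
    rw [Finset.sum_comm]
  linarith

lemma exp_bound {r c : ℝ} (hr : 0 ≤ r) (h : Real.log r ≤ c) : r ≤ Real.exp c := by
  rcases hr.eq_or_lt with h0 | h0
  · rw [← h0]; positivity
  · rwa [Real.log_le_iff_le_exp h0] at h

/-- entry bounds at good places -/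
lemma good_entry {U : Filter ℕ} (Λ : Lev U ev) {W : Finset Q} {c : ℝ} {n : ℕ} {v : Λ.P n}
    (hg : GoodP Λ ψ x W c n v) {σ : L n →+* ℂ} (hσ : ∀ z, Λ.av n v z = ‖σ z‖) {T : Fin m → Fin m → Q}
    (hT : ∀ p q, T p q ∈ W)
    (he : ((gram ψ x)⁻¹ * of fun p q => (ψ (T p q)).trace).map (ev n) =
      (gram ψ x)⁻¹.map (ev n) * (of fun p q => (ψ (T p q)).trace).map (ev n)) (p q : Fin m) :
    ‖σ (ev n (((gram ψ x)⁻¹ * of fun p q => (ψ (T p q)).trace) p q))‖ ≤ m * (Real.exp c * Real.exp (1 + Real.log d)) := by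
  have e1 : ev n (((gram ψ x)⁻¹ * of fun p q => (ψ (T p q)).trace) p q) =
      ∑ l, (gram ψ x)⁻¹.map (ev n) p l * (of fun p q => (ψ (T p q)).trace).map (ev n) l q := by
    rw [← mul_apply, ← he]; rfl
  rw [e1, map_sum]
  refine (norm_sum_le _ _).trans ?_
  have : ∀ l : Fin m, ‖σ ((gram ψ x)⁻¹.map (ev n) p l * (of fun p q => (ψ (T p q)).trace).map (ev n) l q)‖ ≤
      Real.exp c * Real.exp (1 + Real.log d) := by
    intro l
    rw [map_mul, norm_mul]
    refine mul_le_mul ?_ ?_ (norm_nonneg _) (Real.exp_pos _).le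
    · rw [map_apply, ← hσ]
      refine exp_bound ((Λ.av n v).nonneg _) (le_trans ?_ (hg.2.1 p l))
      rw [Real.posLog_def]; exact le_max_right _ _
    · rw [map_apply, of_apply, ← hσ]
      refine exp_bound ((Λ.av n v).nonneg _) ((Λ.log_le_loc (d := d) v _).trans ?_)
      rw [hg.1, one_mul]
      linarith [hg.2.2 _ (hT l q)]
  refine (Finset.sum_le_sum fun l _ => this l).trans ?_
  simp

end gap
end LG

namespace LG
open Filter Matrix
open scoped commutatorElement
universe u
section gap
variable {k : Type*} [Field k] [CharZero k] {L : ℕ → Type u} [∀ n, Field (L n)] {ev : ∀ n, k → L n}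
variable {Q : Type*} [Group Q] {𝒜 : Subalgebra k (Q → k)} {d : ℕ} {ψ : Q →* Matrix (Fin d) (Fin d) k} {m : ℕ} {x : Fin m → Q}

lemma exists_beta (hirr : Irr ψ) {Δ : Subgroup Q} [Δ.Normal] (h : SB ψ Δ x) {y : Q} (hy : y ∈ Δ) (hne : ψ y ≠ 1) :
    ∃ l, (ψ (y * x l)).trace - (ψ (x l)).trace ≠ 0 := by
  by_contra hcon
  push Not at hcon
  apply hne
  rw [← sub_eq_zero]
  refine nondeg hirr Δ (sub_mem (Env.of_mem hy) (by rw [← map_one ψ]; exact Env.of_mem (one_mem _))) fun b hb => ?_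
  obtain ⟨c, rfl⟩ := h.exists_coord hb
  rw [Finset.mul_sum, trace_sum]
  refine Finset.sum_eq_zero fun i _ => ?_
  rw [mul_smul_comm, trace_smul, sub_mul, one_mul, trace_sub, ← map_mul, hcon i, smul_zero]

lemma beta_eq {Δ : Subgroup Q} (h : SB ψ Δ x) (hG : (gram ψ x).det ≠ 0) {y : Q} (hy : y ∈ Δ) (l : Fin m) :
    (ψ (y * x l)).trace - (ψ (x l)).trace = ∑ i, (lfun ψ x y - 1) i l * (ψ (x i)).trace := by
  have h1 := congrArg trace (h.lfun_spec hG hy l)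
  rw [trace_sum] at h1
  have h2 := congrArg trace (sum_one_col (ψ := ψ) (x := x) l)
  rw [trace_sum] at h2
  rw [map_mul, ← h1, ← h2, ← Finset.sum_sub_distrib]
  refine Finset.sum_congr rfl fun i _ => ?_
  rw [trace_smul, trace_smul, Matrix.sub_apply, sub_mul, smul_eq_mul, smul_eq_mul]

lemma sum_bound {M : ℕ} (f t : Fin M → ℝ) (h : ∀ i, f i ≤ t i) (ht : ∀ i, 0 ≤ t i) (e : ℝ) (i0 : Fin M) (h0 : f i0 ≤ e) :
    ∑ i, f i ≤ ∑ i, t i + e := by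
  classical
  have : ∑ i, f i ≤ ∑ i, (t i + if i = i0 then e else 0) := Finset.sum_le_sum fun i _ => by
    split_ifs with hi
    · subst hi; linarith [ht i]
    · linarith [h i]
  rwa [Finset.sum_add_distrib, Finset.sum_ite_eq' Finset.univ i0 (fun _ => e), if_pos (Finset.mem_univ _)] at this

set_option maxHeartbeats 2000000 in
/-- the height gap -/
theorem gap [IsAlgClosed k] (U : Ultrafilter ℕ) (hev : EvHom (U : Filter ℕ) ev) (Λ : Lev (U : Filter ℕ) ev)
    (hD : Dom 𝒜) (hC : Coef 𝒜 ψ) (hirr : Irr ψ) (hns : NS ψ) (s : ℕ)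
    (h : SB ψ (derivedSeries Q s) x) (hx : ∀ j, x j ∈ derivedSeries Q (s + 1)) (hG : (gram ψ x).det ≠ 0) :
    ∃ y ∈ derivedSeries Q (s + 1), ∃ ε : ℝ, 0 < ε ∧ ∀ᶠ n in (U : Filter ℕ), ε ≤ Λ.eta d n (ψ y).trace := by
  classical
  by_contra hneg
  push Not at hneg
  have hd : d ≠ 0 := by
    rintro rfl
    obtain ⟨y, -, hy⟩ := hns 0
    exact hy (Subsingleton.elim _ _)
  have small : ∀ y ∈ derivedSeries Q (s + 1), ∀ ε : ℝ, 0 < ε → ∀ᶠ n in (U : Filter ℕ), Λ.eta d n (ψ y).trace < ε := by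
    intro y hy ε hε
    exact hneg y hy ε hε
  have hle : derivedSeries Q (s + 1) ≤ derivedSeries Q s := derived_mono (Nat.le_succ s)
  have hd1 : (1 : ℝ) ≤ d := by exact_mod_cast Nat.one_le_iff_ne_zero.mpr hd
  have hlogd : 0 ≤ Real.log d := Real.log_nonneg hd1
  -- bounded heights of the inverse Gram matrix
  have h11 : ∃ ε : ℝ, ε > 0 ∧ ∀ᶠ n in (U : Filter ℕ), ε ≤ (fun _ : ℕ => (1 : ℝ)) n := ⟨1, one_pos, Eventually.of_forall fun _ => le_rfl⟩
  have hGB : ∀ i j, (gram ψ x)⁻¹ i j ∈ Λ.B hev (fun _ => 1) h11 := by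
    refine inv_mem_subfield _ _ hG fun i j => ?_
    rw [Λ.mem_B hev]
    refine ⟨1 + Real.log d, by positivity, ?_⟩
    filter_upwards [small (x i * x j) (mul_mem (hx i) (hx j)) 1 one_pos] with n hn
    have := Λ.ht_le_eta (d := d) (n := n) (ψ (x i * x j)).trace
    change Λ.ht n (ψ (x i * x j)).trace ≤ _
    linarith
  choose Cf hCf0 hCf using fun p : Fin m × Fin m => (Λ.mem_B hev).mp (hGB p.1 p.2)
  obtain ⟨C, hCdef⟩ : ∃ C, C = ∑ p, Cf p := ⟨_, rfl⟩
  have hC0 : 0 ≤ C := by rw [hCdef]; exact Finset.sum_nonneg fun p _ => hCf0 p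
  have hGh : ∀ᶠ n in (U : Filter ℕ), ∀ i j, Λ.ht n ((gram ψ x)⁻¹ i j) ≤ C := by
    filter_upwards [eventually_all.mpr hCf] with n hn i j
    refine (hn (i, j)).trans ?_
    rw [mul_one, hCdef]
    exact Finset.single_le_sum (fun p _ => hCf0 p) (Finset.mem_univ (i, j))
  obtain ⟨c, hc⟩ : ∃ c : ℝ, c = 4 * m ^ 2 * C + 1 := ⟨_, rfl⟩
  obtain ⟨b0, hb0⟩ : ∃ b0 : ℝ, b0 = m * (Real.exp c * Real.exp (1 + Real.log d)) := ⟨_, rfl⟩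
  obtain ⟨M, hM1, hM⟩ := place_mat.{u} m b0 (by rw [hb0]; positivity)
  -- a noncontracting element
  obtain ⟨y, hy, hyJ⟩ : ∃ y ∈ derivedSeries Q (s + 1), ∀ i, 1 ≤ i → i ≤ M → ∀ J, ∃ g, ψ (comseq (y ^ i) g J) ≠ 1 := by
    by_contra hcon
    push Not at hcon
    obtain ⟨z, hz, hz1⟩ := hns (s + 2)
    exact hz1 (gap_alg hD hC hirr hd s M hcon z hz)
  obtain ⟨D, hDdef⟩ : ∃ D : ℝ, D = 1 + m * Real.exp (1 + Real.log d) := ⟨_, rfl⟩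
  have hD1 : 1 ≤ D := by rw [hDdef]; have : 0 ≤ (m : ℝ) * Real.exp (1 + Real.log d) := by positivity
                         linarith
  obtain ⟨c1, hc1⟩ : ∃ c1 : ℝ, c1 = 2 * Real.log d + Real.log 2 := ⟨_, rfl⟩
  have hl2 : 0 < Real.log 2 := Real.log_pos (by norm_num)
  have hc10 : 0 ≤ c1 := by rw [hc1]; linarith
  obtain ⟨J, hJ⟩ := exists_nat_gt ((Real.log D + 2 * (1 + M * c1)) / Real.log 2)
  rw [div_lt_iff₀ hl2] at hJ
  choose g hg using fun i : Fin M => hyJ (i + 1) (by lia) (by lia) J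
  have hym : ∀ i : ℕ, y ^ i ∈ derivedSeries Q (s + 1) := fun i => pow_mem hy i
  have hcm : ∀ (i : Fin M), comseq (y ^ (i + 1 : ℕ)) (g i) J ∈ derivedSeries Q (s + 1) := fun i => comseq_mem (hym _) _ _
  choose kk hkk using fun i : Fin M => exists_beta hirr h (hle (hcm i)) (hg i)
  obtain ⟨β, hβ⟩ : ∃ β : Fin M → k, ∀ i : Fin M, β i = (ψ (comseq (y ^ (i + 1 : ℕ)) (g i) J * x (kk i))).trace - (ψ (x (kk i))).trace :=
    ⟨_, fun _ => rfl⟩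
  have hβ0 : ∀ i, β i ≠ 0 := fun i => by rw [hβ]; exact hkk i
  -- the finite set of words
  let Wl : Q → Finset Q := fun z => Finset.univ.image fun p : Fin m × Fin m => x p.1 * (z * x p.2)
  let Wc : Q → Finset Q := fun z => Finset.univ.image fun p : Fin m × Fin m => x p.1 * (z * x p.2 * z⁻¹)
  obtain ⟨W, hW⟩ : ∃ W : Finset Q, W = (Finset.range (M + 1)).biUnion (fun i => Wl (y ^ i) ∪ Wl (y ^ i)⁻¹) ∪
      (Finset.univ.biUnion fun p : Fin M × Fin J => Wc (g p.1 p.2) ∪ Wc (g p.1 p.2)⁻¹) ∪ Finset.univ.image x := ⟨_, rfl⟩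
  have hWl : ∀ z ∈ derivedSeries Q (s + 1), ∀ w ∈ Wl z, w ∈ derivedSeries Q (s + 1) := by
    intro z hz w hw
    obtain ⟨p, -, rfl⟩ := Finset.mem_image.mp hw
    exact mul_mem (hx _) (mul_mem hz (hx _))
  have hWc : ∀ z, ∀ w ∈ Wc z, w ∈ derivedSeries Q (s + 1) := by
    intro z w hw
    obtain ⟨p, -, rfl⟩ := Finset.mem_image.mp hw
    exact mul_mem (hx _) (Subgroup.Normal.conj_mem inferInstance _ (hx _) z)
  have hWm : ∀ w ∈ W, w ∈ derivedSeries Q (s + 1) := by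
    intro w hw
    rw [hW, Finset.mem_union, Finset.mem_union, Finset.mem_biUnion, Finset.mem_biUnion] at hw
    rcases hw with (⟨i, -, hi⟩ | ⟨p, -, hp⟩) | hw
    · rcases Finset.mem_union.mp hi with hi | hi
      · exact hWl _ (hym i) _ hi
      · exact hWl _ (inv_mem (hym i)) _ hi
    · rcases Finset.mem_union.mp hp with hp | hp <;> exact hWc _ _ hp
    · obtain ⟨p, -, rfl⟩ := Finset.mem_image.mp hw
      exact hx _
  have mem1 : ∀ i ≤ M, ∀ p q, x p * (y ^ i * x q) ∈ W := fun i hi p q => by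
    rw [hW]
    refine Finset.mem_union_left _ (Finset.mem_union_left _ (Finset.mem_biUnion.mpr ⟨i, Finset.mem_range.mpr (by lia), ?_⟩))
    exact Finset.mem_union_left _ (Finset.mem_image.mpr ⟨(p, q), Finset.mem_univ _, rfl⟩)
  have mem2 : ∀ i ≤ M, ∀ p q, x p * ((y ^ i)⁻¹ * x q) ∈ W := fun i hi p q => by
    rw [hW]
    refine Finset.mem_union_left _ (Finset.mem_union_left _ (Finset.mem_biUnion.mpr ⟨i, Finset.mem_range.mpr (by lia), ?_⟩))
    exact Finset.mem_union_right _ (Finset.mem_image.mpr ⟨(p, q), Finset.mem_univ _, rfl⟩)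
  have mem3 : ∀ i, ∀ j < J, ∀ p q, x p * (g i j * x q * (g i j)⁻¹) ∈ W := fun i j hj p q => by
    rw [hW]
    refine Finset.mem_union_left _ (Finset.mem_union_right _ (Finset.mem_biUnion.mpr ⟨(i, ⟨j, hj⟩), Finset.mem_univ _, ?_⟩))
    exact Finset.mem_union_left _ (Finset.mem_image.mpr ⟨(p, q), Finset.mem_univ _, rfl⟩)
  have mem4 : ∀ i, ∀ j < J, ∀ p q, x p * ((g i j)⁻¹ * x q * ((g i j)⁻¹)⁻¹) ∈ W := fun i j hj p q => by
    rw [hW]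
    refine Finset.mem_union_left _ (Finset.mem_union_right _ (Finset.mem_biUnion.mpr ⟨(i, ⟨j, hj⟩), Finset.mem_univ _, ?_⟩))
    exact Finset.mem_union_right _ (Finset.mem_image.mpr ⟨(p, q), Finset.mem_univ _, rfl⟩)
  have mem5 : ∀ l, x l ∈ W := fun l => by
    rw [hW]
    exact Finset.mem_union_right _ (Finset.mem_image.mpr ⟨l, Finset.mem_univ _, rfl⟩)
  -- eventual facts
  have evW : ∀ᶠ n in (U : Filter ℕ), ∑ w ∈ W, Λ.eta d n (ψ w).trace ≤ 1 / 4 := by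
    have : ∀ᶠ n in (U : Filter ℕ), ∀ w : W, Λ.eta d n (ψ w.1).trace < 1 / (4 * (W.card + 1)) :=
      eventually_all.mpr fun w => small w.1 (hWm _ w.2) _ (by positivity)
    filter_upwards [this] with n hn
    calc _ ≤ ∑ w ∈ W, 1 / (4 * ((W.card : ℝ) + 1)) := Finset.sum_le_sum fun w hw => (hn ⟨w, hw⟩).le
      _ = W.card / (4 * ((W.card : ℝ) + 1)) := by rw [Finset.sum_const, nsmul_eq_mul]; ring
      _ ≤ 1 / 4 := by rw [div_le_div_iff₀ (by positivity) (by positivity)]; linarith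
  have evβ : ∀ᶠ n in (U : Filter ℕ), ∑ i : Fin M, (Λ.eta d n (ψ (comseq (y ^ (i + 1 : ℕ)) (g i) J * x (kk i))).trace + Λ.eta d n (ψ (x (kk i))).trace) ≤ 1 := by
    have : ∀ᶠ n in (U : Filter ℕ), ∀ i : Fin M, Λ.eta d n (ψ (comseq (y ^ (i + 1 : ℕ)) (g i) J * x (kk i))).trace < 1 / (2 * M) ∧
        Λ.eta d n (ψ (x (kk i))).trace < 1 / (2 * M) :=
      eventually_all.mpr fun i => (small _ (mul_mem (hcm i) (hx _)) _ (by positivity)).and (small _ (hx _) _ (by positivity))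
    filter_upwards [this] with n hn
    calc _ ≤ ∑ i : Fin M, (1 : ℝ) / M := Finset.sum_le_sum fun i _ => by
            have : (1 : ℝ) / M = 1 / (2 * M) + 1 / (2 * M) := by field_simp; norm_num
            linarith [(hn i).1, (hn i).2]
      _ = 1 := by
        rw [Finset.sum_const, Finset.card_univ, Fintype.card_fin, nsmul_eq_mul]
        have : (M : ℝ) ≠ 0 := by positivity
        field_simp
  have evX : ∀ᶠ n in (U : Filter ℕ), ∀ i j : Fin (M + 1), (lfun ψ x (y ^ (i + j : ℕ))).map (ev n) =
      (lfun ψ x (y ^ (i : ℕ))).map (ev n) * (lfun ψ x (y ^ (j : ℕ))).map (ev n) :=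
    eventually_all.mpr fun i => eventually_all.mpr fun j => by
      rw [pow_add]; exact lE_mul hev h hG (hle (hym _)) (hle (hym _))
  have evY : ∀ᶠ n in (U : Filter ℕ), ∀ i : Fin (M + 1), (lfun ψ x (y ^ (i : ℕ))⁻¹).map (ev n) * (lfun ψ x (y ^ (i : ℕ))).map (ev n) = 1 :=
    eventually_all.mpr fun i => by
      have := lE_inv hev h hG (hle (inv_mem (hym i)))
      rwa [inv_inv] at this
  have evR : ∀ᶠ n in (U : Filter ℕ), ∀ i : Fin M, Rel J (fun j => (lfun ψ x (comseq (y ^ (i + 1 : ℕ)) (g i) j)).map (ev n))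
      (fun j => (lfun ψ x (comseq (y ^ (i + 1 : ℕ)) (g i) j)⁻¹).map (ev n))
      (fun j => (cfun ψ x (g i j)).map (ev n)) (fun j => (cfun ψ x (g i j)⁻¹).map (ev n)) :=
    eventually_all.mpr fun i => rel_ev hev h hG (hle (hym _)) (g i) J
  have evE1 : ∀ᶠ n in (U : Filter ℕ), ∀ i : Fin (M + 1),
      (lfun ψ x (y ^ (i : ℕ))).map (ev n) = (gram ψ x)⁻¹.map (ev n) * (lnum ψ x (y ^ (i : ℕ))).map (ev n) ∧
      (lfun ψ x (y ^ (i : ℕ))⁻¹).map (ev n) = (gram ψ x)⁻¹.map (ev n) * (lnum ψ x (y ^ (i : ℕ))⁻¹).map (ev n) :=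
    eventually_all.mpr fun i => (hev.mat_mul _ _).and (hev.mat_mul _ _)
  have evE2 : ∀ᶠ n in (U : Filter ℕ), ∀ (i : Fin M) (j : Fin J),
      (cfun ψ x (g i j)).map (ev n) = (gram ψ x)⁻¹.map (ev n) * (cnum ψ x (g i j)).map (ev n) ∧
      (cfun ψ x (g i j)⁻¹).map (ev n) = (gram ψ x)⁻¹.map (ev n) * (cnum ψ x (g i j)⁻¹).map (ev n) :=
    eventually_all.mpr fun i => eventually_all.mpr fun j => (hev.mat_mul _ _).and (hev.mat_mul _ _)
  have evB1 : ∀ᶠ n in (U : Filter ℕ), ∀ i : Fin M, ev n (β i) = ev n (ψ (comseq (y ^ (i + 1 : ℕ)) (g i) J * x (kk i))).trace - ev n (ψ (x (kk i))).trace :=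
    eventually_all.mpr fun i => by rw [hβ]; exact hev.sub _ _
  have evB2 : ∀ᶠ n in (U : Filter ℕ), ∀ i : Fin M, ev n (β i) =
      ∑ l, ((lfun ψ x (comseq (y ^ (i + 1 : ℕ)) (g i) J)).map (ev n) - 1) l (kk i) * ev n (ψ (x l)).trace := by
    refine eventually_all.mpr fun i => ?_
    rw [hβ, beta_eq h hG (hle (hcm i))]
    filter_upwards [hev.sum Finset.univ fun l => (lfun ψ x (comseq (y ^ (i + 1 : ℕ)) (g i) J) - 1) l (kk i) * (ψ (x l)).trace,
      eventually_all.mpr fun l => hev.mul ((lfun ψ x (comseq (y ^ (i + 1 : ℕ)) (g i) J) - 1) l (kk i)) (ψ (x l)).trace,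
      eventually_all.mpr fun l => hev.sub (lfun ψ x (comseq (y ^ (i + 1 : ℕ)) (g i) J) l (kk i)) ((1 : Matrix (Fin m) (Fin m) k) l (kk i)),
      hev.mat_one (ι := Fin m)] with n h1 h2 h3 h4
    rw [h1]
    refine Finset.sum_congr rfl fun l _ => ?_
    rw [h2, Matrix.sub_apply, h3, ← h4]
    rfl
  have evα := Λ.pf (∏ i, β i) (Finset.prod_ne_zero_iff.mpr fun i _ => hβ0 i)
  have evne : ∀ᶠ n in (U : Filter ℕ), ∀ i : Fin M, ev n (β i) ≠ 0 := eventually_all.mpr fun i => hev.ne_zero (hβ0 i)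
  obtain ⟨n, hGn, hWn, hβn, hXn, hYn, hRn, hE1, hE2, hB1, hB2, hα, hprod, hne⟩ :=
    (hGh.and (evW.and (evβ.and (evX.and (evY.and (evR.and (evE1.and (evE2.and (evB1.and (evB2.and
      (evα.and ((hev.prod Finset.univ β).and evne)))))))))))).exists
  clear evα evne evB1 evB2 evE1 evE2 evR evX evY evβ evW hGh hyJ small hneg
  have hmass := good_mass Λ W C hC0 n hGn hWn
  rw [← hc] at hmass
  -- the place-wise bound
  obtain ⟨t, ht⟩ : ∃ t : Λ.P n → Fin M → ℝ, ∀ v, ∀ i : Fin M, t v i = Λ.loc d n v (ψ (comseq (y ^ (i + 1 : ℕ)) (g i) J * x (kk i))).trace +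
    Λ.loc d n v (ψ (x (kk i))).trace := ⟨_, fun _ _ => rfl⟩
  have ht0 : ∀ v i, 0 ≤ t v i := fun v i => by rw [ht]; exact add_nonneg (Λ.loc_nonneg _ _) (Λ.loc_nonneg _ _)
  have hac : ∀ v, 0 ≤ Λ.a n v * c1 := fun v => mul_nonneg (Λ.pt n v).nonneg hc10
  have hb1 : ∀ v i, Real.log (Λ.av n v (ev n (β i))) ≤ t v i + Λ.a n v * c1 := by
    intro v i
    have h1 : Real.log (Λ.av n v (ev n (β i))) ≤ Real.posLog (Λ.av n v (ev n (β i))) := by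
      rw [Real.posLog_def]; exact le_max_right _ _
    rw [hB1 i] at h1 ⊢
    rw [sub_eq_add_neg] at h1 ⊢
    have h2 := (Λ.pt n v).add (ev n (ψ (comseq (y ^ (i + 1 : ℕ)) (g i) J * x (kk i))).trace) (-ev n (ψ (x (kk i))).trace)
    rw [map_neg_eq_map] at h2
    have h3 := Λ.posLog_le_loc (d := d) v (ψ (comseq (y ^ (i + 1 : ℕ)) (g i) J * x (kk i))).trace
    have h4 := Λ.posLog_le_loc (d := d) v (ψ (x (kk i))).trace
    rw [ht, hc1]
    linarith
  have hb2 : ∀ v, GoodP Λ ψ x W c n v → ∃ i, Real.log (Λ.av n v (ev n (β i))) ≤ Real.log D - J * Real.log 2 := by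
    intro v hv
    obtain ⟨σ, hσ⟩ : ∃ σ : L n →+* ℂ, ∀ z, Λ.av n v z = ‖σ z‖ := by
      rcases Λ.pt n v with ⟨-, h1⟩ | ⟨h1, -⟩
      · exact h1
      · exact absurd (hv.1.symm.trans h1) one_ne_zero
    obtain ⟨i, hi⟩ := hM σ J (fun i => (lfun ψ x (y ^ i)).map (ev n)) (fun i => (lfun ψ x (y ^ i)⁻¹).map (ev n))
      (fun i j => (lfun ψ x (comseq (y ^ (i + 1 : ℕ)) (g i) j)).map (ev n))
      (fun i j => (lfun ψ x (comseq (y ^ (i + 1 : ℕ)) (g i) j)⁻¹).map (ev n))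
      (fun i j => (cfun ψ x (g i j)).map (ev n)) (fun i j => (cfun ψ x (g i j)⁻¹).map (ev n))
      (fun i hi p q => by
        rw [hb0]; exact good_entry Λ hv hσ (T := fun p q => x p * (y ^ i * x q)) (mem1 i hi) ((hE1 ⟨i, by lia⟩).1) p q)
      (fun i hi p q => by
        rw [hb0]; exact good_entry Λ hv hσ (T := fun p q => x p * ((y ^ i)⁻¹ * x q)) (mem2 i hi) ((hE1 ⟨i, by lia⟩).2) p q)
      (fun i j hj p q => by
        rw [hb0]; exact good_entry Λ hv hσ (T := fun p q => x p * (g i j * x q * (g i j)⁻¹)) (mem3 i j hj) ((hE2 i ⟨j, hj⟩).1) p q)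
      (fun i j hj p q => by
        rw [hb0]; exact good_entry Λ hv hσ (T := fun p q => x p * ((g i j)⁻¹ * x q * ((g i j)⁻¹)⁻¹)) (mem4 i j hj) ((hE2 i ⟨j, hj⟩).2) p q)
      (fun i hi j hj => hXn ⟨i, by lia⟩ ⟨j, by lia⟩) (fun i hi => hYn ⟨i, by lia⟩) (fun i => rfl) (fun i => hRn i)
    refine ⟨i, ?_⟩
    have hpos : 0 < Λ.av n v (ev n (β i)) := (Λ.av n v).pos (hne i)
    have hle2 : Λ.av n v (ev n (β i)) ≤ D * (1 / 2) ^ J := by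
      rw [hσ, hB2 i, map_sum]
      refine (norm_sum_le _ _).trans ?_
      have : ∀ l : Fin m, ‖σ (((lfun ψ x (comseq (y ^ (i + 1 : ℕ)) (g i) J)).map (ev n) - 1) l (kk i) * ev n (ψ (x l)).trace)‖ ≤
          (1 / 2) ^ J * Real.exp (1 + Real.log d) := by
        intro l
        rw [map_mul, norm_mul]
        refine mul_le_mul (hi l (kk i)) ?_ (norm_nonneg _) (by positivity)
        rw [← hσ]
        refine exp_bound ((Λ.av n v).nonneg _) ((Λ.log_le_loc (d := d) v _).trans ?_)
        rw [hv.1, one_mul]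
        linarith [hv.2.2 _ (mem5 l)]
      refine (Finset.sum_le_sum fun l _ => this l).trans ?_
      rw [Finset.sum_const, Finset.card_univ, Fintype.card_fin, nsmul_eq_mul, hDdef]
      have : (0 : ℝ) ≤ (1 / 2) ^ J := by positivity
      linarith
    calc _ ≤ Real.log (D * (1 / 2) ^ J) := Real.log_le_log hpos hle2
      _ = _ := by
        rw [Real.log_mul (by linarith) (by positivity), Real.log_pow, one_div, Real.log_inv]; ring
  have hJneg : Real.log D - J * Real.log 2 < 0 := by
    have : 0 ≤ (M : ℝ) * c1 := by positivity
    linarith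
  have hv : ∀ v, Real.log (Λ.av n v (ev n (∏ i, β i))) ≤ (∑ i, t v i + (if GoodP Λ ψ x W c n v then 1 else 0) * (Real.log D - J * Real.log 2)) +
      Λ.a n v * (M * c1) := by
    intro v
    rw [hprod, map_prod, Real.log_prod (fun i _ => ((Λ.av n v).pos (hne i)).ne')]
    have hsum : ∑ i, (t v i + Λ.a n v * c1) = ∑ i, t v i + Λ.a n v * (M * c1) := by
      rw [Finset.sum_add_distrib, Finset.sum_const, Finset.card_univ, Fintype.card_fin, nsmul_eq_mul]; ring
    split_ifs with hgd
    · obtain ⟨i, hi⟩ := hb2 v hgd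
      have := sum_bound _ _ (hb1 v) (fun i => add_nonneg (ht0 v i) (hac v)) _ i hi
      linarith
    · have := Finset.sum_le_sum (s := Finset.univ) fun i _ => hb1 v i
      linarith
  have hfin := Λ.sum_le _ _ _ hv
  rw [hα] at hfin
  simp only [mul_add, Finset.sum_add_distrib, ← mul_assoc, ← Finset.sum_mul] at hfin
  have ht1 : ∑ v, Λ.wt n v * ∑ i, t v i ≤ 1 := by
    refine le_trans (le_of_eq ?_) hβn
    simp only [ht, Lev.eta, Finset.mul_sum, mul_add, Finset.sum_add_distrib]
    congr 1 <;> exact Finset.sum_comm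
  have := mul_le_mul_of_nonpos_right hmass hJneg.le
  linarith
end gap
end LG

namespace LG
open Filter Topology

universe u

/-- powers of an absolute value -/
noncomputable def powAV {F : Type*} [Field F] (av : AbsoluteValue F ℝ) (a e : ℝ) (h : PT av a) (he : 0 < e) (hae : a * e ≤ 1) :
    AbsoluteValue F ℝ where
  toFun x := av x ^ e
  map_mul' x y := by
    rw [map_mul, Real.mul_rpow (av.nonneg _) (av.nonneg _)]
  nonneg' x := Real.rpow_nonneg (av.nonneg _) _
  eq_zero' x := by
    rw [Real.rpow_eq_zero (av.nonneg _) he.ne']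
    exact av.eq_zero
  add_le' x y := by
    rcases h with ⟨rfl, -⟩ | ⟨rfl, hna⟩
    · refine (Real.rpow_le_rpow (av.nonneg _) (av.add_le x y) he.le).trans ?_
      exact Real.rpow_add_le_add_rpow (av.nonneg _) (av.nonneg _) he.le (by linarith)
    · have h1 := hna x y
      rcases le_max_iff.mp h1 with h2 | h2
      · refine (Real.rpow_le_rpow (av.nonneg _) h2 he.le).trans ?_
        linarith [Real.rpow_nonneg (av.nonneg y) e]
      · refine (Real.rpow_le_rpow (av.nonneg _) h2 he.le).trans ?_
        linarith [Real.rpow_nonneg (av.nonneg x) e]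

/-- the limit absolute value -/
theorem limitAV {k : Type*} [Field k] [CharZero k] (U : Ultrafilter ℕ) {L : ℕ → Type u} [∀ n, Field (L n)] {ev : ∀ n, k → L n}
    (hev : EvHom (U : Filter ℕ) ev) (av : ∀ n, AbsoluteValue (L n) ℝ) (a h : ℕ → ℝ) (hpt : ∀ n, PT (av n) (a n))
    (hpos : ∀ᶠ n in (U : Filter ℕ), 0 < h n)
    (hb : ∀ α, ∃ C, ∀ᶠ n in (U : Filter ℕ), Real.posLog (av n (ev n α)) ≤ C * h n) :
    ∃ (vn : ∀ n, AbsoluteValue (L n) ℝ) (N : AbsoluteValue k ℝ) (τ : ℝ), 0 < τ ∧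
      (∀ α, Tendsto (fun n => vn n (ev n α)) (U : Filter ℕ) (𝓝 (N α))) ∧
      ∀ᶠ n in (U : Filter ℕ), ∀ x, vn n x = (av n x) ^ (τ / h n) := by
  classical
  have hlog2 : 0 < Real.log 2 := Real.log_pos (by norm_num)
  obtain ⟨τ, hτ, hτa⟩ : ∃ τ : ℝ, 0 < τ ∧ ∀ᶠ n in (U : Filter ℕ), a n * (τ / h n) ≤ 1 := by
    obtain ⟨C, hC⟩ := hb (1 + 1)
    refine ⟨1 / (1 + |C| / Real.log 2), by positivity, ?_⟩
    filter_upwards [hC, hpos, hev.add 1 1, hev.one] with n h1 h2 h3 h4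
    rw [h3, h4] at h1
    have h5 : a n * Real.log 2 ≤ |C| * h n := by
      have : C * h n ≤ |C| * h n := by gcongr; exact le_abs_self C
      rcases hpt n with ⟨h6, σ, hσ⟩ | ⟨h6, -⟩
      · rw [hσ] at h1
        have h7 : ‖σ (1 + 1)‖ = 2 := by
          rw [map_add, map_one, one_add_one_eq_two]; simp
        rw [h7, Real.posLog_eq_log (by norm_num)] at h1
        rw [h6]; linarith
      · rw [h6, zero_mul]; positivity
    rw [div_div, mul_one_div, div_le_one (by positivity)]
    have h8 : a n ≤ |C| * h n / Real.log 2 := by rwa [le_div_iff₀ hlog2]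
    have : (1 + |C| / Real.log 2) * h n = h n + |C| * h n / Real.log 2 := by ring
    rw [this]; linarith
  obtain ⟨vn, hvn⟩ : ∃ vn : ∀ n, AbsoluteValue (L n) ℝ, ∀ᶠ n in (U : Filter ℕ), ∀ x, vn n x = (av n x) ^ (τ / h n) := by
    refine ⟨fun n => if H : 0 < τ / h n ∧ a n * (τ / h n) ≤ 1 then powAV (av n) (a n) _ (hpt n) H.1 H.2 else av n, ?_⟩
    filter_upwards [hτa, hpos] with n h1 h2 x
    rw [dif_pos ⟨div_pos hτ h2, h1⟩]
    rfl
  have hbd : ∀ α, ∃ M : ℝ, ∀ᶠ n in (U : Filter ℕ), vn n (ev n α) ∈ Set.Icc 0 M := by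
    intro α
    obtain ⟨C, hC⟩ := hb α
    refine ⟨Real.exp (C * τ), ?_⟩
    filter_upwards [hC, hpos, hvn] with n h1 h2 h3
    refine ⟨(vn n).nonneg _, ?_⟩
    rw [h3]
    rcases eq_or_lt_of_le ((av n).nonneg (ev n α)) with h4 | h4
    · rw [← h4, Real.zero_rpow (div_pos hτ h2).ne']; positivity
    · rw [Real.rpow_def_of_pos h4]
      apply Real.exp_le_exp.mpr
      have h5 : Real.log (av n (ev n α)) ≤ C * h n := (le_max_right _ _).trans h1
      calc _ ≤ C * h n * (τ / h n) := by gcongr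
        _ = C * τ := by field_simp
  have hl : ∀ α, ∃ r : ℝ, Tendsto (fun n => vn n (ev n α)) (U : Filter ℕ) (𝓝 r) := by
    intro α
    obtain ⟨M, hM⟩ := hbd α
    obtain ⟨r, -, hr⟩ := (isCompact_Icc (a := (0 : ℝ)) (b := M)).ultrafilter_le_nhds (U.map fun n => vn n (ev n α)) (by
      rw [le_principal_iff]; exact hM)
    exact ⟨r, hr⟩
  choose N hN using hl
  have hmul : ∀ α β, N (α * β) = N α * N β := fun α β =>
    tendsto_nhds_unique (hN _) (((hN α).mul (hN β)).congr' (by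
      filter_upwards [hev.mul α β] with n h1
      rw [h1, map_mul]))
  have h1 : N 1 = 1 := tendsto_nhds_unique (hN _) (tendsto_const_nhds.congr' (by
      filter_upwards [hev.one] with n h1
      rw [h1, map_one]))
  have h0 : N 0 = 0 := tendsto_nhds_unique (hN _) (tendsto_const_nhds.congr' (by
      filter_upwards [hev.zero] with n h1
      rw [h1, map_zero]))
  refine ⟨vn, { toFun := N, map_mul' := hmul, nonneg' := ?_, eq_zero' := ?_, add_le' := ?_ }, τ, hτ, hN, hvn⟩
  · exact fun α => ge_of_tendsto' (hN α) fun n => (vn n).nonneg _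
  · intro α
    refine ⟨fun h => ?_, fun h => by subst h; exact h0⟩
    by_contra hα
    have := hmul α α⁻¹
    rw [mul_inv_cancel₀ hα, h1] at this
    replace h : N α = 0 := h
    rw [h, zero_mul] at this
    exact one_ne_zero this
  · intro α β
    refine le_of_tendsto_of_tendsto (hN _) ((hN α).add (hN β)) ?_
    filter_upwards [hev.add α β] with n h1
    rw [h1]; exact (vn n).add_le _ _

/-- place selection -/
lemma Lev.select {k : Type*} [Field k] (U : Ultrafilter ℕ) (hU : (U : Filter ℕ) ≤ atTop) {L : ℕ → Type u} [∀ n, Field (L n)]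
    {ev : ∀ n, k → L n} (Λ : Lev (U : Filter ℕ) ev) (α : ℕ → k) (C : ℕ → ℝ) (hC : ∀ i, 0 < C i)
    (Hl : ∀ n, Λ.P n → ℝ) (hH : ∀ᶠ n in (U : Filter ℕ), 0 < ∑ v, Λ.wt n v * Hl n v)
    (hα : ∀ i, ∀ᶠ n in (U : Filter ℕ), Λ.ht n (α i) ≤ C i * ∑ v, Λ.wt n v * Hl n v) :
    ∃ v : ∀ n, Λ.P n, (∀ᶠ n in (U : Filter ℕ), 0 < Hl n (v n)) ∧
      ∀ i, ∀ᶠ n in (U : Filter ℕ), Real.posLog (Λ.av n (v n) (ev n (α i))) ≤ 2 ^ (i + 2) * C i * Hl n (v n) := by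
  classical
  have hne : ∀ n, Nonempty (Λ.P n) := by
    intro n
    by_contra h
    rw [not_nonempty_iff] at h
    have := Λ.sum_arch n
    simp at this
  have key : ∀ n, ∃ v : Λ.P n, 0 < ∑ v, Λ.wt n v * Hl n v → 0 < Hl n v ∧
      ∀ i < n, Λ.ht n (α i) ≤ C i * ∑ v, Λ.wt n v * Hl n v → Real.posLog (Λ.av n v (ev n (α i))) ≤ 2 ^ (i + 2) * C i * Hl n v := by
    intro n
    by_cases hp : 0 < ∑ v, Λ.wt n v * Hl n v
    swap
    · exact ⟨(hne n).some, fun h => absurd h hp⟩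
    obtain ⟨H, hHd⟩ : ∃ H, H = ∑ v, Λ.wt n v * Hl n v := ⟨_, rfl⟩
    rw [← hHd] at hp ⊢
    obtain ⟨A, hA⟩ : ∃ A : Finset ℕ, A = (Finset.range n).filter fun i => Λ.ht n (α i) ≤ C i * H := ⟨_, rfl⟩
    obtain ⟨f, hf⟩ : ∃ f : Λ.P n → ℝ, f = fun v => ∑ i ∈ A, (1 / 2) ^ (i + 2) / C i * Real.posLog (Λ.av n v (ev n (α i))) := ⟨_, rfl⟩
    have hf0 : ∀ v, ∀ i ∈ A, (1 / 2) ^ (i + 2) / C i * Real.posLog (Λ.av n v (ev n (α i))) ≤ f v := by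
      intro v i hi
      rw [hf]
      exact Finset.single_le_sum (f := fun i => (1 / 2 : ℝ) ^ (i + 2) / C i * Real.posLog (Λ.av n v (ev n (α i))))
        (fun i _ => mul_nonneg (div_nonneg (by positivity) (hC i).le) Real.posLog_nonneg) hi
    have hfn : ∀ v, 0 ≤ f v := by
      intro v
      rw [hf]
      exact Finset.sum_nonneg fun i _ => mul_nonneg (div_nonneg (by positivity) (hC i).le) Real.posLog_nonneg
    have hsum : ∑ v, Λ.wt n v * f v ≤ H / 2 := by
      have e1 : ∑ v, Λ.wt n v * f v = ∑ i ∈ A, (1 / 2) ^ (i + 2) / C i * Λ.ht n (α i) := by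
        rw [hf]
        simp only [Lev.ht, Finset.mul_sum]
        rw [Finset.sum_comm]
        exact Finset.sum_congr rfl fun i _ => Finset.sum_congr rfl fun v _ => by ring
      have e2 : ∀ i ∈ A, (1 / 2 : ℝ) ^ (i + 2) / C i * Λ.ht n (α i) ≤ (1 / 2) ^ (i + 2) * H := by
        intro i hi
        rw [hA, Finset.mem_filter] at hi
        rw [div_mul_eq_mul_div, div_le_iff₀ (hC i), mul_assoc, mul_comm H]
        exact mul_le_mul_of_nonneg_left hi.2 (by positivity)
      have e3 : ∑ i ∈ A, (1 / 2 : ℝ) ^ (i + 2) ≤ 1 / 2 := by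
        have : ∑ i ∈ A, (1 / 2 : ℝ) ^ (i + 2) ≤ ∑ i ∈ Finset.range n, (1 / 2 : ℝ) ^ (i + 2) :=
          Finset.sum_le_sum_of_subset_of_nonneg (by rw [hA]; exact Finset.filter_subset _ _) fun i _ _ => by positivity
        refine this.trans ?_
        simp only [pow_add, ← Finset.sum_mul]
        have := geom_sum_eq (x := (1 / 2 : ℝ)) (by norm_num) n
        rw [this]
        have : (0 : ℝ) < (1 / 2) ^ n := by positivity
        norm_num; linarith [show (0 : ℝ) < 1 / 2 ^ n by positivity]
      rw [e1]
      refine (Finset.sum_le_sum e2).trans ?_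
      rw [← Finset.sum_mul]
      nlinarith
    obtain ⟨v, -, hv⟩ : ∃ v ∈ Finset.univ, Λ.wt n v * f v < Λ.wt n v * Hl n v :=
      Finset.exists_lt_of_sum_lt (by rw [← hHd]; linarith)
    have hw : 0 < Λ.wt n v := by
      rcases eq_or_lt_of_le (Λ.wt_nonneg n v) with h | h
      · rw [← h] at hv; simp at hv
      · exact h
    have hv' : f v < Hl n v := lt_of_mul_lt_mul_left hv hw.le
    refine ⟨v, fun _ => ⟨(hfn v).trans_lt hv', fun i hi hle => ?_⟩⟩
    have := (hf0 v i (by rw [hA, Finset.mem_filter, Finset.mem_range]; exact ⟨hi, hle⟩)).trans hv'.le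
    rw [div_mul_eq_mul_div, div_le_iff₀ (hC i)] at this
    calc _ = 2 ^ (i + 2) * ((1 / 2) ^ (i + 2) * Real.posLog (Λ.av n v (ev n (α i)))) := by
          rw [← mul_assoc, ← mul_pow]; norm_num
      _ ≤ 2 ^ (i + 2) * (Hl n v * C i) := by gcongr
      _ = _ := by ring
  choose v hv using key
  refine ⟨v, hH.mono fun n h => (hv n h).1, fun i => ?_⟩
  filter_upwards [hH, hα i, hU (eventually_gt_atTop i)] with n h1 h2 h3
  exact (hv n h1).2 i h3 h2

end LG

namespace LG
open Filter Topology Matrix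
open scoped commutatorElement

universe u

theorem transferN {k : Type*} [Field k] [IsAlgClosed k] (N : AbsoluteValue k ℝ) {Q : Type*} [Group Q] {𝒜 : Subalgebra k (Q → k)} (hD : Dom 𝒜)
    {κ : Type*} [Fintype κ] [DecidableEq κ] (c : Q →* Matrix κ κ k) (hc : Coef 𝒜 c)
    {U : Filter ℕ} {L : ℕ → Type*} [∀ n, Field (L n)] {ev : ∀ n, k → L n} (hev : EvHom U ev)
    (vn : ∀ n, AbsoluteValue (L n) ℝ) (hlim : ∀ α, Tendsto (fun n => vn n (ev n α)) U (𝓝 (N α)))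
    (h : Q) (hh : h ∈ commutator Q) (ν : k) (hν : (c h).charpoly.IsRoot ν) (hν1 : 1 < N ν) :
    ∃ a : Fin 2 → Q, ∀ᶠ n in U, ∀ l : List (Fin 2 × Bool), FreeGroup.IsReduced l → l ≠ [] →
      (l.map fun x => em ev c (lett a x) n).prod ≠ 1 := by
  letI : NormedField k := N.toNormedField
  exact transferF hD c hc hev vn hlim h hh ν hν hν1

/-- transfer through a subfield containing all entries -/
theorem descend {k : Type*} [Field k] (S : Subfield k) [IsAlgClosed S] (N : AbsoluteValue S ℝ) {Q : Type*} [Group Q]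
    {𝒜 : Subalgebra k (Q → k)} (hD : Dom 𝒜)
    {m : ℕ} (c : Q →* Matrix (Fin m) (Fin m) k) (hc : Coef 𝒜 c) (hS : ∀ g i j, c g i j ∈ S)
    {U : Filter ℕ} {L : ℕ → Type*} [∀ n, Field (L n)] {ev : ∀ n, k → L n} (hev : EvHom U ev)
    (vn : ∀ n, AbsoluteValue (L n) ℝ) (hlim : ∀ α : S, Tendsto (fun n => vn n (ev n α)) U (𝓝 (N α)))
    (h : Q) (hh : h ∈ commutator Q) (ν : S) (hν : (c h).charpoly.IsRoot ν) (hν1 : 1 < N ν) :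
    ∃ a : Fin 2 → Q, ∀ᶠ n in U, ∀ l : List (Fin 2 × Bool), FreeGroup.IsReduced l → l ≠ [] →
      (l.map fun x => em ev c (lett a x) n).prod ≠ 1 := by
  let 𝒜' : Subalgebra S (Q → S) :=
    { carrier := {f | (fun x => (f x : k)) ∈ 𝒜}
      mul_mem' := fun {f g} hf hg => 𝒜.mul_mem hf hg
      add_mem' := fun {f g} hf hg => 𝒜.add_mem hf hg
      algebraMap_mem' := fun r => 𝒜.algebraMap_mem (r : k) }
  have hD' : Dom 𝒜' := by
    refine ⟨fun f hf g hg hfg => ?_, fun f hf => hD.inv _ hf⟩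
    rcases hD.dom _ hf _ hg (by
      ext x
      have := congrFun hfg x
      exact congrArg Subtype.val this) with h1 | h1
    · exact Or.inl (funext fun x => Subtype.ext (congrFun h1 x))
    · exact Or.inr (funext fun x => Subtype.ext (congrFun h1 x))
  let c0 : Q → Matrix (Fin m) (Fin m) S := fun g => of fun i j => ⟨c g i j, hS g i j⟩
  have hc0 : ∀ g, S.subtype.mapMatrix (c0 g) = c g := fun g => by ext i j; rfl
  have hinj : Function.Injective (S.subtype.mapMatrix : Matrix (Fin m) (Fin m) S →+* _) := by
    intro A B hAB
    ext i j
    exact congrFun (congrFun hAB i) j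
  let cB : Q →* Matrix (Fin m) (Fin m) S :=
    { toFun := c0
      map_one' := hinj (by rw [hc0, map_one, map_one])
      map_mul' := fun a b => hinj (by rw [hc0, map_mul, map_mul, hc0, hc0]) }
  have hcB : Coef 𝒜' cB := fun i j => hc i j
  have hev' : EvHom U (fun n (x : S) => ev n (S.subtype x)) := hev.comp S.subtype
  refine transferN N hD' cB hcB hev' vn hlim h hh ν ?_ hν1
  have : ((c0 h).charpoly.map S.subtype) = (c h).charpoly := by
    rw [← hc0 h]; exact (charpoly_map _ _).symm
  rw [← this] at hν
  exact hν.of_map S.subtype_injective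

lemma chom_field {k : Type*} [Field k] [CharZero k] {Q : Type*} [Group Q] {d : ℕ} {ψ : Q →* Matrix (Fin d) (Fin d) k}
    {Δ : Subgroup Q} [Δ.Normal] {m : ℕ} {x : Fin m → Q} (S : Subfield k) (h : SB ψ Δ x) (hG : (gram ψ x).det ≠ 0)
    (T : Set Q) (hT : Subgroup.closure T = ⊤) (h1 : ∀ i j, (ψ (x i * x j)).trace ∈ S)
    (h2 : ∀ g ∈ T, ∀ i j, (ψ (x i * (g * x j * g⁻¹))).trace ∈ S) (g : Q) (i j : Fin m) : chom h hG g i j ∈ S := by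
  have hg : g ∈ Subgroup.closure T := by rw [hT]; trivial
  have hmul : ∀ A B : Matrix (Fin m) (Fin m) k, (∀ i j, A i j ∈ S) → (∀ i j, B i j ∈ S) → ∀ i j, (A * B) i j ∈ S := by
    intro A B hA hB i j
    rw [mul_apply]
    exact sum_mem fun l _ => mul_mem (hA _ _) (hB _ _)
  suffices H : ∀ i j, chom h hG g i j ∈ S from H i j
  induction hg using Subgroup.closure_induction with
  | mem g hg => exact hmul _ _ (inv_mem_subfield S _ hG h1) (h2 g hg)
  | one =>
    intro i j
    rw [map_one, one_apply]
    split_ifs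
    · exact one_mem _
    · exact zero_mem _
  | mul a b _ _ ha hb => rw [map_mul]; exact hmul _ _ ha hb
  | inv a _ ha =>
    have e : chom h hG a * chom h hG a⁻¹ = 1 := by rw [← map_mul, mul_inv_cancel, map_one]
    have e2 : chom h hG a⁻¹ = (chom h hG a)⁻¹ := (Matrix.inv_eq_right_inv e).symm
    rw [e2]
    refine inv_mem_subfield S _ ?_ ha
    intro h0
    have := congrArg det e
    rw [det_mul, h0, zero_mul, det_one] at this
    exact zero_ne_one this

lemma uf_exists (U : Ultrafilter ℕ) {J : Type*} [Finite J] (p : J → ℕ → Prop) (h : ∀ᶠ n in (U : Filter ℕ), ∃ j, p j n) :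
    ∃ j, ∀ᶠ n in (U : Filter ℕ), p j n := by
  by_contra hn
  push Not at hn
  have h1 : ∀ j, ∀ᶠ n in (U : Filter ℕ), ¬ p j n := hn
  have := eventually_all.mpr h1
  obtain ⟨n, ⟨j, hj⟩, h3⟩ := (h.and this).exists
  exact h3 j hj

/-- a large trace gives a large eigenvalue -/
lemma big_root {k : Type*} [Field k] [IsAlgClosed k] (U : Ultrafilter ℕ) {L : ℕ → Type u} [∀ n, Field (L n)] {ev : ∀ n, k → L n}
    (hev : EvHom (U : Filter ℕ) ev) (av : ∀ n, AbsoluteValue (L n) ℝ) (a : ℕ → ℝ) (hpt : ∀ n, PT (av n) (a n))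
    {d : ℕ} (M : Matrix (Fin d) (Fin d) k) (b : ℕ → ℝ) (hb0 : ∀ᶠ n in (U : Filter ℕ), 0 < b n)
    (hb : ∀ᶠ n in (U : Filter ℕ), b n + a n * Real.log d ≤ Real.posLog (av n (ev n M.trace))) :
    ∃ lam, M.charpoly.IsRoot lam ∧ ∀ᶠ n in (U : Filter ℕ), b n / d ≤ Real.log (av n (ev n lam)) := by
  classical
  obtain ⟨l, hl⟩ : ∃ l : List k, M.charpoly.roots = ↑l := ⟨_, (Multiset.coe_toList _).symm⟩
  have hlen : l.length = d := by
    have h1 : M.charpoly.roots.card = M.charpoly.natDegree :=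
      (IsAlgClosed.splits M.charpoly).natDegree_eq_card_roots.symm
    rw [hl, M.charpoly_natDegree_eq_dim, Fintype.card_fin] at h1
    simpa using h1
  subst hlen
  have htr : M.trace = ∑ i : Fin l.length, l.get i := by
    rw [Matrix.trace_eq_sum_roots_charpoly, hl, Multiset.sum_coe]
    simp
  obtain ⟨i, hi⟩ := uf_exists U (fun (i : Fin l.length) n => b n / l.length ≤ Real.posLog (av n (ev n (l.get i)))) (by
    filter_upwards [hev.sum Finset.univ (fun i : Fin l.length => l.get i), hb, hb0] with n h1 h2 h3
    by_contra hcon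
    push Not at hcon
    have h4 := (hpt n).sum Finset.univ (fun i : Fin l.length => ev n (l.get i))
    rw [htr, h1] at h2
    have h5 : b n ≤ ∑ i : Fin l.length, Real.posLog (av n (ev n (l.get i))) := by
      have : (Finset.univ : Finset (Fin l.length)).card = l.length := by simp
      rw [this] at h4
      linarith
    have hne : (Finset.univ : Finset (Fin l.length)).Nonempty := by
      by_contra hh
      rw [Finset.not_nonempty_iff_eq_empty] at hh
      rw [hh, Finset.sum_empty] at h5
      linarith
    have h6 : ∑ i : Fin l.length, Real.posLog (av n (ev n (l.get i))) < ∑ i : Fin l.length, b n / l.length :=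
      Finset.sum_lt_sum_of_nonempty hne fun i _ => hcon i
    rw [Finset.sum_const, Finset.card_univ, Fintype.card_fin, nsmul_eq_mul] at h6
    have hpos : (l.length : ℝ) ≠ 0 := by
      obtain ⟨i, -⟩ := hne
      have := i.2
      have : 0 < l.length := by lia
      positivity
    rw [mul_div_cancel₀ _ hpos] at h6
    linarith)
  refine ⟨l.get i, ?_, ?_⟩
  · have : l.get i ∈ M.charpoly.roots := by rw [hl]; exact Multiset.mem_coe.mpr (List.get_mem l i)
    exact Polynomial.isRoot_of_mem_roots this
  · filter_upwards [hi, hb0] with n h1 h2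
    have hpos : (0 : ℝ) < l.length := by
      have := i.2
      have : 0 < l.length := by lia
      positivity
    have h3 : 0 < Real.posLog (av n (ev n (l.get i))) := (div_pos h2 hpos).trans_le h1
    rw [Real.posLog_def] at h1 h3
    rcases le_max_iff.mp h1 with h4 | h4
    · exact absurd (div_pos h2 hpos) (not_lt.mpr h4)
    · exact h4

end LG

namespace LG
open Filter Topology Matrix
open scoped commutatorElement

universe u

set_option maxHeartbeats 2000000 in
/-- the irreducible case -/
theorem thmB_irr {k : Type*} [Field k] [CharZero k] [IsAlgClosed k] [Countable k] (U : Ultrafilter ℕ) (hU : (U : Filter ℕ) ≤ atTop)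
    {L : ℕ → Type u} [∀ n, Field (L n)] {ev : ∀ n, k → L n} (hev : EvHom (U : Filter ℕ) ev) (Λ : Lev (U : Filter ℕ) ev)
    {Q : Type*} [Group Q] (T : Finset Q) (hT : Subgroup.closure (T : Set Q) = ⊤)
    {𝒜 : Subalgebra k (Q → k)} (hD : Dom 𝒜) {d : ℕ} (ψ : Q →* Matrix (Fin d) (Fin d) k) (hC : Coef 𝒜 ψ) (hirr : Irr ψ) (hns : NS ψ) :
    ∃ a : Fin 2 → Q, ∀ᶠ n in (U : Filter ℕ), ∀ l : List (Fin 2 × Bool), FreeGroup.IsReduced l → l ≠ [] →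
      (l.map fun x => em ev ψ (lett a x) n).prod ≠ 1 := by
  classical
  obtain ⟨s, hs⟩ := exists_stable ψ
  obtain ⟨m, x, hx1⟩ := exists_SB ψ (derivedSeries Q (s + 1))
  have hx : ∀ j, x j ∈ derivedSeries Q (s + 1) := hx1.mem
  have h : SB ψ (derivedSeries Q s) x :=
    ⟨fun j => derived_mono (Nat.le_succ s) (hx j), hx1.li, by rw [hs]; exact hx1.span⟩
  have hG : (gram ψ x).det ≠ 0 := h.gram_det hirr
  obtain ⟨y, hy, ε, hε, hyε⟩ := gap U hev Λ hD hC hirr hns s h hx hG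
  obtain ⟨BB, hBB⟩ : ∃ BB : Finset Q, BB = insert y
      ((Finset.univ.image fun p : Fin m × Fin m => x p.1 * x p.2) ∪
       ((T ×ˢ (Finset.univ : Finset (Fin m × Fin m))).image fun p => x p.2.1 * (p.1 * x p.2.2 * p.1⁻¹))) := ⟨_, rfl⟩
  have hyB : y ∈ BB := by rw [hBB]; exact Finset.mem_insert_self _ _
  have hxB : ∀ i j, x i * x j ∈ BB := by
    intro i j
    rw [hBB]
    exact Finset.mem_insert_of_mem (Finset.mem_union_left _ (Finset.mem_image.mpr ⟨(i, j), Finset.mem_univ _, rfl⟩))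
  have hgB : ∀ g ∈ T, ∀ i j, x i * (g * x j * g⁻¹) ∈ BB := by
    intro g hg i j
    rw [hBB]
    exact Finset.mem_insert_of_mem (Finset.mem_union_right _
      (Finset.mem_image.mpr ⟨(g, (i, j)), Finset.mem_product.mpr ⟨hg, Finset.mem_univ _⟩, rfl⟩))
  have hB1 : ∀ w ∈ BB, w ∈ derivedSeries Q (s + 1) := by
    intro w hw
    rw [hBB, Finset.mem_insert, Finset.mem_union, Finset.mem_image, Finset.mem_image] at hw
    rcases hw with rfl | ⟨p, -, rfl⟩ | ⟨p, -, rfl⟩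
    · exact hy
    · exact mul_mem (hx _) (hx _)
    · exact mul_mem (hx _) (Subgroup.Normal.conj_mem inferInstance _ (hx _) _)
  clear hBB
  obtain ⟨Hl, hHl⟩ : ∃ Hl : ∀ n, Λ.P n → ℝ, Hl = fun n v => ∑ w ∈ BB, Λ.loc d n v (ψ w).trace := ⟨_, rfl⟩
  obtain ⟨H, hH⟩ : ∃ H : ℕ → ℝ, H = fun n => ∑ v, Λ.wt n v * Hl n v := ⟨_, rfl⟩
  have hHeta : ∀ n, H n = ∑ w ∈ BB, Λ.eta d n (ψ w).trace := by
    intro n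
    rw [hH, hHl]
    simp only [Lev.eta, Finset.mul_sum]
    rw [Finset.sum_comm]
  have heta : ∀ n, ∀ w ∈ BB, Λ.eta d n (ψ w).trace ≤ H n := by
    intro n w hw
    rw [hHeta]
    exact Finset.single_le_sum (f := fun w => Λ.eta d n (ψ w).trace) (fun w _ => Λ.eta_nonneg _) hw
  have hHε : ∀ᶠ n in (U : Filter ℕ), ε ≤ H n := hyε.mono fun n h1 => h1.trans (heta n y hyB)
  have hh : ∃ ε > 0, ∀ᶠ n in (U : Filter ℕ), ε ≤ H n := ⟨ε, hε, hHε⟩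
  have hld : 0 ≤ Real.log d := Real.log_natCast_nonneg d
  have htB : ∀ w ∈ BB, (ψ w).trace ∈ Λ.B hev H hh := by
    intro w hw
    rw [Λ.mem_B hev]
    refine ⟨1 + Real.log d / ε, by positivity, ?_⟩
    filter_upwards [hHε] with n h1
    have h2 := Λ.ht_le_eta (d := d) (n := n) (ψ w).trace
    have h3 := heta n w hw
    have h4 : Real.log d ≤ Real.log d / ε * H n := by
      rw [div_mul_eq_mul_div, le_div_iff₀ hε]
      exact mul_le_mul_of_nonneg_left h1 hld
    linarith
  have hcB : ∀ g i j, chom h hG g i j ∈ Λ.B hev H hh :=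
    chom_field _ h hG (T : Set Q) hT (fun i j => htB _ (hxB i j)) fun g hg i j => htB _ (hgB g hg i j)
  have hac : IsAlgClosed (Λ.B hev H hh) := Λ.isAlgClosed_B hev
  -- enumerate the field and select places
  obtain ⟨e, he⟩ := exists_surjective_nat (Λ.B hev H hh)
  have hCe : ∀ i, ∃ C : ℝ, 0 < C ∧ ∀ᶠ n in (U : Filter ℕ), Λ.ht n (e i : k) ≤ C * H n := by
    intro i
    obtain ⟨C, h0, h1⟩ := (Λ.mem_B hev).mp (e i).2
    refine ⟨C + 1, by linarith, ?_⟩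
    filter_upwards [h1, hHε] with n h2 h3
    linarith
  choose C hC0 hC1 using hCe
  obtain ⟨v, hv0, hv⟩ := Λ.select U hU (fun i => (e i : k)) C hC0 Hl
    (by filter_upwards [hHε] with n h1; rw [hH] at h1; exact hε.trans_le h1)
    (fun i => (hC1 i).mono fun n h1 => h1.trans_eq (by rw [congrFun hH n]))
  have hevS : EvHom (U : Filter ℕ) (fun n (α : Λ.B hev H hh) => ev n (α : k)) := hev.comp (Λ.B hev H hh).subtype
  obtain ⟨vn, N, τ, hτ, hlim, hvn⟩ := limitAV U hevS (fun n => Λ.av n (v n)) (fun n => Λ.a n (v n)) (fun n => Hl n (v n))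
    (fun n => Λ.pt n (v n)) hv0 (fun α => by
      obtain ⟨i, rfl⟩ := he α
      exact ⟨_, hv i⟩)
  -- a fixed group element with large trace
  obtain ⟨⟨w, hw⟩, hwb⟩ := uf_exists U (fun (w : BB) n => Hl n (v n) / BB.card ≤ Λ.loc d n (v n) (ψ w).trace) (by
    filter_upwards [hv0] with n h1
    by_contra hcon
    push Not at hcon
    have h6 : ∑ w ∈ BB, Λ.loc d n (v n) (ψ w).trace < ∑ w ∈ BB, Hl n (v n) / BB.card :=
      Finset.sum_lt_sum_of_nonempty ⟨y, hyB⟩ fun w hw => hcon ⟨w, hw⟩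
    rw [Finset.sum_const, nsmul_eq_mul] at h6
    have hpos : (BB.card : ℝ) ≠ 0 := by
      have := Finset.card_pos.mpr ⟨y, hyB⟩
      positivity
    rw [mul_div_cancel₀ _ hpos] at h6
    rw [hHl] at h6
    exact lt_irrefl _ h6)
  replace hwb : ∀ᶠ n in (U : Filter ℕ), Hl n (v n) / BB.card ≤ Λ.loc d n (v n) (ψ w).trace := hwb
  have hcard : (0 : ℝ) < BB.card := by
    have := Finset.card_pos.mpr ⟨y, hyB⟩
    positivity
  have hb0 : ∀ᶠ n in (U : Filter ℕ), 0 < Hl n (v n) / BB.card := hv0.mono fun n h1 => div_pos h1 hcard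
  obtain ⟨lam, hlam, hlb⟩ := big_root U hev (fun n => Λ.av n (v n)) (fun n => Λ.a n (v n)) (fun n => Λ.pt n (v n)) (ψ w)
    (fun n => Hl n (v n) / BB.card) hb0 (by
      filter_upwards [hwb, hb0] with n h1 h2
      have h3 : 0 < Λ.loc d n (v n) (ψ w).trace := h2.trans_le h1
      rw [Lev.loc] at h1 h3
      have h4 : Hl n (v n) / BB.card ≤ Real.log (Λ.av n (v n) (ev n (ψ w).trace)) - Λ.a n (v n) * Real.log d := by
        rcases le_max_iff.mp h1 with h5 | h5
        · linarith
        · exact h5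
      rw [Real.posLog_def]
      refine le_trans ?_ (le_max_right _ _)
      linarith)
  obtain ⟨r, ms, hr, hprod, hms⟩ := lemmaE h hG w (by rw [← derivedSeries_succ]; exact hB1 w hw) lam hlam
  have hd0 : (0 : ℝ) < d := by
    have : d ≠ 0 := by
      rintro rfl
      obtain ⟨z, -, hz⟩ := hns 0
      exact hz (Subsingleton.elim _ _)
    positivity
  -- roots lie in the field
  have hmsB : ∀ μ ∈ ms, μ ∈ Λ.B hev H hh := by
    intro μ hμ
    have hroot := hms μ hμ
    let c0 : Matrix (Fin m) (Fin m) (Λ.B hev H hh) := of fun i j => ⟨chom h hG w i j, hcB w i j⟩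
    have hc0 : (c0.charpoly.map (Λ.B hev H hh).subtype) = (chom h hG w).charpoly := by
      have : (Λ.B hev H hh).subtype.mapMatrix c0 = chom h hG w := by ext i j; rfl
      rw [← this]; exact (charpoly_map _ _).symm
    have hspl := (IsAlgClosed.splits c0.charpoly).roots_map (Λ.B hev H hh).subtype
    have hne : (chom h hG w).charpoly ≠ 0 := (charpoly_monic _).ne_zero
    have : μ ∈ (c0.charpoly.map (Λ.B hev H hh).subtype).roots := by
      rw [hc0]; exact (Polynomial.mem_roots hne).mpr hroot
    rw [hspl, Multiset.mem_map] at this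
    obtain ⟨β, -, rfl⟩ := this
    exact β.2
  obtain ⟨mB, hmB⟩ : ∃ mB : Multiset (Λ.B hev H hh), mB.map (Λ.B hev H hh).subtype = ms := by
    refine ⟨ms.attach.map fun μ => ⟨μ.1, hmsB μ.1 μ.2⟩, ?_⟩
    rw [Multiset.map_map]
    exact Multiset.attach_map_val ms
  have hpB : ((mB.prod : Λ.B hev H hh) : k) = lam ^ r := by
    rw [← hprod, ← hmB]
    exact map_multiset_prod (Λ.B hev H hh).subtype mB
  have hbig : 1 < N mB.prod := by
    have h1 : ∀ᶠ n in (U : Filter ℕ), Real.exp (τ * r / (BB.card * d)) ≤ vn n (ev n (mB.prod : Λ.B hev H hh)) := by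
      have hpow := hev.prod (Finset.range r) (fun _ => lam)
      filter_upwards [hvn, hlb, hv0, hpow, hb0] with n h1 h2 h3 h4 h5
      simp only [Finset.prod_const, Finset.card_range] at h4
      rw [h1, hpB, h4, map_pow]
      have h6 : 0 < Real.log (Λ.av n (v n) (ev n lam)) := (div_pos h5 hd0).trans_le h2
      have h7 : 0 < Λ.av n (v n) (ev n lam) := by
        rcases eq_or_lt_of_le ((Λ.av n (v n)).nonneg (ev n lam)) with h8 | h8
        · rw [← h8, Real.log_zero] at h6; exact absurd h6 (lt_irrefl _)
        · exact h8
      rw [Real.rpow_def_of_pos (pow_pos h7 r), Real.log_pow]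
      apply Real.exp_le_exp.mpr
      calc τ * r / (BB.card * d) = r * (Hl n (v n) / BB.card / d) * (τ / Hl n (v n)) := by field_simp
        _ ≤ _ := by gcongr
    have h2 : Real.exp (τ * r / (BB.card * d)) ≤ N mB.prod := ge_of_tendsto (hlim mB.prod) h1
    refine lt_of_lt_of_le (Real.one_lt_exp_iff.mpr ?_) h2
    have : (0 : ℝ) < r := by positivity
    positivity
  obtain ⟨ν, hνm, hν⟩ : ∃ ν ∈ mB, 1 < N ν := by
    by_contra hcon
    push Not at hcon
    have : ∀ M : Multiset (Λ.B hev H hh), (∀ ν ∈ M, N ν ≤ 1) → N M.prod ≤ 1 := by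
      intro M
      induction M using Multiset.induction_on with
      | empty => intro _; simp
      | cons a M ih =>
        intro hM
        rw [Multiset.prod_cons, map_mul]
        exact mul_le_one₀ (hM a (Multiset.mem_cons_self a M)) (N.nonneg _)
          (ih fun ν hν => hM ν (Multiset.mem_cons_of_mem hν))
    exact absurd hbig (not_lt.mpr (this mB hcon))
  have hwcomm : w ∈ commutator Q := by
    have := derived_mono (Q := Q) (show 1 ≤ s + 1 by lia) (hB1 w hw)
    rwa [derivedSeries_one] at this
  obtain ⟨a, ha⟩ := descend (Λ.B hev H hh) N hD (chom h hG) (coef_chom hD h hG hC) hcB hev vn hlim w hwcomm ν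
    (hms _ (by rw [← hmB]; exact Multiset.mem_map_of_mem _ hνm)) hν
  refine ⟨a, ?_⟩
  filter_upwards [ha, good_chom hev h hG a] with n h1 h2 l hl hl0 h3
  exact h1 l hl hl0 (h2 l h3)

/-- Theorem B -/
theorem thmB {k : Type*} [Field k] [CharZero k] [IsAlgClosed k] [Countable k] (U : Ultrafilter ℕ) (hU : (U : Filter ℕ) ≤ atTop)
    {L : ℕ → Type u} [∀ n, Field (L n)] {ev : ∀ n, k → L n} (hev : EvHom (U : Filter ℕ) ev) (Λ : Lev (U : Filter ℕ) ev)
    {Q : Type*} [Group Q] (T : Finset Q) (hT : Subgroup.closure (T : Set Q) = ⊤)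
    {𝒜 : Subalgebra k (Q → k)} (hD : Dom 𝒜) {d : ℕ} (φ : Q →* Matrix (Fin d) (Fin d) k) (hC : Coef 𝒜 φ) (hns : NS φ) :
    ∃ a : Fin 2 → Q, ∀ᶠ n in (U : Filter ℕ), ∀ l : List (Fin 2 × Bool), FreeGroup.IsReduced l → l ≠ [] →
      (l.map fun x => em ev φ (lett a x) n).prod ≠ 1 := by
  obtain ⟨m, ψ, h1, h2, h3, h4⟩ := exists_irr hev φ hC hns
  obtain ⟨a, ha⟩ := thmB_irr U hU hev Λ T hT hD ψ h1 h4 h3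
  refine ⟨a, ?_⟩
  filter_upwards [ha, h2 a] with n h1 h2 l hl hl0 h3
  exact h1 l hl hl0 (h2 l h3)

end LG

namespace LG
open Matrix

section conn
variable {k : Type*} [Field k] {G : Type*} [Group G] {d : ℕ} (Φ : G →* Matrix (Fin d) (Fin d) k)

/-- generators of the coordinate algebra -/
def gens : Set (G → k) :=
  (Set.range fun p : Fin d × Fin d => fun x => Φ x p.1 p.2) ∪ Set.range fun p : Fin d × Fin d => fun x => Φ x⁻¹ p.1 p.2

/-- the coordinate algebra -/
def Rfull : Subalgebra k (G → k) := Algebra.adjoin k (gens Φ)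

lemma gens_mem1 (i j : Fin d) : (fun x => Φ x i j) ∈ Rfull Φ := Algebra.subset_adjoin (Or.inl ⟨(i, j), rfl⟩)
lemma gens_mem2 (i j : Fin d) : (fun x => Φ x⁻¹ i j) ∈ Rfull Φ := Algebra.subset_adjoin (Or.inr ⟨(i, j), rfl⟩)

instance : IsNoetherianRing (Rfull Φ) := by
  have hfin : (gens Φ).Finite := (Set.finite_range _).union (Set.finite_range _)
  have : (Rfull Φ).FG := ⟨hfin.toFinset, by rw [Rfull, Set.Finite.coe_toFinset]⟩
  have : Algebra.FiniteType k (Rfull Φ) := (Rfull Φ).fg_iff_finiteType.mp this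
  exact Algebra.FiniteType.isNoetherianRing k _

/-- precomposition -/
def pre {X Y : Type*} (u : X → Y) : (Y → k) →ₐ[k] (X → k) where
  toFun f := fun x => f (u x)
  map_one' := rfl
  map_mul' _ _ := rfl
  map_zero' := rfl
  map_add' _ _ := rfl
  commutes' _ := rfl

lemma pre_apply {X Y : Type*} (u : X → Y) (f : Y → k) (x : X) : pre u f x = f (u x) := rfl

lemma Rfull_pre (u : G → G) (h : ∀ f ∈ gens Φ, pre u f ∈ Rfull Φ) (f : G → k) (hf : f ∈ Rfull Φ) : pre u f ∈ Rfull Φ := by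
  have : Rfull Φ ≤ (Rfull Φ).comap (pre u) := Algebra.adjoin_le h
  exact this hf

lemma Rfull_inv (f : G → k) (hf : f ∈ Rfull Φ) : pre (fun x => x⁻¹) f ∈ Rfull Φ := by
  refine Rfull_pre Φ _ ?_ f hf
  rintro f (⟨p, rfl⟩ | ⟨p, rfl⟩)
  · exact gens_mem2 Φ _ _
  · have : pre (fun x : G => x⁻¹) (fun x => Φ x⁻¹ p.1 p.2) = (fun x => Φ x p.1 p.2 : G → k) := by
      ext x; simp [pre_apply]
    exact this ▸ gens_mem1 Φ _ _

lemma Rfull_trans (g : G) (f : G → k) (hf : f ∈ Rfull Φ) : pre (fun x => x * g) f ∈ Rfull Φ := by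
  refine Rfull_pre Φ _ ?_ f hf
  rintro f (⟨p, rfl⟩ | ⟨p, rfl⟩)
  · have : pre (fun x : G => x * g) (fun x => Φ x p.1 p.2) = ∑ l, Φ g l p.2 • (fun x => Φ x p.1 l : G → k) := by
      ext x
      simp only [pre_apply, map_mul, Matrix.mul_apply,
        Finset.sum_apply, Pi.smul_apply, smul_eq_mul]
      exact Finset.sum_congr rfl fun l _ => mul_comm _ _
    rw [this]
    exact sum_mem fun l _ => Subalgebra.smul_mem _ (gens_mem1 Φ _ _) _
  · have : pre (fun x : G => x * g) (fun x => Φ x⁻¹ p.1 p.2) = ∑ l, Φ g⁻¹ p.1 l • (fun x => Φ x⁻¹ l p.2 : G → k) := by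
      ext x
      simp only [pre_apply, _root_.mul_inv_rev, map_mul, Matrix.mul_apply,
        Finset.sum_apply, Pi.smul_apply, smul_eq_mul]
    rw [this]
    exact sum_mem fun l _ => Subalgebra.smul_mem _ (gens_mem2 Φ _ _) _

/-- translation on the coordinate algebra -/
def tau (g : G) : Rfull Φ →+* Rfull Φ where
  toFun f := ⟨pre (fun x => x * g) f.1, Rfull_trans Φ g f.1 f.2⟩
  map_one' := rfl
  map_mul' _ _ := rfl
  map_zero' := rfl
  map_add' _ _ := rfl

lemma tau_apply (g : G) (f : Rfull Φ) (x : G) : (tau Φ g f).1 x = f.1 (x * g) := rfl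

lemma tau_one : tau Φ 1 = RingHom.id _ := by
  ext f x
  change f.1 (x * 1) = f.1 x
  rw [mul_one]

lemma tau_mul (g h : G) : (tau Φ g).comp (tau Φ h) = tau Φ (g * h) := by
  ext f x
  change f.1 (x * g * h) = f.1 (x * (g * h))
  rw [mul_assoc]

/-- functions vanishing on a subgroup -/
def Ivan (H : Subgroup G) : Ideal (Rfull Φ) where
  carrier := {f | ∀ x ∈ H, f.1 x = 0}
  zero_mem' := fun _ _ => rfl
  add_mem' := fun {f g} hf hg x hx => by
    change f.1 x + g.1 x = 0
    rw [hf x hx, hg x hx, add_zero]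
  smul_mem' := fun c f hf x hx => by
    change c.1 x * f.1 x = 0
    rw [hf x hx, mul_zero]

lemma mem_Ivan {H : Subgroup G} {f : Rfull Φ} : f ∈ Ivan Φ H ↔ ∀ x ∈ H, f.1 x = 0 := Iff.rfl

/-- functions vanishing at one -/
def m1 : Ideal (Rfull Φ) where
  carrier := {f | f.1 1 = 0}
  zero_mem' := rfl
  add_mem' := fun {f g} hf hg => by
    change f.1 1 + g.1 1 = 0
    rw [show f.1 1 = 0 from hf, show g.1 1 = 0 from hg, add_zero]
  smul_mem' := fun c f hf => by
    change c.1 1 * f.1 1 = 0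
    rw [show f.1 1 = 0 from hf, mul_zero]

lemma m1_prime : (m1 Φ).IsPrime := by
  refine ⟨fun h => ?_, fun {f g} hfg => ?_⟩
  · have : (1 : Rfull Φ) ∈ m1 Φ := by rw [h]; trivial
    exact one_ne_zero (show (1 : k) = 0 from this)
  · exact mul_eq_zero.mp (show f.1 1 * g.1 1 = 0 from hfg)

/-- action on ideals -/
@[reducible] def idAct : MulAction G (Ideal (Rfull Φ)) where
  smul g J := J.comap (tau Φ g⁻¹)
  one_smul J := by
    change J.comap (tau Φ 1⁻¹) = J
    rw [inv_one, tau_one, Ideal.comap_id]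
  mul_smul g h J := by
    change J.comap (tau Φ (g * h)⁻¹) = (J.comap (tau Φ h⁻¹)).comap (tau Φ g⁻¹)
    rw [Ideal.comap_comap, tau_mul, _root_.mul_inv_rev]

theorem thmConn : ∃ H : Subgroup G, H.index ≠ 0 ∧ ∃ 𝒜 : Subalgebra k (H → k), Dom 𝒜 ∧ Coef 𝒜 (fun h : H => Φ h) := by
  classical
  obtain ⟨I, ⟨H, hH, rfl⟩, hmax⟩ := set_has_maximal_iff_noetherian.mpr (inferInstance : IsNoetherian (Rfull Φ) (Rfull Φ))
    {I | ∃ H : Subgroup G, H.index ≠ 0 ∧ Ivan Φ H = I} ⟨_, ⊤, by simp, rfl⟩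
  have hI1 : Ivan Φ H ≤ m1 Φ := fun f hf => hf 1 (one_mem _)
  have := m1_prime Φ
  obtain ⟨P, hP, hP1⟩ := Ideal.exists_minimalPrimes_le hI1
  have hfin : (Ivan Φ H).minimalPrimes.Finite := Ideal.finite_minimalPrimes_of_isNoetherianRing _ _
  have hIcom : ∀ h ∈ H, Ivan Φ H ≤ (Ivan Φ H).comap (tau Φ h) := fun h hh f hf x hx => hf (x * h) (mul_mem hx hh)
  have hmin : ∀ h ∈ H, P.comap (tau Φ h) ∈ (Ivan Φ H).minimalPrimes := by
    intro h hh
    have hPp : P.IsPrime := hP.1.1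
    refine ⟨⟨inferInstance, (hIcom h hh).trans (Ideal.comap_mono hP.1.2)⟩, ?_⟩
    rintro J ⟨hJp, hJI⟩ hJP
    have h1 : J.comap (tau Φ h⁻¹) ≤ P := by
      refine (Ideal.comap_mono hJP).trans ?_
      rw [Ideal.comap_comap, tau_mul, mul_inv_cancel, tau_one, Ideal.comap_id]
    have h2 : P ≤ J.comap (tau Φ h⁻¹) :=
      hP.2 ⟨inferInstance, (hIcom h⁻¹ (inv_mem hh)).trans (Ideal.comap_mono hJI)⟩ h1
    refine (Ideal.comap_mono h2).trans ?_
    rw [Ideal.comap_comap, tau_mul, inv_mul_cancel, tau_one, Ideal.comap_id]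
  letI := idAct Φ
  let St : Subgroup H := MulAction.stabilizer H P
  have hSt : St.index ≠ 0 := by
    rw [MulAction.index_stabilizer]
    have hof : (MulAction.orbit H P).Finite := hfin.subset (by
      rintro _ ⟨h, rfl⟩
      exact hmin _ (inv_mem h.2))
    rw [Ne, Set.ncard_eq_zero hof]
    exact (MulAction.nonempty_orbit P).ne_empty
  have hPI : P ≤ Ivan Φ (St.map H.subtype) := by
    rintro f hf _ ⟨h, hh, rfl⟩
    have h1 : h⁻¹ • P = P := St.inv_mem hh
    have h2 : P.comap (tau Φ ((h⁻¹ : H) : G)⁻¹) = P := h1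
    rw [InvMemClass.coe_inv, inv_inv] at h2
    rw [← h2] at hf
    have h3 : (tau Φ (h : G) f).1 1 = 0 := hP1 hf
    rw [tau_apply, one_mul] at h3
    exact h3
  have hIP : Ivan Φ H = P := by
    refine le_antisymm hP.1.2 (hPI.trans ?_)
    have hle : Ivan Φ H ≤ Ivan Φ (St.map H.subtype) := fun f hf x hx => hf x (Subgroup.map_subtype_le St hx)
    by_contra hne
    exact hmax _ ⟨St.map H.subtype, by rw [Subgroup.index_map_subtype]; exact mul_ne_zero hSt hH, rfl⟩
      (lt_of_le_not_ge hle hne)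
  have hprime : (Ivan Φ H).IsPrime := hIP ▸ hP.1.1
  refine ⟨H, hH, (Rfull Φ).map (pre (fun h : H => (h : G))), ⟨?_, ?_⟩, ?_⟩
  · rintro _ ⟨f, hf, rfl⟩ _ ⟨g, hg, rfl⟩ hfg
    have h1 : (⟨f, hf⟩ * ⟨g, hg⟩ : Rfull Φ) ∈ Ivan Φ H := fun x hx => congrFun hfg ⟨x, hx⟩
    rcases hprime.mem_or_mem h1 with h2 | h2
    · exact Or.inl (funext fun x => h2 x.1 x.2)
    · exact Or.inr (funext fun x => h2 x.1 x.2)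
  · rintro _ ⟨f, hf, rfl⟩
    exact ⟨_, Rfull_inv Φ f hf, rfl⟩
  · intro i j
    exact ⟨_, gens_mem1 Φ i j, rfl⟩

end conn
end LG

namespace LG
open Filter NumberField

/-- places of a number field with a product formula for a finite set -/
lemma nf_places (K : Type) [Field K] [NumberField K] (X : Set K) (hX : X.Finite) :
    ∃ (P : Type) (_ : Fintype P) (wt : P → ℝ) (av : P → AbsoluteValue K ℝ) (a : P → ℝ),
      (∀ v, 0 ≤ wt v) ∧ (∀ v, PT (av v) (a v)) ∧ ∑ v, wt v * a v = 1 ∧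
      ∀ x ∈ X, x ≠ 0 → ∑ v, wt v * Real.log (av v x) = 0 := by
  classical
  let Y : Set (FinitePlace K) := ⋃ x ∈ X \ {0}, Function.mulSupport fun w : FinitePlace K => w x
  have hY : Y.Finite := (hX.diff).biUnion fun x hx => FinitePlace.hasFiniteMulSupport hx.2
  have hD : (0 : ℝ) < Module.finrank ℚ K := by
    have := Module.finrank_pos (R := ℚ) (M := K)
    positivity
  obtain ⟨D, hDd⟩ : ∃ D : ℝ, D = Module.finrank ℚ K := ⟨_, rfl⟩
  rw [← hDd] at hD
  refine ⟨InfinitePlace K ⊕ hY.toFinset, inferInstance, Sum.elim (fun w => w.mult / D) (fun _ => 1 / D),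
    Sum.elim (fun w => w.1) (fun w => w.1.1), Sum.elim (fun _ => 1) (fun _ => 0), ?_, ?_, ?_, ?_⟩
  · rintro (w | w) <;> simp only [Sum.elim_inl, Sum.elim_inr] <;> positivity
  · rintro (w | w)
    · exact Or.inl ⟨rfl, w.embedding, fun x => (w.norm_embedding_eq x).symm⟩
    · exact Or.inr ⟨rfl, fun x y => w.1.add_le x y⟩
  · rw [Fintype.sum_sum_type]
    simp only [Sum.elim_inl, Sum.elim_inr, mul_one, mul_zero, Finset.sum_const_zero, add_zero]
    rw [← Finset.sum_div, div_eq_one_iff_eq hD.ne', hDd, ← InfinitePlace.sum_mult_eq]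
    push_cast; rfl
  · intro x hx hx0
    rw [Fintype.sum_sum_type]
    simp only [Sum.elim_inl, Sum.elim_inr]
    have hpf := prod_abs_eq_one hx0
    rw [finprod_eq_prod_of_mulSupport_subset (s := hY.toFinset) _ (by
      rw [Set.Finite.coe_toFinset]
      exact Set.subset_biUnion_of_mem (u := fun x => Function.mulSupport fun w : FinitePlace K => w x) ⟨hx, hx0⟩)] at hpf
    have h1 : ∏ w : InfinitePlace K, w x ^ w.mult ≠ 0 := left_ne_zero_of_mul_eq_one hpf
    have h2 : ∏ w ∈ hY.toFinset, w x ≠ 0 := right_ne_zero_of_mul_eq_one hpf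
    have h3 := congrArg Real.log hpf
    rw [Real.log_mul h1 h2, Real.log_one, Real.log_prod (fun w hw => Finset.prod_ne_zero_iff.mp h1 w hw),
      Real.log_prod (fun w hw => Finset.prod_ne_zero_iff.mp h2 w hw)] at h3
    simp only [Real.log_pow] at h3
    have e1 : ∑ w : InfinitePlace K, (w.mult : ℝ) / D * Real.log (w.1 x) = (∑ w : InfinitePlace K, (w.mult : ℝ) * Real.log (w x)) / D := by
      rw [Finset.sum_div]
      exact Finset.sum_congr rfl fun w _ => by rw [div_mul_eq_mul_div]; rfl
    have e2 : ∑ w : hY.toFinset, 1 / D * Real.log (w.1.1 x) = (∑ w ∈ hY.toFinset, Real.log (w x)) / D := by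
      rw [Finset.sum_div, ← Finset.sum_coe_sort hY.toFinset]
      exact Finset.sum_congr rfl fun w _ => by rw [one_div_mul_eq_div]; rfl
    rw [e1, e2, ← add_div, h3, zero_div]

theorem exists_lev {k : Type*} [Field k] [Countable k] (U : Filter ℕ) (hU : U ≤ atTop) (ev0 : ∀ _ : ℕ, k → AlgebraicClosure ℚ)
    (hev0 : EvHom U ev0) :
    ∃ (L : ℕ → IntermediateField ℚ (AlgebraicClosure ℚ)) (ev : ∀ n, k → L n), EvHom U ev ∧ Nonempty (Lev U ev) ∧
      ∀ α, ∀ᶠ n in U, (ev n α : AlgebraicClosure ℚ) = ev0 n α := by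
  classical
  obtain ⟨enc, henc⟩ := exists_injective_nat k
  let A : ℕ → Set k := fun n => {α | enc α ≤ n}
  have hA : ∀ n, (A n).Finite := fun n => Set.Finite.preimage henc.injOn (Set.finite_Iic n)
  let L : ℕ → IntermediateField ℚ (AlgebraicClosure ℚ) := fun n => IntermediateField.adjoin ℚ (ev0 n '' A n)
  have hnf : ∀ n, NumberField (L n) := by
    intro n
    have : Finite (ev0 n '' A n) := (hA n).image _
    have := IntermediateField.finiteDimensional_adjoin (K := ℚ) (S := ev0 n '' A n)
      (fun x _ => (AlgebraicClosure.isAlgebraic ℚ).isAlgebraic x |>.isIntegral)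
    exact { to_charZero := inferInstance, to_finiteDimensional := this }
  let ev : ∀ n, k → L n := fun n α =>
    if h : α ∈ A n then ⟨ev0 n α, IntermediateField.subset_adjoin ℚ _ ⟨α, h, rfl⟩⟩ else 0
  have hmem : ∀ α, ∀ᶠ n in U, α ∈ A n := fun α => hU (eventually_ge_atTop (enc α))
  have hev : ∀ α, ∀ᶠ n in U, (ev n α : AlgebraicClosure ℚ) = ev0 n α := by
    intro α
    filter_upwards [hmem α] with n hn
    simp only [ev, dif_pos hn]
  refine ⟨L, ev, ⟨?_, ?_, ?_⟩, ?_, hev⟩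
  · intro a b
    filter_upwards [hev a, hev b, hev (a + b), hev0.add a b] with n h1 h2 h3 h4
    apply Subtype.ext
    change (ev n (a + b) : AlgebraicClosure ℚ) = ev n a + ev n b
    rw [h1, h2, h3, h4]
  · intro a b
    filter_upwards [hev a, hev b, hev (a * b), hev0.mul a b] with n h1 h2 h3 h4
    apply Subtype.ext
    change (ev n (a * b) : AlgebraicClosure ℚ) = ev n a * ev n b
    rw [h1, h2, h3, h4]
  · filter_upwards [hev 1, hev0.one] with n h1 h2
    apply Subtype.ext
    change (ev n 1 : AlgebraicClosure ℚ) = 1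
    rw [h1, h2]
  · have key := fun n => nf_places (L n) (ev n '' A n) ((hA n).image _)
    choose P fin wt av a h1 h2 h3 h4 using key
    refine ⟨⟨P, fin, wt, h1, av, a, h2, h3, fun α hα => ?_⟩⟩
    filter_upwards [hmem α, hev α, hev0.ne_zero hα] with n h5 h6 h7
    refine h4 n _ ⟨α, h5, rfl⟩ fun h8 => h7 ?_
    rw [← h6, h8]; rfl

open Polynomial in
lemma germ_isAlgClosed (U : Ultrafilter ℕ) (K : Type*) [Field K] [IsAlgClosed K] : IsAlgClosed (Germ (U : Filter ℕ) K) := by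
  refine IsAlgClosed.of_exists_root _ fun p hp hirr => ?_
  have hrep : ∀ i, ∃ f : ℕ → K, (f : Germ (U : Filter ℕ) K) = p.coeff i := fun i => by
    induction p.coeff i using Germ.inductionOn with | _ f => exact ⟨f, rfl⟩
  choose c hc using hrep
  obtain ⟨N, hN⟩ : ∃ N, p.natDegree = N := ⟨_, rfl⟩
  have hN0 : N ≠ 0 := by rw [← hN]; exact hirr.natDegree_pos.ne'
  have hroot : ∀ n, ∃ x : K, x ^ N + ∑ i ∈ Finset.range N, c i n * x ^ i = 0 := by
    intro n
    let q : K[X] := X ^ N + ∑ i ∈ Finset.range N, C (c i n) * X ^ i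
    have hq : q.degree ≠ 0 := by
      have h1 : (∑ i ∈ Finset.range N, C (c i n) * X ^ i : K[X]).degree < (N : WithBot ℕ) := by
        refine (degree_sum_le _ _).trans_lt ?_
        refine (Finset.sup_lt_iff (WithBot.bot_lt_coe N)).mpr ?_
        intro i hi
        refine (degree_C_mul_X_pow_le i _).trans_lt ?_
        exact WithBot.coe_lt_coe.mpr (Finset.mem_range.mp hi)
      have h2 : q.degree = N := by
        rw [degree_add_eq_left_of_degree_lt (by rwa [degree_X_pow]), degree_X_pow]
      rw [h2]; exact_mod_cast hN0
    obtain ⟨x, hx⟩ := IsAlgClosed.exists_root q hq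
    refine ⟨x, ?_⟩
    simpa [q, IsRoot, eval_finset_sum] using hx
  choose x hx using hroot
  refine ⟨(x : Germ (U : Filter ℕ) K), ?_⟩
  rw [eval_eq_sum_range, hN, Finset.sum_range_succ]
  have h1 : p.coeff N = 1 := by rw [← hN]; exact hp
  rw [h1, one_mul, add_comm]
  have h2 : ∀ M, ∑ i ∈ Finset.range M, p.coeff i * (x : Germ (U : Filter ℕ) K) ^ i =
      ((fun n => ∑ i ∈ Finset.range M, c i n * x n ^ i : ℕ → K) : Germ (U : Filter ℕ) K) := by
    intro M
    induction M with
    | zero => simp only [Finset.range_zero, Finset.sum_empty]; rfl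
    | succ M ih =>
      simp only [Finset.sum_range_succ]
      rw [ih, ← hc M]; rfl
  rw [h2]
  change ((fun n => x n ^ N + ∑ i ∈ Finset.range N, c i n * x n ^ i : ℕ → K) : Germ (U : Filter ℕ) K) = _
  simp only [hx]; rfl

end LG

namespace LG
open Filter Topology Matrix

lemma exists_countable_algClosed {E : Type*} [Field E] [IsAlgClosed E] (S : Set E) (hS : S.Countable) :
    ∃ 𝕂 : Subfield E, S ⊆ 𝕂 ∧ Countable 𝕂 ∧ IsAlgClosed 𝕂 := by
  have h1 : Cardinal.mk (Subfield.closure S) ≤ Cardinal.aleph0 :=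
    (Subfield.cardinalMk_closure_le_max S).trans (max_le (Cardinal.mk_le_aleph0_iff.mpr hS.to_subtype) le_rfl)
  refine ⟨(algebraicClosure (Subfield.closure S) E).toSubfield, ?_, ?_, ?_⟩
  · intro x hx
    exact (algebraicClosure (Subfield.closure S) E).algebraMap_mem ⟨x, Subfield.subset_closure hx⟩
  · have h2 := Algebra.IsAlgebraic.cardinalMk_le_max (Subfield.closure S) (algebraicClosure (Subfield.closure S) E)
    exact Cardinal.mk_le_aleph0_iff.mp (h2.trans (max_le h1 le_rfl))
  · exact (algebraicClosure.isAlgClosure (Subfield.closure S) E).isAlgClosed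

lemma germ_charZero (U : Ultrafilter ℕ) (K : Type*) [Field K] [CharZero K] : CharZero (Germ (U : Filter ℕ) K) := by
  refine ⟨fun a b hab => ?_⟩
  have h : ∀ m : ℕ, ((m : Germ (U : Filter ℕ) K)) = ((fun _ => (m : K) : ℕ → K) : Germ (U : Filter ℕ) K) := fun m => rfl
  rw [h, h, Germ.coe_eq] at hab
  obtain ⟨n, hn⟩ := hab.exists
  exact Nat.cast_injective (R := K) hn

/-- cofinal sequence of finite index subgroups -/
lemma exists_cofinal (k : ℕ) : ∃ Q : ℕ → Subgroup (FreeGroup (Fin k)), (∀ n, (Q n).index ≠ 0) ∧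
    ∀ H : Subgroup (FreeGroup (Fin k)), H.index ≠ 0 → ∃ N, ∀ n, N ≤ n → Q n ≤ H := by
  classical
  let e0 : Finset (FreeGroup (Fin k)) → Subgroup (FreeGroup (Fin k)) := fun S =>
    if (Subgroup.closure (S : Set (FreeGroup (Fin k)))).index ≠ 0 then Subgroup.closure (S : Set (FreeGroup (Fin k))) else ⊤
  have h0 : ∀ S, (e0 S).index ≠ 0 := by
    intro S
    by_cases h : (Subgroup.closure (S : Set (FreeGroup (Fin k)))).index ≠ 0
    · simp only [e0, if_pos h]; exact h
    · simp only [e0, if_neg h]; simp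
  obtain ⟨f, hf⟩ := exists_surjective_nat (Finset (FreeGroup (Fin k)))
  refine ⟨fun n => ⨅ i : Fin (n + 1), e0 (f i), fun n => Subgroup.index_iInf_ne_zero fun i => h0 _, ?_⟩
  intro H hH
  have : H.FiniteIndex := ⟨hH⟩
  have h1 : H.FG := (Group.fg_iff_subgroup_fg H).mp (Subgroup.fg_of_index_ne_zero H)
  obtain ⟨S, hS⟩ := h1
  obtain ⟨N, hN⟩ := hf S
  refine ⟨N, fun n hn => (iInf_le _ (⟨N, by lia⟩ : Fin (n + 1))).trans (le_of_eq ?_)⟩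
  simp only [e0, hN, hS, if_pos hH, ne_eq, not_false_eq_true]

lemma derived_map_le {G : Type*} [Group G] {A B : Subgroup G} (h : A ≤ B) {s t : ℕ} (hst : s ≤ t) :
    (derivedSeries A t).map A.subtype ≤ (derivedSeries B s).map B.subtype := by
  rintro _ ⟨x, hx, rfl⟩
  refine ⟨Subgroup.inclusion h x, derivedSeries_antitone _ hst ?_, rfl⟩
  exact map_derivedSeries_le_derivedSeries (Subgroup.inclusion h) t ⟨x, hx, rfl⟩

set_option maxHeartbeats 2000000 in
theorem allT0 (d k : ℕ) : T0 d k := by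
  classical
  by_contra hcon
  obtain ⟨Qs, hQ0, hQ⟩ := exists_cofinal k
  have hbad : ∀ n : ℕ, ∃ φ : FreeGroup (Fin k) →* GL (Fin d) (AlgebraicClosure ℚ),
      (∀ a b : FreeGroup (Fin k), a.toWord.length ≤ n → b.toWord.length ≤ n →
        ∃ w : FreeGroup (Fin 2), w ≠ 1 ∧
          FreeGroup.lift (fun i : Fin 2 => if i = 0 then φ a else φ b) w = 1) ∧
      ∃ x ∈ (derivedSeries (Qs n) n).map (Qs n).subtype, φ x ≠ 1 := by
    intro n
    by_contra hc
    refine hcon ⟨n, n, Qs n, hQ0 n, fun φ hφ x hx => ?_⟩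
    by_contra hx1
    exact hc ⟨φ, hφ, x, hx, hx1⟩
  choose φ hφ1 hφ2 using hbad
  obtain ⟨U, hUdef⟩ : ∃ U : Ultrafilter ℕ, U = hyperfilter ℕ := ⟨_, rfl⟩
  have hU : (U : Filter ℕ) ≤ atTop := by rw [hUdef]; exact Nat.hyperfilter_le_atTop
  have : IsAlgClosed (Germ (U : Filter ℕ) (AlgebraicClosure ℚ)) := germ_isAlgClosed U _
  have : CharZero (Germ (U : Filter ℕ) (AlgebraicClosure ℚ)) := germ_charZero U _
  obtain ⟨ent, hent⟩ : ∃ ent : FreeGroup (Fin k) → Fin d → Fin d → Germ (U : Filter ℕ) (AlgebraicClosure ℚ),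
      ∀ x i j, ent x i j = ((fun n => (φ n x : Matrix (Fin d) (Fin d) (AlgebraicClosure ℚ)) i j : ℕ → AlgebraicClosure ℚ) :
        Germ (U : Filter ℕ) (AlgebraicClosure ℚ)) := ⟨_, fun _ _ _ => rfl⟩
  obtain ⟨𝕂, hS𝕂, hcount, hac⟩ := exists_countable_algClosed
    (Set.range fun p : FreeGroup (Fin k) × Fin d × Fin d => ent p.1 p.2.1 p.2.2) (Set.countable_range _)
  have hcz : CharZero 𝕂 := ⟨fun a b hab => by
    have := congrArg (fun z : 𝕂 => (z : Germ (U : Filter ℕ) (AlgebraicClosure ℚ))) hab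
    simpa using this⟩
  have hmem : ∀ x i j, ent x i j ∈ 𝕂 := fun x i j => hS𝕂 ⟨(x, i, j), rfl⟩
  have hrep : ∀ α : 𝕂, ∃ f : ℕ → AlgebraicClosure ℚ, (f : Germ (U : Filter ℕ) (AlgebraicClosure ℚ)) = α := fun α => by
    induction (α : Germ (U : Filter ℕ) (AlgebraicClosure ℚ)) using Germ.inductionOn with | _ f => exact ⟨f, rfl⟩
  choose rep hrep using hrep
  have hev0 : EvHom (U : Filter ℕ) (fun n (α : 𝕂) => rep α n) := by
    refine ⟨fun a b => ?_, fun a b => ?_, ?_⟩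
    · have : ((rep (a + b) : ℕ → AlgebraicClosure ℚ) : Germ (U : Filter ℕ) (AlgebraicClosure ℚ)) = ((rep a + rep b : ℕ → AlgebraicClosure ℚ)) := by
        rw [Germ.coe_add, hrep, hrep, hrep]; rfl
      exact Germ.coe_eq.mp this
    · have : ((rep (a * b) : ℕ → AlgebraicClosure ℚ) : Germ (U : Filter ℕ) (AlgebraicClosure ℚ)) = ((rep a * rep b : ℕ → AlgebraicClosure ℚ)) := by
        rw [Germ.coe_mul, hrep, hrep, hrep]; rfl
      exact Germ.coe_eq.mp this
    · have : ((rep 1 : ℕ → AlgebraicClosure ℚ) : Germ (U : Filter ℕ) (AlgebraicClosure ℚ)) = ((1 : ℕ → AlgebraicClosure ℚ)) := by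
        rw [hrep]; rfl
      exact Germ.coe_eq.mp this
  -- the limit representation
  have hone : ∀ i j, ent 1 i j = (1 : Matrix (Fin d) (Fin d) (Germ (U : Filter ℕ) (AlgebraicClosure ℚ))) i j := by
    intro i j
    rw [hent]
    simp only [map_one, Units.val_one, Matrix.one_apply]
    split_ifs <;> rfl
  have hmul : ∀ x y i j, ent (x * y) i j = ∑ l, ent x i l * ent y l j := by
    intro x y i j
    have hs : ∀ S : Finset (Fin d), ∑ l ∈ S, ent x i l * ent y l j =
        ((fun n => ∑ l ∈ S, (φ n x : Matrix (Fin d) (Fin d) (AlgebraicClosure ℚ)) i l *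
          (φ n y : Matrix (Fin d) (Fin d) (AlgebraicClosure ℚ)) l j : ℕ → AlgebraicClosure ℚ) :
          Germ (U : Filter ℕ) (AlgebraicClosure ℚ)) := by
      intro S
      induction S using Finset.induction_on with
      | empty => simp only [Finset.sum_empty]; rfl
      | insert a S ha ih =>
        simp only [Finset.sum_insert ha]
        rw [ih, hent, hent]; rfl
    rw [hs, hent]
    simp only [map_mul, Units.val_mul, Matrix.mul_apply]
  obtain ⟨Φ, hΦ⟩ : ∃ Φ : FreeGroup (Fin k) →* Matrix (Fin d) (Fin d) 𝕂, ∀ x i j, (Φ x i j : Germ (U : Filter ℕ) (AlgebraicClosure ℚ)) = ent x i j := by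
    refine ⟨{ toFun := fun x => Matrix.of fun i j => ⟨ent x i j, hmem x i j⟩, map_one' := ?_, map_mul' := ?_ }, fun x i j => rfl⟩
    · ext i j : 2
      change ent 1 i j = _
      rw [hone, Matrix.one_apply, Matrix.one_apply]
      split_ifs <;> rfl
    · intro x y
      ext i j : 2
      rw [Matrix.mul_apply]
      change ent (x * y) i j = 𝕂.subtype _
      rw [map_sum, hmul]
      rfl
  have hevent : ∀ x, ∀ᶠ n in (U : Filter ℕ), (Φ x).map (rep · n) = (φ n x : Matrix (Fin d) (Fin d) (AlgebraicClosure ℚ)) := by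
    intro x
    have h : ∀ i j, ∀ᶠ n in (U : Filter ℕ), rep (Φ x i j) n = (φ n x : Matrix (Fin d) (Fin d) (AlgebraicClosure ℚ)) i j := by
      intro i j
      refine Germ.coe_eq.mp ?_
      rw [hrep, hΦ, hent]
    filter_upwards [eventually_all.mpr fun i => eventually_all.mpr (h i)] with n hn
    ext i j
    exact hn i j
  have hΦ1 : ∀ x, Φ x = 1 → ∀ᶠ n in (U : Filter ℕ), φ n x = 1 := by
    intro x hx
    have hz := hev0.zero
    filter_upwards [hevent x, hev0.one, hz] with n h1 h2 h3
    apply Units.ext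
    rw [← h1, hx, Units.val_one]
    ext i j
    simp only [Matrix.map_apply, Matrix.one_apply]
    split_ifs
    · exact h2
    · exact h3
  -- connected subgroup
  obtain ⟨H, hH, 𝒜, hD, hC⟩ := thmConn Φ
  have hfi : H.FiniteIndex := ⟨hH⟩
  have hfg : Group.FG H := Subgroup.fg_of_index_ne_zero H
  obtain ⟨T, hT⟩ := hfg.out
  have hns : NS (Φ.comp H.subtype) := by
    intro s
    by_contra hc
    push Not at hc
    obtain ⟨T1, hT1, hT2⟩ := exists_test d k ((derivedSeries H s).map H.subtype : Subgroup (FreeGroup (Fin k)))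
    have h1 : ∀ᶠ n in (U : Filter ℕ), ∀ q ∈ T1, φ n q = 1 := by
      rw [Finset.eventually_all]
      intro q hq
      obtain ⟨x, hx, rfl⟩ := hT1 hq
      exact hΦ1 _ (hc x hx)
    obtain ⟨N, hN⟩ := hQ H hH
    obtain ⟨n, h2, h3⟩ := (h1.and (hU (eventually_ge_atTop (max N s)))).exists
    obtain ⟨x, hx, hx1⟩ := hφ2 n
    exact hx1 (hT2 _ (φ n) h2 x (derived_map_le (hN n ((le_max_left _ _).trans h3)) ((le_max_right _ _).trans h3) hx))
  obtain ⟨L, ev, hev, ⟨Λ⟩, hcomp⟩ := exists_lev (U : Filter ℕ) hU (fun n (α : 𝕂) => rep α n) hev0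
  obtain ⟨a, ha⟩ := thmB U hU hev Λ T hT hD (Φ.comp H.subtype) hC hns
  have h4 : ∀ x : Fin 2 × Bool, ∀ᶠ n in (U : Filter ℕ), (em ev (Φ.comp H.subtype) (lett a x) n).map (L n).val =
      (φ n (H.subtype (lett a x)) : Matrix (Fin d) (Fin d) (AlgebraicClosure ℚ)) := by
    intro x
    filter_upwards [hevent (H.subtype (lett a x)), eventually_all.mpr fun i => eventually_all.mpr fun j => hcomp (Φ (H.subtype (lett a x)) i j)] with n h5 h6
    rw [← h5]
    ext i j
    exact h6 i j
  obtain ⟨n, ⟨h5, h6⟩, h7⟩ := ((ha.and (eventually_all.mpr h4)).and (hU (eventually_ge_atTop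
    (max (a 0 : FreeGroup (Fin k)).toWord.length (a 1 : FreeGroup (Fin k)).toWord.length)))).exists
  obtain ⟨w, hw, hw1⟩ := hφ1 n (a 0) (a 1) ((le_max_left _ _).trans h7) ((le_max_right _ _).trans h7)
  refine h5 w.toWord (FreeGroup.isReduced_toWord) (by simpa using hw) ?_
  have hinj : Function.Injective fun M : Matrix (Fin d) (Fin d) (L n) => M.map (L n).val :=
    Matrix.map_injective (L n).val.injective
  apply hinj
  have h8 : ∀ l : List (Fin 2 × Bool), ((l.map fun x => em ev (Φ.comp H.subtype) (lett a x) n).prod).map (L n).val =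
      ((FreeGroup.lift (fun i : Fin 2 => if i = 0 then φ n (a 0) else φ n (a 1)) (FreeGroup.mk l) : GL (Fin d) (AlgebraicClosure ℚ)) :
        Matrix (Fin d) (Fin d) (AlgebraicClosure ℚ)) := by
    intro l
    rw [FreeGroup.lift_mk]
    induction l with
    | nil => simp
    | cons x l ih =>
      rw [List.map_cons, List.prod_cons, List.map_cons, List.prod_cons, Units.val_mul, ← ih, Matrix.map_mul, h6]
      congr 2
      obtain ⟨i, b⟩ := x
      fin_cases i <;> cases b <;> simp [lett]
  change _ = (1 : Matrix (Fin d) (Fin d) (L n)).map (L n).val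
  refine (h8 _).trans ?_
  rw [ FreeGroup.mk_toWord, hw1]
  simp

end LG

open scoped MatrixGroups Pointwise

/-- **Large girth.** Given `d, k ≥ 1`, there are `N₀, N ≥ 1` and `ε₀, C > 0` such that for every
prime `p`, every field `K` of characteristic `p` and every `k`-element subset `F` of `GL_d(K)`
generating a subgroup containing no solvable subgroup of index at most `N`, the set of products
of at most `N₀` elements of `F ∪ F⁻¹` contains two elements `a, b` with `w(a,b) ≠ 1` for every
nontrivial word `w ∈ F₂` of length at most `C·(log p)^{ε₀}`. -/
theorem large_girth_positive_characteristic :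
    ∀ d k : ℕ, 1 ≤ d → 1 ≤ k →
      ∃ N₀ N : ℕ, 1 ≤ N₀ ∧ 1 ≤ N ∧ ∃ ε₀ C : ℝ, 0 < ε₀ ∧ 0 < C ∧
        ∀ (p : ℕ), p.Prime → ∀ (K : Type) [Field K], ∀ _ : CharP K p,
          ∀ F : Set (GL (Fin d) K), F.Finite → F.ncard = k →
          (∀ H : Subgroup ↥(Subgroup.closure F), IsSolvable ↥H →
            H.index = 0 ∨ N < H.index) →
          ∃ a b : GL (Fin d) K,
            (∃ l : List (GL (Fin d) K), l.length ≤ N₀ ∧ (∀ g ∈ l, g ∈ F ∪ F⁻¹) ∧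
              l.prod = a) ∧
            (∃ l : List (GL (Fin d) K), l.length ≤ N₀ ∧ (∀ g ∈ l, g ∈ F ∪ F⁻¹) ∧
              l.prod = b) ∧
            ∀ w : FreeGroup (Fin 2), w ≠ 1 →
              ((FreeGroup.toWord w).length : ℝ) ≤ C * Real.log p ^ ε₀ →
              FreeGroup.lift (fun i : Fin 2 => if i = 0 then a else b) w ≠ 1 := by
  exact LG.main_of_T0 LG.allT0
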